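/- Let (R, m, k) be a noetherian local ring whose formal fibers are geometrically reduced (respectively geometrically normal), and let φ: R → A be a flat local homomorphism of noetherian local rings such that the closed fiber A/mA is geometrically reduced (respectively geometrically normal) over k. Then φ is a reduced (respectively normal) homomorphism: for every prime p of R, the fiber ring A ⊗_R κ(p) is geometrically reduced (respectively geometrically normal) over κ(p). -/

import Mathlib

set_option synthInstance.maxHeartbeats 1000000
set_option maxHeartbeats 1000000

universe u

open TensorProduct IsLocalRing

/-- A noetherian algebra over a field `k` is geometrically reduced if it stays reduced
after any field extension of `k`. -/
def GeometricallyReducedAlgebra (k A : Type u) [Field k] [CommRing A] [Algebra k A] :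
    Prop :=
  ∀ (k' : Type u) [Field k'] [Algebra k k'], IsReduced (k' ⊗[k] A)

/-- A ring is normal if all its localizations at primes are integrally closed domains. -/
def IsNormalRing (A : Type u) [CommRing A] : Prop :=
  ∀ (p : Ideal A) [p.IsPrime],
    IsDomain (Localization.AtPrime p) ∧ IsIntegrallyClosed (Localization.AtPrime p)

/-- A noetherian algebra over a field `k` is geometrically normal if it stays normal
after any field extension of `k`. -/
def GeometricallyNormalAlgebra (k A : Type u) [Field k] [CommRing A] [Algebra k A] :
    Prop :=
  ∀ (k' : Type u) [Field k'] [Algebra k k'], IsNormalRing (k' ⊗[k] A)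

set_option linter.style.haveILetI false

/-- `a` is integral over the principal ideal generated by `b`. -/
def IntOver {B : Type*} [CommRing B] (a b : B) : Prop :=
  ∃ (n : ℕ) (c : ℕ → B), a ^ n = ∑ i ∈ Finset.range n, c i * a ^ i * b ^ (n - i)

/-- every principal ideal is integrally closed -/
def PIC (B : Type*) [CommRing B] : Prop := ∀ a b : B, IntOver a b → b ∣ a

theorem IntOver.map {B B' : Type*} [CommRing B] [CommRing B'] (f : B →+* B') {a b : B}
    (h : IntOver a b) : IntOver (f a) (f b) := by
  obtain ⟨n, c, h⟩ := h
  refine ⟨n, fun i => f (c i), ?_⟩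
  simp only [← map_pow, ← map_mul, ← map_sum, h]

theorem IntOver.mul_left {B : Type*} [CommRing B] {a b : B} (r : B)
    (h : IntOver a b) : IntOver (r * a) b := by
  obtain ⟨n, c, h⟩ := h
  refine ⟨n, fun i => c i * r ^ (n - i), ?_⟩
  rw [mul_pow, h, Finset.mul_sum]
  refine Finset.sum_congr rfl fun i hi => ?_
  have : r ^ n = r ^ (n - i) * r ^ i := by
    rw [← pow_add]; congr 1; have := Finset.mem_range.1 hi; omega
  rw [this]; ring

theorem IntOver.mul_both {B : Type*} [CommRing B] {a b : B} (r : B)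
    (h : IntOver a b) : IntOver (r * a) (r * b) := by
  obtain ⟨n, c, h⟩ := h
  refine ⟨n, c, ?_⟩
  rw [mul_pow, h, Finset.mul_sum]
  refine Finset.sum_congr rfl fun i hi => ?_
  have : r ^ n = r ^ (n - i) * r ^ i := by
    rw [← pow_add]; congr 1; have := Finset.mem_range.1 hi; omega
  rw [this]; ring

theorem IntOver.of_dvd {B : Type*} [CommRing B] {a b b' : B} (hb : b' ∣ b)
    (h : IntOver a b) : IntOver a b' := by
  obtain ⟨n, c, h⟩ := h
  obtain ⟨r, rfl⟩ := hb
  refine ⟨n, fun i => c i * r ^ (n - i), ?_⟩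
  rw [h]
  refine Finset.sum_congr rfl fun i hi => ?_
  ring

theorem intOver_iff_monic {B : Type*} [CommRing B] {z : B} {S : Type*} [CommRing S] [Algebra S B]
    (h : IsIntegral S z) : ∃ (n : ℕ) (c : ℕ → S), z ^ n =
      ∑ i ∈ Finset.range n, algebraMap S B (c i) * z ^ i := by
  obtain ⟨p, hp, hz⟩ := h
  refine ⟨p.natDegree, fun i => - p.coeff i, ?_⟩
  rw [← Polynomial.aeval_def, Polynomial.aeval_eq_sum_range, Finset.sum_range_succ,
    hp.coeff_natDegree, one_smul] at hz
  rw [eq_neg_of_add_eq_zero_right hz, ← Finset.sum_neg_distrib]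
  refine Finset.sum_congr rfl fun i _ => ?_
  simp [Algebra.smul_def]

theorem isIntegral_of_eq_sum {B : Type*} [CommRing B] {z : B} {S : Type*} [CommRing S] [Algebra S B]
    (n : ℕ) (c : ℕ → S) (h : z ^ n =
      ∑ i ∈ Finset.range n, algebraMap S B (c i) * z ^ i) : IsIntegral S z := by
  refine ⟨Polynomial.X ^ n - ∑ i ∈ Finset.range n, Polynomial.C (c i) * Polynomial.X ^ i, ?_, ?_⟩
  · apply Polynomial.monic_X_pow_sub
    refine (Polynomial.degree_sum_le _ _).trans_lt ?_
    rw [Finset.sup_lt_iff (WithBot.bot_lt_coe _)]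
    intro i hi
    refine (Polynomial.degree_C_mul_X_pow_le _ _).trans_lt ?_
    exact_mod_cast Finset.mem_range.1 hi
  · simp [Polynomial.eval₂_finsetSum, h]

theorem PIC.isReduced {B : Type*} [CommRing B] (h : PIC B) : IsReduced B := by
  refine ⟨fun a ⟨n, hn⟩ => ?_⟩
  have := h a 0 ⟨n, 0, by simp [hn]⟩
  simpa using this

theorem PIC.of_dvd_reflect {B B' : Type*} [CommRing B] [CommRing B'] (f : B →+* B')
    (hf : ∀ a b, f b ∣ f a → b ∣ a) (h : PIC B') : PIC B :=
  fun a b hab => hf a b (h _ _ (hab.map f))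

theorem PIC.of_equiv {B B' : Type*} [CommRing B] [CommRing B'] (f : B ≃+* B') (h : PIC B') :
    PIC B :=
  PIC.of_dvd_reflect (f : B →+* B') (fun a b hd => by
    simpa using map_dvd (f.symm : B' →+* B) hd) h

theorem PIC.localization {B : Type*} [CommRing B] (h : PIC B) (M : Submonoid B) (S : Type*)
    [CommRing S] [Algebra B S] [IsLocalization M S] : PIC S := by
  classical
  intro a b ⟨n, c, e⟩
  obtain ⟨⟨a', s⟩, ha⟩ := IsLocalization.surj M a
  obtain ⟨⟨b', t⟩, hb⟩ := IsLocalization.surj M b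
  simp only at ha hb
  obtain ⟨us, hus⟩ := IsLocalization.map_units S s
  obtain ⟨ut, hut⟩ := IsLocalization.map_units S t
  have h1 : IntOver (algebraMap B S a') (algebraMap B S b') := by
    rw [← ha, ← hb, mul_comm a]
    apply IntOver.mul_left
    rw [← hut]
    exact IntOver.of_dvd (b := b) ⟨↑ut⁻¹, by simp⟩ ⟨n, c, e⟩
  obtain ⟨n, c, e⟩ := h1
  obtain ⟨w, hw⟩ := IsLocalization.exist_integer_multiples_of_finset M
    ((Finset.range n).image c)
  have hw' : ∀ i, ∃ d : B, i ∈ Finset.range n → algebraMap B S d = algebraMap B S w * c i := by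
    intro i
    by_cases hi : i ∈ Finset.range n
    · obtain ⟨d, hd⟩ := hw (c i) (Finset.mem_image_of_mem _ hi)
      exact ⟨d, fun _ => by rw [hd, Algebra.smul_def]⟩
    · exact ⟨0, fun h => absurd h hi⟩
  choose d hd using hw'
  have h2 : algebraMap B S (w * a' ^ n) = algebraMap B S (∑ i ∈ Finset.range n,
      d i * a' ^ i * b' ^ (n - i)) := by
    rw [map_mul, map_pow, e, map_sum, Finset.mul_sum]
    refine Finset.sum_congr rfl fun i hi => ?_
    rw [map_mul, map_mul, hd i hi, map_pow, map_pow]; ring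
  obtain ⟨v, hv⟩ := (IsLocalization.eq_iff_exists M S).1 h2
  have h3 : IntOver ((v * w : B) * a') b' := by
    rcases Nat.eq_zero_or_pos n with rfl | hn
    · refine ⟨1, fun _ => 0, ?_⟩
      simp only [pow_zero, mul_one, Finset.range_zero, Finset.sum_empty, mul_zero] at hv
      simp [hv]
    · refine ⟨n, fun i => d i * (v * w) ^ (n - 1 - i) * v, ?_⟩
      have hvw : ((v : B) * w) ^ n = (v * w) ^ (n - 1) * (v * w) := by
        rw [← pow_succ]; congr 1; omega
      rw [mul_pow, hvw, show ((v : B) * w) ^ (n - 1) * (v * w) * a' ^ n =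
        (v * w) ^ (n - 1) * (v * (w * a' ^ n)) by ring, hv, Finset.mul_sum, Finset.mul_sum]
      refine Finset.sum_congr rfl fun i hi => ?_
      have : ((v : B) * w) ^ (n - 1) = (v * w) ^ (n - 1 - i) * (v * w) ^ i := by
        rw [← pow_add]; congr 1; have := Finset.mem_range.1 hi; omega
      rw [this]; ring
  obtain ⟨r, hr⟩ := h _ _ h3
  obtain ⟨uv, huv⟩ := IsLocalization.map_units S v
  obtain ⟨uw, huw⟩ := IsLocalization.map_units S w
  have h4 : algebraMap B S b' ∣ algebraMap B S a' := by
    refine ⟨algebraMap B S r * ↑uv⁻¹ * ↑uw⁻¹, ?_⟩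
    have := congrArg (algebraMap B S) hr
    rw [map_mul, map_mul, map_mul, ← huv, ← huw] at this
    rw [← mul_assoc, ← mul_assoc, ← this]
    rw [show (uv : S) * uw * algebraMap B S a' * ↑uv⁻¹ * ↑uw⁻¹ =
      (uv * ↑uv⁻¹) * (uw * ↑uw⁻¹) * algebraMap B S a' by ring]
    simp
  rw [← ha, ← hb, ← hus, ← hut, Units.dvd_mul_right, Units.mul_right_dvd] at h4
  exact h4

theorem PIC.of_local {B : Type*} [CommRing B] (h : ∀ (P : Ideal B) [P.IsPrime] (a b : B),
    IntOver a b → ∃ s ∉ P, b ∣ s * a) : PIC B := by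
  intro a b hab
  let I : Ideal B :=
    { carrier := {s | b ∣ s * a}
      add_mem' := fun {x y} hx hy => by
        simp only [Set.mem_ofPred_eq] at *; rw [add_mul]; exact dvd_add hx hy
      zero_mem' := by simp
      smul_mem' := fun c x hx => by
        simp only [Set.mem_ofPred_eq, smul_eq_mul] at *; rw [mul_assoc]; exact hx.mul_left c }
  by_contra hne
  have hI : I ≠ ⊤ := fun e => hne (by
    have : (1 : B) ∈ I := e ▸ Submodule.mem_top
    simpa [I] using this)
  obtain ⟨P, hP, hIP⟩ := Ideal.exists_le_maximal I hI
  obtain ⟨s, hs, hs'⟩ := h P a b hab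
  exact hs (hIP hs')

theorem PIC.of_localization {B : Type*} [CommRing B] (h : ∀ (P : Ideal B) [P.IsPrime],
    PIC (Localization.AtPrime P)) : PIC B := by
  refine PIC.of_local fun P _ a b hab => ?_
  obtain ⟨r, hr⟩ := h P _ _ (hab.map (algebraMap B (Localization.AtPrime P)))
  obtain ⟨⟨r', t⟩, hrt⟩ := IsLocalization.surj P.primeCompl r
  simp only at hrt
  have : algebraMap B (Localization.AtPrime P) (t * a) = algebraMap _ _ (b * r') := by
    rw [map_mul, map_mul, hr, ← hrt]; ring
  obtain ⟨v, hv⟩ := (IsLocalization.eq_iff_exists P.primeCompl _).1 this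
  refine ⟨v * t, (v * t).2, v * r', ?_⟩
  rw [mul_assoc, hv]; ring

theorem div_pow_eq_sum_iff {B K : Type*} [CommRing B] [Field K] [Algebra B K] {a b : B}
    (hb : algebraMap B K b ≠ 0) (n : ℕ) (c : ℕ → B) :
    (algebraMap B K a / algebraMap B K b) ^ n = ∑ i ∈ Finset.range n,
      algebraMap B K (c i) * (algebraMap B K a / algebraMap B K b) ^ i ↔
    algebraMap B K (a ^ n) = algebraMap B K (∑ i ∈ Finset.range n, c i * a ^ i * b ^ (n - i)) := by
  rw [div_pow, div_eq_iff (pow_ne_zero _ hb), Finset.sum_mul, ← map_pow, map_sum]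
  have : ∀ i ∈ Finset.range n, algebraMap B K (c i) * (algebraMap B K a / algebraMap B K b) ^ i *
      algebraMap B K b ^ n = algebraMap B K (c i * a ^ i * b ^ (n - i)) := by
    intro i hi
    have := Finset.mem_range.1 hi
    have h2 : algebraMap B K b ^ n = algebraMap B K b ^ (n - i) * algebraMap B K b ^ i := by
      rw [← pow_add]; congr 1; omega
    rw [h2, div_pow]; simp only [map_mul, map_pow]; field_simp
  rw [Finset.sum_congr rfl this]

theorem PIC.of_isIntegrallyClosed {B : Type*} [CommRing B] [IsDomain B] [IsIntegrallyClosed B] :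
    PIC B := by
  intro a b ⟨n, c, e⟩
  rcases eq_or_ne b 0 with rfl | hb
  · rw [zero_dvd_iff]
    refine eq_zero_of_pow_eq_zero (n := n) (e.trans (Finset.sum_eq_zero fun i hi => ?_))
    have := Finset.mem_range.1 hi
    rw [zero_pow (by omega), mul_zero]
  · let K := FractionRing B
    have hb' : algebraMap B K b ≠ 0 := by simpa using hb
    have : IsIntegral B (algebraMap B K a / algebraMap B K b) := by
      refine isIntegral_of_eq_sum n c ?_
      rw [div_pow_eq_sum_iff hb', e]
    obtain ⟨y, hy⟩ := (IsIntegrallyClosed.isIntegral_iff).1 this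
    refine ⟨y, ?_⟩
    apply FaithfulSMul.algebraMap_injective B K
    rw [map_mul, hy, mul_div_cancel₀ _ hb']

theorem PIC.isIntegrallyClosed {B : Type*} [CommRing B] [IsDomain B] (h : PIC B) :
    IsIntegrallyClosed B := by
  let K := FractionRing B
  rw [isIntegrallyClosed_iff K]
  intro x hx
  obtain ⟨n, c, e⟩ := intOver_iff_monic hx
  obtain ⟨a, b, hb, rfl⟩ := IsFractionRing.div_surjective (A := B) x
  have hb' : algebraMap B K b ≠ 0 := by simpa using nonZeroDivisors.ne_zero hb
  have : IntOver a b := by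
    refine ⟨n, c, ?_⟩
    apply FaithfulSMul.algebraMap_injective B K
    exact (div_pow_eq_sum_iff hb' n c).1 e
  obtain ⟨y, hy⟩ := h _ _ this
  exact ⟨y, by rw [hy, map_mul, mul_div_cancel_left₀ _ hb']⟩

theorem PIC.isDomain {B : Type*} [CommRing B] [IsLocalRing B] (h : PIC B) : IsDomain B := by
  have := h.isReduced
  have : NoZeroDivisors B := by
    refine ⟨fun {a b} hab => ?_⟩
    have : IntOver a (a + b) := ⟨2, fun i => if i = 1 then 1 else 0, by
      simp; linear_combination - hab⟩
    obtain ⟨c, hc⟩ := h _ _ this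
    have h1 : a * (1 - c) = 0 := by
      apply eq_zero_of_pow_eq_zero (n := 2)
      have : a * (1 - c) = b * c := by linear_combination hc
      linear_combination (a * (1-c)) * this + c * (1 - c) * hab
    have h2 : b * c = 0 := by linear_combination h1 - hc
    rcases IsLocalRing.isUnit_or_isUnit_one_sub_self c with h' | h'
    · right; exact (h'.mul_left_eq_zero).1 h2
    · left; exact (h'.mul_left_eq_zero).1 h1
  exact NoZeroDivisors.to_isDomain B

theorem isNormalRing_iff {B : Type u} [CommRing B] : IsNormalRing B ↔ PIC B := by
  constructor
  · intro h
    refine PIC.of_localization fun P _ => ?_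
    have := (h P).1
    have := (h P).2
    exact PIC.of_isIntegrallyClosed
  · intro h P _
    have h1 : PIC (Localization.AtPrime P) := h.localization P.primeCompl _
    have := h1.isDomain
    exact ⟨this, h1.isIntegrallyClosed⟩

/-- division reflects along faithfully flat maps -/
theorem dvd_of_faithfullyFlat {B B' : Type*} [CommRing B] [CommRing B'] [Algebra B B']
    [Module.FaithfullyFlat B B'] {a b : B} (h : algebraMap B B' b ∣ algebraMap B B' a) : b ∣ a := by
  have h1 := Ideal.comap_map_eq_self_of_faithfullyFlat (B := B') (Ideal.span {b})
  rw [Ideal.map_span, Set.image_singleton] at h1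
  rw [← Ideal.mem_span_singleton, ← h1, Ideal.mem_comap, Ideal.mem_span_singleton]
  exact h

theorem PIC.of_faithfullyFlat {B B' : Type*} [CommRing B] [CommRing B'] [Algebra B B']
    [Module.FaithfullyFlat B B'] (h : PIC B') : PIC B :=
  PIC.of_dvd_reflect (algebraMap B B') (fun _ _ => dvd_of_faithfullyFlat) h

theorem length_quot_add_one_le {O : Type*} [CommRing O] {I J : Ideal O} (h : I < J) :
    Module.length O (O ⧸ J) + 1 ≤ Module.length O (O ⧸ I) := by
  let f : (J.map (Ideal.Quotient.mk I)).restrictScalars O →ₗ[O] (O ⧸ I) := Submodule.subtype _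
  let g : (O ⧸ I) →ₗ[O] (O ⧸ J) := Submodule.factor h.le
  have hg : Function.Surjective g := Submodule.factor_surjective h.le
  let k : LinearMap.ker g →ₗ[O] (O ⧸ I) := (LinearMap.ker g).subtype
  have := Module.length_eq_add_of_exact k g Subtype.val_injective hg (by
    rw [LinearMap.exact_iff]; simp [k])
  rw [this, add_comm]
  gcongr
  obtain ⟨x, hxJ, hxI⟩ := Set.exists_of_ssubset h
  have : Nontrivial (LinearMap.ker g) := by
    refine ⟨⟨⟨Submodule.Quotient.mk x, ?_⟩, 0, ?_⟩⟩
    · change g (Submodule.Quotient.mk x) = 0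
      exact (Submodule.Quotient.mk_eq_zero J).2 hxJ
    · intro hh
      apply hxI
      have := congrArg Subtype.val hh
      exact (Submodule.Quotient.mk_eq_zero I).1 this
  exact Order.one_le_iff_pos.2 Module.length_pos

open scoped Pointwise in
theorem chain_bound {O W : Type*} [CommRing O] [IsDomain O] [IsNoetherianRing O] [CommRing W]
    [IsDomain W] [Algebra O W] (inj : Function.Injective (algebraMap O W))
    (frac : ∀ w : W, ∃ c : O, c ≠ 0 ∧ ∃ d, algebraMap O W c * w = algebraMap O W d)
    (hart : ∀ y : O, y ≠ 0 → IsArtinianRing (O ⧸ Ideal.span {y}))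
    (y : O) (hy : y ≠ 0) (n : ℕ) (w : ℕ → W) (hw : ∀ i, DvdNotUnit (w i) (w (i + 1)))
    (hwn : w n ∣ algebraMap O W y) :
    (n : ℕ∞) ≤ Module.length O (O ⧸ Ideal.span {y}) := by
  classical
  choose c0 hc0 d0 hd0 using frac
  let c : O := ∏ i ∈ Finset.range (n + 1), c0 (w i)
  have hc : c ≠ 0 := Finset.prod_ne_zero_iff.2 fun i _ => hc0 _
  have hcd : ∀ i, ∃ d, i ≤ n → algebraMap O W c * w i = algebraMap O W d := by
    intro i
    by_cases hi : i ≤ n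
    · refine ⟨(∏ j ∈ (Finset.range (n + 1)).erase i, c0 (w j)) * d0 (w i), fun _ => ?_⟩
      have : c = c0 (w i) * ∏ j ∈ (Finset.range (n + 1)).erase i, c0 (w j) :=
        (Finset.mul_prod_erase _ _ (by simpa using by omega)).symm
      rw [this, map_mul, map_mul, ← hd0]; ring
    · exact ⟨0, fun h => absurd h hi⟩
  choose d hd using hcd
  have hcW : algebraMap O W c ≠ 0 := by simpa using (map_ne_zero_iff _ inj).2 hc
  have hmono : ∀ i j, i ≤ j → w i ∣ w j := by
    intro i j hij
    induction j, hij using Nat.le_induction with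
    | base => exact dvd_rfl
    | succ j _ ih => exact ih.trans (by obtain ⟨_, x, _, hx⟩ := hw j; exact ⟨x, hx⟩)
  have hw0 : ∀ i, w i ≠ 0 := fun i => (hw i).1
  let J : Ideal O := Ideal.span (d '' {i | i ≤ n})
  let K : ℕ → Ideal O := fun i => J ⊓ (Ideal.span {algebraMap O W c * w i}).comap (algebraMap O W)
  have hK0 : K 0 = J := by
    refine le_antisymm inf_le_left (le_inf le_rfl ?_)
    refine Ideal.span_le.2 ?_
    rintro _ ⟨i, hi, rfl⟩
    change _ ∈ Ideal.span _
    rw [Ideal.mem_span_singleton, ← hd i hi]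
    exact mul_dvd_mul_left _ (hmono 0 i (Nat.zero_le _))
  have hdK : ∀ i j, i ≤ n → (d i ∈ K j ↔ w j ∣ w i) := by
    intro i j hi
    have h1 : d i ∈ J := Ideal.subset_span ⟨i, hi, rfl⟩
    have : d i ∈ K j ↔ algebraMap O W (d i) ∈ Ideal.span {algebraMap O W c * w j} :=
      ⟨fun h => h.2, fun h => ⟨h1, h⟩⟩
    rw [this, Ideal.mem_span_singleton, ← hd i hi, mul_dvd_mul_iff_left hcW]
  have hKlt : ∀ i, i < n → K (i + 1) < K i := by
    intro i hi
    refine lt_of_le_of_ne ?_ ?_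
    · refine inf_le_inf_left _ (Ideal.comap_mono ?_)
      rw [Ideal.span_singleton_le_span_singleton]
      exact mul_dvd_mul_left _ (hmono _ _ (Nat.le_succ _))
    · intro h
      have h1 : d i ∈ K i := (hdK i i hi.le).2 dvd_rfl
      rw [← h, hdK i _ hi.le] at h1
      obtain ⟨_, x, hx, hx2⟩ := hw i
      obtain ⟨z, hz⟩ := h1
      apply hx
      have : w i * (x * z) = w i * 1 := by rw [← mul_assoc, ← hx2, ← hz, mul_one]
      exact IsUnit.of_mul_eq_one z (mul_left_cancel₀ (hw0 i) this)
  have hlen : ∀ i, i ≤ n → Module.length O (O ⧸ J) + i ≤ Module.length O (O ⧸ K i) := by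
    intro i
    induction i with
    | zero => intro _; rw [hK0]; simp
    | succ i ih =>
      intro hi
      have := length_quot_add_one_le (hKlt i (by omega))
      refine le_trans ?_ this
      push_cast
      rw [← add_assoc]
      gcongr
      exact ih (by omega)
  have hJ0 : d 0 ≠ 0 := by
    intro h0
    have := hd 0 (Nat.zero_le _)
    rw [h0, map_zero] at this
    exact (mul_ne_zero hcW (hw0 0)) this
  have hJfin : Module.length O (O ⧸ J) ≠ ⊤ := by
    have hle : Ideal.span {d 0} ≤ J := by
      rw [Ideal.span_singleton_le_iff_mem]; exact Ideal.subset_span ⟨0, Nat.zero_le _, rfl⟩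
    have hs : Function.Surjective (Submodule.factor hle) := Submodule.factor_surjective hle
    have h1 := Module.length_le_of_surjective (R := O) (Submodule.factor hle) hs
    have := hart _ hJ0
    have h2 : Module.length O (O ⧸ Ideal.span {d 0}) ≠ ⊤ := by
      rw [Module.length_eq_of_surjective (S := O) (R := O ⧸ Ideal.span {d 0})
        (M := O ⧸ Ideal.span {d 0}) Ideal.Quotient.mk_surjective]
      exact Module.length_ne_top
    exact ne_top_of_le_ne_top h2 h1
  have hyK : y • J ≤ K n := by
    rintro _ ⟨x, hx, rfl⟩
    refine ⟨J.mul_mem_left y hx, ?_⟩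
    change algebraMap O W (y * x) ∈ Ideal.span _
    have hx0 : x ∈ K 0 := hK0.symm ▸ hx
    have hx1 : algebraMap O W x ∈ Ideal.span {algebraMap O W c * w 0} := hx0.2
    rw [Ideal.mem_span_singleton] at hx1 ⊢
    obtain ⟨z, hz⟩ := hx1
    obtain ⟨z', hz'⟩ := hwn
    exact ⟨z' * (w 0 * z), by rw [map_mul, hz, hz']; ring⟩
  have h3 := Module.length_eq_add_of_exact (Ideal.mulQuot y J)
          (Ideal.quotOfMul y J) (Ideal.mulQuot_injective J (mem_nonZeroDivisors_of_ne_zero hy))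
          (Ideal.quotOfMul_surjective J)
          (Ideal.exact_mulQuot_quotOfMul J)
  have h4 := Module.length_le_of_surjective (R := O) (Submodule.factor hyK)
    (Submodule.factor_surjective hyK)
  have h5 := (hlen n le_rfl).trans h4
  rw [h3] at h5
  exact (ENat.add_le_add_iff_left hJfin).1 h5

theorem isDVR_of_chain {O W : Type*} [CommRing O] [IsDomain O] [IsNoetherianRing O] [CommRing W]
    [IsDomain W] [ValuationRing W] [Algebra O W] (inj : Function.Injective (algebraMap O W))
    (frac : ∀ w : W, ∃ c : O, c ≠ 0 ∧ ∃ d, algebraMap O W c * w = algebraMap O W d)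
    (hart : ∀ y : O, y ≠ 0 → IsArtinianRing (O ⧸ Ideal.span {y}))
    (x : W) (hx0 : x ≠ 0) (hxu : ¬ IsUnit x) : IsDiscreteValuationRing W := by
  have hdvd : ∀ w : W, w ≠ 0 → ∃ y : O, y ≠ 0 ∧ w ∣ algebraMap O W y := by
    intro w hw
    obtain ⟨c, hc, d, hd⟩ := frac w
    refine ⟨d, ?_, ?_⟩
    · rintro rfl
      rw [map_zero] at hd
      exact mul_ne_zero ((map_ne_zero_iff _ inj).2 hc) hw hd
    · exact ⟨algebraMap O W c, by rw [← hd, mul_comm]⟩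
  have wf : WfDvdMonoid W := by
    refine ⟨?_⟩
    rw [wellFounded_iff_isEmpty_descending_chain]
    refine ⟨?_⟩
    rintro ⟨f, hf⟩
    obtain ⟨y, hy, hfy⟩ := hdvd (f 1) (hf 0).1
    have := hart y hy
    have hfin : Module.length O (O ⧸ Ideal.span {y}) ≠ ⊤ := by
      rw [Module.length_eq_of_surjective (S := O) (R := O ⧸ Ideal.span {y})
        (M := O ⧸ Ideal.span {y}) Ideal.Quotient.mk_surjective]
      exact Module.length_ne_top
    obtain ⟨l, hl⟩ := ENat.ne_top_iff_exists.1 hfin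
    have hb := chain_bound inj frac hart y hy
    have key : ∀ n : ℕ, ∀ w : ℕ → W, (∀ i < n, DvdNotUnit (w i) (w (i + 1))) → w n ≠ 0 →
      w n ∣ algebraMap O W y → (n : ℕ∞) ≤ Module.length O (O ⧸ Ideal.span {y}) := by
      intro n w hw hn0 hwn
      refine hb n (fun i => if i ≤ n then w i else w n * x ^ (i - n)) ?_ ?_
      · intro i
        rcases lt_trichotomy i n with h | h | h
        · have h1 : i ≤ n := by omega
          have h2 : i + 1 ≤ n := by omega
          simpa [h1, h2] using hw i h
        · subst h
          simpa using ⟨hn0, x, hxu, rfl⟩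
        · have h1 : ¬ i ≤ n := by omega
          have h2 : ¬ i + 1 ≤ n := by omega
          simp only [h1, h2, if_false]
          refine ⟨mul_ne_zero hn0 (pow_ne_zero _ hx0), x, hxu, ?_⟩
          rw [show i + 1 - n = (i - n) + 1 by omega, pow_succ, mul_assoc]
      · simpa using hwn
    have := key (l + 1) (fun i => f (l + 2 - i)) (by
      intro i hi
      have := hf (l + 2 - (i + 1))
      rwa [show l + 2 - (i + 1) + 1 = l + 2 - i by omega] at this) (by
      simpa using (hf 0).1) (by simpa using hfy)
    rw [← hl] at this
    norm_cast at this
    omega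
  apply IsDiscreteValuationRing.ofHasUnitMulPowIrreducibleFactorization
  obtain ⟨p, hp, -⟩ := WfDvdMonoid.exists_irreducible_factor hxu hx0
  refine ⟨p, hp, ?_⟩
  intro z hz
  induction z using WfDvdMonoid.induction_on_irreducible with
  | zero => exact absurd rfl hz
  | unit u hu => exact ⟨0, by rw [pow_zero]; exact (associated_one_iff_isUnit.2 hu).symm⟩
  | mul a i ha hi ih =>
    obtain ⟨n, hn⟩ := ih ha
    refine ⟨n + 1, ?_⟩
    rw [pow_succ, mul_comm]
    refine Associated.mul_mul ?_ hn
    rcases ValuationRing.dvd_total p i with h | h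
    · exact hp.associated_of_dvd hi h
    · exact (hi.associated_of_dvd hp h).symm

theorem exists_val {O K : Type*} [CommRing O] [Field K] (f : O →+* K) (hf : Function.Injective f)
    (I : Ideal O) (hI : I ≠ ⊤) : ∃ W : ValuationSubring K, (∀ d : O, f d ∈ W) ∧
      ∀ d ∈ I, f d ∈ W.nonunits := by
  let e : O ≃+* f.range := RingEquiv.ofBijective f.rangeRestrict
      ⟨fun a b h => hf (congrArg Subtype.val h), f.rangeRestrict_surjective⟩
  obtain ⟨B, hB, hB2⟩ := Ideal.image_subset_nonunits_valuationSubring (K := K)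
      (I.map e) (fun h => hI (by
        have := congrArg (Ideal.comap e) h
        rwa [Ideal.comap_top, Ideal.comap_map_of_bijective _ e.bijective] at this))
  exact ⟨B, fun d => hB ⟨d, rfl⟩, fun d hd => hB2 ⟨e d, Ideal.mem_map_of_mem _ hd, rfl⟩⟩

theorem exists_dvr_one {O : Type u} [CommRing O] [IsDomain O] [IsNoetherianRing O] [IsLocalRing O]
    (hheight : (maximalIdeal O).height ≤ 1) (x : O) (hx : x ∈ maximalIdeal O) (hx0 : x ≠ 0) :
    ∃ (V : Type u) (_ : CommRing V) (_ : IsDomain V) (_ : IsDiscreteValuationRing V)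
      (φ : O →+* V), Function.Injective φ ∧ ∀ x ∈ maximalIdeal O, φ x ∈ maximalIdeal V := by
  have hOinj := IsFractionRing.injective O (FractionRing O)
  have hart : ∀ y : O, y ≠ 0 → IsArtinianRing (O ⧸ Ideal.span {y}) := by
    intro y hy
    by_cases hyu : IsUnit y
    · have : Subsingleton (O ⧸ Ideal.span {y}) :=
        Ideal.Quotient.subsingleton_iff.2 (Ideal.span_singleton_eq_top.2 hyu)
      infer_instance
    · apply IsLocalRing.quotient_artinian_of_mem_minimalPrimes_of_isLocalRing
      refine Ideal.mem_minimalPrimes_of_height_le ?_ (hheight.trans ?_)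
      · rw [Ideal.span_singleton_le_iff_mem]; exact hyu
      · exact Ideal.one_le_height_span_singleton_of_mem_nonZeroDivisors
          (mem_nonZeroDivisors_of_ne_zero hy)
  obtain ⟨W', hW'1, hW'2⟩ := exists_val (algebraMap O (FractionRing O)) hOinj (maximalIdeal O)
    (maximalIdeal.isMaximal O).ne_top
  let ψ : O →+* W' := (algebraMap O (FractionRing O)).codRestrict W'.toSubring hW'1
  let _ : Algebra O W' := ψ.toAlgebra
  have hmax : ∀ o ∈ maximalIdeal O, ψ o ∈ maximalIdeal W' := by
    intro o ho
    obtain ⟨h, h2⟩ := ValuationSubring.mem_nonunits_iff_exists_mem_maximalIdeal.1 (hW'2 o ho)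
    exact h2
  have hψ : Function.Injective ψ := fun a b h => hOinj (congrArg Subtype.val h)
  have hDVR : IsDiscreteValuationRing W' := by
    refine isDVR_of_chain (O := O) (W := W') hψ ?_ hart (ψ x)
      ((map_ne_zero_iff _ hψ).2 hx0) (hmax _ hx)
    intro w
    obtain ⟨a, b, hb, h⟩ := IsFractionRing.div_surjective (A := O) (w : FractionRing O)
    have hb0 : b ≠ 0 := nonZeroDivisors.ne_zero hb
    refine ⟨b, hb0, a, ?_⟩
    apply Subtype.ext
    change algebraMap O (FractionRing O) _ * (w : FractionRing O) = algebraMap O (FractionRing O) _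
    rw [← h, mul_div_cancel₀]
    exact (map_ne_zero_iff _ hOinj).2 hb0
  exact ⟨W', inferInstance, inferInstance, hDVR, ψ, hψ, hmax⟩

theorem exists_dvr_two {T : Type u} [CommRing T] [IsDomain T] [IsNoetherianRing T] (xT : T)
    (hx0 : xT ≠ 0) (hxT : ¬ IsUnit xT) :
    ∃ (V : Type u) (_ : CommRing V) (_ : IsDomain V) (_ : IsDiscreteValuationRing V)
      (φ : T →+* V), Function.Injective φ ∧ φ xT ∈ maximalIdeal V := by
  obtain ⟨P, hP⟩ := Ideal.nonempty_minimalPrimes (I := Ideal.span {xT}) (by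
    rwa [Ne, Ideal.span_singleton_eq_top])
  have hPp : P.IsPrime := hP.1.1
  have hxP : xT ∈ P := hP.1.2 (Ideal.mem_span_singleton_self _)
  have hle : P.primeCompl ≤ nonZeroDivisors T := P.primeCompl_le_nonZeroDivisors
  have hOdom : IsDomain (Localization.AtPrime P) := IsLocalization.isDomain_localization hle
  have hOnoeth : IsNoetherianRing (Localization.AtPrime P) :=
    IsLocalization.isNoetherianRing P.primeCompl _ ‹_›
  have hheight : (maximalIdeal (Localization.AtPrime P)).height ≤ 1 := by
    have := Ideal.height_le_one_of_isPrincipal_of_mem_minimalPrimes _ P hP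
    rwa [← Localization.AtPrime.under_maximalIdeal (I := P),
      IsLocalization.height_under P.primeCompl] at this
  have hTO : Function.Injective (algebraMap T (Localization.AtPrime P)) :=
    IsLocalization.injective _ hle
  have hx := (IsLocalization.AtPrime.to_map_mem_maximal_iff (Localization.AtPrime P) P xT).2 hxP
  obtain ⟨V, i1, i2, i3, φ, h1, h2⟩ := exists_dvr_one hheight
    (algebraMap T (Localization.AtPrime P) xT) hx ((map_ne_zero_iff _ hTO).2 hx0)
  exact ⟨V, i1, i2, i3, φ.comp (algebraMap _ _), h1.comp hTO, h2 _ hx⟩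

theorem exists_dvr {D : Type u} [CommRing D] [IsDomain D] [IsNoetherianRing D] (n : Ideal D)
    (hn : n ≠ ⊤) (hn0 : n ≠ ⊥) :
    ∃ (V : Type u) (_ : CommRing V) (_ : IsDomain V) (_ : IsDiscreteValuationRing V)
      (φ : D →+* V), Function.Injective φ ∧ ∀ x ∈ n, φ x ∈ maximalIdeal V := by
  classical
  obtain ⟨W, hW1, hW2⟩ := exists_val (algebraMap D (FractionRing D))
    (IsFractionRing.injective _ _) n hn
  obtain ⟨s, hs⟩ := (IsNoetherian.noetherian n : n.FG)
  have hsne : s.Nonempty := by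
    rw [Finset.nonempty_iff_ne_empty]; rintro rfl
    apply hn0; rw [← hs]; simp
  obtain ⟨x, hxs, hx⟩ := s.exists_max_image
    (fun d => W.valuation (algebraMap D (FractionRing D) d)) hsne
  have hx0 : x ≠ 0 := by
    rintro rfl
    apply hn0
    rw [← hs, Submodule.span_eq_bot]
    intro d hd
    have := hx d hd
    simpa using this
  have hxK : algebraMap D (FractionRing D) x ≠ 0 :=
    (map_ne_zero_iff _ (IsFractionRing.injective D _)).2 hx0
  have hxn : x ∈ n := hs ▸ Submodule.subset_span hxs
  let T : Subalgebra D (FractionRing D) := Algebra.adjoin D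
    ((fun d => algebraMap D (FractionRing D) d / algebraMap D (FractionRing D) x) '' s)
  have hTW : ∀ t ∈ T, t ∈ W := by
    intro t ht
    induction ht using Algebra.adjoin_induction with
    | mem t h =>
      obtain ⟨d, hd, rfl⟩ := h
      rw [← W.valuation_le_one_iff]
      change W.valuation (_ / _) ≤ 1
      rw [map_div₀]
      have : 0 < W.valuation (algebraMap D (FractionRing D) x) := by
        rw [zero_lt_iff]; simpa using hx0
      exact (div_le_one₀ this).2 (hx d hd)
    | algebraMap d => exact hW1 d
    | add a b _ _ h1 h2 => exact W.add_mem _ _ h1 h2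
    | mul a b _ _ h1 h2 => exact W.mul_mem _ _ h1 h2
  have hTnoeth : IsNoetherianRing T := by
    have : Algebra.FiniteType D T := by
      rw [← Subalgebra.fg_iff_finiteType]
      exact ⟨s.image _, by rw [Finset.coe_image]⟩
    exact Algebra.FiniteType.isNoetherianRing D T
  let xT : T := algebraMap D T x
  have hxT : ¬ IsUnit xT := by
    intro h
    obtain ⟨y, hy⟩ := h.exists_right_inv
    have hy' : algebraMap D (FractionRing D) x * (y : FractionRing D) = 1 :=
      congrArg Subtype.val hy
    have h1 := hW2 x hxn
    rw [ValuationSubring.mem_nonunits_iff] at h1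
    have h2 : W.valuation (y : FractionRing D) ≤ 1 := (W.valuation_le_one_iff _).2 (hTW _ y.2)
    have h3 := congrArg W.valuation hy'
    rw [map_mul, map_one] at h3
    exact absurd h3 (mul_lt_one_of_lt_of_le h1 h2).ne
  have hDT : Function.Injective (algebraMap D T) := fun a b h =>
    IsFractionRing.injective D (FractionRing D) (congrArg Subtype.val h)
  obtain ⟨V, i1, i2, i3, φ, h1, h2⟩ := exists_dvr_two xT ((map_ne_zero_iff _ hDT).2 hx0) hxT
  refine ⟨V, i1, i2, i3, φ.comp (algebraMap D T), h1.comp hDT, ?_⟩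
  have : n ≤ (maximalIdeal V).comap (φ.comp (algebraMap D T)) := by
    rw [← hs, Submodule.span_le]
    intro d hd
    change φ (algebraMap D T d) ∈ maximalIdeal V
    have : algebraMap D T d = xT * ⟨algebraMap D (FractionRing D) d /
        algebraMap D (FractionRing D) x, Algebra.subset_adjoin ⟨d, hd, rfl⟩⟩ := by
      apply Subtype.ext
      change algebraMap D (FractionRing D) d = algebraMap D (FractionRing D) x *
        (algebraMap D (FractionRing D) d / algebraMap D (FractionRing D) x)
      rw [mul_div_cancel₀]
      exact hxK
    rw [this, map_mul]
    exact (maximalIdeal V).mul_mem_right _ h2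
  exact this

-- completeness of finite modules
theorem isPrecomplete_of_surjective {R M N : Type*} [CommRing R] [AddCommGroup M] [Module R M]
    [AddCommGroup N] [Module R N] (I : Ideal R) (f : M →ₗ[R] N) (hf : Function.Surjective f)
    (hM : IsPrecomplete I M) : IsPrecomplete I N := by
  have hmap : ∀ n : ℕ, (I ^ n • ⊤ : Submodule R N) = Submodule.map f (I ^ n • ⊤) := by
    intro n
    rw [Submodule.map_smul'', Submodule.map_top, LinearMap.range_eq_top.mpr hf]
  refine ⟨fun g hg => ?_⟩
  have h1 : ∀ n, ∃ d ∈ (I ^ n • ⊤ : Submodule R M), f d = g (n + 1) - g n := by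
    intro n
    have := (SModEq.sub_mem).mp (hg (Nat.le_succ n)).symm
    rw [hmap] at this
    exact this
  choose d hd hfd using h1
  obtain ⟨x0, hx0⟩ := hf (g 0)
  let x : ℕ → M := fun n => x0 + ∑ i ∈ Finset.range n, d i
  have hx : ∀ n, f (x n) = g n := by
    intro n
    induction n with
    | zero => simp [x, hx0]
    | succ n ih =>
      have : x (n + 1) = x n + d n := by simp [x, Finset.sum_range_succ, add_assoc]
      rw [this, map_add, ih, hfd]; abel
  have hc : ∀ {m n}, m ≤ n → x m ≡ x n [SMOD (I ^ m • ⊤ : Submodule R M)] := by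
    intro m n hmn
    induction n, hmn using Nat.le_induction with
    | base => rfl
    | succ n hmn ih =>
      refine ih.trans ?_
      have : x (n + 1) = x n + d n := by simp [x, Finset.sum_range_succ, add_assoc]
      rw [this]
      refine SModEq.symm (SModEq.sub_mem.mpr ?_)
      rw [add_sub_cancel_left]
      exact Submodule.smul_mono_left (Ideal.pow_le_pow_right hmn) (hd n)
  obtain ⟨L, hL⟩ := hM.prec hc
  refine ⟨f L, fun n => ?_⟩
  rw [← hx n, hmap]
  exact SModEq.sub_mem.mpr (by
    rw [← map_sub]
    exact Submodule.mem_map_of_mem (SModEq.sub_mem.mp (hL n)))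

theorem mem_smul_top_pi {R ι : Type*} [CommRing R] [Finite ι] (I : Ideal R) (x : ι → R) :
    x ∈ (I • ⊤ : Submodule R (ι → R)) ↔ ∀ i, x i ∈ I := by
  classical
  cases nonempty_fintype ι
  constructor
  · intro h i
    have : (LinearMap.proj i : (ι → R) →ₗ[R] R) x ∈ Submodule.map (LinearMap.proj i) (I • ⊤ : Submodule R (ι → R)) :=
      Submodule.mem_map_of_mem h
    rw [Submodule.map_smul''] at this
    have h2 := Submodule.smul_mono (le_refl I) (le_top : Submodule.map (LinearMap.proj i : (ι → R) →ₗ[R] R) ⊤ ≤ ⊤) this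
    simpa using h2
  · intro h
    rw [pi_eq_sum_univ' x]
    refine Submodule.sum_mem _ fun i _ => Submodule.smul_mem_smul (h i) trivial

theorem isPrecomplete_pi {R ι : Type*} [CommRing R] [Finite ι] (I : Ideal R)
    (h : IsPrecomplete I R) : IsPrecomplete I (ι → R) := by
  refine ⟨fun g hg => ?_⟩
  have : ∀ i, ∃ L : R, ∀ n, g n i ≡ L [SMOD (I ^ n • ⊤ : Submodule R R)] := by
    intro i
    refine h.prec fun {m n} hmn => ?_
    have := SModEq.sub_mem.mp (hg hmn)
    rw [mem_smul_top_pi] at this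
    exact SModEq.sub_mem.mpr (by simpa using this i)
  choose L hL using this
  refine ⟨L, fun n => SModEq.sub_mem.mpr ?_⟩
  rw [mem_smul_top_pi]
  intro i
  simpa using SModEq.sub_mem.mp (hL i n)

theorem isPrecomplete_of_finite {R M : Type*} [CommRing R] [AddCommGroup M] [Module R M]
    [Module.Finite R M] (I : Ideal R) (h : IsPrecomplete I R) : IsPrecomplete I M := by
  obtain ⟨n, f, hf⟩ := Module.Finite.exists_fin' R M
  exact isPrecomplete_of_surjective I f hf (isPrecomplete_pi I h)

theorem isAdicComplete_of_finite {R M : Type*} [CommRing R] [IsNoetherianRing R] [AddCommGroup M] [Module R M]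
    [Module.Finite R M] (I : Ideal R) [h : IsAdicComplete I R] : IsAdicComplete I M := by
  haveI : IsHausdorff I M := IsHausdorff.of_le_jacobson I M (IsAdicComplete.le_jacobson_bot I)
  haveI : IsPrecomplete I M := isPrecomplete_of_finite I inferInstance
  constructor

-- complete Nakayama
theorem finite_of_complete {R M : Type*} [CommRing R] [AddCommGroup M] [Module R M] (I : Ideal R)
    [IsPrecomplete I R] [IsHausdorff I M] {ι : Type*} [Finite ι] (v : ι → M)
    (hv : Submodule.span R (Set.range v) ⊔ I • ⊤ = ⊤) : Submodule.span R (Set.range v) = ⊤ := by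
  classical
  cases nonempty_fintype ι
  haveI := isPrecomplete_pi (ι := ι) I inferInstance
  have := surjective_of_mkQ_comp_surjective (I := I) (f := Fintype.linearCombination R v) (by
    intro y
    obtain ⟨y, rfl⟩ := Submodule.mkQ_surjective _ y
    have hy : y ∈ Submodule.span R (Set.range v) ⊔ I • ⊤ := by rw [hv]; trivial
    obtain ⟨a, ha, b, hb, rfl⟩ := Submodule.mem_sup.mp hy
    rw [← Fintype.range_linearCombination R] at ha
    obtain ⟨c, rfl⟩ := ha
    refine ⟨c, ?_⟩
    simp only [LinearMap.comp_apply, map_add]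
    rw [left_eq_add]
    simpa using hb)
  rw [← Fintype.range_linearCombination R, LinearMap.range_eq_top.mpr this]

-- evaluation of power series
theorem exists_mvPowerSeries_eval {σ C S : Type*} [Finite σ] [CommRing C] [CommRing S] (I : Ideal S)
    [IsAdicComplete I S] (φ : C →+* S) (s : σ → S) (hs : ∀ i, s i ∈ I) :
    ∃ F : MvPowerSeries σ C →+* S, ∀ p : MvPolynomial σ C,
      F (p : MvPowerSeries σ C) = MvPolynomial.eval₂ φ s p := by
  have hle : ∀ n : ℕ, MvPolynomial.idealOfVars σ C ^ n ≤ Ideal.comap (MvPolynomial.eval₂Hom φ s) (I ^ n) := by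
    intro n
    have h1 : MvPolynomial.idealOfVars σ C ≤ Ideal.comap (MvPolynomial.eval₂Hom φ s) I := by
      rw [MvPolynomial.idealOfVars, Ideal.span_le]
      rintro _ ⟨i, rfl⟩
      simpa using hs i
    exact (Ideal.pow_right_mono h1 n).trans (Ideal.le_comap_pow _ n)
  let f : ∀ n, MvPowerSeries σ C →+* S ⧸ I ^ n := fun n =>
    ((Ideal.quotientMap (I ^ n) (MvPolynomial.eval₂Hom φ s) (hle n)).comp
      (AdicCompletion.evalₐ (MvPolynomial.idealOfVars σ C) n).toRingHom).comp
      (MvPowerSeries.toAdicCompletionAlgEquiv σ C).toRingEquiv.toRingHom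
  have hf : ∀ {m n} (hle : m ≤ n), (Ideal.Quotient.factorPow I hle).comp (f n) = f m := by
    intro m n hmn
    ext x
    obtain ⟨y, hy⟩ := AdicCompletion.mk_surjective _ _ (MvPowerSeries.toAdicCompletionAlgEquiv σ C x)
    have h3 := SModEq.sub_mem.mp (y.2 hmn)
    rw [smul_eq_mul, Ideal.mul_top] at h3
    simp only [f, RingHom.comp_apply]
    change Ideal.Quotient.factorPow I hmn (Ideal.quotientMap _ _ _ (AdicCompletion.evalₐ (MvPolynomial.idealOfVars σ C) n (MvPowerSeries.toAdicCompletionAlgEquiv σ C x))) = Ideal.quotientMap _ _ _ (AdicCompletion.evalₐ (MvPolynomial.idealOfVars σ C) m (MvPowerSeries.toAdicCompletionAlgEquiv σ C x))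
    rw [← hy, AdicCompletion.evalₐ_mk, AdicCompletion.evalₐ_mk]
    simp only [Ideal.quotientMap_mk]
    refine Eq.symm (Ideal.Quotient.eq.mpr ?_)
    rw [← map_sub]
    exact hle m h3
  refine ⟨IsAdicComplete.liftRingHom I f hf, fun p => ?_⟩
  have key : ∀ n : ℕ, Ideal.Quotient.mk (I ^ n) (IsAdicComplete.liftRingHom I f hf p) = Ideal.Quotient.mk (I ^ n) (MvPolynomial.eval₂ φ s p) := by
    intro n
    rw [IsAdicComplete.mk_liftRingHom]
    simp only [f, RingHom.comp_apply]
    change Ideal.quotientMap _ _ _ (AdicCompletion.evalₐ (MvPolynomial.idealOfVars σ C) n (MvPowerSeries.toAdicCompletionAlgEquiv σ C p)) = _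
    rw [MvPowerSeries.toAdicCompletionAlgEquiv_apply, MvPowerSeries.toAdicCompletion_coe, AdicCompletion.evalₐ_of]
    simp
  rw [← sub_eq_zero]
  refine IsHausdorff.haus (inferInstance : IsHausdorff I S) _ fun n => ?_
  rw [SModEq.zero]
  have := Ideal.Quotient.eq.mp (key n)
  simpa using this

theorem isNoetherianRing_of_complete {R0 S : Type*} [CommRing R0] [IsNoetherianRing R0] [CommRing S]
    (I : Ideal S) (hI : I.FG) [IsAdicComplete I S] (φ : R0 →+* S)
    (h : Function.Surjective ((Ideal.Quotient.mk I).comp φ)) : IsNoetherianRing S := by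
  obtain ⟨n, s, hs⟩ := Submodule.fg_iff_exists_fin_generating_family.mp hI
  obtain ⟨F, hF⟩ := exists_mvPowerSeries_eval I φ s (fun i => hs ▸ Submodule.subset_span ⟨i, rfl⟩)
  have hmap : Ideal.map F (Ideal.span (Set.range MvPowerSeries.X)) = I := by
    rw [Ideal.map_span, ← Set.range_comp, ← hs]
    congr 1
    congr 1
    ext i
    simpa using hF (MvPolynomial.X i)
  haveI : IsNoetherianRing (MvPowerSeries (Fin n) R0) := MvPowerSeries.isNoetherianRing R0
  haveI : IsHausdorff (Ideal.map F (Ideal.span (Set.range MvPowerSeries.X))) S := by rw [hmap]; infer_instance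
  refine isNoetherianRing_of_surjective _ _ F (surjective_of_mk_map_comp_surjective (I := Ideal.span (Set.range MvPowerSeries.X)) F ?_)
  intro y
  obtain ⟨y, rfl⟩ := Ideal.Quotient.mk_surjective y
  obtain ⟨c, hc⟩ := h (Ideal.Quotient.mk I y)
  refine ⟨MvPowerSeries.C c, ?_⟩
  have : F (MvPowerSeries.C c) = φ c := by simpa using hF (MvPolynomial.C c)
  rw [RingHom.comp_apply, this, Ideal.Quotient.eq, hmap]
  exact Ideal.Quotient.eq.mp hc

instance adicCompletion_noetherian {R : Type*} [CommRing R] [IsNoetherianRing R] [IsLocalRing R] :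
    IsNoetherianRing (AdicCompletion (maximalIdeal R) R) := by
  refine isNoetherianRing_of_complete (R0 := R) (maximalIdeal (AdicCompletion (maximalIdeal R) R)) ?_ (algebraMap _ _) ?_
  · rw [AdicCompletion.maximalIdeal_eq_map]
    exact Ideal.FG.map (IsNoetherian.noetherian (maximalIdeal R)) _
  · have := (AdicCompletion.residueField_map_bijective (R := R)).2
    intro y
    obtain ⟨x, hx⟩ := this y
    obtain ⟨x, rfl⟩ := IsLocalRing.residue_surjective x
    exact ⟨x, hx⟩

theorem lTensor_injective_of_field {R k W N N' : Type*} [CommRing R] [Field k] [Algebra R k]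
    [AddCommGroup W] [Module R W] [Module k W] [IsScalarTower R k W] [AddCommGroup N] [Module R N]
    [AddCommGroup N'] [Module R N'] (f : N →ₗ[R] N') (hf : Function.Injective (f.baseChange k)) :
    Function.Injective (f.lTensor W) := by
  have h1 : Function.Injective ((f.baseChange k).lTensor W) :=
    Module.Flat.lTensor_preserves_injective_linearMap _ hf
  let e := TensorProduct.AlgebraTensorModule.cancelBaseChange R k k W N
  let e' := TensorProduct.AlgebraTensorModule.cancelBaseChange R k k W N'
  have h2 : ∀ t, f.lTensor W (e t) = e' ((f.baseChange k).lTensor W t) := by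
    intro t
    induction t with
    | zero => simp
    | add x y hx hy => simp only [map_add, hx, hy]
    | tmul w y =>
      induction y with
      | zero => simp
      | add x y hx hy => simp only [map_add, TensorProduct.tmul_add, hx, hy]
      | tmul c n => simp [e, e']
  intro x y hxy
  obtain ⟨x, rfl⟩ := e.surjective x
  obtain ⟨y, rfl⟩ := e.surjective y
  rw [h2, h2] at hxy
  rw [h1 (e'.injective hxy)]

theorem mem_pow_smul_of_mem_range {R A M X : Type*} [CommRing R] [CommRing A] [Algebra R A]
    [AddCommGroup M] [Module R M] [Module A M] [IsScalarTower R A M] [AddCommGroup X] [Module R X]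
    (I : Ideal R) (t : M ⊗[R] X)
    (h : t ∈ LinearMap.range (LinearMap.lTensor M (I • ⊤ : Submodule R X).subtype)) :
    t ∈ (I.map (algebraMap R A) • ⊤ : Submodule A (M ⊗[R] X)) := by
  obtain ⟨s, rfl⟩ := h
  induction s with
  | zero => simp
  | add x y hx hy => rw [map_add]; exact Submodule.add_mem _ hx hy
  | tmul a x =>
    obtain ⟨x, hx⟩ := x
    simp only [LinearMap.lTensor_tmul, Submodule.subtype_apply]
    induction hx using Submodule.smul_induction_on' with
    | smul r hr n hn =>
      rw [TensorProduct.tmul_smul, ← algebraMap_smul A r (a ⊗ₜ[R] n)]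
      exact Submodule.smul_mem_smul (Ideal.mem_map_of_mem _ hr) trivial
    | add x hx y hy h1 h2 => rw [TensorProduct.tmul_add]; exact Submodule.add_mem _ h1 h2

theorem krull_tensor {R A M X : Type*} [CommRing R] [IsLocalRing R] [CommRing A] [IsNoetherianRing A]
    [IsLocalRing A] [Algebra R A] [IsLocalHom (algebraMap R A)]
    [AddCommGroup M] [Module R M] [Module A M] [IsScalarTower R A M] [Module.Finite A M]
    [AddCommGroup X] [Module R X] [Module.Finite R X] (t : M ⊗[R] X)
    (h : ∀ n : ℕ, t ∈ LinearMap.range (LinearMap.lTensor M ((maximalIdeal R) ^ n • ⊤ : Submodule R X).subtype)) :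
    t = 0 := by
  have hle : (maximalIdeal R).map (algebraMap R A) ≤ maximalIdeal A := by
    rw [Ideal.map_le_iff_le_comap]
    exact (((local_hom_TFAE (algebraMap R A)).out 0 4 rfl rfl).mp inferInstance).ge
  haveI : Module.Finite A (M ⊗[R] X) :=
    Module.Finite.equiv (TensorProduct.AlgebraTensorModule.cancelBaseChange R A A M X)
  haveI : IsHausdorff (maximalIdeal A) (M ⊗[R] X) := inferInstance
  refine IsHausdorff.haus this t fun n => ?_
  rw [SModEq.zero]
  have := mem_pow_smul_of_mem_range (A := A) _ t (h n)
  rw [Ideal.map_pow] at this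
  exact Submodule.smul_mono_left (Ideal.pow_right_mono hle n) this

theorem mem_range_of_quot {R M X : Type*} [CommRing R] [AddCommGroup M] [Module R M]
    [AddCommGroup X] [Module R X] (Y : Submodule R X) (t : M ⊗[R] X)
    (h : LinearMap.lTensor M Y.mkQ t = 0) : t ∈ LinearMap.range (LinearMap.lTensor M Y.subtype) := by
  have := lTensor_exact M (f := Y.subtype) (g := Y.mkQ) (LinearMap.exact_subtype_mkQ Y) (Submodule.mkQ_surjective Y)
  exact (this t).mp h

theorem lemmaH_fg {R A X : Type*} [CommRing R] [IsNoetherianRing R] [IsLocalRing R]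
    [CommRing A] [IsNoetherianRing A] [IsLocalRing A] [Algebra R A] [IsLocalHom (algebraMap R A)]
    [Module.Flat R A] (h : A)
    (hk : ∀ t : ResidueField R ⊗[R] A, (1 ⊗ₜ h) * t = 0 → t = 0)
    [AddCommGroup X] [Module R X] [Module.Finite R X] (t : A ⊗[R] X) (ht : h • t = 0) : t = 0 := by
  have hsm : ∀ (W : Type _) [AddCommGroup W] [Module R W] (t : A ⊗[R] W),
      TensorProduct.comm R A W (h • t) = LinearMap.lTensor W (LinearMap.mulLeft R h) (TensorProduct.comm R A W t) := by
    intro W _ _ t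
    induction t with
    | zero => simp
    | add x y hx hy => simp only [smul_add, map_add, hx, hy]
    | tmul a x => simp [TensorProduct.smul_tmul']
  have hbc : Function.Injective ((LinearMap.mulLeft R h).baseChange (ResidueField R)) := by
    rw [injective_iff_map_eq_zero]
    intro t ht
    apply hk
    rw [← ht]
    clear ht
    induction t with
    | zero => simp
    | add x y hx hy => rw [mul_add, map_add, hx, hy]
    | tmul a x => simp
  have hW : ∀ (Y : Submodule R X) (t : A ⊗[R] (Y ⧸ (maximalIdeal R • ⊤ : Submodule R Y))), h • t = 0 → t = 0 := by
    intro Y t ht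
    letI : Module (ResidueField R) (Y ⧸ (maximalIdeal R • ⊤ : Submodule R Y)) :=
      inferInstanceAs (Module (R ⧸ maximalIdeal R) _)
    haveI : IsScalarTower R (ResidueField R) (Y ⧸ (maximalIdeal R • ⊤ : Submodule R Y)) :=
      inferInstanceAs (IsScalarTower R (R ⧸ maximalIdeal R) _)
    have h1 := lTensor_injective_of_field (W := (Y ⧸ (maximalIdeal R • ⊤ : Submodule R Y))) (LinearMap.mulLeft R h) hbc
    have h2 := hsm _ t
    rw [ht, map_zero] at h2
    apply (TensorProduct.comm R A _).injective
    apply h1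
    rw [← h2]; simp
  refine krull_tensor (A := A) t fun n => ?_
  induction n with
  | zero =>
    apply mem_range_of_quot
    have : (maximalIdeal R ^ 0 • ⊤ : Submodule R X).mkQ = 0 := by
      ext x; simp
    rw [this]; simp
  | succ n ih =>
    set Y := (maximalIdeal R ^ n • ⊤ : Submodule R X) with hY
    obtain ⟨t', rfl⟩ := ih
    have hinj : Function.Injective (LinearMap.lTensor A Y.subtype) :=
      Module.Flat.lTensor_preserves_injective_linearMap _ Y.injective_subtype
    have hAl : ∀ {P Q : Type _} [AddCommGroup P] [AddCommGroup Q] [Module R P] [Module R Q] (f : P →ₗ[R] Q) (a : A) (t : A ⊗[R] P), LinearMap.lTensor A f (a • t) = a • LinearMap.lTensor A f t := by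
      intro P Q _ _ _ _ f a t
      exact map_smul (TensorProduct.AlgebraTensorModule.lTensor A A f) a t
    have ht' : h • t' = 0 := by
      apply hinj
      rw [hAl, ht, map_zero]
    have h3 : LinearMap.lTensor A (maximalIdeal R • ⊤ : Submodule R Y).mkQ t' = 0 := by
      apply hW
      rw [← hAl, ht', map_zero]
    obtain ⟨t'', rfl⟩ := mem_range_of_quot _ _ h3
    have hle : ∀ y : (maximalIdeal R • ⊤ : Submodule R Y), ((y : Y) : X) ∈ (maximalIdeal R ^ (n + 1) • ⊤ : Submodule R X) := by
      intro y
      have h4 : ((y : Y) : X) ∈ Submodule.map Y.subtype (maximalIdeal R • ⊤ : Submodule R Y) := ⟨y, y.2, rfl⟩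
      rw [Submodule.map_smul'', Submodule.map_top, Submodule.range_subtype] at h4
      rw [pow_succ', mul_smul]
      exact h4
    refine ⟨LinearMap.lTensor A (LinearMap.codRestrict _ (Y.subtype ∘ₗ (maximalIdeal R • ⊤ : Submodule R Y).subtype) hle) t'', ?_⟩
    rw [← LinearMap.comp_apply, ← LinearMap.comp_apply, ← LinearMap.lTensor_comp, ← LinearMap.lTensor_comp]
    congr 1

theorem lTensor_smulA {R A P Q : Type*} [CommRing R] [CommRing A] [Algebra R A] [AddCommGroup P] [AddCommGroup Q] [Module R P] [Module R Q] (f : P →ₗ[R] Q) (a : A) (t : A ⊗[R] P) : LinearMap.lTensor A f (a • t) = a • LinearMap.lTensor A f t :=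
  map_smul (TensorProduct.AlgebraTensorModule.lTensor A A f) a t

theorem lemmaH {R A X : Type*} [CommRing R] [IsNoetherianRing R] [IsLocalRing R]
    [CommRing A] [IsNoetherianRing A] [IsLocalRing A] [Algebra R A] [IsLocalHom (algebraMap R A)]
    [Module.Flat R A] (h : A)
    (hk : ∀ t : ResidueField R ⊗[R] A, (1 ⊗ₜ h) * t = 0 → t = 0)
    [AddCommGroup X] [Module R X] (t : A ⊗[R] X) (ht : h • t = 0) : t = 0 := by
  obtain ⟨Y, hY, hs⟩ := TensorProduct.exists_finite_submodule_right_of_setFinite ({t} : Set (A ⊗[R] X)) (Set.finite_singleton t)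
  obtain ⟨t', rfl⟩ := hs rfl
  have hinj : Function.Injective (LinearMap.lTensor A Y.subtype) :=
      Module.Flat.lTensor_preserves_injective_linearMap _ Y.injective_subtype
  rw [lemmaH_fg h hk t' (hinj (by rw [lTensor_smulA, ht, map_zero])), map_zero]

-- A / hA is flat
theorem flat_quot {R A : Type*} [CommRing R] [IsNoetherianRing R] [IsLocalRing R]
    [CommRing A] [IsNoetherianRing A] [IsLocalRing A] [Algebra R A] [IsLocalHom (algebraMap R A)]
    [Module.Flat R A] (h : A)
    (hk : ∀ t : ResidueField R ⊗[R] A, (1 ⊗ₜ h) * t = 0 → t = 0) :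
    Module.Flat R (A ⧸ Ideal.span {h}) := by
  have hq : ∀ (X : Type _) [AddCommGroup X] [Module R X] (z : A ⊗[R] X),
      LinearMap.rTensor X ((Ideal.Quotient.mkₐ R (Ideal.span {h})).toLinearMap) z = 0 → ∃ w, z = h • w := by
    intro X _ _ z hz
    have hex : Function.Exact (LinearMap.mulLeft R h) (Ideal.Quotient.mkₐ R (Ideal.span {h})).toLinearMap := by
      intro y
      simp only [AlgHom.toLinearMap_apply, Ideal.Quotient.mkₐ_eq_mk, Ideal.Quotient.eq_zero_iff_mem, Ideal.mem_span_singleton, Set.mem_range, LinearMap.mulLeft_apply]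
      exact ⟨fun ⟨c, hc⟩ => ⟨c, hc.symm⟩, fun ⟨c, hc⟩ => ⟨c, hc.symm⟩⟩
    have := rTensor_exact X hex (Ideal.Quotient.mkₐ_surjective R _)
    obtain ⟨w, hw⟩ := (this z).mp hz
    refine ⟨w, hw ▸ ?_⟩
    clear hw hz
    induction w with
    | zero => simp
    | add x y hx hy => rw [map_add, smul_add, hx, hy]
    | tmul a x => simp [TensorProduct.smul_tmul']
  have hqs : ∀ (X : Type _) [AddCommGroup X] [Module R X], Function.Surjective (LinearMap.rTensor X ((Ideal.Quotient.mkₐ R (Ideal.span {h})).toLinearMap)) := by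
    intro X _ _
    exact LinearMap.rTensor_surjective X (Ideal.Quotient.mkₐ_surjective R _)
  have hq0 : ∀ (X : Type _) [AddCommGroup X] [Module R X] (w : A ⊗[R] X),
      LinearMap.rTensor X ((Ideal.Quotient.mkₐ R (Ideal.span {h})).toLinearMap) (h • w) = 0 := by
    intro X _ _ w
    induction w with
    | zero => simp
    | add x y hx hy => rw [smul_add, map_add, hx, hy, add_zero]
    | tmul a x =>
      have : (Ideal.Quotient.mk (Ideal.span {h})) h = 0 := Ideal.Quotient.eq_zero_iff_mem.mpr (Ideal.mem_span_singleton_self h)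
      simp [TensorProduct.smul_tmul', this]
  rw [Module.Flat.iff_lTensor_injective']
  intro I
  rw [injective_iff_map_eq_zero]
  intro z hz
  obtain ⟨z', rfl⟩ := hqs I z
  rw [← LinearMap.comp_apply, LinearMap.lTensor_comp_rTensor, ← LinearMap.rTensor_comp_lTensor, LinearMap.comp_apply] at hz
  obtain ⟨w, hw⟩ := hq _ _ hz
  have h5 : LinearMap.lTensor A (Submodule.mkQ I) w = 0 := by
    apply lemmaH h hk
    rw [← lTensor_smulA, ← hw, ← LinearMap.comp_apply, ← LinearMap.lTensor_comp]
    have : (Submodule.mkQ I) ∘ₗ (Submodule.subtype I) = 0 := by ext x; simp [Ideal.Quotient.eq_zero_iff_mem]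
    rw [this]; simp
  obtain ⟨w', rfl⟩ := mem_range_of_quot _ _ h5
  rw [← lTensor_smulA] at hw
  have hinj : Function.Injective (LinearMap.lTensor A I.subtype) :=
      Module.Flat.lTensor_preserves_injective_linearMap _ I.injective_subtype
  rw [hinj hw, hq0]

theorem ker_inf {R M X : Type*} [CommRing R] [AddCommGroup M] [Module R M] [Module.Flat R M]
    [AddCommGroup X] [Module R X] (J1 J2 : Submodule R X) (t : M ⊗[R] X)
    (h1 : LinearMap.lTensor M J1.mkQ t = 0) (h2 : LinearMap.lTensor M J2.mkQ t = 0) :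
    LinearMap.lTensor M (J1 ⊓ J2).mkQ t = 0 := by
  let g : X →ₗ[R] (X ⧸ J1) × (X ⧸ J2) := J1.mkQ.prod J2.mkQ
  have hker : LinearMap.ker g = J1 ⊓ J2 := by
    ext x; simp [g]
  let g' : (X ⧸ (J1 ⊓ J2)) →ₗ[R] (X ⧸ J1) × (X ⧸ J2) := (J1 ⊓ J2).liftQ g hker.ge
  have hg' : Function.Injective g' := by
    rw [← LinearMap.ker_eq_bot]
    exact Submodule.ker_liftQ_eq_bot _ _ _ hker.le
  have hinj : Function.Injective (LinearMap.lTensor M g') :=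
    Module.Flat.lTensor_preserves_injective_linearMap _ hg'
  apply hinj
  rw [map_zero, ← LinearMap.comp_apply, ← LinearMap.lTensor_comp]
  have h3 : g' ∘ₗ (J1 ⊓ J2).mkQ = LinearMap.inl R _ _ ∘ₗ J1.mkQ + LinearMap.inr R _ _ ∘ₗ J2.mkQ := by
    ext x <;> simp [g', g]
  rw [h3, LinearMap.lTensor_add, LinearMap.add_apply, LinearMap.lTensor_comp, LinearMap.lTensor_comp,
    LinearMap.comp_apply, LinearMap.comp_apply, h1, h2]
  simp

/-- `J` is a test ideal -/
def IsTest (R : Type*) {R1 : Type*} [CommRing R] [IsLocalRing R] [CommRing R1] [Algebra R R1] (J : Ideal R1) : Prop :=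
  ∃ (V : Type u) (_ : CommRing V) (_ : IsDomain V) (_ : IsDiscreteValuationRing V) (φ : R1 →+* V) (n : ℕ),
    (∀ x ∈ maximalIdeal R, φ (algebraMap R R1 x) ∈ maximalIdeal V) ∧
    J = Ideal.comap φ (maximalIdeal V ^ n)

theorem lemmaV {R A M R1 : Type*} [CommRing R] [IsLocalRing R] [CommRing A] [IsNoetherianRing A]
    [IsLocalRing A] [Algebra R A] [IsLocalHom (algebraMap R A)]
    [AddCommGroup M] [Module R M] [Module A M] [IsScalarTower R A M] [Module.Finite A M] [Module.Flat R M]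
    [CommRing R1] [Algebra R R1] [Module.Finite R R1]
    (chev : ∀ N : ℕ, ∃ s : Finset (Ideal R1), (∀ J ∈ s, IsTest.{u} R J) ∧
      s.inf id ≤ (maximalIdeal R ^ N).map (algebraMap R R1))
    (t : M ⊗[R] R1)
    (ht : ∀ (V : Type u) [CommRing V] [IsDomain V] [IsDiscreteValuationRing V] [Algebra R V]
      (φ : R1 →ₐ[R] V) (n : ℕ), (∀ x ∈ maximalIdeal R, algebraMap R V x ∈ maximalIdeal V) →
      LinearMap.lTensor M ((Ideal.Quotient.mkₐ R (maximalIdeal V ^ n)).comp φ).toLinearMap t = 0) : t = 0 := by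
  refine krull_tensor (A := A) t fun N => mem_range_of_quot _ _ ?_
  obtain ⟨s, hs, hle⟩ := chev N
  have h1 : ∀ J : Ideal R1, IsTest.{u} R J → LinearMap.lTensor M (J.restrictScalars R).mkQ t = 0 := by
    rintro J ⟨V, _, _, _, φ, n, hm, rfl⟩
    letI : Algebra R V := (φ.comp (algebraMap R R1)).toAlgebra
    let ψ : R1 →ₐ[R] V := { φ with commutes' := fun r => rfl }
    have := ht V ψ n hm
    let g := ((Ideal.Quotient.mkₐ R (maximalIdeal V ^ n)).comp ψ).toLinearMap
    have hker : LinearMap.ker g = (Ideal.comap φ (maximalIdeal V ^ n)).restrictScalars R := by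
      ext x
      simp only [g, LinearMap.mem_ker, AlgHom.toLinearMap_apply, AlgHom.comp_apply, Ideal.Quotient.mkₐ_eq_mk,
        Ideal.Quotient.eq_zero_iff_mem, Submodule.restrictScalars_mem, Ideal.mem_comap]
      rfl
    let g' := Submodule.liftQ _ g hker.ge
    have hinj : Function.Injective (LinearMap.lTensor M g') := by
      refine Module.Flat.lTensor_preserves_injective_linearMap _ ?_
      rw [← LinearMap.ker_eq_bot]
      exact Submodule.ker_liftQ_eq_bot _ _ _ hker.le
    apply hinj
    rw [map_zero, ← LinearMap.comp_apply, ← LinearMap.lTensor_comp, Submodule.liftQ_mkQ]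
    exact this
  have h2 : ∀ s : Finset (Ideal R1), (∀ J ∈ s, IsTest.{u} R J) →
      LinearMap.lTensor M ((s.inf id).restrictScalars R).mkQ t = 0 := by
    classical
    intro s
    induction s using Finset.induction_on with
    | empty =>
      intro _
      have : ((Finset.inf ∅ id : Ideal R1).restrictScalars R).mkQ = 0 := by
        ext x; simp
      rw [this]; simp
    | insert J s _ ih =>
      intro hJ
      have h3 := ker_inf _ _ t (h1 J (hJ J (Finset.mem_insert_self _ _)))
        (ih fun J' h' => hJ J' (Finset.mem_insert_of_mem h'))
      have h4 : ((Finset.inf (insert J s) id : Ideal R1).restrictScalars R) = J.restrictScalars R ⊓ (s.inf id).restrictScalars R := by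
        rw [Finset.inf_insert]; rfl
      rw [h4]
      exact h3
  have h5 : ((s.inf id).restrictScalars R) ≤ (maximalIdeal R ^ N • ⊤ : Submodule R R1) := by
    rw [Ideal.smul_top_eq_map]
    exact hle
  rw [← Submodule.factor_comp_mk h5, LinearMap.lTensor_comp, LinearMap.comp_apply, h2 s hs, map_zero]

/-- Chevalley's theorem -/
theorem chevalley {C : Type*} [CommRing C] (I : Ideal C) [IsAdicComplete I C]
    (hart : ∀ n : ℕ, IsArtinianRing (C ⧸ I ^ n)) (S : Set (Ideal C)) (htop : ⊤ ∈ S)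
    (hinf : ∀ J ∈ S, ∀ J' ∈ S, J ⊓ J' ∈ S)
    (hcl : ∀ J ∈ S, ∀ x, (∀ n : ℕ, x ∈ J ⊔ I ^ n) → x ∈ J)
    (hbot : ∀ x, (∀ J ∈ S, x ∈ J) → x = 0) (N : ℕ) : ∃ J ∈ S, J ≤ I ^ N := by
  have h1 : ∀ n : ℕ, ∃ J ∈ S, ∀ J' ∈ S, J ⊔ I ^ n ≤ J' ⊔ I ^ n := by
    intro n
    haveI := hart n
    obtain ⟨E, ⟨J, hJ, rfl⟩, hmin⟩ := WellFounded.has_min (wellFounded_lt (α := Ideal (C ⧸ I ^ n)))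
      ((fun J => Ideal.map (Ideal.Quotient.mk (I ^ n)) J) '' S) ⟨_, ⊤, htop, rfl⟩
    refine ⟨J, hJ, fun J' hJ' => ?_⟩
    have h2 := hmin _ ⟨J ⊓ J', hinf J hJ J' hJ', rfl⟩
    have h3 : Ideal.map (Ideal.Quotient.mk (I ^ n)) (J ⊓ J') = Ideal.map (Ideal.Quotient.mk (I ^ n)) J := by
      by_contra hne
      exact h2 (lt_of_le_of_ne (Ideal.map_mono inf_le_left) hne)
    have h4 : Ideal.map (Ideal.Quotient.mk (I ^ n)) J ≤ Ideal.map (Ideal.Quotient.mk (I ^ n)) J' :=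
      h3 ▸ Ideal.map_mono inf_le_right
    refine sup_le (fun x hx => ?_) le_sup_right
    have h5 := h4 (Ideal.mem_map_of_mem _ hx)
    obtain ⟨y, hy, hxy⟩ := (Ideal.mem_map_iff_of_surjective _ Ideal.Quotient.mk_surjective).mp h5
    have := Ideal.Quotient.eq.mp hxy.symm
    rw [← sub_add_cancel x y, add_comm]
    exact Submodule.add_mem_sup hy this
  choose J hJ hmin using h1
  by_contra! hcon
  obtain ⟨x0, hx0, hx0'⟩ := SetLike.not_le_iff_exists.mp (hcon (J N) (hJ N))
  have hstep : ∀ n x, x ∈ J n ⊔ I ^ n → ∃ y ∈ J (n + 1) ⊔ I ^ (n + 1), y - x ∈ I ^ n := by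
    intro n x hx
    obtain ⟨a, ha, b, hb, rfl⟩ := Submodule.mem_sup.mp (hmin n _ (hJ (n + 1)) hx)
    exact ⟨a, Submodule.mem_sup_left ha, by simpa using hb⟩
  choose! f hf hfx using hstep
  let x : ℕ → C := fun n => Nat.rec x0 (fun k y => f (N + k) y) n
  have hx : ∀ k, x k ∈ J (N + k) ⊔ I ^ (N + k) := by
    intro k
    induction k with
    | zero => exact Submodule.mem_sup_left hx0
    | succ k ih => exact hf _ _ ih
  have hd : ∀ k, x (k + 1) - x k ∈ I ^ (N + k) := fun k => hfx _ _ (hx k)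
  have hc : ∀ {m n}, m ≤ n → x n - x m ∈ I ^ (N + m) := by
    intro m n hmn
    induction n, hmn using Nat.le_induction with
    | base => simp
    | succ n hmn ih =>
      rw [← sub_add_sub_cancel _ (x n)]
      exact Submodule.add_mem _ (Ideal.pow_le_pow_right (by omega) (hd n)) ih
  obtain ⟨L, hL⟩ := IsPrecomplete.prec (inferInstance : IsPrecomplete I C) (f := x) (by
    intro m n hmn
    refine SModEq.symm (SModEq.sub_mem.mpr ?_)
    rw [smul_eq_mul, Ideal.mul_top]
    exact Ideal.pow_le_pow_right (by omega) (hc hmn))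
  have hL' : ∀ n, x n - L ∈ I ^ n := fun n => by
    have := SModEq.sub_mem.mp (hL n)
    rwa [smul_eq_mul, Ideal.mul_top] at this
  have hLJ : ∀ J' ∈ S, L ∈ J' := by
    intro J' hJ'
    refine hcl J' hJ' L fun n => ?_
    have h6 : x n ∈ J' ⊔ I ^ n :=
      (sup_le_sup_left (Ideal.pow_le_pow_right (Nat.le_add_left n N)) J' : J' ⊔ I ^ (N + n) ≤ J' ⊔ I ^ n)
        (hmin _ J' hJ' (hx n))
    have := Submodule.sub_mem _ h6 (Submodule.mem_sup_right (hL' n))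
    simpa using this
  have hL0 := hbot L hLJ
  apply hx0'
  have h7 := hL' N
  rw [hL0, sub_zero] at h7
  have h8 := hc (Nat.zero_le N)
  have h9 := Submodule.sub_mem _ h7 (show x N - x 0 ∈ I ^ N from by simpa using h8)
  have h10 : x 0 ∈ I ^ N := by simpa using h9
  exact h10

theorem artin_quot {S C : Type*} [CommRing S] [IsNoetherianRing S] [IsLocalRing S] [CommRing C]
    [Algebra S C] [Module.Finite S C] (n : ℕ) :
    IsArtinianRing (C ⧸ ((maximalIdeal S).map (algebraMap S C)) ^ n) := by
  have h1 : IsArtinianRing (S ⧸ maximalIdeal S ^ n) := by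
    rcases Nat.eq_zero_or_pos n with rfl | hn
    · have : Subsingleton (S ⧸ maximalIdeal S ^ 0) := by
        rw [Ideal.Quotient.subsingleton_iff]; simp
      infer_instance
    · apply IsLocalRing.quotient_artinian_of_mem_minimalPrimes_of_isLocalRing
      exact ⟨⟨inferInstance, Ideal.pow_le_self hn.ne'⟩, fun Q hQ _ => hQ.1.le_of_pow_le hQ.2⟩
  rw [← Ideal.map_pow]
  exact IsArtinianRing.of_finite (S ⧸ maximalIdeal S ^ n) _

theorem exists_test {S C : Type u} {T : Type*} [CommRing S] [IsNoetherianRing S] [IsLocalRing S] [CommRing C]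
    [Algebra S C] [Module.Finite S C] [CommRing T] [IsReduced T] (f : C →+* T) (hf : Function.Injective f)
    (hr : ∃ r ∈ maximalIdeal S, IsUnit (f (algebraMap S C r))) (x : C) (hx : x ≠ 0) :
    ∃ J : Ideal C, IsTest.{u} S J ∧ x ∉ J := by
  haveI : IsNoetherianRing C := IsNoetherianRing.of_finite S C
  have h1 : f x ∉ nilradical T := by
    rw [nilradical_eq_zero]
    exact fun h => hx (hf (by rw [map_zero]; exact h))
  rw [nilradical_eq_sInf, Ideal.mem_sInf] at h1
  push Not at h1
  obtain ⟨q', hq', hxq⟩ := h1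
  haveI : q'.IsPrime := hq'
  let q := Ideal.comap f q'
  haveI : q.IsPrime := Ideal.comap_isPrime f q'
  obtain ⟨r, hrm, hru⟩ := hr
  let n : Ideal (C ⧸ q) := ((maximalIdeal S).map (algebraMap S C)).map (Ideal.Quotient.mk q)
  have hn0 : n ≠ ⊥ := by
    intro h
    have h2 : Ideal.Quotient.mk q (algebraMap S C r) ∈ n :=
      Ideal.mem_map_of_mem _ (Ideal.mem_map_of_mem _ hrm)
    rw [h, Ideal.mem_bot, Ideal.Quotient.eq_zero_iff_mem] at h2
    exact hq'.ne_top (Ideal.eq_top_of_isUnit_mem _ h2 hru)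
  have hn : n ≠ ⊤ := by
    obtain ⟨M, hM, hqM⟩ := Ideal.exists_le_maximal q (Ideal.IsPrime.ne_top inferInstance)
    have h3 : (maximalIdeal S).map (algebraMap S C) ≤ M := by
      rw [Ideal.map_le_iff_le_comap]
      have := Ideal.isMaximal_comap_of_isIntegral_of_isMaximal (R := S) M
      rw [IsLocalRing.eq_maximalIdeal this]
    intro h
    have h4 : n ≤ Ideal.map (Ideal.Quotient.mk q) M := Ideal.map_mono h3
    rw [h, top_le_iff] at h4
    have h5 : Ideal.comap (Ideal.Quotient.mk q) (Ideal.map (Ideal.Quotient.mk q) M) = ⊤ := by rw [h4]; rfl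
    rw [Ideal.comap_map_of_surjective _ Ideal.Quotient.mk_surjective, ← RingHom.ker_eq_comap_bot, Ideal.mk_ker, sup_eq_left.mpr hqM] at h5
    exact hM.ne_top h5
  obtain ⟨V, _, _, _, φ, hφ, hmax⟩ := exists_dvr n hn hn0
  have hx2 : φ (Ideal.Quotient.mk q x) ≠ 0 := by
    intro h
    rw [← map_zero φ] at h
    have h' : x ∈ q := Ideal.Quotient.eq_zero_iff_mem.mp (hφ h)
    exact hxq h'
  have h6 : ∃ n : ℕ, φ (Ideal.Quotient.mk q x) ∉ maximalIdeal V ^ n := by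
    by_contra! hcon
    apply hx2
    have h7 := Ideal.iInf_pow_eq_bot_of_isLocalRing (maximalIdeal V) (Ideal.IsPrime.ne_top inferInstance)
    rw [← Ideal.mem_bot, ← h7]
    simpa using hcon
  obtain ⟨n', hn'⟩ := h6
  exact ⟨_, ⟨V, inferInstance, inferInstance, inferInstance, φ.comp (Ideal.Quotient.mk q), n',
    fun y hy => hmax _ (Ideal.mem_map_of_mem _ (Ideal.mem_map_of_mem _ hy)), rfl⟩, hn'⟩

theorem chev_complete {S C : Type u} {T : Type*} [CommRing S] [IsNoetherianRing S] [IsLocalRing S] [CommRing C]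
    [IsAdicComplete (maximalIdeal S) S]
    [Algebra S C] [Module.Finite S C] [CommRing T] [IsReduced T] (f : C →+* T) (hf : Function.Injective f)
    (hr : ∃ r ∈ maximalIdeal S, IsUnit (f (algebraMap S C r))) (N : ℕ) :
    ∃ s : Finset (Ideal C), (∀ J ∈ s, IsTest.{u} S J) ∧
      s.inf id ≤ ((maximalIdeal S).map (algebraMap S C)) ^ N := by
  classical
  haveI : IsNoetherianRing C := IsNoetherianRing.of_finite S C
  have hc : IsAdicComplete (maximalIdeal S) C := isAdicComplete_of_finite _
  haveI : IsAdicComplete ((maximalIdeal S).map (algebraMap S C)) C := (IsAdicComplete.map_algebraMap_iff _ _).mpr hc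
  obtain ⟨J, ⟨s, hs, rfl⟩, hJ⟩ := chevalley ((maximalIdeal S).map (algebraMap S C)) (fun n => artin_quot n)
    {J | ∃ s : Finset (Ideal C), (∀ J ∈ s, IsTest.{u} S J) ∧ J = s.inf id}
    ⟨∅, by simp, by simp⟩ (by
      rintro _ ⟨s, hs, rfl⟩ _ ⟨s', hs', rfl⟩
      refine ⟨s ∪ s', fun J hJ => ?_, by rw [Finset.inf_union]⟩
      rcases Finset.mem_union.mp hJ with h | h
      exacts [hs J h, hs' J h])
    (by
      intro J _ x hx
      have hH : IsHausdorff ((maximalIdeal S).map (algebraMap S C)) (C ⧸ J) :=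
        IsHausdorff.of_le_jacobson _ _ (IsAdicComplete.le_jacobson_bot _)
      rw [← Ideal.Quotient.eq_zero_iff_mem]
      refine hH.haus _ fun n => ?_
      rw [SModEq.zero]
      obtain ⟨a, ha, b, hb, rfl⟩ := Submodule.mem_sup.mp (hx n)
      rw [map_add, Ideal.Quotient.eq_zero_iff_mem.mpr ha, zero_add]
      have : Ideal.Quotient.mk J b = b • (1 : C ⧸ J) := by
        rw [Algebra.smul_def, mul_one]; rfl
      rw [this]
      exact Submodule.smul_mem_smul hb trivial)
    (by
      intro x hx
      by_contra hne
      obtain ⟨J, hJ, hxJ⟩ := exists_test f hf hr x hne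
      exact hxJ (hx J ⟨{J}, by simpa using hJ, by simp⟩)) N
  exact ⟨s, hs, hJ⟩

theorem chev_local {R R1 : Type u} {T : Type*} [CommRing R] [IsNoetherianRing R] [IsLocalRing R] [CommRing R1]
    [Algebra R R1] [Module.Finite R R1] [CommRing T] [IsReduced T]
    (f : AdicCompletion (maximalIdeal R) R ⊗[R] R1 →+* T) (hf : Function.Injective f)
    (hr : ∃ r ∈ maximalIdeal R, IsUnit (f (algebraMap R _ r))) (N : ℕ) :
    ∃ s : Finset (Ideal R1), (∀ J ∈ s, IsTest.{u} R J) ∧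
      s.inf id ≤ (maximalIdeal R ^ N).map (algebraMap R R1) := by
  classical
  let S := AdicCompletion (maximalIdeal R) R
  have hmS : maximalIdeal S = (maximalIdeal R).map (algebraMap R S) := AdicCompletion.maximalIdeal_eq_map
  obtain ⟨s, hs, hle⟩ := chev_complete (S := S) f hf (by
    obtain ⟨r, h1, h2⟩ := hr
    refine ⟨algebraMap R S r, hmS ▸ Ideal.mem_map_of_mem _ h1, ?_⟩
    rwa [← IsScalarTower.algebraMap_apply]) N
  let ι : R1 →ₐ[R] S ⊗[R] R1 := Algebra.TensorProduct.includeRight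
  refine ⟨s.image (Ideal.comap ι), ?_, ?_⟩
  · intro J hJ
    obtain ⟨J', hJ', rfl⟩ := Finset.mem_image.mp hJ
    obtain ⟨V, _, _, _, φ, n, h1, rfl⟩ := hs J' hJ'
    refine ⟨V, inferInstance, inferInstance, inferInstance, φ.comp (ι : R1 →+* S ⊗[R] R1), n, fun x hx => ?_, rfl⟩
    have h2 := h1 (algebraMap R S x) (hmS ▸ Ideal.mem_map_of_mem _ hx)
    rw [← IsScalarTower.algebraMap_apply] at h2
    simpa using h2
  · intro x hx
    have h3 : ι x ∈ s.inf id := by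
      rw [Finset.inf_eq_iInf] at hx ⊢
      simp only [Ideal.mem_iInf, id] at hx ⊢
      intro J hJ
      exact hx (Ideal.comap ι J) (Finset.mem_image_of_mem _ hJ)
    have h4 := hle h3
    rw [hmS, Ideal.map_map, ← Ideal.map_pow, ← IsScalarTower.algebraMap_eq] at h4
    let Y : Submodule R R1 := ((maximalIdeal R ^ N).map (algebraMap R R1)).restrictScalars R
    have h5 : LinearMap.lTensor S Y.mkQ (ι x) = 0 := by
      have h6 : ι x ∈ ((maximalIdeal R ^ N) • ⊤ : Submodule R (S ⊗[R] R1)) := by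
        rw [Ideal.smul_top_eq_map]; exact h4
      generalize ι x = y at h6
      induction h6 using Submodule.smul_induction_on' with
      | smul r hr n hn =>
        rw [map_smul]
        induction n with
        | zero => simp
        | add x y hx hy => rw [map_add, smul_add, hx trivial, hy trivial, add_zero]
        | tmul a b =>
          rw [LinearMap.lTensor_tmul, ← TensorProduct.tmul_smul, ← map_smul]
          have : r • b ∈ Y := by
            rw [Algebra.smul_def]
            exact Ideal.mul_mem_right _ _ (Ideal.mem_map_of_mem _ hr)
          rw [Submodule.mkQ_apply, (Submodule.Quotient.mk_eq_zero Y).mpr this, TensorProduct.tmul_zero]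
      | add x hx y hy h1 h2 => rw [map_add, h1, h2, add_zero]
    haveI : Module.FaithfullyFlat R S := @Module.FaithfullyFlat.of_flat_of_isLocalHom R (AdicCompletion (maximalIdeal R) R) _ _ _ _ _ _ _
    have h7 := Module.FaithfullyFlat.tensorProduct_mk_injective (A := R) (B := S) (R1 ⧸ Y)
    have h8 : Y.mkQ x = 0 := h7 (by rw [map_zero]; simpa [ι] using h5)
    exact (Submodule.Quotient.mk_eq_zero Y).mp h8

abbrev tmap {R : Type*} (A : Type*) {B C : Type*} [CommRing R] [CommRing A] [CommRing B] [CommRing C] [Algebra R A]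
    [Algebra R B] [Algebra R C] (φ : B →ₐ[R] C) : A ⊗[R] B →ₐ[R] A ⊗[R] C :=
  Algebra.TensorProduct.map (AlgHom.id R A) φ

theorem tmap_eq_lTensor {R A B C : Type*} [CommRing R] [CommRing A] [CommRing B] [CommRing C] [Algebra R A]
    [Algebra R B] [Algebra R C] (φ : B →ₐ[R] C) (t : A ⊗[R] B) :
    LinearMap.lTensor A φ.toLinearMap t = tmap A φ t := rfl

theorem tmap_injective {R A B C : Type*} [CommRing R] [CommRing A] [CommRing B] [CommRing C] [Algebra R A]
    [Module.Flat R A]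
    [Algebra R B] [Algebra R C] (φ : B →ₐ[R] C) (h : Function.Injective φ) :
    Function.Injective (tmap A φ) :=
  Module.Flat.lTensor_preserves_injective_linearMap (M := A) φ.toLinearMap h

theorem exists_of_tmap_eq_zero {R A V C : Type*} [CommRing R] [CommRing A] [CommRing V] [CommRing C]
    [Algebra R A] [Algebra R V] [Algebra R C] (g : V →ₐ[R] C) (hg : Function.Surjective g) (ϖ : V)
    (hker : RingHom.ker g = Ideal.span {ϖ}) (z : A ⊗[R] V) (hz : tmap A g z = 0) :
    ∃ w, z = (1 ⊗ₜ ϖ) * w := by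
  have h := Algebra.TensorProduct.lTensor_ker (A := A) g hg
  have h1 : z ∈ RingHom.ker (tmap A g) := hz
  rw [h, hker, Ideal.map_span, Set.image_singleton, Ideal.mem_span_singleton] at h1
  exact h1

theorem nzd_one_tmul {R A V : Type*} [CommRing R] [CommRing A] [CommRing V]
    [Algebra R A] [Algebra R V] [Module.Flat R A] (ϖ : V) (h : ∀ x, ϖ * x = 0 → x = 0)
    (w : A ⊗[R] V) (hw : (1 ⊗ₜ ϖ) * w = 0) : w = 0 := by
  have hi : Function.Injective (LinearMap.lTensor A (LinearMap.mulLeft R ϖ)) :=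
    Module.Flat.lTensor_preserves_injective_linearMap _ (by
      rw [← LinearMap.ker_eq_bot, LinearMap.ker_eq_bot']; exact h)
  apply hi
  rw [map_zero, ← hw]
  clear hw
  induction w with
  | zero => simp
  | add x y hx hy => rw [map_add, mul_add, hx, hy]
  | tmul a b => simp

theorem nilpotent_mem_pow {U : Type*} [CommRing U] (π : U) (hπ : ∀ x, π * x = 0 → x = 0)
    (hred : ∀ x k, π ∣ x ^ k → π ∣ x) (u : U) (hu : IsNilpotent u) (n : ℕ) : π ^ n ∣ u := by
  have hpi : ∀ n x, π ^ n * x = 0 → x = 0 := by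
    intro n
    induction n with
    | zero => simp
    | succ n ih => intro x hx; exact ih x (hπ _ (by rw [← hx]; ring))
  induction n with
  | zero => simp
  | succ n ih =>
    obtain ⟨v, rfl⟩ := ih
    obtain ⟨k, hk⟩ := hu
    rw [mul_pow, ← pow_mul] at hk
    obtain ⟨w, rfl⟩ := hred v k (by rw [hpi _ _ hk]; exact dvd_zero _)
    exact ⟨w, by ring⟩

/-- main part of reducedness -/
theorem reduced_finite {R A R1 : Type u} [CommRing R] [IsLocalRing R] [CommRing A] [IsNoetherianRing A]
    [IsLocalRing A] [Algebra R A] [IsLocalHom (algebraMap R A)] [Module.Flat R A]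
    [CommRing R1] [Algebra R R1] [Module.Finite R R1]
    (chev : ∀ N : ℕ, ∃ s : Finset (Ideal R1), (∀ J ∈ s, IsTest.{u} R J) ∧
      s.inf id ≤ (maximalIdeal R ^ N).map (algebraMap R R1))
    (hk : ∀ (F : Type u) [Field F] [Algebra R F], (∀ x ∈ maximalIdeal R, algebraMap R F x = 0) →
      IsReduced (A ⊗[R] F)) : IsReduced (A ⊗[R] R1) := by
  constructor
  intro t ht
  refine lemmaV (A := A) chev t ?_
  intro V _ _ _ _ φ n hm
  rw [tmap_eq_lTensor]
  obtain ⟨ϖ, hϖ⟩ := IsDiscreteValuationRing.exists_irreducible V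
  have hmax : maximalIdeal V = Ideal.span {ϖ} := hϖ.maximalIdeal_eq
  have hu : IsNilpotent (tmap A φ t) := ht.map (tmap A φ)
  have h1 : (1 ⊗ₜ ϖ : A ⊗[R] V) ^ n ∣ tmap A φ t := by
    refine nilpotent_mem_pow _ (nzd_one_tmul ϖ (fun x hx => by simpa [hϖ.ne_zero] using hx)) ?_ _ hu n
    intro x k hx
    have hred := hk (ResidueField V) (fun x hx => by
      rw [IsScalarTower.algebraMap_apply R V (ResidueField V)]
      exact (residue_eq_zero_iff _).mpr (hm x hx))
    let g : V →ₐ[R] ResidueField V := IsScalarTower.toAlgHom R V (ResidueField V)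
    have hgϖ : g ϖ = 0 := (residue_eq_zero_iff _).mpr (hmax ▸ Ideal.mem_span_singleton_self _)
    have h2 : (tmap A g x) ^ k = 0 := by
      rw [← map_pow]
      obtain ⟨w, hw⟩ := hx
      rw [hw, map_mul]
      simp [hgϖ]
    have h3 : tmap A g x = 0 := hred.1 _ ⟨k, h2⟩
    obtain ⟨w, hw⟩ := exists_of_tmap_eq_zero g (residue_surjective) ϖ
      (by rw [← hmax]; exact ker_residue) x h3
    exact ⟨w, hw⟩
  have h4 : tmap A ((Ideal.Quotient.mkₐ R (maximalIdeal V ^ n)).comp φ) t =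
    tmap A (Ideal.Quotient.mkₐ R (maximalIdeal V ^ n)) (tmap A φ t) := by
    rw [← AlgHom.comp_apply, tmap, tmap, tmap, ← Algebra.TensorProduct.map_comp]; rfl
  rw [h4]
  obtain ⟨w, hw⟩ := h1
  rw [hw, map_mul, map_pow]
  have h5 : (Ideal.Quotient.mkₐ R (maximalIdeal V ^ n)) (ϖ ^ n) = 0 := by
    rw [Ideal.Quotient.mkₐ_eq_mk, Ideal.Quotient.eq_zero_iff_mem]
    exact Ideal.pow_mem_pow (hmax ▸ Ideal.mem_span_singleton_self _) n
  rw [← map_pow, Algebra.TensorProduct.tmul_pow, Algebra.TensorProduct.map_tmul, h5, TensorProduct.tmul_zero, zero_mul]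

/-- elements of `A ⊗ L` scale into `A ⊗ R1` -/
theorem exists_scale {R A L : Type*} [CommRing R] [CommRing A] [Algebra R A] [Field L] [Algebra R L]
    (hL : ∀ l : L, ∃ s : R, algebraMap R L s ≠ 0 ∧ IsIntegral R (s • l)) (Z : Finset (A ⊗[R] L)) :
    ∃ (R1 : Subalgebra R L) (s : R), Module.Finite R R1 ∧ algebraMap R L s ≠ 0 ∧
      ∀ z ∈ Z, ∃ z1 : A ⊗[R] R1, tmap A R1.val z1 = s • z := by
  classical
  obtain ⟨Y, hY, hs⟩ := TensorProduct.exists_finite_submodule_right_of_setFinite (Z : Set (A ⊗[R] L)) Z.finite_toSet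
  obtain ⟨S, hS⟩ := hY.fg_top.map Y.subtype
  rw [Submodule.map_top, Submodule.range_subtype] at hS
  have hcom : ∃ s : R, algebraMap R L s ≠ 0 ∧ ∀ y ∈ S, IsIntegral R (s • y) := by
    clear hS
    induction S using Finset.induction_on with
    | empty => exact ⟨1, by simp, by simp⟩
    | insert a S ha ih =>
      obtain ⟨s, hs0, hs⟩ := ih
      obtain ⟨s', hs0', hs'⟩ := hL a
      refine ⟨s * s', by simp [hs0, hs0'], fun y hy => ?_⟩
      rcases Finset.mem_insert.mp hy with rfl | hy
      · rw [mul_smul]; exact hs'.smul s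
      · rw [mul_comm, mul_smul]; exact (hs y hy).smul s'
  obtain ⟨s, hs0, hIntg⟩ := hcom
  let R1 := Algebra.adjoin R ((S.image (fun y => s • y) : Finset L) : Set L)
  have hmem : ∀ y : Y, s • (y : L) ∈ R1 := by
    intro y
    have hy : (y : L) ∈ Submodule.span R (S : Set L) := by rw [hS]; exact y.2
    generalize (y : L) = y at hy
    induction hy using Submodule.span_induction with
    | mem x hx => exact Algebra.subset_adjoin (by simpa using ⟨x, hx, rfl⟩)
    | zero => simp
    | add x y _ _ hx hy => rw [smul_add]; exact add_mem hx hy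
    | smul a x _ hx => rw [smul_comm]; exact R1.smul_mem hx a
  refine ⟨R1, s, ?_, hs0, ?_⟩
  · apply Algebra.finite_adjoin_of_finite_of_isIntegral (Finset.finite_toSet _)
    intro x hx
    obtain ⟨y, hy, rfl⟩ := Finset.mem_image.mp (Finset.mem_coe.mp hx)
    exact hIntg y hy
  · intro z hz
    obtain ⟨z', rfl⟩ := hs hz
    let g : Y →ₗ[R] R1 := LinearMap.codRestrict (Subalgebra.toSubmodule R1) (s • Y.subtype) hmem
    refine ⟨LinearMap.lTensor A g z', ?_⟩
    rw [← tmap_eq_lTensor, ← LinearMap.comp_apply, ← LinearMap.lTensor_comp]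
    have : R1.val.toLinearMap ∘ₗ g = s • Y.subtype := rfl
    rw [this, LinearMap.lTensor_smul, LinearMap.smul_apply]

theorem reduced_alg {R A L : Type u} [CommRing R] [IsNoetherianRing R] [IsLocalRing R] [CommRing A] [IsNoetherianRing A]
    [IsLocalRing A] [Algebra R A] [IsLocalHom (algebraMap R A)] [Module.Flat R A]
    [Field L] [Algebra R L]
    (hL : ∀ l : L, ∃ s : R, algebraMap R L s ≠ 0 ∧ IsIntegral R (s • l))
    (hR : IsReduced (AdicCompletion (maximalIdeal R) R ⊗[R] L))
    (hk : ∀ (F : Type u) [Field F] [Algebra R F], (∀ x ∈ maximalIdeal R, algebraMap R F x = 0) →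
      IsReduced (A ⊗[R] F)) : IsReduced (A ⊗[R] L) := by
  by_cases hm : ∀ x ∈ maximalIdeal R, algebraMap R L x = 0
  · exact hk L hm
  push Not at hm
  obtain ⟨r, hr, hr0⟩ := hm
  constructor
  intro z hz
  obtain ⟨R1, s, hfin, hs, h⟩ := exists_scale hL {z}
  obtain ⟨z1, hz1⟩ := h z (Finset.mem_singleton_self _)
  have hred : IsReduced (A ⊗[R] R1) := by
    refine reduced_finite ?_ hk
    refine chev_local (T := AdicCompletion (maximalIdeal R) R ⊗[R] L) (tmap _ R1.val).toRingHom
      (tmap_injective _ Subtype.val_injective) ⟨r, hr, ?_⟩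
    have h1 := ((IsUnit.mk0 _ hr0).map (Algebra.TensorProduct.includeRight : L →ₐ[R] AdicCompletion (maximalIdeal R) R ⊗[R] L))
    rw [AlgHom.commutes] at h1
    convert h1
    exact AlgHom.commutes (tmap _ R1.val) r
  have h2 : z1 = 0 := by
    refine hred.1 z1 ?_
    have h3 : IsNilpotent (tmap A R1.val z1) := by
      rw [hz1, Algebra.smul_def]
      exact (Commute.all _ _).isNilpotent_mul_left hz
    exact (IsNilpotent.map_iff (tmap_injective _ Subtype.val_injective)).mp h3
  rw [h2, map_zero, Algebra.smul_def] at hz1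
  have h1 := ((IsUnit.mk0 _ hs).map (Algebra.TensorProduct.includeRight : L →ₐ[R] A ⊗[R] L))
  rw [AlgHom.commutes] at h1
  exact (h1.mul_right_eq_zero).mp hz1.symm

theorem reduced_of_isAlgClosed {k B F : Type*} [Field k] [IsAlgClosed k] [CommRing B] [Algebra k B] [IsReduced B]
    [Field F] [Algebra k F] : IsReduced (F ⊗[k] B) := by
  apply IsReduced.tensorProduct_of_flat_of_forall_fg
  intro B0 hB0
  haveI : Algebra.FiniteType k B0 := B0.fg_iff_finiteType.mp hB0
  haveI : IsReduced B0 := isReduced_of_injective B0.val Subtype.val_injective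
  haveI : IsJacobsonRing B0 := isJacobsonRing_of_finiteType (A := k)
  classical
  constructor
  intro z hz
  let bs := Module.Basis.ofVectorSpace k F
  let e : F ⊗[k] B0 ≃ₗ[k] (_ →₀ B0) := TensorProduct.equivFinsuppOfBasisLeft bs
  have key : ∀ i, e z i = 0 := by
    intro i
    have hrad : e z i ∈ Ideal.jacobson (⊥ : Ideal B0) := by
      rw [Ideal.jacobson, Ideal.mem_sInf]
      rintro M ⟨-, hM⟩
      haveI := hM
      letI : Field (B0 ⧸ M) := Ideal.Quotient.field M
      haveI : Module.Finite k (B0 ⧸ M) := finite_of_finite_type_of_isJacobsonRing k (B0 ⧸ M)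
      let ε : k ≃ₐ[k] B0 ⧸ M := AlgEquiv.ofBijective (Algebra.ofId k (B0 ⧸ M)) IsAlgClosed.algebraMap_bijective_of_isIntegral
      let ψ : B0 →ₐ[k] k := (ε.symm : (B0 ⧸ M) →ₐ[k] k).comp (Ideal.Quotient.mkₐ k M)
      let g : F ⊗[k] B0 →ₐ[k] F := Algebra.TensorProduct.lift (AlgHom.id k F) ((Algebra.ofId k F).comp ψ) (fun _ _ => Commute.all _ _)
      have hgz : g z = 0 := (hz.map g).eq_zero
      have hrep : ∀ z, bs.repr (g z) i = ψ (e z i) := by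
        intro z
        induction z with
        | zero => simp
        | add x y hx hy => simp only [map_add, Finsupp.add_apply, hx, hy]
        | tmul f b =>
          have h1 : e (f ⊗ₜ b) i = bs.repr f i • b := TensorProduct.equivFinsuppOfBasisLeft_apply_tmul_apply _ _ _ _
          have h2 : g (f ⊗ₜ b) = ψ b • f := by
            rw [Algebra.smul_def, mul_comm]; rfl
          rw [h1, h2, map_smul, map_smul, Finsupp.smul_apply, smul_eq_mul, smul_eq_mul, mul_comm]
      have h3 := hrep z
      rw [hgz, map_zero, Finsupp.zero_apply] at h3
      have h4 : Ideal.Quotient.mk M (e z i) = 0 := by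
        apply ε.symm.injective
        rw [map_zero]; exact h3.symm
      exact Ideal.Quotient.eq_zero_iff_mem.mp h4
    have h0 : Ideal.jacobson (⊥ : Ideal B0) = ⊥ := by
      rw [← Ideal.radical_eq_jacobson]
      exact nilradical_eq_zero B0
    rw [h0] at hrad
    exact hrad
  exact e.injective (by ext i; simp [key i])

theorem alg_scale {R Ω : Type u} [CommRing R] [Field Ω] [Algebra R Ω] :
    ∃ (k : Type u) (_ : Field k) (_ : Algebra R k) (_ : Algebra k Ω) (_ : IsScalarTower R k Ω),
      ((∀ l : k, ∃ s : R, algebraMap R k s ≠ 0 ∧ IsIntegral R (s • l)) ∧ (IsAlgClosed Ω → IsAlgClosed k)) := by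
  let D := R ⧸ RingHom.ker (algebraMap R Ω)
  letI : Algebra D Ω := (RingHom.kerLift (algebraMap R Ω)).toAlgebra
  have hinj : Function.Injective (algebraMap D Ω) := RingHom.kerLift_injective (algebraMap R Ω)
  haveI : IsScalarTower R D Ω := IsScalarTower.of_algebraMap_eq fun x => rfl
  haveI : IsDomain D := hinj.isDomain (algebraMap D Ω)
  haveI : FaithfulSMul D Ω := (faithfulSMul_iff_algebraMap_injective D Ω).mpr hinj
  let K := FractionRing D
  letI : Algebra K Ω := FractionRing.liftAlgebra D Ω
  haveI : IsScalarTower D K Ω := FractionRing.isScalarTower_liftAlgebra D Ω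
  let k := algebraicClosure K Ω
  letI : Algebra R k := ((algebraMap K k).comp ((algebraMap D K).comp (algebraMap R D))).toAlgebra
  have hRk : ∀ r : R, ((algebraMap R k r : k) : Ω) = algebraMap R Ω r := by
    intro r
    change algebraMap K Ω (algebraMap D K (algebraMap R D r)) = _
    rw [← IsScalarTower.algebraMap_apply D K Ω, ← IsScalarTower.algebraMap_apply R D Ω]
  haveI : IsScalarTower R k Ω := IsScalarTower.of_algebraMap_eq fun r => (hRk r).symm
  refine ⟨k, inferInstance, inferInstance, inferInstance, inferInstance, ?_, ?_⟩
  · intro l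
    have h1 : IsAlgebraic K (l : Ω) := mem_algebraicClosure_iff.mp l.2
    have h2 : IsAlgebraic D (l : Ω) := (IsFractionRing.isAlgebraic_iff D K Ω).mpr h1
    obtain ⟨y, hy0, hy⟩ := h2.exists_integral_multiple
    obtain ⟨s, rfl⟩ := Ideal.Quotient.mk_surjective y
    refine ⟨s, ?_, ?_⟩
    · intro h
      apply hy0
      apply hinj
      rw [map_zero]
      change algebraMap R Ω s = 0
      rw [← hRk, h]; rfl
    · have h3 : IsIntegral R ((Ideal.Quotient.mk _ s : D) • (l : Ω)) := by
        haveI : Algebra.IsIntegral R D := Algebra.isIntegral_of_surjective Ideal.Quotient.mk_surjective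
        exact isIntegral_trans _ hy
      have h4 : (algebraMap k Ω) (s • l) = ((Ideal.Quotient.mk _ s : D) • (l : Ω)) := by
        rw [Algebra.smul_def, Algebra.smul_def, map_mul, ← IsScalarTower.algebraMap_apply]
        rfl
      rw [← isIntegral_algebraMap_iff (algebraMap k Ω).injective, h4]
      exact h3
  · intro _
    haveI := algebraicClosure.isAlgClosure K Ω
    exact IsAlgClosure.isAlgClosed K

theorem reduced_all {R A : Type u} [CommRing R] [IsNoetherianRing R] [IsLocalRing R] [CommRing A] [IsNoetherianRing A]
    [IsLocalRing A] [Algebra R A] [IsLocalHom (algebraMap R A)] [Module.Flat R A]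
    (hR : ∀ (F : Type u) [Field F] [Algebra R F], IsReduced (AdicCompletion (maximalIdeal R) R ⊗[R] F))
    (hk : ∀ (F : Type u) [Field F] [Algebra R F], (∀ x ∈ maximalIdeal R, algebraMap R F x = 0) →
      IsReduced (A ⊗[R] F)) (F : Type u) [Field F] [Algebra R F] : IsReduced (A ⊗[R] F) := by
  obtain ⟨k, _, _, _, _, hs, hcl⟩ := alg_scale (R := R) (Ω := AlgebraicClosure F)
  haveI := hcl inferInstance
  haveI := reduced_alg (A := A) hs (hR k) hk
  have h1 : IsReduced (AlgebraicClosure F ⊗[k] (k ⊗[R] A)) := by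
    haveI : IsReduced (k ⊗[R] A) := isReduced_of_injective (Algebra.TensorProduct.comm R k A) (AlgEquiv.injective _)
    exact reduced_of_isAlgClosed
  have e := (Algebra.TensorProduct.cancelBaseChange R k k (AlgebraicClosure F) A)
  have h2 : IsReduced (AlgebraicClosure F ⊗[R] A) := isReduced_of_injective e.symm e.symm.injective
  have h3 : IsReduced (A ⊗[R] AlgebraicClosure F) :=
    isReduced_of_injective (Algebra.TensorProduct.comm R A (AlgebraicClosure F)) (AlgEquiv.injective _)
  exact isReduced_of_injective (tmap A (IsScalarTower.toAlgHom R F (AlgebraicClosure F)))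
    (tmap_injective _ (algebraMap F (AlgebraicClosure F)).injective)

noncomputable def fibIso (R k K X : Type*) [CommRing R] [Field k] [Field K] [CommRing X] [Algebra R k] [Algebra R K] [Algebra k K]
    [IsScalarTower R k K] [Algebra R X] : K ⊗[k] (k ⊗[R] X) ≃+* X ⊗[R] K :=
  (Algebra.TensorProduct.cancelBaseChange R k k K X).toRingEquiv.trans
    (Algebra.TensorProduct.comm R K X).toRingEquiv

theorem exists_tower (R F : Type u) [CommRing R] [Field F] [Algebra R F] (p : Ideal R) [p.IsPrime]
    (hp : p = RingHom.ker (algebraMap R F)) :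
    ∃ (_ : Algebra (ResidueField (Localization.AtPrime p)) F), IsScalarTower R (ResidueField (Localization.AtPrime p)) F := by
  have hu : ∀ y : p.primeCompl, IsUnit (algebraMap R F y) := by
    intro y
    refine IsUnit.mk0 _ fun h => y.2 ?_
    exact hp.ge h
  let g : Localization.AtPrime p →+* F := IsLocalization.lift hu
  have hg : ∀ x, g (algebraMap R _ x) = algebraMap R F x := fun x => IsLocalization.lift_eq hu x
  have hl : IsLocalHom g := by
    constructor
    intro a ha
    by_contra hna
    have h1 : a ∈ maximalIdeal (Localization.AtPrime p) := hna
    rw [← Localization.AtPrime.map_eq_maximalIdeal] at h1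
    have h2 : Ideal.map (algebraMap R (Localization.AtPrime p)) p ≤ RingHom.ker g := by
      rw [Ideal.map_le_iff_le_comap]
      intro x hx
      rw [Ideal.mem_comap, RingHom.mem_ker, hg]
      rwa [hp] at hx
    have h3 : g a = 0 := h2 h1
    rw [h3] at ha
    exact not_isUnit_zero ha
  letI : Algebra (ResidueField (Localization.AtPrime p)) F := (ResidueField.lift g).toAlgebra
  refine ⟨inferInstance, IsScalarTower.of_algebraMap_eq fun x => ?_⟩
  rw [← hg]
  rfl

theorem exists_tower' (R F : Type u) [CommRing R] [IsLocalRing R] [Field F] [Algebra R F]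
    (hm : ∀ x ∈ maximalIdeal R, algebraMap R F x = 0) :
    ∃ (_ : Algebra (ResidueField R) F), IsScalarTower R (ResidueField R) F := by
  have hl : IsLocalHom (algebraMap R F) := by
    constructor
    intro a ha
    by_contra hna
    rw [hm a hna] at ha
    exact not_isUnit_zero ha
  letI : Algebra (ResidueField R) F := (ResidueField.lift (algebraMap R F)).toAlgebra
  exact ⟨inferInstance, IsScalarTower.of_algebraMap_eq fun x => rfl⟩

theorem fib_in (P : ∀ (B : Type u) [CommRing B], Prop)
    (hP : ∀ (B B' : Type u) [CommRing B] [CommRing B'], (B ≃+* B') → P B → P B')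
    (R X : Type u) [CommRing R] [CommRing X] [Algebra R X]
    (h : ∀ (p : Ideal R) [p.IsPrime] (k' : Type u) [Field k'] [Algebra (ResidueField (Localization.AtPrime p)) k'],
      P (k' ⊗[ResidueField (Localization.AtPrime p)] ((ResidueField (Localization.AtPrime p)) ⊗[R] X)))
    (F : Type u) [Field F] [Algebra R F] : P (X ⊗[R] F) := by
  haveI : (RingHom.ker (algebraMap R F)).IsPrime := RingHom.ker_isPrime _
  obtain ⟨_, _⟩ := exists_tower R F (RingHom.ker (algebraMap R F)) rfl
  exact hP _ _ (fibIso R (ResidueField (Localization.AtPrime (RingHom.ker (algebraMap R F)))) F X) (h _ F)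

theorem fib_out (P : ∀ (B : Type u) [CommRing B], Prop)
    (hP : ∀ (B B' : Type u) [CommRing B] [CommRing B'], (B ≃+* B') → P B → P B')
    (R X : Type u) [CommRing R] [CommRing X] [Algebra R X]
    (h : ∀ (F : Type u) [Field F] [Algebra R F], P (X ⊗[R] F))
    (k k' : Type u) [Field k] [Algebra R k] [Field k'] [Algebra k k'] :
      P (k' ⊗[k] (k ⊗[R] X)) := by
  letI : Algebra R k' := ((algebraMap k k').comp (algebraMap R k)).toAlgebra
  haveI : IsScalarTower R k k' := IsScalarTower.of_algebraMap_eq fun x => rfl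
  exact hP _ _ (fibIso R k k' X).symm (h k')

theorem fib_closed (P : ∀ (B : Type u) [CommRing B], Prop)
    (hP : ∀ (B B' : Type u) [CommRing B] [CommRing B'], (B ≃+* B') → P B → P B')
    (R X : Type u) [CommRing R] [IsLocalRing R] [CommRing X] [Algebra R X]
    (h : ∀ (k' : Type u) [Field k'] [Algebra (ResidueField R) k'],
      P (k' ⊗[ResidueField R] ((ResidueField R) ⊗[R] X)))
    (F : Type u) [Field F] [Algebra R F] (hm : ∀ x ∈ maximalIdeal R, algebraMap R F x = 0) : P (X ⊗[R] F) := by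
  obtain ⟨_, _⟩ := exists_tower' R F hm
  exact hP _ _ (fibIso R (ResidueField R) F X) (h F)

theorem nishimura_andre_reduced
    (R A : Type u) [CommRing R] [IsNoetherianRing R] [IsLocalRing R]
    [CommRing A] [IsNoetherianRing A] [IsLocalRing A]
    [Algebra R A] [IsLocalHom (algebraMap R A)] [Module.Flat R A] :
    ((∀ (p : Ideal R) [p.IsPrime],
        GeometricallyReducedAlgebra (ResidueField (Localization.AtPrime p))
          ((ResidueField (Localization.AtPrime p)) ⊗[R]
            (AdicCompletion (maximalIdeal R) R))) →
      GeometricallyReducedAlgebra (ResidueField R) ((ResidueField R) ⊗[R] A) →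
      ∀ (p : Ideal R) [p.IsPrime],
        GeometricallyReducedAlgebra (ResidueField (Localization.AtPrime p))
          ((ResidueField (Localization.AtPrime p)) ⊗[R] A)) := by
  intro h1 h2 p _ k' _ _
  have hP : ∀ (B B' : Type u) [CommRing B] [CommRing B'], (B ≃+* B') → IsReduced B → IsReduced B' :=
    fun B B' _ _ e h => isReduced_of_injective e.symm e.symm.injective
  exact fib_out (fun B _ => IsReduced B) hP R A
    (fun F _ _ => reduced_all (fib_in (fun B _ => IsReduced B) hP R _ (fun p _ k' _ _ => h1 p k'))
      (fib_closed (fun B _ => IsReduced B) hP R A (fun k' _ _ => h2 k')) F) _ k'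

theorem PIC.of_finite_sub {T : Type*} [CommRing T]
    (h : ∀ Z : Finset T, ∃ (T0 : Type u) (_ : CommRing T0) (f : T0 →+* T), Function.Injective f ∧
      (∀ z ∈ Z, ∃ z0, f z0 = z) ∧ PIC T0) : PIC T := by
  classical
  rintro a b ⟨n, c, e⟩
  obtain ⟨T0, _, f, hf, hZ, hP⟩ := h ({a, b} ∪ (Finset.range n).image c)
  obtain ⟨a0, rfl⟩ := hZ a (by simp)
  obtain ⟨b0, rfl⟩ := hZ b (by simp)
  have hc : ∀ i, ∃ c0, i < n → f c0 = c i := by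
    intro i
    by_cases hi : i < n
    · obtain ⟨c0, hc0⟩ := hZ (c i) (Finset.mem_union_right _ (Finset.mem_image_of_mem _ (Finset.mem_range.mpr hi)))
      exact ⟨c0, fun _ => hc0⟩
    · exact ⟨0, fun h => absurd h hi⟩
  choose c0 hc0 using hc
  refine map_dvd f (hP a0 b0 ⟨n, c0, hf ?_⟩)
  rw [map_pow, e, map_sum]
  refine Finset.sum_congr rfl fun i hi => ?_
  rw [map_mul, map_mul, map_pow, map_pow, hc0 i (Finset.mem_range.mp hi)]

theorem PIC.of_base_local {B S : Type*} [CommRing B] [CommRing S] [Algebra B S]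
    (h : ∀ (q : Ideal B) [q.IsPrime], PIC (Localization.AtPrime q ⊗[B] S)) : PIC S := by
  refine PIC.of_local fun P _ a b hab => ?_
  haveI : (P.comap (algebraMap B S)).IsPrime := Ideal.comap_isPrime _ _
  let q := P.comap (algebraMap B S)
  obtain ⟨r, hr⟩ := h q _ _ (hab.map (Algebra.TensorProduct.includeRight : S →ₐ[B] Localization.AtPrime q ⊗[B] S).toRingHom)
  letI : Algebra S (Localization.AtPrime q ⊗[B] S) := Algebra.TensorProduct.rightAlgebra
  haveI : IsLocalization (Algebra.algebraMapSubmonoid S q.primeCompl) (Localization.AtPrime q ⊗[B] S) := inferInstance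
  obtain ⟨⟨r', t⟩, hrt⟩ := IsLocalization.surj (Algebra.algebraMapSubmonoid S q.primeCompl) r
  simp only at hrt
  have h1 : algebraMap S (Localization.AtPrime q ⊗[B] S) (t * a) = algebraMap _ _ (b * r') := by
    rw [map_mul, map_mul, ← hrt]
    change _ * (1 ⊗ₜ a) = (1 ⊗ₜ b) * _
    change (1 ⊗ₜ a) = (1 ⊗ₜ b) * r at hr
    rw [hr]; ring
  obtain ⟨t', ht'⟩ := (IsLocalization.eq_iff_exists (Algebra.algebraMapSubmonoid S q.primeCompl) _).mp h1
  refine ⟨t' * t, ?_, ⟨t' * r', by rw [mul_assoc, ht']; ring⟩⟩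
  have hmem : ∀ t : Algebra.algebraMapSubmonoid S q.primeCompl, (t : S) ∉ P := by
    rintro ⟨_, t0, ht0, rfl⟩ hP
    exact ht0 hP
  intro hP
  rcases (inferInstance : P.IsPrime).mem_or_mem hP with h | h
  exacts [hmem _ h, hmem _ h]

/-- strong division property -/
def Good (Y : Type*) [CommRing Y] : Prop :=
  ∀ a b : Y, IntOver a b → ∃ z e : Y, a = b * z ∧ e * z = z ∧ ∀ w, b * w = 0 → e * w = 0

theorem Good.of_equiv {Y Y' : Type*} [CommRing Y] [CommRing Y'] (f : Y ≃+* Y') (h : Good Y') : Good Y := by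
  intro a b hab
  obtain ⟨z, e, h1, h2, h3⟩ := h _ _ (hab.map (f : Y →+* Y'))
  refine ⟨f.symm z, f.symm e, f.injective (by simpa using h1), f.injective (by simpa using h2), fun w hw => f.injective ?_⟩
  have := h3 (f w) (by simpa using congrArg f hw)
  simpa using this

theorem Good.of_domain {Y : Type*} [CommRing Y] [IsDomain Y] (h : PIC Y) : Good Y := by
  intro a b hab
  obtain ⟨z, hz⟩ := h a b hab
  rcases eq_or_ne b 0 with rfl | hb
  · exact ⟨0, 0, by simpa using hz, by simp, by simp⟩
  · exact ⟨z, 1, hz, by simp, fun w hw => by simpa [hb] using hw⟩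

theorem Good.of_artinian {Y : Type*} [CommRing Y] [IsArtinianRing Y] [IsReduced Y] : Good Y := by
  rintro a b ⟨n, c, h⟩
  obtain ⟨m, y, hy⟩ := IsArtinian.exists_pow_succ_smul_dvd b (1 : Y)
  have hb : b = b * b * y := by
    have h1 : IsNilpotent (b * (1 - b * y)) := by
      refine ⟨m + 1, ?_⟩
      have h2 : b ^ m * (1 - b * y) = 0 := by
        simp only [smul_eq_mul, mul_one, Nat.succ_eq_add_one, pow_succ] at hy
        linear_combination -hy
      rw [mul_pow, pow_succ, pow_succ]
      linear_combination (b * (1 - b * y) ^ m) * h2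
    linear_combination h1.eq_zero
  have ha : a = b * y * a := by
    have h1 : IsNilpotent ((1 - b * y) * a) := by
      refine ⟨n + 1, ?_⟩
      rw [pow_succ, mul_pow, h, Finset.mul_sum, Finset.sum_mul]
      refine Finset.sum_eq_zero fun i hi => ?_
      obtain ⟨j, hj⟩ := Nat.exists_eq_add_of_lt (Finset.mem_range.mp hi)
      rw [show n - i = j + 1 by omega, pow_succ]
      linear_combination ((1 - b * y) ^ n * c i * a ^ i * b ^ j * a) * hb
    linear_combination h1.eq_zero
  refine ⟨y * a, b * y, by linear_combination ha, by linear_combination - y * ha, fun w hw => by linear_combination y * hw⟩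

theorem PIC.of_good {S Y : Type*} [CommRing S] [CommRing Y] [Algebra S Y]
    (hinj : Function.Injective (algebraMap S Y)) (hS : ∀ z : Y, IsIntegral S z → ∃ s, algebraMap S Y s = z)
    (hY : Good Y) : PIC S := by
  intro a b hab
  obtain ⟨n, c, h⟩ := id hab
  obtain ⟨z, e, h1, h2, h3⟩ := hY _ _ (hab.map (algebraMap S Y))
  have hpow : ∀ m w, algebraMap S Y b ^ m * w = 0 → e ^ m * w = 0 := by
    intro m
    induction m with
    | zero => simp
    | succ m ih =>
      intro w hw
      have := h3 _ (ih (algebraMap S Y b * w) (by rw [← hw]; ring) ▸ (by ring : algebraMap S Y b * (e ^ m * w) = e ^ m * (algebraMap S Y b * w)))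
      rw [← this]; ring
  have hez : ∀ m, e ^ m * z = z := by
    intro m
    induction m with
    | zero => simp
    | succ m ih => rw [pow_succ, mul_assoc, h2, ih]
  have h4 : z ^ (n + 1) = ∑ i ∈ Finset.range (n + 1), algebraMap S Y (if i = 0 then 0 else c (i - 1)) * z ^ i := by
    rw [Finset.sum_range_succ']
    simp only [Nat.add_eq_zero_iff, one_ne_zero, and_false, if_false, Nat.add_sub_cancel, if_true, map_zero, zero_mul, add_zero]
    have h5 : algebraMap S Y b ^ n * (z ^ n - ∑ i ∈ Finset.range n, algebraMap S Y (c i) * z ^ i) = 0 := by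
      have h6 := congrArg (algebraMap S Y) h
      rw [map_pow, h1, mul_pow, map_sum] at h6
      rw [mul_sub, h6, sub_eq_zero, Finset.mul_sum]
      refine Finset.sum_congr rfl fun i hi => ?_
      rw [map_mul, map_mul, map_pow, map_pow, h1]
      have : algebraMap S Y b ^ n = algebraMap S Y b ^ (n - i) * algebraMap S Y b ^ i := by
        rw [← pow_add]; congr 1; have := Finset.mem_range.mp hi; omega
      rw [this]; ring
    have h7 := hpow _ _ h5
    have h8 : z * (z ^ n - ∑ i ∈ Finset.range n, algebraMap S Y (c i) * z ^ i) = 0 := by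
      have h9 := hez n
      generalize (z ^ n - ∑ i ∈ Finset.range n, algebraMap S Y (c i) * z ^ i) = X at h7 ⊢
      linear_combination z * h7 - X * h9
    rw [mul_sub, sub_eq_zero, Finset.mul_sum] at h8
    rw [pow_succ, mul_comm, h8]
    exact Finset.sum_congr rfl fun i hi => by ring
  obtain ⟨s, rfl⟩ := hS z (isIntegral_of_eq_sum _ _ h4)
  exact ⟨s, hinj (by rw [map_mul, h1])⟩

theorem smooth_step {B S : Type*} [CommRing B] [CommRing S] [Algebra B S] [IsDomain B] [IsIntegrallyClosed B]
    [Algebra.Smooth B S] [Module.Flat B S] (hY : Good (S ⊗[B] FractionRing B)) : PIC S := by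
  have hinjB : Function.Injective (algebraMap B (FractionRing B)) := IsFractionRing.injective B _
  refine PIC.of_good (Y := S ⊗[B] FractionRing B) ?_ ?_ hY
  · have := Module.Flat.lTensor_preserves_injective_linearMap (M := S) (Algebra.linearMap B (FractionRing B)) hinjB
    have h2 : Function.Injective (LinearMap.lTensor S (Algebra.linearMap B (FractionRing B)) ∘ (TensorProduct.rid B S).symm) :=
      this.comp (LinearEquiv.injective _)
    convert h2 using 1
    ext s
    simp
  · intro z hz
    obtain ⟨t, ht⟩ := (TensorProduct.toIntegralClosure_bijective_of_smooth (R := B) (S := S) (B := FractionRing B)).2 ⟨z, hz⟩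
    have ht' : (Algebra.TensorProduct.map (.id S S) (integralClosure B (FractionRing B)).val) t = z := congrArg Subtype.val ht
    rw [← ht']
    clear ht ht'
    induction t with
    | zero => exact ⟨0, by simp⟩
    | add x y hx hy =>
      obtain ⟨s, hs⟩ := hx
      obtain ⟨s', hs'⟩ := hy
      exact ⟨s + s', by rw [map_add, map_add, hs, hs']⟩
    | tmul s x =>
      obtain ⟨b, hb⟩ := (IsIntegrallyClosed.isIntegral_iff (R := B) (K := FractionRing B)).mp x.2
      refine ⟨b • s, ?_⟩
      rw [Algebra.TensorProduct.map_tmul, Algebra.TensorProduct.algebraMap_apply]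
      simp [← hb, Algebra.algebraMap_eq_smul_one, TensorProduct.smul_tmul]

theorem smooth_pic {B S : Type u} [CommRing B] [CommRing S] [Algebra B S] (hB : PIC B)
    [Algebra.Smooth B S] [Module.Flat B S]
    (hY : ∀ (K : Type u) [Field K] [Algebra B K], Good (K ⊗[B] S)) : PIC S := by
  refine PIC.of_base_local (B := B) fun q _ => ?_
  have hq : PIC (Localization.AtPrime q) := hB.localization q.primeCompl _
  haveI := hq.isDomain
  haveI := hq.isIntegrallyClosed
  refine smooth_step (B := Localization.AtPrime q) ?_
  exact Good.of_equiv (((Algebra.TensorProduct.comm (Localization.AtPrime q) _ (FractionRing (Localization.AtPrime q))).toRingEquiv).trans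
    (Algebra.TensorProduct.cancelBaseChange B (Localization.AtPrime q) (Localization.AtPrime q) (FractionRing (Localization.AtPrime q)) S).toRingEquiv) (hY _)

theorem etale_good (K Y : Type u) [Field K] [CommRing Y] [Algebra K Y] [Algebra.Etale K Y] : Good Y := by
  haveI : Algebra.EssFiniteType K Y := inferInstance
  haveI : Module.Finite K Y := Algebra.FormallyUnramified.finite_of_free K Y
  haveI : IsReduced Y := Algebra.FormallyUnramified.isReduced_of_field K Y
  haveI : IsArtinianRing Y := IsArtinianRing.of_finite K Y
  exact Good.of_artinian

theorem etale_pic {B S : Type u} [CommRing B] [CommRing S] [Algebra B S] (hB : PIC B)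
    [Algebra.Etale B S] [Module.Flat B S] : PIC S := by
  refine smooth_pic hB fun K _ _ => ?_
  exact etale_good K (K ⊗[B] S)

theorem mvPoly_pic {B : Type u} [CommRing B] (hB : PIC B) (σ : Type u) [Finite σ] : PIC (MvPolynomial σ B) := by
  haveI : Algebra.Smooth B (MvPolynomial σ B) := ⟨inferInstance, inferInstance⟩
  refine smooth_pic hB fun K _ _ => ?_
  refine Good.of_equiv (MvPolynomial.algebraTensorAlgEquiv (σ := σ) B K).toRingEquiv (Good.of_domain PIC.of_isIntegrallyClosed)

theorem geo_frac {k P E B : Type u} [Field k] [CommRing P] [CommRing E] [CommRing B] [Algebra k P] [Algebra k E]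
    [Algebra P E] [IsScalarTower k P E] [Algebra k B] (M : Submonoid P) [IsLocalization M E]
    (h : PIC (P ⊗[k] B)) : PIC (E ⊗[k] B) := by
  refine PIC.of_equiv (Algebra.TensorProduct.cancelBaseChange k P P E B).toRingEquiv.symm ?_
  letI : Algebra (P ⊗[k] B) (E ⊗[P] (P ⊗[k] B)) := Algebra.TensorProduct.rightAlgebra
  haveI : IsLocalization (Algebra.algebraMapSubmonoid (P ⊗[k] B) M) (E ⊗[P] (P ⊗[k] B)) := inferInstance
  exact h.localization (Algebra.algebraMapSubmonoid (P ⊗[k] B) M) _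

theorem geo_etale {k E F B : Type u} [Field k] [Field E] [Field F] [CommRing B] [Algebra k E] [Algebra k F]
    [Algebra E F] [IsScalarTower k E F] [Algebra k B] [Algebra.Etale E F]
    (h : PIC (E ⊗[k] B)) : PIC (F ⊗[k] B) := by
  refine PIC.of_equiv (Algebra.TensorProduct.cancelBaseChange k E E F B).toRingEquiv.symm ?_
  refine PIC.of_equiv (Algebra.TensorProduct.comm E F (E ⊗[k] B)).toRingEquiv ?_
  exact etale_pic (S := (E ⊗[k] B) ⊗[E] F) h

open scoped IntermediateField.algebraAdjoinAdjoin in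
theorem geo_adjoin {k F B : Type u} [Field k] [Field F] [CommRing B] [Algebra k F] [Algebra k B]
    (hB : PIC B) {ι : Type u} [Finite ι] {v : ι → F} (hb : AlgebraicIndependent k v) :
    PIC (IntermediateField.adjoin k (Set.range v) ⊗[k] B) := by
  refine geo_frac (P := Algebra.adjoin k (Set.range v)) (nonZeroDivisors _) ?_
  refine PIC.of_equiv (Algebra.TensorProduct.congr hb.aevalEquiv.symm (AlgEquiv.refl (R := k) (A₁ := B))).toRingEquiv ?_
  refine PIC.of_equiv (Algebra.TensorProduct.comm k _ B).toRingEquiv ?_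
  refine PIC.of_equiv (MvPolynomial.algebraTensorAlgEquiv (σ := ι) k B).toRingEquiv ?_
  exact mvPoly_pic hB ι

theorem geo_ess {k F B : Type u} [Field k] [Field F] [CommRing B] [Algebra k F] [Algebra k B]
    [PerfectField k] [Algebra.EssFiniteType k F] (hB : PIC B) : PIC (F ⊗[k] B) := by
  obtain ⟨s, hs, H⟩ := exists_isTranscendenceBasis_and_isSeparable_of_perfectField k F
  have : Algebra.IsSeparable (↥(IntermediateField.adjoin k (Set.range ((↑) : s → F)))) F := by
    convert! H <;> simp
  haveI : Algebra.EssFiniteType (IntermediateField.adjoin k (Set.range ((↑) : s → F))) F :=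
    Algebra.EssFiniteType.of_comp k _ F
  haveI : Algebra.FormallyEtale (IntermediateField.adjoin k (Set.range ((↑) : s → F))) F :=
    Algebra.FormallyEtale.of_isSeparable _ F
  haveI : Module.Finite (IntermediateField.adjoin k (Set.range ((↑) : s → F))) F :=
    Algebra.FormallyUnramified.finite_of_free _ F
  haveI : Algebra.FinitePresentation (IntermediateField.adjoin k (Set.range ((↑) : s → F))) F :=
    Algebra.FinitePresentation.of_finiteType.mp inferInstance
  haveI : Algebra.Etale (IntermediateField.adjoin k (Set.range ((↑) : s → F))) F := ⟨inferInstance, inferInstance⟩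
  exact geo_etale (geo_adjoin hB hs.1)

/-- reduction to subfields -/
theorem geo_union {k F B : Type u} [Field k] [Field F] [CommRing B] [Algebra k F] [Algebra k B]
    (h : ∀ Z : Finset F, ∃ E : IntermediateField k F, (Z : Set F) ⊆ E ∧ PIC (E ⊗[k] B)) : PIC (F ⊗[k] B) := by
  classical
  refine PIC.of_finite_sub fun Z => ?_
  have key : ∀ z : F ⊗[k] B, ∃ S : Finset F, ∀ E : IntermediateField k F, (S : Set F) ⊆ E →
      ∃ z0 : E ⊗[k] B, Algebra.TensorProduct.map E.val (AlgHom.id k B) z0 = z := by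
    intro z
    induction z with
    | zero => exact ⟨∅, fun E _ => ⟨0, map_zero _⟩⟩
    | tmul x b => exact ⟨{x}, fun E hE => ⟨⟨x, hE (by simp)⟩ ⊗ₜ b, by simp⟩⟩
    | add x y hx hy =>
      obtain ⟨S, hS⟩ := hx
      obtain ⟨S', hS'⟩ := hy
      refine ⟨S ∪ S', fun E hE => ?_⟩
      obtain ⟨a, rfl⟩ := hS E (fun z hz => hE (by simp at hz; simp [hz]))
      obtain ⟨b, rfl⟩ := hS' E (fun z hz => hE (by simp at hz; simp [hz]))
      exact ⟨a + b, map_add _ _ _⟩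
  choose S hS using key
  obtain ⟨E, hE, hP⟩ := h (Z.biUnion S)
  refine ⟨E ⊗[k] B, inferInstance, (Algebra.TensorProduct.map E.val (AlgHom.id k B)).toRingHom, ?_, ?_, hP⟩
  · exact Module.Flat.rTensor_preserves_injective_linearMap (M := B) E.val.toLinearMap Subtype.val_injective
  · intro z hz
    exact hS z E fun x hx => hE (by simp; exact ⟨z, hz, hx⟩)

theorem geo_perfect {k B : Type u} [Field k] [CommRing B] [Algebra k B]
    [PerfectField k] (hB : PIC B) (F : Type u) [Field F] [Algebra k F] : PIC (F ⊗[k] B) := by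
  refine geo_union fun Z => ⟨IntermediateField.adjoin k (Z : Set F), IntermediateField.subset_adjoin _ _, ?_⟩
  haveI : Algebra.EssFiniteType k (IntermediateField.adjoin k (Z : Set F)) :=
    (IntermediateField.essFiniteType_iff).mpr ⟨Z, rfl⟩
  exact geo_ess hB

theorem geo_descend {k F F' B : Type u} [Field k] [Field F] [Field F'] [CommRing B] [Algebra k F] [Algebra k F']
    [Algebra F F'] [IsScalarTower k F F'] [Algebra k B] (h : PIC (F' ⊗[k] B)) : PIC (F ⊗[k] B) := by
  have h1 : PIC (F' ⊗[F] (F ⊗[k] B)) := PIC.of_equiv (Algebra.TensorProduct.cancelBaseChange k F F F' B).toRingEquiv h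
  have h2 : PIC ((F ⊗[k] B) ⊗[F] F') := PIC.of_equiv (Algebra.TensorProduct.comm F _ _).toRingEquiv h1
  exact PIC.of_faithfullyFlat (B := F ⊗[k] B) (B' := (F ⊗[k] B) ⊗[F] F') h2

theorem geo {k B : Type u} [Field k] [CommRing B] [Algebra k B]
    (hB : ∀ (l : Type u) [Field l] [Algebra k l] [Module.Finite k l] [IsPurelyInseparable k l], PIC (l ⊗[k] B))
    (F : Type u) [Field F] [Algebra k F] : PIC (F ⊗[k] B) := by
  refine geo_descend (F' := AlgebraicClosure F) ?_
  let Ω := AlgebraicClosure F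
  let P := perfectClosure k Ω
  have h1 : PIC (P ⊗[k] B) := by
    refine geo_union fun Z => ⟨IntermediateField.adjoin k (Z : Set P), IntermediateField.subset_adjoin _ _, ?_⟩
    haveI : Module.Finite k (IntermediateField.adjoin k (Z : Set P)) :=
      IntermediateField.finiteDimensional_adjoin fun x _ => Algebra.IsIntegral.isIntegral x
    haveI : IsPurelyInseparable k (IntermediateField.adjoin k (Z : Set P)) :=
      IsPurelyInseparable.tower_bot k _ P
    exact hB _
  have h2 := geo_perfect (k := P) h1 Ω
  exact PIC.of_equiv (Algebra.TensorProduct.cancelBaseChange k P P Ω B).toRingEquiv.symm h2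

/-- almost integral -/
def AInt {B : Type*} [CommRing B] (a h : B) : Prop := ∃ N : ℕ, ∀ n, h ^ n ∣ h ^ N * a ^ n

theorem AInt.map {B B' : Type*} [CommRing B] [CommRing B'] (f : B →+* B') {a h : B} (H : AInt a h) : AInt (f a) (f h) := by
  obtain ⟨N, hN⟩ := H
  refine ⟨N, fun n => ?_⟩
  simpa using map_dvd f (hN n)

theorem IntOver.aint {B : Type*} [CommRing B] {a h : B} (H : IntOver a h) : AInt a h := by
  obtain ⟨N, c, e⟩ := H
  refine ⟨N, fun n => ?_⟩
  induction n using Nat.strong_induction_on with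
  | _ n ih =>
    by_cases hn : n ≤ N
    · exact (pow_dvd_pow h hn).mul_right _
    · have h1 : a ^ n = a ^ (n - N) * a ^ N := by rw [← pow_add]; congr 1; omega
      rw [h1, e, Finset.mul_sum, Finset.mul_sum]
      refine Finset.dvd_sum fun i hi => ?_
      have hi' := Finset.mem_range.mp hi
      obtain ⟨w, hw⟩ := ih (n - N + i) (by omega)
      refine ⟨c i * w, ?_⟩
      have h2 : h ^ n = h ^ (N - i) * h ^ (n - N + i) := by rw [← pow_add]; congr 1; omega
      rw [h2]
      rw [pow_add a] at hw
      linear_combination (c i * h ^ (N - i)) * hw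

theorem almost_ring {B : Type*} [CommRing B] [IsNoetherianRing B] (hB : PIC B) (h a : B)
    (hn : ∀ x, h * x = 0 → x = 0) (H : AInt a h) : h ∣ a := by
  obtain ⟨N, hN⟩ := H
  choose w hw using hN
  have hpow : ∀ m x, h ^ m * x = 0 → x = 0 := by
    intro m
    induction m with
    | zero => simp
    | succ m ih => intro x hx; exact ih _ (hn _ (by rw [← hx]; ring))
  let I : ℕ →o Ideal B := ⟨fun n => Ideal.span (w '' Set.Iio n), fun m n hmn => Ideal.span_mono
    (Set.image_mono (Set.Iio_subset_Iio hmn))⟩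
  obtain ⟨n, hI⟩ := monotone_stabilizes_iff_noetherian.mpr (inferInstance : IsNoetherian B B) I
  have h1 : w n ∈ I n := by
    rw [hI (n + 1) (by omega)]
    exact Ideal.subset_span ⟨n, by simp, rfl⟩
  have h2 : ∃ c : ℕ → B, w n = ∑ i ∈ Finset.range n, c i * w i := by
    have : w n ∈ Submodule.span B (w '' (Finset.range n : Set ℕ)) := by
      rw [Finset.coe_range]; exact h1
    obtain ⟨c, hc⟩ := (Submodule.mem_span_image_finset_iff_exists_fun B).mp this
    refine ⟨fun i => if hi : i ∈ Finset.range n then c ⟨i, hi⟩ else 0, ?_⟩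
    rw [← hc, ← Finset.sum_coe_sort (Finset.range n)]
    refine Finset.sum_congr rfl fun i _ => ?_
    have hi := i.2
    simp only [hi, dif_pos, smul_eq_mul]
  obtain ⟨c, hc⟩ := h2
  refine hB a h ⟨n, c, ?_⟩
  rw [← sub_eq_zero]
  apply hpow N
  rw [mul_sub, hw n, hc, sub_eq_zero, Finset.mul_sum, Finset.mul_sum]
  refine Finset.sum_congr rfl fun i hi => ?_
  have hi' := Finset.mem_range.mp hi
  have h3 : h ^ n = h ^ (n - i) * h ^ i := by rw [← pow_add]; congr 1; omega
  rw [h3]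
  linear_combination (-c i * h ^ (n - i)) * hw i

theorem hstep_ring {U : Type*} [CommRing U] (h ϖ : U) (hϖ : ∀ x, ϖ * x = 0 → x = 0)
    (hcop : ∀ x, ϖ ∣ h * x → ϖ ∣ x) (hq : ∀ a, AInt a h → ∃ u, ϖ ∣ a - h * u) :
    ∀ n a, AInt a h → ∃ u, ϖ ^ n ∣ a - h * u := by
  intro n
  have hϖp : ∀ m x, ϖ ^ m * x = 0 → x = 0 := by
    intro m
    induction m with
    | zero => simp
    | succ m ih => intro x hx; exact ih _ (hϖ _ (by rw [← hx]; ring))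
  have hhp : ∀ m x, ϖ ∣ h ^ m * x → ϖ ∣ x := by
    intro m
    induction m with
    | zero => simp
    | succ m ih => intro x hx; exact ih _ (hcop _ (by rw [← mul_assoc, ← pow_succ']; exact hx))
  have hcop2 : ∀ j m x, ϖ ^ j ∣ h ^ m * x → ϖ ^ j ∣ x := by
    intro j m
    induction j with
    | zero => simp
    | succ j ih =>
      intro x hx
      obtain ⟨y, rfl⟩ := ih x ((pow_dvd_pow ϖ (Nat.le_succ j)).trans hx)
      obtain ⟨z, hz⟩ := hx
      have h1 : h ^ m * y = ϖ * z := by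
        rw [← sub_eq_zero]
        apply hϖp j
        linear_combination hz
      obtain ⟨y', rfl⟩ := hhp m y ⟨z, h1⟩
      exact ⟨y', by ring⟩
  induction n with
  | zero => intro a _; exact ⟨0, by simp⟩
  | succ n ih =>
    intro a ha
    obtain ⟨u, a1, hu⟩ := hq a ha
    have h1 : AInt a1 h := by
      obtain ⟨N, hN⟩ := ha
      refine ⟨N, fun m => ?_⟩
      have h2 : h ^ m ∣ h ^ N * (a - h * u) ^ m := by
        rw [sub_eq_add_neg, add_pow, Finset.mul_sum]
        refine Finset.dvd_sum fun i hi => ?_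
        have h3 : h ^ m = h ^ i * h ^ (m - i) := by
          rw [← pow_add]; congr 1; have := Finset.mem_range.mp hi; omega
        obtain ⟨w, hw⟩ := hN i
        rw [h3]
        refine ⟨w * (-u) ^ (m - i) * (m.choose i), ?_⟩
        rw [show -(h * u) = h * (-u) by ring, mul_pow]
        linear_combination (h ^ (m - i) * (-u) ^ (m - i) * (m.choose i)) * hw
      rw [hu] at h2
      obtain ⟨w, hw⟩ := h2
      obtain ⟨w', rfl⟩ := hcop2 m m w ⟨h ^ N * a1 ^ m, by rw [← hw]; ring⟩
      refine ⟨w', ?_⟩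
      rw [← sub_eq_zero]
      apply hϖp m
      linear_combination hw
    obtain ⟨u1, y, hy⟩ := ih a1 h1
    refine ⟨u + ϖ * u1, y, ?_⟩
    linear_combination hu + ϖ * hy

theorem smul_eq_tmul_mul {R A X : Type*} [CommRing R] [CommRing A] [Algebra R A] [CommRing X] [Algebra R X]
    (h : A) (x : A ⊗[R] X) : h • x = (h ⊗ₜ[R] (1 : X)) * x := by
  induction x with
  | zero => simp
  | tmul a b => simp [TensorProduct.smul_tmul']
  | add x y hx hy => rw [smul_add, hx, hy, mul_add]

theorem dvd_of_field {R A E F : Type*} [CommRing R] [CommRing A] [Algebra R A] [Field E] [Field F] [Algebra R E] [Algebra R F]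
    [Algebra E F] [IsScalarTower R E F] (b : A) (a : A ⊗[R] E)
    (h : (b ⊗ₜ[R] (1 : F)) ∣ tmap A (IsScalarTower.toAlgHom R E F) a) : (b ⊗ₜ[R] (1 : E)) ∣ a := by
  obtain ⟨ρ, hρ⟩ := (Algebra.linearMap E F).exists_leftInverse_of_injective
    (LinearMap.ker_eq_bot.mpr (algebraMap E F).injective)
  let g : A ⊗[R] F →ₗ[A] A ⊗[R] E := TensorProduct.AlgebraTensorModule.lTensor A A (ρ.restrictScalars R)
  have hg : ∀ x, g (tmap A (IsScalarTower.toAlgHom R E F) x) = x := by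
    intro x
    induction x with
    | zero => simp
    | tmul a b =>
      have := LinearMap.congr_fun hρ b
      simp at this
      simp [g, this]
    | add x y hx hy => rw [map_add, map_add, hx, hy]
  obtain ⟨w, hw⟩ := h
  refine ⟨g w, ?_⟩
  rw [← hg a, hw, ← smul_eq_tmul_mul, ← smul_eq_tmul_mul, map_smul]

theorem almost_field {R A : Type u} [CommRing R] [IsNoetherianRing R] [IsLocalRing R] [CommRing A] [IsNoetherianRing A]
    [IsLocalRing A] [Algebra R A] [IsLocalHom (algebraMap R A)] [Module.Flat R A]
    (hk : ∀ (F : Type u) [Field F] [Algebra R F], (∀ x ∈ maximalIdeal R, algebraMap R F x = 0) → PIC (A ⊗[R] F))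
    (h : A) (hh : ∀ (t : ResidueField R ⊗[R] A), 1 ⊗ₜ[R] h * t = 0 → t = 0)
    (F : Type u) [Field F] [Algebra R F] (hF : ∀ x ∈ maximalIdeal R, algebraMap R F x = 0)
    (a : A ⊗[R] F) (ha : AInt a (h ⊗ₜ 1)) : (h ⊗ₜ 1) ∣ a := by
  obtain ⟨_, _⟩ := exists_tower' R F hF
  have key : ∃ S : Finset F, ∀ E : IntermediateField (ResidueField R) F, (S : Set F) ⊆ E →
      ∃ z0 : A ⊗[R] E, tmap A (E.val.restrictScalars R) z0 = a := by
    classical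
    clear ha
    induction a with
    | zero => exact ⟨∅, fun E _ => ⟨0, map_zero _⟩⟩
    | tmul b x => exact ⟨{x}, fun E hE => ⟨b ⊗ₜ ⟨x, hE (by simp)⟩, by simp⟩⟩
    | add x y hx hy =>
      obtain ⟨S, hS⟩ := hx
      obtain ⟨S', hS'⟩ := hy
      refine ⟨S ∪ S', fun E hE => ?_⟩
      obtain ⟨a, rfl⟩ := hS E (fun z hz => hE (by simp at hz; simp [hz]))
      obtain ⟨b, rfl⟩ := hS' E (fun z hz => hE (by simp at hz; simp [hz]))
      exact ⟨a + b, map_add _ _ _⟩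
  obtain ⟨S, hS⟩ := key
  let E := IntermediateField.adjoin (ResidueField R) (S : Set F)
  obtain ⟨a0, rfl⟩ := hS E (IntermediateField.subset_adjoin _ _)
  haveI : Algebra.EssFiniteType (ResidueField R) E := (IntermediateField.essFiniteType_iff).mpr ⟨S, rfl⟩
  haveI : Algebra.EssFiniteType R (ResidueField R) := inferInstance
  haveI : Algebra.EssFiniteType R E := Algebra.EssFiniteType.comp R (ResidueField R) E
  haveI : IsNoetherianRing (A ⊗[R] E) := Algebra.EssFiniteType.isNoetherianRing A (A ⊗[R] E)
  have this0 : ∀ x, algebraMap R F x = algebraMap E F (algebraMap R E x) := by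
    intro x
    have h3 : algebraMap R E x = algebraMap (ResidueField R) E (algebraMap R (ResidueField R) x) := by
      rw [Algebra.algebraMap_eq_smul_one, Algebra.algebraMap_eq_smul_one (A := E), Algebra.algebraMap_eq_smul_one, smul_assoc, one_smul]
    rw [IsScalarTower.algebraMap_apply R (ResidueField R) F, h3]
    rfl
  haveI : IsScalarTower R E F := IsScalarTower.of_algebraMap_eq this0
  have hE : PIC (A ⊗[R] E) := hk E fun x hx => by
    have := hF x hx
    apply (algebraMap E F).injective
    rw [map_zero]; exact this0 x ▸ this
  have h1 : h ⊗ₜ (1 : E) ∣ a0 := by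
    refine almost_ring hE _ _ ?_ ?_
    · intro x hx
      refine lemmaH h hh x ?_
      rw [← hx, smul_eq_tmul_mul]
    · obtain ⟨N, hN⟩ := ha
      refine ⟨N, fun n => ?_⟩
      have h4 := hN n
      rw [Algebra.TensorProduct.tmul_pow, one_pow] at h4 ⊢
      refine dvd_of_field (F := F) _ _ ?_
      convert h4 using 1
      rw [map_mul, map_pow, map_pow]
      congr 1
  have h2 := map_dvd (tmap A (E.val.restrictScalars R)) h1
  have h3 : tmap A (E.val.restrictScalars R) (h ⊗ₜ (1 : E)) = h ⊗ₜ 1 := by simp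
  rwa [h3] at h2

theorem mkQ_smul_zero {R A X : Type*} [CommRing R] [CommRing A] [Algebra R A] [AddCommGroup X] [Module R X] (h : A)
    (t : A ⊗[R] X) : LinearMap.rTensor X (Ideal.Quotient.mkₐ R (Ideal.span {h})).toLinearMap (h • t) = 0 := by
  induction t with
  | zero => simp
  | tmul a x =>
    rw [TensorProduct.smul_tmul', LinearMap.rTensor_tmul]
    have : (Ideal.Quotient.mkₐ R (Ideal.span {h})).toLinearMap (h • a) = 0 := by
      refine Ideal.Quotient.eq_zero_iff_mem.mpr ?_
      exact Ideal.mul_mem_right _ _ (Ideal.mem_span_singleton_self h)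
    rw [this, zero_tmul]
  | add x y hx hy => rw [smul_add, map_add, hx, hy, add_zero]

theorem dvd_of_mkQ {R A X : Type*} [CommRing R] [CommRing A] [Algebra R A] [CommRing X] [Algebra R X] (h : A)
    (t : A ⊗[R] X) (ht : LinearMap.rTensor X (Ideal.Quotient.mkₐ R (Ideal.span {h})).toLinearMap t = 0) :
    (h ⊗ₜ[R] (1 : X)) ∣ t := by
  have hex : Function.Exact (LinearMap.mulLeft R h) (Ideal.Quotient.mkₐ R (Ideal.span {h})).toLinearMap := by
    intro a
    change (Ideal.Quotient.mk _ a = 0) ↔ _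
    rw [Ideal.Quotient.eq_zero_iff_mem, Ideal.mem_span_singleton]
    exact ⟨fun ⟨c, hc⟩ => ⟨c, hc.symm⟩, fun ⟨c, hc⟩ => ⟨c, hc.symm⟩⟩
  obtain ⟨w, hw⟩ := (rTensor_exact X hex (Ideal.Quotient.mkₐ_surjective R _) t).mp ht
  refine ⟨w, ?_⟩
  rw [← hw, ← smul_eq_tmul_mul]
  clear hw
  induction w with
  | zero => simp
  | tmul a x => rw [LinearMap.rTensor_tmul, TensorProduct.smul_tmul']; rfl
  | add x y hx hy => rw [map_add, smul_add, hx, hy]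

theorem hstep_V {R A V : Type u} [CommRing R] [IsNoetherianRing R] [IsLocalRing R] [CommRing A] [IsNoetherianRing A]
    [IsLocalRing A] [Algebra R A] [IsLocalHom (algebraMap R A)] [Module.Flat R A]
    (hk : ∀ (F : Type u) [Field F] [Algebra R F], (∀ x ∈ maximalIdeal R, algebraMap R F x = 0) → PIC (A ⊗[R] F))
    (h : A) (hh : ∀ (t : ResidueField R ⊗[R] A), 1 ⊗ₜ[R] h * t = 0 → t = 0)
    [CommRing V] [IsDomain V] [IsDiscreteValuationRing V] [Algebra R V]
    (hV : ∀ x ∈ maximalIdeal R, algebraMap R V x ∈ maximalIdeal V) (ϖ : V) (hϖ : Irreducible ϖ)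
    (a : A ⊗[R] V) (ha : AInt a (h ⊗ₜ[R] 1)) (n : ℕ) :
    ∃ u, (1 ⊗ₜ[R] ϖ) ^ n ∣ a - (h ⊗ₜ[R] 1) * u := by
  let g : V →ₐ[R] ResidueField V := IsScalarTower.toAlgHom R V (ResidueField V)
  have hg : Function.Surjective g := residue_surjective
  have hker : RingHom.ker g = Ideal.span {ϖ} := by
    rw [← hϖ.maximalIdeal_eq]
    exact ker_residue
  have hF : ∀ x ∈ maximalIdeal R, algebraMap R (ResidueField V) x = 0 := by
    intro x hx
    rw [IsScalarTower.algebraMap_apply R V (ResidueField V)]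
    exact (residue_eq_zero_iff _).mpr (hV x hx)
  have hgs : Function.Surjective (tmap A g) :=
    TensorProduct.map_surjective Function.surjective_id hg
  have hg0 : tmap A g (1 ⊗ₜ ϖ) = 0 := by
    have : g ϖ = 0 := by
      have : ϖ ∈ RingHom.ker g := by rw [hker]; exact Ideal.mem_span_singleton_self ϖ
      exact this
    simp [this]
  have hgh : tmap A g (h ⊗ₜ 1) = h ⊗ₜ 1 := by simp
  refine hstep_ring _ _ (nzd_one_tmul ϖ fun x hx => by simpa [hϖ.ne_zero] using hx) ?_ ?_ n a ha
  · rintro x ⟨y, hy⟩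
    have h1 := congrArg (tmap A g) hy
    rw [map_mul, map_mul, hg0, zero_mul, hgh, ← smul_eq_tmul_mul] at h1
    obtain ⟨w, hw⟩ := exists_of_tmap_eq_zero g hg ϖ hker x (lemmaH h hh _ h1)
    exact ⟨w, hw⟩
  · intro a ha
    have h1 := ha.map (tmap A g).toRingHom
    obtain ⟨w, hw⟩ := almost_field hk h hh _ hF _ (hgh ▸ h1 : AInt (tmap A g a) (h ⊗ₜ 1))
    obtain ⟨u, rfl⟩ := hgs w
    refine ⟨u, ?_⟩
    obtain ⟨w, hw⟩ := exists_of_tmap_eq_zero g hg ϖ hker (a - h ⊗ₜ 1 * u) (by rw [map_sub, map_mul, hgh, hw, sub_self])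
    exact ⟨w, hw⟩

theorem hstep {R A R1 : Type u} [CommRing R] [IsNoetherianRing R] [IsLocalRing R] [CommRing A] [IsNoetherianRing A]
    [IsLocalRing A] [Algebra R A] [IsLocalHom (algebraMap R A)] [Module.Flat R A]
    (hk : ∀ (F : Type u) [Field F] [Algebra R F], (∀ x ∈ maximalIdeal R, algebraMap R F x = 0) → PIC (A ⊗[R] F))
    (h : A) (hh : ∀ (t : ResidueField R ⊗[R] A), 1 ⊗ₜ[R] h * t = 0 → t = 0)
    [CommRing R1] [Algebra R R1] [Module.Finite R R1]
    (chev : ∀ (N : ℕ), ∃ s : Finset (Ideal R1), (∀ J ∈ s, IsTest.{u} R J) ∧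
      s.inf id ≤ Ideal.map (algebraMap R R1) (maximalIdeal R ^ N))
    (a : A ⊗[R] R1) (ha : IntOver a (h ⊗ₜ[R] 1)) : (h ⊗ₜ[R] 1) ∣ a := by
  haveI := flat_quot h hh
  apply dvd_of_mkQ
  refine lemmaV (A := A) (M := A ⧸ Ideal.span {h}) chev _ fun V _ _ _ _ φ n hV => ?_
  obtain ⟨ϖ, hϖ⟩ := IsDiscreteValuationRing.exists_irreducible V
  have hφh : tmap A φ (h ⊗ₜ 1) = h ⊗ₜ 1 := by simp
  have h1 := ha.aint.map (tmap A φ).toRingHom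
  obtain ⟨u, w, hw⟩ := hstep_V hk h hh hV ϖ hϖ (tmap A φ a) (hφh ▸ h1 : AInt (tmap A φ a) (h ⊗ₜ 1)) n
  have h2 : ∀ t : A ⊗[R] R1, LinearMap.lTensor (A ⧸ Ideal.span {h}) ((Ideal.Quotient.mkₐ R (maximalIdeal V ^ n)).comp φ).toLinearMap
      (LinearMap.rTensor R1 (Ideal.Quotient.mkₐ R (Ideal.span {h})).toLinearMap t) =
      LinearMap.rTensor (V ⧸ maximalIdeal V ^ n) (Ideal.Quotient.mkₐ R (Ideal.span {h})).toLinearMap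
        (tmap A (Ideal.Quotient.mkₐ R (maximalIdeal V ^ n)) (tmap A φ t)) := by
    intro t
    induction t with
    | zero => simp
    | tmul a x => rfl
    | add x y hx hy => simp only [map_add, hx, hy]
  rw [h2, eq_add_of_sub_eq hw, map_add, map_mul, map_mul, map_pow]
  have h3 : (tmap A (Ideal.Quotient.mkₐ R (maximalIdeal V ^ n)) (1 ⊗ₜ ϖ)) ^ n = 0 := by
    have : (Ideal.Quotient.mkₐ R (maximalIdeal V ^ n) ϖ) ^ n = 0 := by
      rw [← map_pow]
      refine Ideal.Quotient.eq_zero_iff_mem.mpr (Ideal.pow_mem_pow ?_ n)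
      rw [hϖ.maximalIdeal_eq]; exact Ideal.mem_span_singleton_self ϖ
    rw [Algebra.TensorProduct.map_tmul, Algebra.TensorProduct.tmul_pow, this, tmul_zero]
  have h4 : tmap A (Ideal.Quotient.mkₐ R (maximalIdeal V ^ n)) (h ⊗ₜ 1) = h ⊗ₜ 1 := by simp
  rw [h3, zero_mul, zero_add, h4, ← smul_eq_tmul_mul]
  exact mkQ_smul_zero _ _

theorem exists_nzd_add {B : Type*} [CommRing B] [IsNoetherianRing B] [IsReduced B] (b : B) :
    ∃ b', b * b' = 0 ∧ ∀ x, (b + b') * x = 0 → x = 0 := by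
  classical
  have hfin : (minimalPrimes B).Finite := minimalPrimes.finite_of_isNoetherianRing B
  let I : Ideal B := Ideal.span {b} |>.annihilator
  have hI : ∀ y, y ∈ I ↔ b * y = 0 := by
    intro y
    rw [Submodule.mem_annihilator_span_singleton, smul_eq_mul, mul_comm]
  let s : Finset (Ideal B) := hfin.toFinset.filter (fun p => b ∈ p)
  have hav : ¬ ((I : Set B) ⊆ ⋃ p ∈ (s : Set (Ideal B)), (p : Set B)) := by
    intro h
    obtain ⟨p, hp, hle⟩ := (Ideal.subset_union_prime (s := s) (f := id) ⊥ ⊥ (fun p hp _ _ => by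
      simp only [s, Finset.mem_filter, Set.Finite.mem_toFinset] at hp
      exact hp.1.1.1)).mp h
    simp only [s, Finset.mem_filter, Set.Finite.mem_toFinset, id] at hp hle
    haveI := hp.1.1.1
    let M : Submonoid B := p.primeCompl ⊔ Submonoid.powers b
    have h0 : Disjoint ((⊥ : Ideal B) : Set B) (M : Set B) := by
      rw [Set.disjoint_left]
      intro x hx hxM
      have hx0 : x = 0 := hx
      subst hx0
      obtain ⟨t, ht, y, ⟨n, rfl⟩, hty⟩ := Submonoid.mem_sup.mp hxM
      have h1 : IsNilpotent (b * t) := ⟨n + 1, by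
        rw [mul_pow, pow_succ, pow_succ]; linear_combination (b * t ^ n) * hty⟩
      exact ht (hle ((hI t).mpr h1.eq_zero))
    obtain ⟨q, hq, -, hqM⟩ := Ideal.exists_le_prime_disjoint (⊥ : Ideal B) M h0
    have hqp : q ≤ p := by
      intro x hx
      by_contra hxp
      exact Set.disjoint_left.mp hqM hx ((le_sup_left : p.primeCompl ≤ M) hxp)
    have hpq := hp.1.2 ⟨hq, bot_le⟩ hqp
    exact Set.disjoint_left.mp hqM (hpq hp.2) ((le_sup_right : Submonoid.powers b ≤ M) (Submonoid.mem_powers b))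
  rw [Set.not_subset] at hav
  obtain ⟨b', hb', hbs⟩ := hav
  have hbb : b * b' = 0 := (hI b').mp hb'
  refine ⟨b', hbb, fun x hx => ?_⟩
  have : x ∈ nilradical B := by
    rw [nilradical, ← Ideal.sInf_minimalPrimes]
    rw [Ideal.mem_sInf]
    intro p hp
    haveI := hp.1.1
    have h1 : (b + b') * x ∈ p := by rw [hx]; exact p.zero_mem
    refine (this.mem_or_mem h1).resolve_left fun h2 => ?_
    by_cases hbp : b ∈ p
    · have : b' ∈ p := (p.add_mem_iff_right hbp).mp h2
      apply hbs
      simp only [Set.mem_iUnion]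
      exact ⟨p, by simp [s, hbp]; exact hp, this⟩
    · have h3 : b * b' ∈ p := by rw [hbb]; exact p.zero_mem
      have := (this.mem_or_mem h3).resolve_left hbp
      exact hbp ((p.add_mem_iff_left this).mp h2)
  rw [nilradical_eq_zero] at this
  exact this

theorem PIC.of_nzd {B : Type*} [CommRing B] [IsNoetherianRing B] [IsReduced B]
    (h : ∀ a b : B, (∀ x, b * x = 0 → x = 0) → IntOver a b → b ∣ a) : PIC B := by
  intro a b hab
  obtain ⟨b', hbb, hd⟩ := exists_nzd_add b
  obtain ⟨e, he⟩ := h b (b + b') hd ⟨2, fun i => if i = 1 then 1 else 0, by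
    simp [Finset.sum_range_succ]; linear_combination -hbb⟩
  have he2 : b * e = b := by
    have : (b + b') * (b * e - b) = 0 := by linear_combination (-b) * he - hbb
    linear_combination hd _ this
  have hae : a * e = a := by
    obtain ⟨n, c, hn⟩ := id hab
    have h1 : IsNilpotent ((1 - e) * a) := by
      refine ⟨n + 1, ?_⟩
      rw [pow_succ, mul_pow, hn, Finset.mul_sum, Finset.sum_mul]
      refine Finset.sum_eq_zero fun i hi => ?_
      obtain ⟨j, hj⟩ := Nat.exists_eq_add_of_lt (Finset.mem_range.mp hi)
      rw [show n - i = j + 1 by omega, pow_succ]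
      linear_combination (-(1 - e) ^ n * c i * a ^ i * b ^ j * a) * he2
    linear_combination -h1.eq_zero
  obtain ⟨y, hy⟩ := h a (b + b') hd (hab.of_dvd ⟨e, he⟩)
  exact ⟨y, by linear_combination (-1) * hae + e * hy - y * he⟩

theorem hstep_L {R A L : Type u} [CommRing R] [IsNoetherianRing R] [IsLocalRing R] [CommRing A] [IsNoetherianRing A]
    [IsLocalRing A] [Algebra R A] [IsLocalHom (algebraMap R A)] [Module.Flat R A]
    [Field L] [Algebra R L]
    (hL : ∀ l : L, ∃ s : R, algebraMap R L s ≠ 0 ∧ IsIntegral R (s • l))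
    (hR : IsReduced (AdicCompletion (maximalIdeal R) R ⊗[R] L))
    (hk : ∀ (F : Type u) [Field F] [Algebra R F], (∀ x ∈ maximalIdeal R, algebraMap R F x = 0) →
      PIC (A ⊗[R] F))
    (h : A) (hh : ∀ (t : ResidueField R ⊗[R] A), 1 ⊗ₜ[R] h * t = 0 → t = 0)
    (a : A ⊗[R] L) (ha : IntOver a (h ⊗ₜ[R] 1)) : (h ⊗ₜ[R] 1) ∣ a := by
  classical
  by_cases hm : ∀ x ∈ maximalIdeal R, algebraMap R L x = 0
  · exact hk L hm _ _ ha
  push Not at hm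
  obtain ⟨r, hr, hr0⟩ := hm
  obtain ⟨n, c, e⟩ := ha
  obtain ⟨R1, s, hfin, hs, H⟩ := exists_scale hL ({a} ∪ (Finset.range n).image c)
  obtain ⟨a1, ha1⟩ := H a (by simp)
  have hc : ∀ i, ∃ c1, i < n → tmap A R1.val c1 = s • c i := by
    intro i
    by_cases hi : i < n
    · obtain ⟨c1, hc1⟩ := H (c i) (Finset.mem_union_right _ (Finset.mem_image_of_mem _ (Finset.mem_range.mpr hi)))
      exact ⟨c1, fun _ => hc1⟩
    · exact ⟨0, fun h => absurd h hi⟩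
  choose c1 hc1 using hc
  have hf1 : tmap A R1.val (h ⊗ₜ 1) = h ⊗ₜ 1 := by simp
  have h1 : IntOver a1 (h ⊗ₜ 1) := by
    refine ⟨n, fun i => algebraMap R _ (s ^ (n - i - 1)) * c1 i, tmap_injective R1.val Subtype.val_injective ?_⟩
    rw [map_pow, ha1, map_sum, Algebra.smul_def, mul_pow, e, Finset.mul_sum]
    refine Finset.sum_congr rfl fun i hi => ?_
    have hi' := Finset.mem_range.mp hi
    have : n = (n - i - 1) + 1 + i := by omega
    simp only [map_mul, map_pow, hf1, hc1 i hi', ha1, AlgHom.commutes, Algebra.smul_def, mul_pow]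
    generalize hσ : algebraMap R (A ⊗[R] L) s = σ
    have h5 : σ ^ n = σ ^ (n - i - 1) * σ * σ ^ i := by
      rw [← pow_succ, ← pow_add, ← this]
    rw [h5]; ring
  have h2 : (h ⊗ₜ 1) ∣ a1 := by
    refine hstep hk h hh ?_ a1 h1
    refine chev_local (T := AdicCompletion (maximalIdeal R) R ⊗[R] L) (tmap _ R1.val).toRingHom
      (tmap_injective _ Subtype.val_injective) ⟨r, hr, ?_⟩
    have h1 := ((IsUnit.mk0 _ hr0).map (Algebra.TensorProduct.includeRight : L →ₐ[R] AdicCompletion (maximalIdeal R) R ⊗[R] L))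
    rw [AlgHom.commutes] at h1
    convert h1
    exact AlgHom.commutes (tmap _ R1.val) r
  have h3 := map_dvd (tmap A R1.val) h2
  rw [hf1, ha1, Algebra.smul_def] at h3
  have h1 := ((IsUnit.mk0 _ hs).map (Algebra.TensorProduct.includeRight : L →ₐ[R] A ⊗[R] L))
  rw [AlgHom.commutes] at h1
  exact (h1.dvd_mul_left).mp h3

theorem closed_fiber {R A : Type u} [CommRing R] [IsNoetherianRing R] [IsLocalRing R] [CommRing A]
    [IsLocalRing A] [Algebra R A] [IsLocalHom (algebraMap R A)]
    (hk : PIC (A ⊗[R] ResidueField R)) :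
    ((maximalIdeal R).map (algebraMap R A)).IsPrime ∧ ∀ h ∉ (maximalIdeal R).map (algebraMap R A),
      ∀ (t : ResidueField R ⊗[R] A), 1 ⊗ₜ[R] h * t = 0 → t = 0 := by
  let P := (maximalIdeal R).map (algebraMap R A)
  have hPm : P ≤ maximalIdeal A := Ideal.map_le_iff_le_comap.mpr fun x hx => map_nonunit (algebraMap R A) x hx
  let ψ : ResidueField R →ₐ[R] A ⧸ P := Ideal.Quotient.liftₐ (maximalIdeal R) (Algebra.ofId R (A ⧸ P)) (by
    intro x hx
    exact Ideal.Quotient.eq_zero_iff_mem.mpr (Ideal.mem_map_of_mem _ hx))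
  let θ : A ⊗[R] ResidueField R →ₐ[R] A ⧸ P := Algebra.TensorProduct.lift (Ideal.Quotient.mkₐ R P) ψ (fun _ _ => Commute.all _ _)
  have hθ : ∀ a : A, θ (a ⊗ₜ 1) = Ideal.Quotient.mk P a := by
    intro a
    simp [θ]
  have hker : ∀ a : A, a ⊗ₜ[R] (1 : ResidueField R) = 0 ↔ a ∈ P := by
    intro a
    constructor
    · intro h
      rw [← Ideal.Quotient.eq_zero_iff_mem, ← hθ, h, map_zero]
    · intro h
      have : P ≤ RingHom.ker (Algebra.TensorProduct.includeLeft : A →ₐ[R] A ⊗[R] ResidueField R) := by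
        rw [Ideal.map_le_iff_le_comap]
        intro x hx
        change algebraMap R A x ⊗ₜ[R] (1 : ResidueField R) = 0
        rw [Algebra.algebraMap_eq_smul_one, TensorProduct.smul_tmul, ← Algebra.algebraMap_eq_smul_one]
        rw [show algebraMap R (ResidueField R) x = 0 from (residue_eq_zero_iff _).mpr hx, tmul_zero]
      exact this h
  haveI : Nontrivial (A ⊗[R] ResidueField R) := by
    refine nontrivial_of_ne ((1 : A) ⊗ₜ[R] (1 : ResidueField R)) 0 fun h => ?_
    exact (Ideal.ne_top_iff_one _).mp (maximalIdeal.isMaximal A).ne_top (hPm ((hker 1).mp h))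
  have hsurj : Function.Surjective (Algebra.TensorProduct.includeLeft : A →ₐ[R] A ⊗[R] ResidueField R) := by
    intro t
    induction t with
    | zero => exact ⟨0, map_zero _⟩
    | tmul a x =>
      obtain ⟨r, rfl⟩ := residue_surjective x
      refine ⟨r • a, ?_⟩
      change (r • a) ⊗ₜ[R] (1 : ResidueField R) = _
      rw [TensorProduct.smul_tmul, ← Algebra.algebraMap_eq_smul_one]; rfl
    | add x y hx hy =>
      obtain ⟨a, ha⟩ := hx
      obtain ⟨b, hb⟩ := hy
      exact ⟨a + b, by rw [map_add, ha, hb]⟩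
  haveI : IsLocalRing (A ⊗[R] ResidueField R) := IsLocalRing.of_surjective' (Algebra.TensorProduct.includeLeft : A →ₐ[R] A ⊗[R] ResidueField R).toRingHom hsurj
  haveI := hk.isDomain
  constructor
  · have : P = RingHom.ker (Algebra.TensorProduct.includeLeft : A →ₐ[R] A ⊗[R] ResidueField R) := by
      ext a; exact (hker a).symm
    change P.IsPrime
    rw [this]
    exact RingHom.ker_isPrime _
  · intro h hh t ht
    have h1 := congrArg (Algebra.TensorProduct.comm R _ _) ht
    rw [map_mul, map_zero, Algebra.TensorProduct.comm_tmul] at h1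
    rcases mul_eq_zero.mp h1 with h2 | h2
    · exact absurd ((hker h).mp h2) hh
    · exact (map_eq_zero_iff _ (AlgEquiv.injective _)).mp h2

theorem normal_of_generic {R A L : Type u} [CommRing R] [IsNoetherianRing R] [IsLocalRing R] [CommRing A] [IsNoetherianRing A]
    [IsLocalRing A] [Algebra R A] [IsLocalHom (algebraMap R A)] [Module.Flat R A]
    [Field L] [Algebra R L] [Algebra.EssFiniteType R L]
    (hL : ∀ l : L, ∃ s : R, algebraMap R L s ≠ 0 ∧ IsIntegral R (s • l))
    (hR : IsReduced (AdicCompletion (maximalIdeal R) R ⊗[R] L))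
    (hk : ∀ (F : Type u) [Field F] [Algebra R F], (∀ x ∈ maximalIdeal R, algebraMap R F x = 0) → PIC (A ⊗[R] F))
    [((maximalIdeal R).map (algebraMap R A)).IsPrime]
    (hP : PIC (Localization.AtPrime ((maximalIdeal R).map (algebraMap R A)) ⊗[R] L)) : PIC (A ⊗[R] L) := by
  set P := (maximalIdeal R).map (algebraMap R A) with hPdef
  obtain ⟨-, hh⟩ := closed_fiber (A := A) (hk (ResidueField R) fun x hx => (residue_eq_zero_iff _).mpr hx)
  haveI : IsReduced (A ⊗[R] L) := reduced_alg hL hR fun F _ _ hF => (hk F hF).isReduced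
  haveI : IsNoetherianRing (A ⊗[R] L) := Algebra.EssFiniteType.isNoetherianRing A (A ⊗[R] L)
  refine PIC.of_nzd fun a b hb hab => ?_
  have hP' : PIC (Localization.AtPrime P ⊗[A] (A ⊗[R] L)) :=
    PIC.of_equiv (Algebra.TensorProduct.cancelBaseChange R A A (Localization.AtPrime P) L).toRingEquiv hP
  letI : Algebra (A ⊗[R] L) (Localization.AtPrime P ⊗[A] (A ⊗[R] L)) := Algebra.TensorProduct.rightAlgebra
  haveI : IsLocalization (Algebra.algebraMapSubmonoid (A ⊗[R] L) P.primeCompl) (Localization.AtPrime P ⊗[A] (A ⊗[R] L)) := inferInstance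
  obtain ⟨r, hr⟩ := hP' _ _ (hab.map (algebraMap (A ⊗[R] L) (Localization.AtPrime P ⊗[A] (A ⊗[R] L))))
  obtain ⟨⟨r', t⟩, hrt⟩ := IsLocalization.surj (Algebra.algebraMapSubmonoid (A ⊗[R] L) P.primeCompl) r
  simp only at hrt
  have h1 : algebraMap (A ⊗[R] L) (Localization.AtPrime P ⊗[A] (A ⊗[R] L)) (t * a) = algebraMap _ _ (b * r') := by
    rw [map_mul, map_mul, ← hrt, hr]; ring
  obtain ⟨t', ht'⟩ := (IsLocalization.eq_iff_exists (Algebra.algebraMapSubmonoid (A ⊗[R] L) P.primeCompl) _).mp h1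
  obtain ⟨h, hhP, hheq⟩ := (t' * t).2
  have e1 : (h ⊗ₜ[R] (1 : L)) * a = b * (t' * r') := by
    have : (h ⊗ₜ[R] (1 : L)) = t' * t := hheq
    rw [this, mul_assoc, ht']; ring
  generalize (t' : A ⊗[R] L) * r' = w at e1
  have h2 : IntOver w (h ⊗ₜ[R] (1 : L)) := by
    obtain ⟨n, c, hn⟩ := hab.mul_both (h ⊗ₜ[R] (1 : L))
    refine ⟨n, c, ?_⟩
    have hbp : ∀ m x, b ^ m * x = 0 → x = 0 := by
      intro m
      induction m with
      | zero => simp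
      | succ m ih => intro x hx; exact ih _ (hb _ (by rw [← hx]; ring))
    rw [← sub_eq_zero]
    apply hbp n
    rw [e1] at hn
    rw [mul_sub, ← mul_pow, hn, sub_eq_zero, Finset.mul_sum]
    refine Finset.sum_congr rfl fun i hi => ?_
    have hi' := Finset.mem_range.mp hi
    have h3 : b ^ n = b ^ (n - i) * b ^ i := by rw [← pow_add]; congr 1; omega
    rw [h3, mul_pow, mul_pow]; ring
  obtain ⟨y, hy⟩ := hstep_L hL hR hk h (hh h hhP) w h2
  refine ⟨y, ?_⟩
  rw [← sub_eq_zero]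
  refine lemmaH h (hh h hhP) _ ?_
  rw [smul_eq_tmul_mul]
  rw [hy] at e1
  linear_combination e1

theorem exists_colon_of_zd {B : Type*} [CommRing B] [IsNoetherianRing B] (x : B) (q : Ideal B)
    (h : ∀ y ∈ q, ∃ w, ¬ x ∣ w ∧ x ∣ y * w) : ∃ w, ¬ x ∣ w ∧ ∀ y ∈ q, x ∣ y * w := by
  classical
  have hfin := associatedPrimes.finite B (B ⧸ Ideal.span {x})
  have h1 : (q : Set B) ⊆ ⋃ p ∈ (hfin.toFinset : Set (Ideal B)), (p : Set B) := by
    rw [Set.Finite.coe_toFinset, biUnion_associatedPrimes_eq_zero_divisors]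
    intro y hy
    obtain ⟨w, hw, hyw⟩ := h y hy
    refine ⟨Ideal.Quotient.mk _ w, ?_, ?_⟩
    · rwa [Ne, Ideal.Quotient.eq_zero_iff_mem, Ideal.mem_span_singleton]
    · change Ideal.Quotient.mk _ (y * w) = 0
      rwa [Ideal.Quotient.eq_zero_iff_mem, Ideal.mem_span_singleton]
  obtain ⟨p, hp, hle⟩ := (Ideal.subset_union_prime (s := hfin.toFinset) (f := id) ⊥ ⊥ (fun p hp _ _ => by
    rw [Set.Finite.mem_toFinset] at hp
    exact IsAssociatedPrime.isPrime hp)).mp h1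
  rw [Set.Finite.mem_toFinset, AssociatedPrimes.mem_iff, isAssociatedPrime_iff] at hp
  obtain ⟨hpp, w, hw⟩ := hp
  obtain ⟨w, rfl⟩ := Ideal.Quotient.mk_surjective w
  have hmem : ∀ y, y ∈ p ↔ x ∣ y * w := by
    intro y
    rw [hw, Submodule.mem_colon_singleton, Submodule.mem_bot]
    change Ideal.Quotient.mk _ (y * w) = 0 ↔ _
    rw [Ideal.Quotient.eq_zero_iff_mem, Ideal.mem_span_singleton]
  refine ⟨w, fun hxw => hpp.ne_top ((Ideal.eq_top_iff_one _).mpr ((hmem 1).mpr (by simpa using hxw))),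
    fun y hy => (hmem y).mp (hle hy)⟩

/-- dichotomy for noetherian normal local domains -/
theorem normal_dichotomy {B : Type*} [CommRing B] [IsNoetherianRing B] [IsLocalRing B] [IsDomain B]
    (hB : PIC B) (x : B) (hx : x ∈ maximalIdeal B) (hx0 : x ≠ 0) :
    (∃ y ∈ maximalIdeal B, ∀ w, x ∣ y * w → x ∣ w) ∨ ∃ t, maximalIdeal B = Ideal.span {t} := by
  by_contra hcon
  push Not at hcon
  obtain ⟨h1, h2⟩ := hcon
  obtain ⟨w, hw, hq⟩ := exists_colon_of_zd x (maximalIdeal B) fun y hy => by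
    obtain ⟨w, h3, h4⟩ := h1 y hy
    exact ⟨w, h4, h3⟩
  have hw0 : w ≠ 0 := by rintro rfl; exact hw (dvd_zero x)
  by_cases hc : ∃ t ∈ maximalIdeal B, ∃ c, c ∉ maximalIdeal B ∧ t * w = x * c
  · obtain ⟨t, ht, c, hc, e⟩ := hc
    apply h2 t
    refine le_antisymm (fun y hy => ?_) ((Ideal.span_singleton_le_iff_mem _).mpr ht)
    rw [Ideal.mem_span_singleton]
    obtain ⟨d, hd⟩ := hq y hy
    have hcu : IsUnit c := by
      rw [mem_maximalIdeal, mem_nonunits_iff, not_not] at hc; exact hc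
    rw [← hcu.dvd_mul_right]
    refine ⟨d, mul_left_cancel₀ hw0 ?_⟩
    linear_combination c * hd - d * e
  · push Not at hc
    let K := FractionRing B
    let q : Submodule B K := Submodule.map (Algebra.linearMap B K) (maximalIdeal B)
    have hinj : Function.Injective (algebraMap B K) := IsFractionRing.injective B K
    have hxK : algebraMap B K x ≠ 0 := by
      rw [Ne, map_eq_zero_iff _ hinj]; exact hx0
    have hIntg : IsIntegral B (algebraMap B K w / algebraMap B K x) := by
      refine isIntegral_of_smul_mem_submodule q ?_ ?_ _ ?_
      · intro h
        have : algebraMap B K x ∈ q := ⟨x, hx, rfl⟩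
        rw [h, Submodule.mem_bot] at this
        exact hxK this
      · exact Submodule.FG.map _ ((isNoetherianRing_iff_ideal_fg B).mp inferInstance _)
      · rintro _ ⟨y, hy, rfl⟩
        obtain ⟨c, hc'⟩ := hq y hy
        have hcm : c ∈ maximalIdeal B := by
          by_contra hcm
          exact hc y hy c hcm hc'
        refine ⟨c, hcm, ?_⟩
        have e := congrArg (algebraMap B K) hc'
        rw [map_mul, map_mul] at e
        change algebraMap B K c = _ / _ * algebraMap B K y
        rw [div_mul_eq_mul_div, eq_div_iff hxK]
        linear_combination -e
    haveI := hB.isIntegrallyClosed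
    obtain ⟨v, hv⟩ := IsIntegrallyClosed.isIntegral_iff.mp hIntg
    apply hw
    refine ⟨v, hinj ?_⟩
    rw [map_mul, hv, mul_div_cancel₀ _ hxK]

theorem flat_regular_pair {B O : Type*} [CommRing B] [CommRing O] [Algebra B O] [Module.Flat B O]
    (x y : B) (h : ∀ w, x ∣ y * w → x ∣ w) (u v : O)
    (huv : algebraMap B O x * v = algebraMap B O y * u) : algebraMap B O x ∣ u := by
  have h0 : ∑ i : Fin 2, ((![y, -x] : Fin 2 → B) i) • ((![u, v] : Fin 2 → O) i) = 0 := by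
    simp [Fin.sum_univ_two, Algebra.smul_def, huv]
  obtain ⟨k, a, z, hz, ha⟩ := Module.Flat.isTrivialRelation_of_sum_smul_eq_zero (R := B) (M := O) (f := ![y, -x]) (x := ![u, v]) h0
  have h1 := hz 0
  simp only [Matrix.cons_val_zero] at h1
  rw [h1]
  refine Finset.dvd_sum fun j _ => ?_
  have h2 := ha j
  simp only [Fin.sum_univ_two, Matrix.cons_val_zero, Matrix.cons_val_one] at h2
  obtain ⟨c, hc⟩ := h (a 0 j) ⟨a 1 j, by linear_combination h2⟩
  rw [Algebra.smul_def, hc, map_mul]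
  exact ⟨algebraMap B O c * z j, by ring⟩

theorem ascent_local {B O X : Type*} [CommRing B] [IsNoetherianRing B] [IsLocalRing B] [CommRing O] [IsLocalRing O]
    [Algebra B O] [Module.Flat B O] [IsLocalHom (algebraMap B O)] [IsReduced O] (hB : PIC B)
    (a b : O) (hb : ∀ x, b * x = 0 → x = 0) (hQ : ∀ x, x ∈ maximalIdeal O ↔ b ∣ x * a) (hab : IntOver a b)
    [CommRing X] (hX : PIC X) (f : O →+* X) (hf : ∀ x ∈ maximalIdeal B, f (algebraMap B O x) = 0)
    (hr : ∀ x y : O, f x ∣ f y → ∃ z, y - x * z ∈ (maximalIdeal B).map (algebraMap B O)) : False := by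
  haveI := hB.isDomain
  haveI := hX.isReduced
  have hnd : ¬ b ∣ a := fun h => by
    have h1 := (hQ 1).mpr (by simpa using h)
    exact (Ideal.ne_top_iff_one _).mp (maximalIdeal.isMaximal O).ne_top h1
  have hloc : ∀ x ∈ maximalIdeal B, algebraMap B O x ∈ maximalIdeal O := fun x hx =>
    map_nonunit (algebraMap B O) x hx
  have hreg : ∀ x : B, x ≠ 0 → ∀ z : O, algebraMap B O x * z = 0 → z = 0 := by
    intro x hx z hz
    have h1 : IsSMulRegular B x := fun u v huv => mul_left_cancel₀ hx huv
    have h2 : IsSMulRegular O (algebraMap B O x) := h1.of_flat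
    exact h2 (by simpa using hz)
  by_cases hq : maximalIdeal B = ⊥
  · obtain ⟨z, hz⟩ := hr b a (hX _ _ (hab.map f))
    rw [hq, Ideal.map_bot, Ideal.mem_bot] at hz
    exact hnd ⟨z, by linear_combination hz⟩
  obtain ⟨x, hx, hx0⟩ := Submodule.exists_mem_ne_zero_of_ne_bot hq
  rcases normal_dichotomy hB x hx hx0 with ⟨y, hy, hxy⟩ | ⟨t, ht⟩
  · obtain ⟨u, hu⟩ := (hQ _).mp (hloc x hx)
    obtain ⟨v, hv⟩ := (hQ _).mp (hloc y hy)
    have e1 : algebraMap B O x * v = algebraMap B O y * u := by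
      rw [← sub_eq_zero]
      apply hb
      linear_combination algebraMap B O y * hu - algebraMap B O x * hv
    obtain ⟨w, hw⟩ := flat_regular_pair x y hxy u v e1
    apply hnd
    refine ⟨w, ?_⟩
    rw [← sub_eq_zero]
    apply hreg x hx0
    rw [hw] at hu
    linear_combination hu
  · have htm : t ∈ maximalIdeal B := by rw [ht]; exact Ideal.mem_span_singleton_self t
    have ht0 : t ≠ 0 := by rintro rfl; exact hq (by rw [ht]; simp)
    obtain ⟨c, hc⟩ := (hQ _).mp (hloc t htm)
    have hct : ¬ algebraMap B O t ∣ c := by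
      rintro ⟨c1, rfl⟩
      refine hnd ⟨c1, ?_⟩
      rw [← sub_eq_zero]
      apply hreg t ht0
      linear_combination hc
    by_cases hcm : c ∈ maximalIdeal O
    · obtain ⟨v, hv⟩ := (hQ _).mp hcm
      have e1 : c * c = algebraMap B O t * v := by
        rw [← sub_eq_zero]
        apply hb
        linear_combination algebraMap B O t * hv - c * hc
      have e2 : f c = 0 := by
        have : IsNilpotent (f c) := ⟨2, by rw [pow_two, ← map_mul, e1, map_mul, hf t htm, zero_mul]⟩
        exact this.eq_zero
      obtain ⟨z, hz⟩ := hr 0 c (by rw [e2, map_zero])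
      rw [zero_mul, sub_zero, ht, Ideal.map_span, Set.image_singleton, Ideal.mem_span_singleton] at hz
      exact hct hz
    · rw [mem_maximalIdeal, mem_nonunits_iff, not_not] at hcm
      obtain ⟨c', hc'⟩ := hcm.exists_right_inv
      have hb' : b = algebraMap B O t * (a * c') := by linear_combination -c' * hc - b * hc'
      obtain ⟨n, d, hn⟩ := hab
      have h1 : algebraMap B O t * (∑ i ∈ Finset.range n, d i * (algebraMap B O t) ^ (n - i - 1) * c' ^ (n - i)) * a ^ n = a ^ n := by
        conv_rhs => rw [hn]
        rw [Finset.mul_sum, Finset.sum_mul]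
        refine Finset.sum_congr rfl fun i hi => ?_
        have hi' := Finset.mem_range.mp hi
        obtain ⟨j, hj⟩ : ∃ j, n = i + (j + 1) := ⟨n - i - 1, by omega⟩
        rw [show n - i = j + 1 by omega, show j + 1 - 1 = j by omega, hj, hb']
        ring
      generalize hs : ∑ i ∈ Finset.range n, d i * (algebraMap B O t) ^ (n - i - 1) * c' ^ (n - i) = s at h1
      have h2 : IsUnit (1 - algebraMap B O t * s) := by
        have : algebraMap B O t * s ∈ maximalIdeal O := Ideal.mul_mem_right _ _ (hloc t htm)
        by_contra hcon
        have h3 : 1 - algebraMap B O t * s ∈ maximalIdeal O := hcon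
        have := Ideal.add_mem _ h3 this
        rw [sub_add_cancel] at this
        exact (Ideal.ne_top_iff_one _).mp (maximalIdeal.isMaximal O).ne_top this
      have h3 : a ^ n = 0 := by
        apply h2.mul_left_cancel
        linear_combination -h1
      have : IsNilpotent a := ⟨n, h3⟩
      exact hnd (by rw [this.eq_zero]; exact dvd_zero b)

theorem reduced_flat {B B' : Type u} [CommRing B] [IsNoetherianRing B] [IsReduced B] [CommRing B']
    [Algebra B B'] [Module.Flat B B']
    (hfib : ∀ (F : Type u) [Field F] [Algebra B F], IsReduced (B' ⊗[B] F)) : IsReduced B' := by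
  classical
  have hfin : (minimalPrimes B).Finite := minimalPrimes.finite_of_isNoetherianRing B
  haveI : Finite (minimalPrimes B) := hfin
  haveI : Fintype (minimalPrimes B) := Fintype.ofFinite _
  haveI hpr : ∀ p : minimalPrimes B, p.1.IsPrime := fun p => p.2.1.1
  let g : B →ₗ[B] (∀ p : minimalPrimes B, p.1.ResidueField) := LinearMap.pi fun p => Algebra.linearMap B _
  have hg : Function.Injective g := by
    rw [← LinearMap.ker_eq_bot, LinearMap.ker_eq_bot']
    intro x hx
    have : x ∈ nilradical B := by
      rw [nilradical, ← Ideal.sInf_minimalPrimes, Ideal.mem_sInf]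
      intro p hp
      haveI := hp.1.1
      exact (Ideal.algebraMap_residueField_eq_zero).mp (congrFun hx ⟨p, hp⟩)
    rw [nilradical_eq_zero] at this
    exact this
  have hg' := Module.Flat.lTensor_preserves_injective_linearMap (M := B') g hg
  refine ⟨fun x hx => ?_⟩
  have h1 : g.lTensor B' (x ⊗ₜ[B] 1) = 0 := by
    have e := (TensorProduct.piRight B B B' (fun p : minimalPrimes B => p.1.ResidueField)).injective
    apply e
    rw [map_zero]
    ext p
    rw [LinearMap.lTensor_tmul, TensorProduct.piRight_apply, TensorProduct.piRightHom_tmul]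
    have h2 : IsNilpotent (x ⊗ₜ[B] (1 : p.1.ResidueField)) := by
      obtain ⟨n, hn⟩ := hx
      exact ⟨n, by rw [Algebra.TensorProduct.tmul_pow, hn, zero_tmul]⟩
    haveI := hfib p.1.ResidueField
    have := h2.eq_zero
    change x ⊗ₜ (algebraMap B p.1.ResidueField 1) = _
    rw [map_one]
    exact this
  have h2 := hg' (h1.trans (map_zero _).symm)
  have h3 := congrArg (TensorProduct.rid B B') h2
  rwa [TensorProduct.rid_tmul, one_smul, map_zero] at h3

theorem exists_prime_colon {B : Type*} [CommRing B] [IsNoetherianRing B] (a b : B) (h : ¬ b ∣ a) :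
    ∃ (Q : Ideal B) (r : B), Q.IsPrime ∧ ∀ x, x ∈ Q ↔ b ∣ x * (r * a) := by
  let m : B ⧸ Ideal.span {b} := Ideal.Quotient.mk _ a
  let M : Submodule B (B ⧸ Ideal.span {b}) := Submodule.span B {m}
  have hm : (⟨m, Submodule.mem_span_singleton_self m⟩ : M) ≠ 0 := by
    intro h0
    have : m = 0 := congrArg Subtype.val h0
    rw [Ideal.Quotient.eq_zero_iff_mem, Ideal.mem_span_singleton] at this
    exact h this
  obtain ⟨Q, hQ, -⟩ := exists_le_isAssociatedPrime_of_isNoetherianRing B _ hm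
  rw [isAssociatedPrime_iff] at hQ
  obtain ⟨hp, ⟨w, hw⟩, hQ⟩ := hQ
  obtain ⟨r, rfl⟩ := Submodule.mem_span_singleton.mp hw
  refine ⟨Q, r, hp, fun x => ?_⟩
  rw [hQ, Submodule.mem_colon_singleton, Submodule.mem_bot, ← Ideal.mem_span_singleton, ← Ideal.Quotient.eq_zero_iff_mem]
  rw [Subtype.ext_iff]
  rfl

theorem ascent_at {B B' : Type u} [CommRing B] [IsNoetherianRing B] [CommRing B']
    [Algebra B B'] [Module.Flat B B'] [IsReduced B'] (hB : PIC B)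
    (Q : Ideal B') [Q.IsPrime] (a b : B') (hQ : ∀ x, x ∈ Q ↔ b ∣ x * a) (hb : ∀ x, b * x = 0 → x = 0) (hab : IntOver a b)
    (hfib : PIC (B' ⊗[B] (Q.comap (algebraMap B B')).ResidueField)) : False := by
  let q := Q.comap (algebraMap B B')
  let Bq := Localization.AtPrime q
  let O := Localization.AtPrime Q
  let g : Bq →+* O := Localization.localRingHom q Q (algebraMap B B') rfl
  letI : Algebra Bq O := g.toAlgebra
  haveI hflat : Module.Flat Bq O :=
    RingHom.Flat.localRingHom (f := algebraMap B B') ((RingHom.flat_algebraMap_iff).mpr inferInstance) Q q rfl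
  haveI : IsLocalHom (algebraMap Bq O) := Localization.isLocalHom_localRingHom q Q (algebraMap B B') rfl
  haveI : IsScalarTower B Bq O := IsScalarTower.of_algebraMap_eq fun x => by
    rw [IsScalarTower.algebraMap_apply B B' O]
    exact (Localization.localRingHom_to_map q Q (algebraMap B B') rfl x).symm
  haveI : IsReduced O := isReduced_localizationPreserves Q.primeCompl O inferInstance
  let κ := q.ResidueField
  have hX : PIC (O ⊗[B] κ) := by
    letI : Algebra (B' ⊗[B] κ) (O ⊗[B'] (B' ⊗[B] κ)) := Algebra.TensorProduct.rightAlgebra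
    haveI : IsLocalization (Algebra.algebraMapSubmonoid (B' ⊗[B] κ) Q.primeCompl) (O ⊗[B'] (B' ⊗[B] κ)) := inferInstance
    have h1 : PIC (O ⊗[B'] (B' ⊗[B] κ)) := hfib.localization (Algebra.algebraMapSubmonoid (B' ⊗[B] κ) Q.primeCompl) _
    exact PIC.of_equiv (Algebra.TensorProduct.cancelBaseChange B B' B' O κ).symm.toRingEquiv h1
  let f : O →+* O ⊗[B] κ := (Algebra.TensorProduct.includeLeft : O →ₐ[B] O ⊗[B] κ).toRingHom
  have hf0 : (maximalIdeal Bq).map (algebraMap Bq O) ≤ RingHom.ker f := by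
    rw [← Localization.AtPrime.map_eq_maximalIdeal, Ideal.map_map, ← IsScalarTower.algebraMap_eq, Ideal.map_le_iff_le_comap]
    intro x hx
    change algebraMap B O x ⊗ₜ[B] (1 : κ) = 0
    rw [Algebra.algebraMap_eq_smul_one, TensorProduct.smul_tmul, ← Algebra.algebraMap_eq_smul_one,
      Ideal.algebraMap_residueField_eq_zero.mpr hx, tmul_zero]
  let I := (maximalIdeal Bq).map (algebraMap Bq O)
  let ψ : κ →ₐ[B] O ⧸ I :=
    { Ideal.Quotient.lift (maximalIdeal Bq) ((Ideal.Quotient.mk I).comp (algebraMap Bq O)) (fun x hx =>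
        Ideal.Quotient.eq_zero_iff_mem.mpr (Ideal.mem_map_of_mem _ hx)) with
      commutes' := fun x => by
        change Ideal.Quotient.mk I (algebraMap Bq O (algebraMap B Bq x)) = _
        rw [← IsScalarTower.algebraMap_apply]; rfl }
  let θ : O ⊗[B] κ →ₐ[B] O ⧸ I := Algebra.TensorProduct.lift (Ideal.Quotient.mkₐ B I) ψ (fun _ _ => Commute.all _ _)
  have hθ : ∀ x, θ (f x) = Ideal.Quotient.mk I x := by
    intro x
    change θ (x ⊗ₜ 1) = _
    rw [Algebra.TensorProduct.lift_tmul, map_one, mul_one]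
    rfl
  refine ascent_local (B := Bq) (O := O) (X := O ⊗[B] κ) (hB.localization q.primeCompl Bq) (algebraMap B' O a) (algebraMap B' O b)
    ?_ ?_ (hab.map _) hX f (fun x hx => hf0 (Ideal.mem_map_of_mem _ hx)) ?_
  · intro x hx
    obtain ⟨y, s, rfl⟩ := IsLocalization.exists_mk'_eq Q.primeCompl x
    rw [← IsLocalization.mk'_one (M := Q.primeCompl) O b, ← IsLocalization.mk'_mul, IsLocalization.mk'_eq_zero_iff] at hx
    obtain ⟨m, hm⟩ := hx
    rw [IsLocalization.mk'_eq_zero_iff]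
    exact ⟨m, hb _ (by linear_combination hm)⟩
  · intro x
    obtain ⟨y, s, rfl⟩ := IsLocalization.exists_mk'_eq Q.primeCompl x
    rw [IsLocalization.AtPrime.mk'_mem_maximal_iff O Q y s, hQ]
    constructor
    · intro h
      have h1 := map_dvd (algebraMap B' O) h
      have hs : IsUnit (algebraMap B' O s) := IsLocalization.map_units O s
      rw [← hs.dvd_mul_left]
      rwa [← mul_assoc, mul_comm (algebraMap B' O s), IsLocalization.mk'_spec, ← map_mul]
    · rintro ⟨c, hc⟩
      obtain ⟨c, t, rfl⟩ := IsLocalization.exists_mk'_eq Q.primeCompl c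
      rw [← IsLocalization.mk'_one (M := Q.primeCompl) O b, ← IsLocalization.mk'_one (M := Q.primeCompl) O a,
        ← IsLocalization.mk'_mul, ← IsLocalization.mk'_mul, IsLocalization.mk'_eq_iff_eq, IsLocalization.eq_iff_exists Q.primeCompl] at hc
      obtain ⟨m, hm⟩ := hc
      have h2 : ((m * t : Q.primeCompl) : B') * y ∈ Q := by
        rw [hQ]
        refine ⟨m * s * c, ?_⟩
        simp only [Submonoid.coe_mul, one_mul, mul_one, Submonoid.coe_one] at hm ⊢
        linear_combination hm
      rw [← hQ]
      exact (Ideal.IsPrime.mem_or_mem inferInstance h2).resolve_left (m * t).2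
  · rintro x y ⟨z, hz⟩
    obtain ⟨z', hz'⟩ := Ideal.Quotient.mk_surjective (θ z)
    refine ⟨z', ?_⟩
    rw [← Ideal.Quotient.eq_zero_iff_mem, map_sub, map_mul, hz', ← hθ, ← hθ, hz, map_mul, sub_self]

theorem ascent {B B' : Type u} [CommRing B] [IsNoetherianRing B] [CommRing B'] [IsNoetherianRing B']
    [Algebra B B'] [Module.Flat B B'] (hB : PIC B)
    (hfib : ∀ (F : Type u) [Field F] [Algebra B F], PIC (B' ⊗[B] F)) : PIC B' := by
  haveI := hB.isReduced
  haveI : IsReduced B' := reduced_flat (B := B) fun F _ _ => (hfib F).isReduced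
  refine PIC.of_nzd fun a b hb hab => ?_
  by_contra h
  obtain ⟨Q, r, hQ, hr⟩ := exists_prime_colon a b h
  exact ascent_at hB Q (r * a) b hr hb (hab.mul_left r) (hfib _)

theorem lTensor_injective_of_flat_baseChange {S Q A X Y : Type*} [CommRing S] [CommRing Q] [Algebra S Q] [CommRing A] [Algebra S A]
    [AddCommGroup X] [Module Q X] [Module S X] [IsScalarTower S Q X]
    [AddCommGroup Y] [Module Q Y] [Module S Y] [IsScalarTower S Q Y]
    [Module.Flat Q (Q ⊗[S] A)] (f : X →ₗ[Q] Y) (hf : Function.Injective f) :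
    Function.Injective ((f.restrictScalars S).lTensor A) := by
  have h1 : Function.Injective (f.rTensor (Q ⊗[S] A)) :=
    Module.Flat.rTensor_preserves_injective_linearMap _ hf
  let e := TensorProduct.AlgebraTensorModule.cancelBaseChange S Q Q X A
  let e' := TensorProduct.AlgebraTensorModule.cancelBaseChange S Q Q Y A
  have h2 : ∀ t, (f.restrictScalars S).rTensor A (e t) = e' (f.rTensor (Q ⊗[S] A) t) := by
    intro t
    induction t with
    | zero => simp
    | add x y hx hy => simp only [map_add, hx, hy]
    | tmul w y =>
      induction y with
      | zero => simp
      | add x y hx hy => simp only [map_add, TensorProduct.tmul_add, hx, hy]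
      | tmul c n => simp [e, e']
  have h3 : Function.Injective ((f.restrictScalars S).rTensor A) := by
    intro x y hxy
    obtain ⟨x, rfl⟩ := e.surjective x
    obtain ⟨y, rfl⟩ := e.surjective y
    rw [h2, h2] at hxy
    rw [h1 (e'.injective hxy)]
  exact (LinearMap.lTensor_inj_iff_rTensor_inj A _).mpr h3

theorem flat_of_quot {S A : Type*} [CommRing S] [IsNoetherianRing S] [IsLocalRing S] [CommRing A] [IsNoetherianRing A] [IsLocalRing A]
    [Algebra S A] [IsLocalHom (algebraMap S A)]
    (h : ∀ j : ℕ, Module.Flat (S ⧸ (maximalIdeal S) ^ j) ((S ⧸ (maximalIdeal S) ^ j) ⊗[S] A)) : Module.Flat S A := by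
  rw [Module.Flat.iff_lTensor_injective']
  intro I
  rw [← LinearMap.ker_eq_bot, LinearMap.ker_eq_bot']
  intro t ht
  haveI : Module.Finite S I := Module.Finite.iff_fg.mpr ((isNoetherianRing_iff_ideal_fg S).mp inferInstance _)
  refine krull_tensor (A := A) t fun n => ?_
  obtain ⟨k, hk⟩ := Ideal.exists_pow_inf_eq_pow_smul (maximalIdeal S) (I : Submodule S S)
  have hk' := hk (n + k) (by omega)
  rw [Nat.add_sub_cancel] at hk'
  set Q := S ⧸ (maximalIdeal S) ^ (n + k) with hQ
  let J : Ideal Q := I.map (Ideal.Quotient.mk _)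
  let g : I →ₗ[S] J := LinearMap.codRestrict (J.restrictScalars S)
    ((Algebra.linearMap S Q).comp I.subtype) (fun x => Ideal.mem_map_of_mem (Ideal.Quotient.mk _) x.2)
  have hg : Function.Surjective g := by
    rintro ⟨y, hy⟩
    obtain ⟨x, hx, rfl⟩ := (Ideal.mem_map_iff_of_surjective _ Ideal.Quotient.mk_surjective).mp hy
    exact ⟨⟨x, hx⟩, rfl⟩
  haveI := h (n + k)
  have h1 := lTensor_injective_of_flat_baseChange (S := S) (Q := Q) (A := A) (J.subtype) Subtype.val_injective
  have h2 : g.lTensor A t = 0 := by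
    apply h1
    rw [map_zero]
    have e : (J.subtype.restrictScalars S).comp g = (Algebra.linearMap S Q).comp I.subtype := rfl
    rw [← LinearMap.comp_apply, ← LinearMap.lTensor_comp, e, LinearMap.lTensor_comp, LinearMap.comp_apply, ht, map_zero]
  have h3 := (lTensor_exact A (LinearMap.exact_subtype_ker_map g) hg) t
  obtain ⟨s, hs⟩ := h3.mp h2
  have hle : LinearMap.ker g ≤ ((maximalIdeal S) ^ n • ⊤ : Submodule S I) := by
    intro x hx
    have hx1 : (x : S) ∈ (maximalIdeal S) ^ (n + k) := by
      have := congrArg Subtype.val (LinearMap.mem_ker.mp hx)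
      exact Ideal.Quotient.eq_zero_iff_mem.mp this
    have hx2 : (x : S) ∈ (maximalIdeal S) ^ n • (I : Submodule S S) := by
      have h5 : (x : S) ∈ (maximalIdeal S) ^ (n + k) • (⊤ : Submodule S S) ⊓ I := ⟨by simpa using hx1, x.2⟩
      rw [hk'] at h5
      exact Submodule.smul_mono (le_refl _) inf_le_right h5
    have h6 : (maximalIdeal S) ^ n • (I : Submodule S S) = ((maximalIdeal S) ^ n • ⊤ : Submodule S I).map I.subtype := by
      rw [Submodule.map_smul'', Submodule.map_top, Submodule.range_subtype]
    rw [h6] at hx2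
    obtain ⟨y, hy, hyx⟩ := hx2
    have : y = x := Subtype.ext hyx
    rwa [← this]
  refine ⟨(Submodule.inclusion hle).lTensor A s, ?_⟩
  rw [← LinearMap.comp_apply, ← LinearMap.lTensor_comp]
  exact hs

theorem exists_completion_lift {R A : Type*} [CommRing R] [CommRing A] [Algebra R A] (I : Ideal R) (J : Ideal A)
    (hIJ : I.map (algebraMap R A) ≤ J) [IsAdicComplete J A] :
    ∃ g : AdicCompletion I R →+* A, ∀ x, g (algebraMap R _ x) = algebraMap R A x := by
  have hle : ∀ n : ℕ, I ^ n ≤ (J ^ n).comap (algebraMap R A) := by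
    intro n
    rw [← Ideal.map_le_iff_le_comap, Ideal.map_pow]
    exact Ideal.pow_right_mono hIJ n
  let f : (n : ℕ) → AdicCompletion I R →+* A ⧸ J ^ n := fun n =>
    (Ideal.quotientMap (J ^ n) (algebraMap R A) (hle n)).comp (AdicCompletion.evalₐ I n : _ →+* _)
  have hf : ∀ {m n : ℕ} (h : m ≤ n), (Ideal.Quotient.factorPow J h).comp (f n) = f m := by
    intro m n h
    ext x
    have h1 : AdicCompletion.evalₐ I m x = Ideal.Quotient.factorPow I h (AdicCompletion.evalₐ I n x) := by
      induction x using AdicCompletion.induction_on with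
      | h x =>
        rw [AdicCompletion.evalₐ_mk, AdicCompletion.evalₐ_mk, Ideal.Quotient.factor_mk, Ideal.Quotient.eq]
        have := x.property h
        rw [SModEq.sub_mem] at this
        simpa using this
    obtain ⟨y, hy⟩ := Ideal.Quotient.mk_surjective (AdicCompletion.evalₐ I n x)
    simp only [f, RingHom.comp_apply, RingHom.coe_coe, h1, ← hy]
    rfl
  refine ⟨IsAdicComplete.liftRingHom J f hf, fun x => ?_⟩
  have h1 : ∀ n : ℕ, Ideal.Quotient.mk (J ^ n) (IsAdicComplete.liftRingHom J f hf (algebraMap R _ x)) = Ideal.Quotient.mk (J ^ n) (algebraMap R A x) := by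
    intro n
    rw [IsAdicComplete.mk_liftRingHom]
    simp [f]
  rw [← sub_eq_zero]
  refine IsHausdorff.haus (I := J) inferInstance _ fun n => ?_
  rw [SModEq.zero]
  have := Ideal.Quotient.eq.mp (h1 n)
  simpa using this

theorem surj_pow {R S : Type*} [CommRing R] [CommRing S] [Algebra R S] (I : Ideal R)
    (h : ∀ s : S, ∃ r : R, s - algebraMap R S r ∈ I.map (algebraMap R S)) (j : ℕ) :
    ∀ s : S, ∃ r : R, s - algebraMap R S r ∈ (I ^ j).map (algebraMap R S) := by
  induction j with
  | zero => intro s; exact ⟨0, by simp [Ideal.map_top]⟩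
  | succ j ih =>
    intro s
    obtain ⟨r, hr⟩ := ih s
    have key : ∀ t ∈ (I ^ j).map (algebraMap R S), ∃ r : R, t - algebraMap R S r ∈ (I ^ (j + 1)).map (algebraMap R S) := by
      intro t ht
      have hg : ∀ s : S, ∃ r : R, s * t - algebraMap R S r ∈ (I ^ (j + 1)).map (algebraMap R S) := by
        refine Submodule.span_induction (p := fun t _ => ∀ s : S, ∃ r : R, s * t - algebraMap R S r ∈ (I ^ (j + 1)).map (algebraMap R S)) ?_ ?_ ?_ ?_ ht
        · rintro _ ⟨x, hx, rfl⟩ s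
          obtain ⟨r', hr'⟩ := h s
          refine ⟨r' * x, ?_⟩
          rw [map_mul, ← sub_mul, pow_succ', Ideal.map_mul]
          exact Ideal.mul_mem_mul hr' (Ideal.mem_map_of_mem _ hx)
        · intro s; exact ⟨0, by simp⟩
        · intro x y _ _ hx hy s
          obtain ⟨r1, h1⟩ := hx s
          obtain ⟨r2, h2⟩ := hy s
          refine ⟨r1 + r2, ?_⟩
          have := Ideal.add_mem _ h1 h2
          rw [map_add]
          convert this using 1
          ring
        · intro a x _ hx s
          obtain ⟨r, hr⟩ := hx (s * a)
          exact ⟨r, by rw [smul_eq_mul, ← mul_assoc]; exact hr⟩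
      obtain ⟨r, hr⟩ := hg 1
      exact ⟨r, by rwa [one_mul] at hr⟩
    obtain ⟨r', hr'⟩ := key _ hr
    exact ⟨r + r', by rw [map_add, ← sub_sub]; exact hr'⟩

theorem quot_flat {R S A A' : Type*} [CommRing R] [CommRing S] [CommRing A] [CommRing A'] [Algebra R S] [Algebra R A]
    [Algebra R A'] [Algebra S A'] [Algebra A A'] [IsScalarTower R S A'] [IsScalarTower R A A'] [Module.Flat R A]
    (I : Ideal R) (hS : ∀ s : S, ∃ r : R, s - algebraMap R S r ∈ I.map (algebraMap R S))
    (hA : ∀ s : A', ∃ r : A, s - algebraMap A A' r ∈ I.map (algebraMap R A'))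
    (hI : ∀ a : A, algebraMap A A' a ∈ I.map (algebraMap R A') → a ∈ I.map (algebraMap R A))
    (J : Ideal S) (hJ : J = I.map (algebraMap R S)) :
    Module.Flat (S ⧸ J) ((S ⧸ J) ⊗[S] A') := by
  subst hJ
  set Q := S ⧸ I.map (algebraMap R S) with hQ
  let ψ : Q ⊗[R] A →ₐ[Q] Q ⊗[S] A' := Algebra.TensorProduct.lift (Algebra.ofId _ _)
    (((Algebra.TensorProduct.includeRight : A' →ₐ[S] Q ⊗[S] A').restrictScalars R).comp (IsScalarTower.toAlgHom R A A'))
    (fun _ _ => Commute.all _ _)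
  have hψ : ∀ a : A, ψ (1 ⊗ₜ a) = 1 ⊗ₜ algebraMap A A' a := by
    intro a; simp [ψ]
  have hz : ∀ x ∈ I.map (algebraMap R A), (1 : Q) ⊗ₜ[R] x = 0 := by
    intro x hx
    have : I.map (algebraMap R A) ≤ RingHom.ker (Algebra.TensorProduct.includeRight : A →ₐ[R] Q ⊗[R] A) := by
      rw [Ideal.map_le_iff_le_comap]
      intro y hy
      change (1 : Q) ⊗ₜ[R] algebraMap R A y = 0
      rw [Algebra.algebraMap_eq_smul_one, ← TensorProduct.smul_tmul, ← Algebra.algebraMap_eq_smul_one]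
      rw [show algebraMap R Q y = 0 from Ideal.Quotient.eq_zero_iff_mem.mpr (Ideal.mem_map_of_mem _ hy), zero_tmul]
    exact this hx
  have hz' : ∀ x : A', (1 : Q) ⊗ₜ[S] x = 0 ↔ x ∈ I.map (algebraMap R A') := by
    intro x
    have e1 : I.map (algebraMap R A') = (I.map (algebraMap R S)).map (algebraMap S A') := by
      rw [Ideal.map_map, ← IsScalarTower.algebraMap_eq]
    constructor
    · intro h
      let θ : Q ⊗[S] A' →ₐ[S] A' ⧸ I.map (algebraMap R A') := Algebra.TensorProduct.lift
        (Ideal.Quotient.liftₐ _ (Algebra.ofId S _) (fun y hy => Ideal.Quotient.eq_zero_iff_mem.mpr (by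
          rw [e1]; exact Ideal.mem_map_of_mem _ hy))) (Ideal.Quotient.mkₐ S _) (fun _ _ => Commute.all _ _)
      have := congrArg θ h
      rw [map_zero, Algebra.TensorProduct.lift_tmul, map_one, one_mul] at this
      exact Ideal.Quotient.eq_zero_iff_mem.mp this
    · intro hx
      have : I.map (algebraMap R A') ≤ RingHom.ker (Algebra.TensorProduct.includeRight : A' →ₐ[S] Q ⊗[S] A') := by
        rw [e1, Ideal.map_le_iff_le_comap]
        intro y hy
        change (1 : Q) ⊗ₜ[S] algebraMap S A' y = 0
        rw [Algebra.algebraMap_eq_smul_one, ← TensorProduct.smul_tmul, ← Algebra.algebraMap_eq_smul_one]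
        rw [show algebraMap S Q y = 0 from Ideal.Quotient.eq_zero_iff_mem.mpr hy, zero_tmul]
      exact this hx
  have hsurj1 : ∀ t : Q ⊗[R] A, ∃ a : A, t = 1 ⊗ₜ a := by
    intro t
    induction t with
    | zero => exact ⟨0, by simp⟩
    | add x y hx hy =>
      obtain ⟨a, rfl⟩ := hx
      obtain ⟨b, rfl⟩ := hy
      exact ⟨a + b, by rw [tmul_add]⟩
    | tmul s a =>
      obtain ⟨s, rfl⟩ := Ideal.Quotient.mk_surjective s
      obtain ⟨r, hr⟩ := hS s
      refine ⟨r • a, ?_⟩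
      rw [← TensorProduct.smul_tmul, ← Algebra.algebraMap_eq_smul_one]
      congr 1
      exact Ideal.Quotient.eq.mpr hr
  have hbij : Function.Bijective ψ := by
    constructor
    · rw [injective_iff_map_eq_zero]
      intro t ht
      obtain ⟨a, rfl⟩ := hsurj1 t
      rw [hψ, hz'] at ht
      exact hz a (hI a ht)
    · intro t
      induction t with
      | zero => exact ⟨0, by simp⟩
      | add x y hx hy =>
        obtain ⟨a, rfl⟩ := hx
        obtain ⟨b, rfl⟩ := hy
        exact ⟨a + b, by rw [map_add]⟩
      | tmul s a =>
        obtain ⟨r, hr⟩ := hA a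
        refine ⟨s ⊗ₜ r, ?_⟩
        have h1 := (hz' _).mpr hr
        rw [tmul_sub, sub_eq_zero] at h1
        have h2 : s ⊗ₜ[R] r = s • ((1 : Q) ⊗ₜ[R] r) := by rw [TensorProduct.smul_tmul', smul_eq_mul, mul_one]
        rw [h2, map_smul, hψ, ← h1, TensorProduct.smul_tmul', smul_eq_mul, mul_one]
  exact Module.Flat.of_linearEquiv (LinearEquiv.ofBijective ψ.toLinearMap hbij).symm

/-- complete integral closedness, in divisibility form -/
def CIC (U : Type*) [CommRing U] : Prop :=
  ∀ a b d : U, d ≠ 0 → (∀ n : ℕ, b ^ n ∣ d * a ^ n) → b ∣ a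

theorem mem_span_pow {U : Type*} [CommRing U] (π x : U) (n : ℕ) :
    x ≡ 0 [SMOD (Ideal.span {π} ^ n • ⊤ : Submodule U U)] ↔ π ^ n ∣ x := by
  rw [SModEq.zero, smul_eq_mul, Ideal.mul_top, Ideal.span_singleton_pow, Ideal.mem_span_singleton]

theorem CIC.pi_pow {U V : Type*} [CommRing U] [CommRing V] [IsDomain V] (f : U →+* V) (π : U)
    [IsHausdorff (Ideal.span {π}) U] (hker : ∀ x, f x = 0 ↔ π ∣ x) {x : U} (hx : x ≠ 0) :
    ∃ (k : ℕ) (y : U), x = π ^ k * y ∧ f y ≠ 0 := by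
  by_contra! hcon
  apply hx
  refine IsHausdorff.haus (I := Ideal.span {π}) inferInstance _ fun n => ?_
  rw [mem_span_pow]
  induction n with
  | zero => simp
  | succ n ih =>
    obtain ⟨y, hy⟩ := ih
    obtain ⟨z, hz⟩ := (hker y).mp (hcon n y hy)
    exact ⟨z, by rw [hy, hz, pow_succ, mul_assoc]⟩

theorem CIC.isDomain {U V : Type*} [CommRing U] [CommRing V] [IsDomain V] (f : U →+* V) (π : U)
    [IsHausdorff (Ideal.span {π}) U] (hπ : ∀ x, π * x = 0 → x = 0)
    (hker : ∀ x, f x = 0 ↔ π ∣ x) : IsDomain U := by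
  have hn : Nontrivial U := f.domain_nontrivial
  have hπn : ∀ n x, π ^ n * x = 0 → x = 0 := by
    intro n
    induction n with
    | zero => simp
    | succ n ih => intro x hx; rw [pow_succ', mul_assoc] at hx; exact ih x (hπ _ hx)
  have : NoZeroDivisors U := ⟨by
    intro a b hab
    by_contra! hcon
    obtain ⟨k, a', rfl, ha⟩ := CIC.pi_pow f π hker hcon.1
    obtain ⟨l, b', rfl, hb⟩ := CIC.pi_pow f π hker hcon.2
    have h1 : π ^ (k + l) * (a' * b') = 0 := by rw [← hab]; ring
    have h2 := hπn _ _ h1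
    have h3 := congrArg f h2
    rw [map_mul, map_zero] at h3
    exact mul_ne_zero ha hb h3⟩
  exact NoZeroDivisors.to_isDomain U

theorem CIC.dvd_cancel {U V : Type*} [CommRing U] [CommRing V] [IsDomain V] [IsDomain U] (f : U →+* V) (π : U)
    (h0 : π ≠ 0) (hker : ∀ x, f x = 0 ↔ π ∣ x) {b : U} (hb : f b ≠ 0) (k : ℕ) (x : U) (h : b ∣ π ^ k * x) : b ∣ x := by
  induction k with
  | zero => simpa using h
  | succ k ih =>
    apply ih
    obtain ⟨u, hu⟩ := h
    have h1 : f b * f u = 0 := by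
      rw [← map_mul, ← hu, hker]
      exact ⟨π ^ k * x, by ring⟩
    have h2 : π ∣ u := (hker u).mp ((mul_eq_zero.mp h1).resolve_left hb)
    obtain ⟨w, rfl⟩ := h2
    refine ⟨w, mul_left_cancel₀ h0 ?_⟩
    rw [← mul_assoc, ← pow_succ', hu]
    ring

theorem CIC.dvd_of_approx {U : Type*} [CommRing U] (π : U) [IsAdicComplete (Ideal.span {π}) U] (b : U) (H : Set U)
    (hH : ∀ a ∈ H, ∃ c, ∃ a' ∈ H, a = c * b + π * a') (a : U) (ha : a ∈ H) : b ∣ a := by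
  choose! c a' ha' hc using hH
  let s : ℕ → U := fun n => a'^[n] a
  have hs : ∀ n, s n ∈ H := by
    intro n
    induction n with
    | zero => exact ha
    | succ n ih => simp only [s, Function.iterate_succ_apply']; exact ha' _ ih
  let t : ℕ → U := fun n => ∑ i ∈ Finset.range n, c (s i) * π ^ i
  have ht : ∀ n, a = t n * b + π ^ n * s n := by
    intro n
    induction n with
    | zero => simp [t, s]
    | succ n ih =>
      have h1 : s (n + 1) = a' (s n) := Function.iterate_succ_apply' _ _ _
      have h2 := hc _ (hs n)
      have h3 : t (n + 1) = t n + c (s n) * π ^ n := Finset.sum_range_succ _ _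
      rw [h3, h1]
      calc a = t n * b + π ^ n * s n := ih
        _ = t n * b + π ^ n * (c (s n) * b + π * a' (s n)) := by rw [← h2]
        _ = _ := by ring
  obtain ⟨L, hL⟩ := IsPrecomplete.prec (I := Ideal.span {π}) (M := U) inferInstance (f := t) (by
    intro m n hmn
    rw [← sub_smodEq_zero, mem_span_pow, ← dvd_neg, neg_sub]
    have : t n - t m = ∑ i ∈ Finset.Ico m n, c (s i) * π ^ i := (Finset.sum_Ico_eq_sub _ hmn).symm
    rw [this]
    refine Finset.dvd_sum fun i hi => Dvd.dvd.mul_left (pow_dvd_pow _ (Finset.mem_Ico.mp hi).1) _)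
  refine ⟨L, ?_⟩
  rw [← sub_eq_zero]
  refine IsHausdorff.haus (I := Ideal.span {π}) inferInstance _ fun n => ?_
  rw [mem_span_pow]
  have h1 := hL n
  rw [← sub_smodEq_zero, mem_span_pow] at h1
  obtain ⟨w, hw⟩ := h1
  refine ⟨w * b + s n, ?_⟩
  have h2 : t n = L + π ^ n * w := by rw [← hw]; ring
  have h3 := ht n
  rw [h2] at h3
  rw [h3]
  ring

theorem CIC.of_complete {U V : Type*} [CommRing U] [CommRing V] [IsDomain V] [IsDomain U] (f : U →+* V) (π : U)
    [IsAdicComplete (Ideal.span {π}) U] (h0 : π ≠ 0) (hf : Function.Surjective f)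
    (hker : ∀ x, f x = 0 ↔ π ∣ x) (hV : CIC V) : CIC U := by
  have main : ∀ a b d : U, f d ≠ 0 → f b ≠ 0 → (∀ n : ℕ, b ^ n ∣ d * a ^ n) → b ∣ a := by
    intro a b d hd hb h
    refine CIC.dvd_of_approx π b {a | ∀ n : ℕ, b ^ n ∣ d * a ^ n} ?_ a h
    intro a ha
    have h1 : f b ∣ f a := hV _ _ (f d) hd fun n => by
      have := map_dvd f (ha n)
      simpa using this
    obtain ⟨c, hc⟩ := h1
    obtain ⟨c, rfl⟩ := hf c
    have h2 : π ∣ a - c * b := by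
      rw [← hker]
      simp [hc, mul_comm]
    obtain ⟨a', ha'⟩ := h2
    refine ⟨c, a', fun n => ?_, by rw [← ha']; ring⟩
    have h3 : b ^ n ∣ d * (a - c * b) ^ n := by
      rw [sub_eq_add_neg, add_pow, Finset.mul_sum]
      refine Finset.dvd_sum fun i hi => ?_
      have hi' : i ≤ n := by have := Finset.mem_range.mp hi; omega
      obtain ⟨w, hw⟩ := ha i
      refine ⟨w * (-c) ^ (n - i) * (n.choose i), ?_⟩
      have : b ^ n = b ^ i * b ^ (n - i) := by rw [← pow_add]; congr 1; omega
      rw [this]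
      calc d * (a ^ i * (-(c * b)) ^ (n - i) * (n.choose i)) = (d * a ^ i) * (-(c * b)) ^ (n - i) * (n.choose i) := by ring
        _ = (b ^ i * w) * ((-c) * b) ^ (n - i) * (n.choose i) := by rw [hw, neg_mul]
        _ = _ := by rw [mul_pow]; ring
    rw [ha', mul_pow] at h3
    refine CIC.dvd_cancel f π h0 hker (by rw [map_pow]; exact pow_ne_zero _ hb) n _ ?_
    convert h3 using 1
    ring
  intro a b d hd h
  by_cases ha : a = 0
  · rw [ha]; exact dvd_zero b
  by_cases hb : b = 0
  · have := h 1
    rw [hb, pow_one, zero_dvd_iff, pow_one] at this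
    exact absurd this (mul_ne_zero hd ha)
  obtain ⟨k, d', rfl, hd'⟩ := CIC.pi_pow f π hker hd
  obtain ⟨l, b', rfl, hb'⟩ := CIC.pi_pow f π hker hb
  obtain ⟨j, a', rfl, ha'⟩ := CIC.pi_pow f π hker ha
  have hlj : l ≤ j := by
    by_contra hlj
    have hlj : j + 1 ≤ l := by omega
    have h1 := h (k + 1)
    have h2 : π ^ (k + j * (k + 1) + 1) ∣ π ^ (k + j * (k + 1)) * (d' * a' ^ (k + 1)) := by
      have h3 : π ^ k * d' * (π ^ j * a') ^ (k + 1) = π ^ (k + j * (k + 1)) * (d' * a' ^ (k + 1)) := by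
        rw [mul_pow, ← pow_mul, pow_add]; ring
      rw [← h3]
      refine dvd_trans ?_ h1
      rw [mul_pow, ← pow_mul]
      refine Dvd.dvd.mul_right (pow_dvd_pow _ ?_) _
      nlinarith
    rw [pow_succ] at h2
    have h4 := (mul_dvd_mul_iff_left (pow_ne_zero _ h0)).mp h2
    rw [← hker, map_mul, map_pow] at h4
    exact mul_ne_zero hd' (pow_ne_zero _ ha') h4
  obtain ⟨i, rfl⟩ := Nat.exists_eq_add_of_le hlj
  have h5 : b' ∣ π ^ i * a' := by
    refine main _ _ d' hd' hb' fun n => ?_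
    have h1 := h n
    refine CIC.dvd_cancel f π h0 hker (by rw [map_pow]; exact pow_ne_zero _ hb') k _ ?_
    have h6 : π ^ (l * n) * b' ^ n ∣ π ^ (l * n) * (π ^ k * (d' * (π ^ i * a') ^ n)) := by
      convert h1 using 1
      · rw [mul_pow, ← pow_mul]
      · rw [pow_add, mul_assoc (π ^ l), mul_pow (π ^ l), ← pow_mul]; ring
    exact (mul_dvd_mul_iff_left (pow_ne_zero _ h0)).mp h6
  rw [pow_add, mul_assoc]
  exact mul_dvd_mul_left _ h5

theorem CIC.of_field (K : Type*) [Field K] : CIC K := by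
  intro a b d hd h
  by_cases hb : b = 0
  · have := h 1
    rw [hb, pow_one, zero_dvd_iff, pow_one] at this
    rw [(mul_eq_zero.mp this).resolve_left hd]
    exact dvd_zero b
  · exact (IsUnit.mk0 b hb).dvd

theorem CIC.pic {U : Type*} [CommRing U] [IsDomain U] (h : CIC U) : PIC U := by
  rintro a b ⟨n, c, hab⟩
  by_cases hb : b = 0
  · subst hb
    have h1 : a ^ n = 0 := by
      rw [hab]
      refine Finset.sum_eq_zero fun i hi => ?_
      have := Finset.mem_range.mp hi
      rw [zero_pow (by omega), mul_zero]
    rw [eq_zero_of_pow_eq_zero h1]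
  refine h a b (b ^ n) (pow_ne_zero _ hb) fun m => ?_
  induction m using Nat.strong_induction_on with
  | _ m ih =>
    by_cases hm : m < n
    · exact Dvd.dvd.mul_right (pow_dvd_pow _ hm.le) _
    · push Not at hm
      obtain ⟨j, rfl⟩ := Nat.exists_eq_add_of_le hm
      rw [pow_add a, hab, Finset.sum_mul, Finset.mul_sum]
      refine Finset.dvd_sum fun i hi => ?_
      have hi' := Finset.mem_range.mp hi
      obtain ⟨w, hw⟩ := ih (i + j) (by omega)
      refine ⟨c i * w, ?_⟩
      have : b ^ (n + j) = b ^ (i + j) * b ^ (n - i) := by rw [← pow_add]; congr 1; omega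
      rw [this]
      calc b ^ n * (c i * a ^ i * b ^ (n - i) * a ^ j) = c i * b ^ (n - i) * (b ^ n * a ^ (i + j)) := by ring
        _ = _ := by rw [hw]; ring

theorem CIC.of_equiv {U V : Type*} [CommRing U] [CommRing V] (e : U ≃+* V) (h : CIC V) : CIC U := by
  intro a b d hd hn
  have := h (e a) (e b) (e d) (by simpa using hd) fun n => by simpa using map_dvd e (hn n)
  simpa using map_dvd e.symm this

theorem CIC.powerSeries {U : Type*} [CommRing U] [IsDomain U] (h : CIC U) : CIC (PowerSeries U) := by
  refine CIC.of_complete (PowerSeries.constantCoeff (R := U)) PowerSeries.X PowerSeries.X_ne_zero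
    PowerSeries.constantCoeff_surj (fun x => ?_) h
  rw [PowerSeries.X_dvd_iff]

theorem CIC.mvPowerSeries {U : Type*} [CommRing U] [IsDomain U] (h : CIC U) (n : ℕ) : CIC (MvPowerSeries (Fin n) U) := by
  induction n with
  | zero =>
    refine CIC.of_equiv (V := U) (RingEquiv.symm (RingEquiv.ofBijective (MvPowerSeries.C (σ := Fin 0) (R := U)) ⟨MvPowerSeries.C_injective, fun x => ⟨MvPowerSeries.constantCoeff x, ?_⟩⟩)) h
    ext i
    obtain rfl : i = 0 := Subsingleton.elim _ _
    simp
  | succ n ih =>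
    haveI : IsDomain (MvPowerSeries (Fin n) U) := NoZeroDivisors.to_isDomain _
    exact CIC.of_equiv (MvPowerSeries.finSuccEquiv U n).toRingEquiv (CIC.powerSeries ih)

theorem exists_series {σ U : Type*} [CommRing U] (g : (σ →₀ ℕ) → U) :
    ∃ G : MvPowerSeries σ U, ∀ i, MvPowerSeries.coeff i G = g i := ⟨g, fun _ => rfl⟩

theorem C_dvd_iff {σ U : Type*} [CommRing U] (a : U) (f : MvPowerSeries σ U) :
    MvPowerSeries.C a ∣ f ↔ ∀ i, a ∣ MvPowerSeries.coeff i f := by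
  constructor
  · rintro ⟨g, rfl⟩ i
    rw [MvPowerSeries.coeff_C_mul]
    exact dvd_mul_right _ _
  · intro h
    choose g hg using h
    obtain ⟨G, hG⟩ := exists_series g
    refine ⟨G, ?_⟩
    ext i
    rw [MvPowerSeries.coeff_C_mul, hg, hG]

theorem mvPowerSeries_complete {σ U : Type*} [CommRing U] (a : U) [IsAdicComplete (Ideal.span {a}) U] :
    IsAdicComplete (Ideal.span {MvPowerSeries.C (σ := σ) a}) (MvPowerSeries σ U) where
  haus' := by
    intro f hf
    ext i
    refine IsHausdorff.haus (I := Ideal.span {a}) inferInstance _ fun n => ?_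
    have h := hf n
    rw [mem_span_pow, ← map_pow, C_dvd_iff] at h
    rw [mem_span_pow]
    exact h i
  prec' := by
    intro f hf
    have h1 : ∀ i, ∃ L : U, ∀ n, MvPowerSeries.coeff i (f n) ≡ L [SMOD (Ideal.span {a} ^ n • ⊤ : Submodule U U)] := by
      intro i
      refine IsPrecomplete.prec (I := Ideal.span {a}) inferInstance fun {m n} hmn => ?_
      have h := hf hmn
      rw [← sub_smodEq_zero, mem_span_pow, ← map_pow, C_dvd_iff] at h
      rw [← sub_smodEq_zero, mem_span_pow]
      simpa using h i
    choose L hL using h1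
    obtain ⟨G, hG⟩ := exists_series L
    refine ⟨G, fun n => ?_⟩
    rw [← sub_smodEq_zero, mem_span_pow, ← map_pow, C_dvd_iff]
    intro i
    have h := hL i n
    rw [← sub_smodEq_zero, mem_span_pow] at h
    rw [map_sub, hG]
    exact h

/-- series with coefficients divisible by `a` form the principal ideal; kernel of the reduction -/
theorem map_eq_zero_iff_dvd {σ U V : Type*} [CommRing U] [CommRing V] (f : U →+* V) (a : U) (hker : ∀ x, f x = 0 ↔ a ∣ x)
    (x : MvPowerSeries σ U) : MvPowerSeries.map f x = 0 ↔ MvPowerSeries.C a ∣ x := by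
  rw [C_dvd_iff, MvPowerSeries.ext_iff]
  simp [hker]

theorem cartier_span {K l ι n : Type*} [Field K] [Field l] [Algebra K l] (q : ℕ) (p e : ℕ) [ExpChar K p] (hq : q = p ^ e) [Fintype n]
    (b : Module.Basis n K l) (ε : n → K) (hε : ∀ i, b i ^ q = algebraMap K l (ε i))
    (φ : ι → K →+ K) (hφ : ∀ i x y, φ i (x ^ q * y) = x * φ i y) (hsep : ∀ x, (∀ i, φ i x = 0) → x = 0) :
    Submodule.span K (Set.range fun i => fun k => φ i (ε k)) = ⊤ := by
  classical
  by_contra hcon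
  obtain ⟨f, hf, hle⟩ := Submodule.exists_le_ker_of_lt_top _ (lt_top_iff_ne_top.mpr hcon)
  apply hf
  have hpi := LinearMap.pi_apply_eq_sum_univ f
  obtain ⟨u, hu⟩ : ∃ u : n → K, ∀ k, u k = f (fun j => if k = j then 1 else 0) := ⟨_, fun _ => rfl⟩
  simp only [← hu] at hpi
  have h1 : ∀ i, ∑ k, φ i (ε k) * u k = 0 := by
    intro i
    have h := hle (Submodule.subset_span ⟨i, rfl⟩)
    rw [LinearMap.mem_ker, hpi] at h
    simpa using h
  have h2 : ∑ k, u k ^ q * ε k = 0 := by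
    apply hsep
    intro i
    rw [map_sum]
    refine Eq.trans ?_ (h1 i)
    refine Finset.sum_congr rfl fun k _ => ?_
    rw [hφ, mul_comm]
  haveI : ExpChar l p := expChar_of_injective_algebraMap (algebraMap K l).injective p
  have h3 : (∑ k, u k • b k) ^ q = 0 := by
    rw [hq, sum_pow_char_pow, ← hq]
    refine Eq.trans ?_ ((congrArg (algebraMap K l) h2).trans (map_zero _))
    rw [map_sum]
    refine Finset.sum_congr rfl fun k _ => ?_
    rw [smul_pow, hε, Algebra.smul_def, map_mul]
  have h4 := eq_zero_of_pow_eq_zero h3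
  have h5 := Fintype.linearIndependent_iff.mp b.linearIndependent _ h4
  refine LinearMap.ext fun x => ?_
  rw [hpi]
  simp [h5]

theorem cartier_pic {K l D ι : Type*} [Field K] [Field l] [Algebra K l] [FiniteDimensional K l] [CommRing D] [IsDomain D] [Algebra K D]
    (q : ℕ) (p e : ℕ) [ExpChar K p] (hq : q = p ^ e) (hl : ∀ x : l, ∃ y : K, x ^ q = algebraMap K l y)
    (φ : ι → K →+ K) (ψ : ι → D →+ D) (hφψ : ∀ i x, ψ i (algebraMap K D x) = algebraMap K D (φ i x))
    (hψ : ∀ i x y, ψ i (x ^ q * y) = x * ψ i y) (hsep : ∀ x, (∀ i, φ i x = 0) → x = 0)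
    (hD : PIC D) : PIC (l ⊗[K] D) := by
  classical
  have hq0 : q ≠ 0 := by rw [hq]; exact pow_ne_zero _ (expChar_pos K p).ne'
  have hφ : ∀ i x y, φ i (x ^ q * y) = x * φ i y := by
    intro i x y
    apply (algebraMap K D).injective
    rw [← hφψ, map_mul, map_pow, hψ, hφψ, map_mul]
  let b := Module.finBasis K l
  choose N hN using hl
  have hspan := cartier_span q p e hq b (fun i => N (b i)) (fun i => hN _) φ hφ hsep
  let j : D →ₐ[K] l ⊗[K] D := Algebra.TensorProduct.includeRight
  have hj : Function.Injective j := Algebra.TensorProduct.includeRight_injective (algebraMap K l).injective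
  have hjc : ∀ c, c ≠ 0 → ∀ x, j c * x = 0 → x = 0 := by
    intro c hc x hx
    have h1 : Function.Injective ((LinearMap.mulLeft K c).lTensor l) :=
      Module.Flat.lTensor_preserves_injective_linearMap _ (fun y z hyz => mul_left_cancel₀ hc hyz)
    apply h1
    rw [map_zero, ← hx]
    induction x with
    | zero => simp
    | add x y hx' hy' =>
      rw [map_add, mul_add]
      have h2 : ∀ x : l ⊗[K] D, (LinearMap.mulLeft K c).lTensor l x = j c * x := by
        intro x
        induction x with
        | zero => simp
        | add x y hx hy => rw [map_add, mul_add, hx, hy]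
        | tmul x y => simp [j]
      rw [h2, h2]
    | tmul x y => simp [j]
  haveI : Nontrivial (l ⊗[K] D) := hj.nontrivial
  haveI : ExpChar (l ⊗[K] D) p := expChar_of_injective_algebraMap (algebraMap K _).injective p
  have hrep : ∀ x : l ⊗[K] D, ∃ z : Fin (Module.finrank K l) → D, x = ∑ k, b k ⊗ₜ z k := by
    intro x
    induction x with
    | zero => exact ⟨0, by simp⟩
    | add x y hx hy =>
      obtain ⟨z, rfl⟩ := hx
      obtain ⟨w, rfl⟩ := hy
      exact ⟨z + w, by simp [tmul_add, Finset.sum_add_distrib]⟩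
    | tmul x y =>
      refine ⟨fun k => b.repr x k • y, ?_⟩
      conv_lhs => rw [← b.sum_repr x]
      rw [sum_tmul]
      refine Finset.sum_congr rfl fun k _ => ?_
      rw [smul_tmul]
  have hpow : ∀ z : Fin (Module.finrank K l) → D, (∑ k, b k ⊗ₜ[K] z k) ^ q = j (∑ k, z k ^ q * algebraMap K D (N (b k))) := by
    intro z
    rw [hq, sum_pow_char_pow, ← hq, map_sum]
    refine Finset.sum_congr rfl fun k _ => ?_
    rw [Algebra.TensorProduct.tmul_pow, hN, Algebra.algebraMap_eq_smul_one, smul_tmul]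
    simp [j, Algebra.smul_def, mul_comm]
  have key : ∀ (z : Fin (Module.finrank K l) → D) (w c : D), ∑ k, z k ^ q * algebraMap K D (N (b k)) = w * c ^ q → ∀ k, c ∣ z k := by
    intro z w c h k
    have h1 : ∀ v ∈ Submodule.span K (Set.range fun i => fun k => φ i (N (b k))), c ∣ ∑ k, z k * algebraMap K D (v k) := by
      intro v hv
      induction hv using Submodule.span_induction with
      | mem v hv =>
        obtain ⟨i, rfl⟩ := hv
        have h2 := congrArg (ψ i) h
        rw [map_sum, mul_comm w, hψ] at h2
        simp only [hψ, hφψ] at h2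
        exact ⟨_, h2⟩
      | zero => simp
      | add v w _ _ hv hw =>
        have : ∑ k, z k * algebraMap K D ((v + w) k) = ∑ k, z k * algebraMap K D (v k) + ∑ k, z k * algebraMap K D (w k) := by
          rw [← Finset.sum_add_distrib]
          simp [mul_add]
        rw [this]
        exact dvd_add hv hw
      | smul a v _ hv =>
        have : ∑ k, z k * algebraMap K D ((a • v) k) = algebraMap K D a * ∑ k, z k * algebraMap K D (v k) := by
          rw [Finset.mul_sum]
          refine Finset.sum_congr rfl fun k _ => ?_
          simp only [Pi.smul_apply, smul_eq_mul, map_mul]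
          ring
        rw [this]
        exact Dvd.dvd.mul_left hv _
    have h3 := h1 (Pi.single k 1) (by rw [hspan]; trivial)
    rw [Finset.sum_eq_single k (fun i _ hik => by simp [Pi.single_eq_of_ne hik]) (by simp)] at h3
    simpa using h3
  have key2 : ∀ (x : l ⊗[K] D) (w c : D), x ^ q = j (w * c ^ q) → j c ∣ x := by
    intro x w c h
    obtain ⟨z, rfl⟩ := hrep x
    rw [hpow] at h
    have h1 := key z w c (hj h)
    refine Finset.dvd_sum fun k _ => ?_
    obtain ⟨y, hy⟩ := h1 k
    exact ⟨b k ⊗ₜ y, by simp [j, hy]⟩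
  have hg : ∃ g : l ⊗[K] D →+* D, ∀ x, j (g x) = x ^ q := by
    have hr : ∀ x : l ⊗[K] D, iterateFrobenius (l ⊗[K] D) p e x ∈ j.toRingHom.range := by
      intro x
      obtain ⟨z, rfl⟩ := hrep x
      rw [iterateFrobenius_def, ← hq, hpow]
      exact ⟨_, rfl⟩
    let E : D ≃+* j.toRingHom.range := RingEquiv.ofBijective j.toRingHom.rangeRestrict
      ⟨fun x y hxy => hj (congrArg Subtype.val hxy), j.toRingHom.rangeRestrict_surjective⟩
    refine ⟨E.symm.toRingHom.comp ((iterateFrobenius (l ⊗[K] D) p e).codRestrict _ hr), fun x => ?_⟩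
    have h1 := congrArg Subtype.val (E.apply_symm_apply ((iterateFrobenius (l ⊗[K] D) p e).codRestrict _ hr x))
    rw [hq, ← iterateFrobenius_def]
    exact h1
  obtain ⟨g, hg⟩ := hg
  intro a β hab
  obtain ⟨w, hw⟩ := hD _ _ (hab.map g)
  by_cases hc : g β = 0
  · have h1 : j 0 ∣ a := by
      apply key2 a 0 0
      rw [← hg, hw, hc]; simp
    rw [map_zero, zero_dvd_iff] at h1
    rw [h1]; exact dvd_zero _
  · obtain ⟨q', rfl⟩ := Nat.exists_eq_succ_of_ne_zero hq0
    have h1 : j (g β) ∣ a * β ^ q' := by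
      apply key2 _ w
      rw [mul_pow, ← pow_mul, mul_comm q', pow_mul, ← hg a, ← hg β, hw, map_mul, map_mul, map_pow, Nat.succ_eq_add_one, pow_succ]
      ring
    obtain ⟨y, hy⟩ := h1
    refine ⟨y, ?_⟩
    rw [← sub_eq_zero]
    apply hjc _ hc
    rw [hg, pow_succ]
    rw [hg, pow_succ] at hy
    calc β ^ q' * β * (a - β * y) = β * (a * β ^ q' - β ^ q' * β * y) := by ring
      _ = 0 := by rw [hy]; ring

theorem lin_disj {k k' : Type u} [Field k] [Field k'] [Algebra k k'] (p e : ℕ) [ExpChar k p]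
    (hk : ∀ (F : Type u) [Field F] [Algebra k F], IsReduced (k' ⊗[k] F)) {n : Type*} [Fintype n] (b : n → k)
    (hb : ∀ c : n → k, ∑ i, c i ^ p ^ e * b i = 0 → c = 0) (x : n → k')
    (hx : ∑ i, x i ^ p ^ e * algebraMap k k' (b i) = 0) : x = 0 := by
  classical
  let F := AlgebraicClosure k
  haveI := hk F
  haveI : ExpChar F p := expChar_of_injective_algebraMap (algebraMap k F).injective p
  haveI : ExpChar k' p := expChar_of_injective_algebraMap (algebraMap k k').injective p
  have hroot : ∀ i, ∃ β : F, β ^ p ^ e = algebraMap k F (b i) := fun i =>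
    IsAlgClosed.exists_pow_nat_eq _ (pow_pos (expChar_pos k p) e)
  choose β hβ using hroot
  have hli : LinearIndependent k β := by
    rw [Fintype.linearIndependent_iff]
    intro c hc i
    have h1 : algebraMap k F (∑ i, c i ^ p ^ e * b i) = 0 := by
      have this : (∑ i, c i • β i) ^ p ^ e = 0 := by rw [hc, zero_pow (pow_ne_zero e (expChar_pos k p).ne')]
      rw [sum_pow_char_pow] at this
      rw [map_sum]
      refine Eq.trans ?_ this
      refine Finset.sum_congr rfl fun j _ => ?_
      rw [smul_pow, hβ, Algebra.smul_def, map_mul]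
    have h2 := hb c ((map_eq_zero_iff _ (algebraMap k F).injective).mp h1)
    exact congrFun h2 i
  haveI : Nontrivial (k' ⊗[k] F) := inferInstance
  haveI : ExpChar (k' ⊗[k] F) p := expChar_of_injective_algebraMap (algebraMap k _).injective p
  have ht : (∑ i, x i ⊗ₜ[k] β i) ^ p ^ e = 0 := by
    rw [sum_pow_char_pow]
    have h3 : ∀ i, (x i ⊗ₜ[k] β i) ^ p ^ e = (x i ^ p ^ e * algebraMap k k' (b i)) ⊗ₜ[k] (1 : F) := by
      intro i
      rw [Algebra.TensorProduct.tmul_pow, hβ, Algebra.algebraMap_eq_smul_one, ← smul_tmul, Algebra.smul_def, mul_comm]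
    rw [Finset.sum_congr rfl fun i _ => h3 i, ← sum_tmul, hx, zero_tmul]
  have ht0 := eq_zero_of_pow_eq_zero ht
  obtain ⟨B, hB⟩ : ∃ B : F →ₗ[k] (n →₀ k), ∀ i, B (β i) = Finsupp.single i 1 := by
    obtain ⟨g, hg⟩ := hli.repr.exists_extend
    refine ⟨g, fun i => ?_⟩
    have h4 : g (β i) = hli.repr ⟨β i, Submodule.subset_span ⟨i, rfl⟩⟩ := by
      rw [← hg]; rfl
    rw [h4]
    exact hli.repr_eq_single i _ rfl
  funext i
  have h5 := congrArg ((((Finsupp.lapply i : (n →₀ k) →ₗ[k] k).comp B).lTensor k')) ht0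
  rw [map_sum, map_zero] at h5
  simp only [LinearMap.lTensor_tmul, LinearMap.comp_apply, hB, Finsupp.lapply_apply] at h5
  rw [Finset.sum_eq_single i (fun j _ hj => by rw [Finsupp.single_eq_of_ne (Ne.symm hj), tmul_zero]) (by simp)] at h5
  have h6 := congrArg (TensorProduct.rid k k') h5
  simpa using h6

/-- `q`-th roots of coordinates with respect to a basis of `k` over `k^q` extended to `k'`. -/
theorem exists_theta {k k' : Type u} [Field k] [Field k'] [Algebra k k'] (p e : ℕ) [ExpChar k p]
    (hk : ∀ (F : Type u) [Field F] [Algebra k F], IsReduced (k' ⊗[k] F)) :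
    ∃ (ι : Type u) (φ : ι → k →+ k) (ψ : ι → k' →+ k'),
      (∀ i x y, ψ i (x ^ p ^ e * y) = x * ψ i y) ∧ (∀ i x, ψ i (algebraMap k k' x) = algebraMap k k' (φ i x)) ∧
      ∀ x, (∀ i, φ i x = 0) → x = 0 := by
  classical
  haveI : ExpChar k' p := expChar_of_injective_algebraMap (algebraMap k k').injective p
  let L := (iterateFrobenius k p e).fieldRange
  let L' := (iterateFrobenius k' p e).fieldRange
  have hL : ∀ c : L, ∃ y : k, (c : k) = y ^ p ^ e := fun c => by
    obtain ⟨y, hy⟩ := c.2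
    exact ⟨y, hy.symm⟩
  have hL' : ∀ c : L', ∃ y : k', (c : k') = y ^ p ^ e := fun c => by
    obtain ⟨y, hy⟩ := c.2
    exact ⟨y, hy.symm⟩
  choose r hr using hL
  choose r' hr' using hL'
  have inj' : ∀ x y : k', x ^ p ^ e = y ^ p ^ e → x = y := fun x y h => iterateFrobenius_inj k' p e h
  have inj : ∀ x y : k, x ^ p ^ e = y ^ p ^ e → x = y := fun x y h => iterateFrobenius_inj k p e h
  have hadd : ∀ x y, r (x + y) = r x + r y := fun x y => inj _ _ (by
    rw [← hr, add_pow_expChar_pow, ← hr, ← hr]; rfl)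
  have hadd' : ∀ x y, r' (x + y) = r' x + r' y := fun x y => inj' _ _ (by
    rw [← hr', add_pow_expChar_pow, ← hr', ← hr']; rfl)
  have hmul' : ∀ (x : k') (c y : L'), (c : k') = x ^ p ^ e → r' (c * y) = x * r' y := fun x c y h => inj' _ _ (by
    rw [← hr', mul_pow, ← hr', ← h]; rfl)
  let b := Module.Basis.ofVectorSpace L k
  have hli : LinearIndependent L' (fun i => algebraMap k k' (b i)) := by
    rw [linearIndependent_iff']
    intro s g hg i hi
    have h1 := lin_disj p e hk (fun j : s => b j) (by
      intro c hc
      have h2 := linearIndependent_iff'.mp b.linearIndependent s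
        (fun j => if hj : j ∈ s then ⟨c ⟨j, hj⟩ ^ p ^ e, ⟨c ⟨j, hj⟩, rfl⟩⟩ else 0) (by
          rw [← Finset.sum_coe_sort]
          refine Eq.trans ?_ hc
          refine Finset.sum_congr rfl fun j _ => ?_
          simp [Algebra.smul_def]
          left
          rfl)
      funext j
      have h3 := h2 j j.2
      rw [dif_pos j.2] at h3
      have h4 : c j ^ p ^ e = 0 := congrArg Subtype.val h3
      exact eq_zero_of_pow_eq_zero h4) (fun j : s => r' (g j)) (by
      refine Eq.trans ?_ ((Finset.sum_coe_sort s (fun j => g j • algebraMap k k' (b j))).trans hg)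
      refine Finset.sum_congr rfl fun j _ => ?_
      rw [← hr', Algebra.smul_def]
      rfl)
    have h2 := congrFun h1 ⟨i, hi⟩
    have h3 : ((g i : L') : k') = 0 := by
      rw [hr', show r' (g i) = 0 from h2, zero_pow (pow_ne_zero e (expChar_pos k p).ne')]
    exact Subtype.ext h3
  have hex : ∀ i, ∃ f : k' →ₗ[L'] L', ∀ j, f (algebraMap k k' (b j)) = if j = i then 1 else 0 := by
    intro i
    obtain ⟨g, hg⟩ := (((Finsupp.lapply i : (_ →₀ L') →ₗ[L'] L').comp hli.repr)).exists_extend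
    refine ⟨g, fun j => ?_⟩
    have hm : algebraMap k k' (b j) ∈ Submodule.span L' (Set.range fun i => algebraMap k k' (b i)) :=
      Submodule.subset_span ⟨j, rfl⟩
    have h4 : g (algebraMap k k' (b j)) = hli.repr ⟨algebraMap k k' (b j), hm⟩ i :=
      LinearMap.congr_fun hg ⟨algebraMap k k' (b j), hm⟩
    rw [h4, hli.repr_eq_single j _ rfl, Finsupp.single_apply]
  choose f hf using hex
  refine ⟨_, fun i => AddMonoidHom.mk' (fun x => r (b.coord i x)) (fun x y => by rw [map_add, hadd]),
    fun i => AddMonoidHom.mk' (fun x => r' (f i x)) (fun x y => by rw [map_add, hadd']), ?_, ?_, ?_⟩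
  · intro i x y
    let c : L' := ⟨x ^ p ^ e, ⟨x, rfl⟩⟩
    have h1 : x ^ p ^ e * y = c • y := rfl
    simp only [AddMonoidHom.mk'_apply]
    rw [h1, map_smul, smul_eq_mul, hmul' x c _ rfl]
  · intro i x
    simp only [AddMonoidHom.mk'_apply]
    apply inj'
    rw [← hr', ← map_pow, ← hr]
    have hx : ∀ x : k, ((f i (algebraMap k k' x) : L') : k') = algebraMap k k' ((b.coord i x : L) : k) := by
      intro x
      induction (b.mem_span x) using Submodule.span_induction with
      | zero => simp
      | add x y _ _ hx hy =>
        rw [map_add, map_add, map_add]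
        simp only [Subfield.coe_add, map_add, hx, hy]
      | smul c x _ hx =>
        obtain ⟨y, hy⟩ := c.2
        have hy : (c : k) = y ^ p ^ e := hy.symm
        let c' : L' := ⟨(algebraMap k k' y) ^ p ^ e, ⟨_, rfl⟩⟩
        have h1 : algebraMap k k' (c • x) = c' • algebraMap k k' x := by
          change algebraMap k k' ((c : k) * x) = (c' : k') * algebraMap k k' x
          rw [map_mul, hy, map_pow]
        rw [h1, map_smul, map_smul]
        change (c' : k') * _ = algebraMap k k' ((c : k) * _)
        rw [hx, map_mul, hy, map_pow]
      | mem x hx =>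
        obtain ⟨j, rfl⟩ := hx
        rw [hf]
        simp only [Module.Basis.coord_apply, Module.Basis.repr_self, Finsupp.single_apply]
        split_ifs <;> simp
    exact hx x
  · intro x hx
    simp only [AddMonoidHom.mk'_apply] at hx
    apply b.ext_elem
    intro i
    have h1 := hr (b.coord i x)
    rw [hx, zero_pow (pow_ne_zero e (expChar_pos k p).ne')] at h1
    rw [map_zero]
    exact Subtype.ext h1

theorem coeff_pow_q {σ k : Type*} [Finite σ] [Field k] (p e : ℕ) [ExpChar k p] (x : MvPowerSeries σ k) :
    (∀ a, MvPowerSeries.coeff ((p ^ e) • a) (x ^ p ^ e) = (MvPowerSeries.coeff a x) ^ p ^ e) ∧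
    ∀ a, (¬ ∃ a', a = (p ^ e) • a') → MvPowerSeries.coeff a (x ^ p ^ e) = 0 := by
  have hp : p ≠ 0 := (expChar_pos k p).ne'
  have h1 := MvPowerSeries.map_iterateFrobenius_expand p hp x e
  constructor
  · intro a
    rw [← h1, MvPowerSeries.coeff_map, MvPowerSeries.coeff_expand_smul]
    rfl
  · intro a ha
    rw [← h1, MvPowerSeries.coeff_map]
    have h2 : ∃ i, ¬ p ^ e ∣ a i := by
      by_contra! hcon
      apply ha
      choose c hc using hcon
      refine ⟨Finsupp.equivFunOnFinite.symm c, ?_⟩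
      ext i
      simp [hc]
    obtain ⟨i, hi⟩ := h2
    rw [MvPowerSeries.coeff_expand_of_not_dvd _ _ _ hi, map_zero]

theorem cartier_series {σ k : Type*} [Finite σ] [Field k] (p e : ℕ) [ExpChar k p] (θ : k →+ k)
    (hθ : ∀ x y, θ (x ^ p ^ e * y) = x * θ y) (r : σ →₀ ℕ) (hr : ∀ i, r i < p ^ e) :
    ∃ φ : MvPowerSeries σ k →+ MvPowerSeries σ k,
      (∀ f m, MvPowerSeries.coeff m (φ f) = θ (MvPowerSeries.coeff ((p ^ e) • m + r) f)) ∧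
      ∀ x y, φ (x ^ p ^ e * y) = x * φ y := by
  classical
  have hex : ∀ f : MvPowerSeries σ k, ∃ G : MvPowerSeries σ k, ∀ m, MvPowerSeries.coeff m G = θ (MvPowerSeries.coeff ((p ^ e) • m + r) f) :=
    fun f => exists_series _
  choose G hG using hex
  refine ⟨AddMonoidHom.mk' G (fun x y => ?_), fun f m => hG f m, fun x y => ?_⟩
  · ext m
    simp [hG]
  · obtain ⟨h1, h2⟩ := coeff_pow_q p e x
    have hq : p ^ e ≠ 0 := pow_ne_zero _ (expChar_pos k p).ne'
    ext m
    simp only [AddMonoidHom.mk'_apply]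
    rw [hG, MvPowerSeries.coeff_mul, MvPowerSeries.coeff_mul]
    have h3 : ∑ s ∈ Finset.HasAntidiagonal.antidiagonal m, (MvPowerSeries.coeff s.1 x) ^ p ^ e * MvPowerSeries.coeff ((p ^ e) • s.2 + r) y =
        ∑ s ∈ Finset.HasAntidiagonal.antidiagonal ((p ^ e) • m + r), MvPowerSeries.coeff s.1 (x ^ p ^ e) * MvPowerSeries.coeff s.2 y := by
      refine Finset.sum_of_injOn (fun s => ((p ^ e) • s.1, (p ^ e) • s.2 + r)) ?_ ?_ ?_ ?_
      · rintro ⟨a, b⟩ - ⟨c, d⟩ - h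
        simp only [Prod.mk.injEq, add_left_inj] at h
        ext i
        · have := DFunLike.congr_fun h.1 i
          simpa [hq, (expChar_pos k p).ne'] using this
        · have := DFunLike.congr_fun h.2 i
          simpa [hq, (expChar_pos k p).ne'] using this
      · rintro ⟨a, b⟩ h
        simp only [Finset.coe_sort_coe, Finset.mem_coe, Finset.HasAntidiagonal.mem_antidiagonal] at h ⊢
        rw [← h, smul_add, add_assoc]
      · rintro ⟨a, b⟩ h hn
        rw [Finset.HasAntidiagonal.mem_antidiagonal] at h
        simp only at h
        by_cases ha : ∃ a', a = (p ^ e) • a'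
        · exfalso
          obtain ⟨a', rfl⟩ := ha
          apply hn
          have hle : ∀ i, a' i ≤ m i := by
            intro i
            have h4 := DFunLike.congr_fun h i
            simp only [Finsupp.add_apply, Finsupp.smul_apply, smul_eq_mul] at h4
            have h5 := hr i
            by_contra hlt
            push Not at hlt
            have h6 : p ^ e * (m i + 1) ≤ p ^ e * a' i := Nat.mul_le_mul_left _ hlt
            rw [mul_add] at h6
            omega
          obtain ⟨c, hc⟩ := exists_add_of_le (show a' ≤ m from hle)
          refine ⟨(a', c), ?_, ?_⟩
          · simp [hc]
          · simp only [Prod.mk.injEq, true_and]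
            rw [hc, smul_add, add_assoc] at h
            exact (add_left_cancel h).symm
        · rw [h2 a ha, zero_mul]
      · rintro ⟨a, b⟩ -
        rw [h1]
    rw [← h3, map_sum]
    refine Finset.sum_congr rfl fun s _ => ?_
    rw [hθ, hG]

theorem cartier_ext {Λ D : Type*} [CommRing Λ] [CommRing D] [Algebra Λ D] (M : Submonoid Λ) [IsLocalization M D]
    [IsDomain Λ] (q : ℕ) (hq : q ≠ 0) (φ : Λ →+ Λ) (hφ : ∀ x y, φ (x ^ q * y) = x * φ y) :
    ∃ ψ : D →+ D, (∀ x, ψ (algebraMap Λ D x) = algebraMap Λ D (φ x)) ∧ ∀ x y, ψ (x ^ q * y) = x * ψ y := by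
  obtain ⟨q, rfl⟩ := Nat.exists_eq_succ_of_ne_zero hq
  have hφ' : ∀ x y, φ (x * y ^ (q + 1)) = y * φ x := fun x y => by rw [mul_comm]; exact hφ y x
  let g : D → D := fun d => IsLocalization.mk' D (φ ((IsLocalization.sec M d).1 * (IsLocalization.sec M d).2 ^ q)) (IsLocalization.sec M d).2
  have hchar : ∀ (d : D) (x : Λ) (s : M), d * algebraMap Λ D s = algebraMap Λ D x → g d * algebraMap Λ D s = algebraMap Λ D (φ (x * s ^ q)) := by
    intro d x s h
    have h1 := IsLocalization.sec_spec M d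
    set y := (IsLocalization.sec M d).1
    set t := (IsLocalization.sec M d).2
    have h2 : g d * algebraMap Λ D t = algebraMap Λ D (φ (y * t ^ q)) := IsLocalization.mk'_spec D _ t
    have h3 : algebraMap Λ D (x * t) = algebraMap Λ D (y * s) := by
      rw [map_mul, map_mul, ← h, ← h1]; ring
    obtain ⟨c, hc⟩ := (IsLocalization.eq_iff_exists M D).mp h3
    have h4 : (c : Λ) * (t * φ (x * s ^ q)) = c * (s * φ (y * t ^ q)) := by
      calc (c : Λ) * (t * φ (x * s ^ q)) = φ (x * s ^ q * (c * t) ^ (q + 1)) := by rw [hφ']; ring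
        _ = φ (y * t ^ q * (c * s) ^ (q + 1)) := by
            congr 1
            calc x * (s : Λ) ^ q * (c * t) ^ (q + 1) = (c * (x * t)) * (s ^ q * t ^ q * c ^ q) := by ring
              _ = (c * (y * s)) * (s ^ q * t ^ q * c ^ q) := by rw [hc]
              _ = _ := by ring
        _ = _ := by rw [hφ']; ring
    have h5 := (IsLocalization.eq_iff_exists M D).mpr ⟨c, h4⟩
    have hu : IsUnit (algebraMap Λ D t) := IsLocalization.map_units D t
    apply hu.mul_right_cancel
    rw [(algebraMap Λ D).map_mul, (algebraMap Λ D).map_mul] at h5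
    calc g d * algebraMap Λ D s * algebraMap Λ D t = (g d * algebraMap Λ D t) * algebraMap Λ D s := by ring
      _ = algebraMap Λ D s * algebraMap Λ D (φ (y * t ^ q)) := by rw [h2]; ring
      _ = _ := by rw [← h5]; ring
  have hadd : ∀ x y, g (x + y) = g x + g y := by
    intro x y
    obtain ⟨⟨a, s⟩, ha⟩ := IsLocalization.surj M x
    obtain ⟨⟨b, t⟩, hb⟩ := IsLocalization.surj M y
    simp only at ha hb
    have h1 := hchar x (a * t) (s * t) (by simp only [Submonoid.coe_mul, map_mul]; rw [← ha]; ring)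
    have h2 := hchar y (b * s) (s * t) (by simp only [Submonoid.coe_mul, map_mul]; rw [← hb]; ring)
    have h3 := hchar (x + y) (a * t + b * s) (s * t) (by simp only [Submonoid.coe_mul, map_mul, map_add]; rw [← ha, ← hb]; ring)
    apply (IsLocalization.map_units D (s * t)).mul_right_cancel
    rw [add_mul, h1, h2, h3, add_mul, map_add, map_add]
  refine ⟨AddMonoidHom.mk' g hadd, fun x => ?_, fun x y => ?_⟩
  · have := hchar (algebraMap Λ D x) x 1 (by simp)
    simpa using this
  · simp only [AddMonoidHom.mk'_apply]
    obtain ⟨⟨a, s⟩, ha⟩ := IsLocalization.surj M x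
    obtain ⟨⟨b, t⟩, hb⟩ := IsLocalization.surj M y
    simp only at ha hb
    have h1 := hchar y b t hb
    have h2 := hchar (x ^ (q + 1) * y) (a ^ (q + 1) * b) (s ^ (q + 1) * t) (by
      simp only [Submonoid.coe_mul, map_mul, map_pow, SubmonoidClass.coe_pow]; rw [← ha, ← hb]; ring)
    have h3 : φ (a ^ (q + 1) * b * ((s ^ (q + 1) * t : M) : Λ) ^ q) = a * s ^ q * φ (b * t ^ q) := by
      rw [← hφ']
      congr 1
      simp only [Submonoid.coe_mul, SubmonoidClass.coe_pow]
      ring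
    rw [h3] at h2
    apply (IsLocalization.map_units D (s ^ (q + 1) * t)).mul_right_cancel
    rw [h2]
    simp only [Submonoid.coe_mul, map_mul, map_pow, SubmonoidClass.coe_pow]
    rw [← ha, ← h1]
    ring

theorem cartier_loc {R0 Λ K D ι : Type*} [CommRing R0] [CommRing Λ] [Field K] [CommRing D] [Algebra R0 Λ] [Algebra R0 K]
    [Algebra R0 D] [Algebra Λ D] [Algebra K D] [IsScalarTower R0 Λ D] [IsScalarTower R0 K D] [IsDomain R0] [IsDomain Λ]
    [IsFractionRing R0 K] (M : Submonoid Λ) [IsLocalization M D] (q : ℕ) (hq : q ≠ 0)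
    (φ : ι → R0 →+ R0) (ψ : ι → Λ →+ Λ) (hφ : ∀ i x y, φ i (x ^ q * y) = x * φ i y)
    (hψ : ∀ i x y, ψ i (x ^ q * y) = x * ψ i y) (hφψ : ∀ i x, ψ i (algebraMap R0 Λ x) = algebraMap R0 Λ (φ i x))
    (hsep : ∀ x, (∀ i, φ i x = 0) → x = 0) :
    ∃ (φ' : ι → K →+ K) (ψ' : ι → D →+ D), (∀ i x, ψ' i (algebraMap K D x) = algebraMap K D (φ' i x)) ∧
      (∀ i x y, ψ' i (x ^ q * y) = x * ψ' i y) ∧ ∀ x, (∀ i, φ' i x = 0) → x = 0 := by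
  choose φ' h1 h2 using fun i => cartier_ext (D := K) (nonZeroDivisors R0) q hq (φ i) (hφ i)
  choose ψ' h3 h4 using fun i => cartier_ext (D := D) M q hq (ψ i) (hψ i)
  have key : ∀ x : K, ∃ s ∈ nonZeroDivisors R0, ∃ z, (algebraMap R0 K s) ^ q * x = algebraMap R0 K z := by
    intro x
    obtain ⟨⟨a, s⟩, ha⟩ := IsLocalization.surj (nonZeroDivisors R0) x
    simp only at ha
    obtain ⟨q, rfl⟩ := Nat.exists_eq_succ_of_ne_zero hq
    refine ⟨s, s.2, s ^ q * a, ?_⟩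
    rw [map_mul, ← ha, map_pow, Nat.succ_eq_add_one]
    ring
  have hKs : ∀ s ∈ nonZeroDivisors R0, algebraMap R0 K s ≠ 0 := fun s hs =>
    IsLocalization.to_map_ne_zero_of_mem_nonZeroDivisors K le_rfl hs
  refine ⟨φ', ψ', fun i x => ?_, h4, fun x hx => ?_⟩
  · obtain ⟨s, hs, z, hz⟩ := key x
    have hu : IsUnit (algebraMap K D (algebraMap R0 K s)) := (hKs s hs).isUnit.map _
    apply hu.mul_left_cancel
    rw [← h4, ← map_mul, ← h2, ← map_pow, ← map_mul, hz, h1, ← IsScalarTower.algebraMap_apply, ← IsScalarTower.algebraMap_apply,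
      IsScalarTower.algebraMap_apply R0 Λ D, h3, hφψ, ← IsScalarTower.algebraMap_apply]
  · obtain ⟨s, hs, z, hz⟩ := key x
    have h5 : z = 0 := by
      apply hsep
      intro i
      apply IsFractionRing.injective R0 K
      rw [← h1, ← hz, h2, hx, mul_zero, map_zero]
    rw [h5, map_zero] at hz
    exact (mul_eq_zero.mp hz).resolve_left (pow_ne_zero _ (hKs s hs))

theorem cartier_geo {R0 Λ F : Type u} [CommRing R0] [CommRing Λ] [Field F] [Algebra R0 Λ] [Algebra R0 F] [IsDomain R0] [IsDomain Λ]
    (p : ℕ) [ExpChar R0 p] (hinj : Function.Injective (algebraMap R0 Λ)) (hF : Function.Injective (algebraMap R0 F))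
    (hΛ : PIC Λ) (h : ∀ e : ℕ, ∃ (ι : Type u) (φ : ι → R0 →+ R0) (ψ : ι → Λ →+ Λ), (∀ i x y, φ i (x ^ p ^ e * y) = x * φ i y) ∧
    (∀ i x y, ψ i (x ^ p ^ e * y) = x * ψ i y) ∧ (∀ i x, ψ i (algebraMap R0 Λ x) = algebraMap R0 Λ (φ i x)) ∧
    (∀ x, (∀ i, φ i x = 0) → x = 0)) : PIC (F ⊗[R0] Λ) := by
  haveI : FaithfulSMul R0 F := (faithfulSMul_iff_algebraMap_injective R0 F).mpr hF
  haveI : ExpChar (FractionRing R0) p := expChar_of_injective_algebraMap (IsFractionRing.injective R0 (FractionRing R0)) p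
  letI : Algebra (FractionRing R0) F := FractionRing.liftAlgebra R0 F
  haveI : IsScalarTower R0 (FractionRing R0) F := FractionRing.isScalarTower_liftAlgebra R0 F
  refine PIC.of_equiv (Algebra.TensorProduct.cancelBaseChange R0 (FractionRing R0) (FractionRing R0) F Λ).toRingEquiv.symm ?_
  letI : Algebra Λ (FractionRing R0 ⊗[R0] Λ) := Algebra.TensorProduct.rightAlgebra
  haveI : IsLocalization (Algebra.algebraMapSubmonoid Λ (nonZeroDivisors R0)) (FractionRing R0 ⊗[R0] Λ) := inferInstance
  haveI : IsDomain (FractionRing R0 ⊗[R0] Λ) := by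
    refine IsLocalization.isDomain_of_le_nonZeroDivisors (R := Λ) (S := FractionRing R0 ⊗[R0] Λ) (M := Algebra.algebraMapSubmonoid Λ (nonZeroDivisors R0)) ?_
    rintro _ ⟨s, hs, rfl⟩
    exact mem_nonZeroDivisors_of_ne_zero ((map_ne_zero_iff _ hinj).mpr (nonZeroDivisors.ne_zero hs))
  refine geo ?_ F
  intro l _ _ _ _
  obtain ⟨e, he⟩ : ∃ e, ∀ x : l, ∃ y : FractionRing R0, x ^ p ^ e = algebraMap _ l y := by
    obtain ⟨e, he⟩ := (IsPurelyInseparable.hasExponent_iff' (FractionRing R0) l p).mp inferInstance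
    refine ⟨e, fun x => ?_⟩
    obtain ⟨y, hy⟩ := he x
    exact ⟨y, hy.symm⟩
  obtain ⟨ι, φ, ψ, h1, h2, h3, h4⟩ := h e
  obtain ⟨φ', ψ', h5, h6, h7⟩ := cartier_loc (K := FractionRing R0) (D := FractionRing R0 ⊗[R0] Λ)
    (Algebra.algebraMapSubmonoid Λ (nonZeroDivisors R0)) (p ^ e) (pow_ne_zero _ (expChar_pos R0 p).ne') φ ψ h1 h2 h3 h4
  exact cartier_pic (p ^ e) p e rfl he φ' ψ' h5 h6 h7 (hΛ.localization (Algebra.algebraMapSubmonoid Λ (nonZeroDivisors R0)) _)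

theorem geo_power_field {k k' F : Type u} [Field k] [Field k'] [Field F] [Algebra k k'] (p n : ℕ) [ExpChar k p]
    (hk : ∀ (F : Type u) [Field F] [Algebra k F], IsReduced (k' ⊗[k] F)) [Algebra (MvPowerSeries (Fin n) k) F]
    (hF : Function.Injective (algebraMap (MvPowerSeries (Fin n) k) F)) :
    PIC (F ⊗[MvPowerSeries (Fin n) k] (MvPowerSeries (Fin n) k')) := by
  haveI : ExpChar k' p := expChar_of_injective_algebraMap (algebraMap k k').injective p
  haveI : ExpChar (MvPowerSeries (Fin n) k) p := expChar_of_injective_algebraMap (algebraMap k (MvPowerSeries (Fin n) k)).injective p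
  have hmap : ∀ (x : MvPowerSeries (Fin n) k) m, MvPowerSeries.coeff m (algebraMap (MvPowerSeries (Fin n) k) (MvPowerSeries (Fin n) k') x) = algebraMap k k' (MvPowerSeries.coeff m x) := by
    intro x m
    rfl
  haveI : IsDomain (MvPowerSeries (Fin n) k) := NoZeroDivisors.to_isDomain _
  haveI : IsDomain (MvPowerSeries (Fin n) k') := NoZeroDivisors.to_isDomain _
  refine cartier_geo p ?_ hF ((CIC.of_field k').mvPowerSeries n).pic ?_
  · intro x y h
    ext m
    apply (algebraMap k k').injective
    rw [← hmap, ← hmap, h]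
  · intro e
    obtain ⟨ι, φ, ψ, h1, h2, h3⟩ := exists_theta p e hk
    have h0 : ∀ i x y, φ i (x ^ p ^ e * y) = x * φ i y := by
      intro i x y
      apply (algebraMap k k').injective
      rw [← h2, map_mul, map_pow, h1, h2, map_mul]
    choose Φ hΦ hΦ' using fun s : ι × {r : Fin n →₀ ℕ // ∀ i, r i < p ^ e} => cartier_series p e (φ s.1) (h0 s.1) s.2.1 s.2.2
    choose Ψ hΨ hΨ' using fun s : ι × {r : Fin n →₀ ℕ // ∀ i, r i < p ^ e} => cartier_series p e (ψ s.1) (h1 s.1) s.2.1 s.2.2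
    refine ⟨_, Φ, Ψ, hΦ', hΨ', fun s x => ?_, fun x hx => ?_⟩
    · ext m
      rw [hΨ, hmap, hmap, h2, hΦ]
    · ext m
      rw [map_zero]
      apply h3
      intro i
      have hq : 0 < p ^ e := pow_pos (expChar_pos k p) _
      have := hΦ (i, ⟨Finsupp.equivFunOnFinite.symm (fun j => m j % p ^ e), fun j => by simpa using Nat.mod_lt _ hq⟩) x
        (Finsupp.equivFunOnFinite.symm (fun j => m j / p ^ e))
      rw [hx, map_zero] at this
      have hm : m = (p ^ e • Finsupp.equivFunOnFinite.symm fun j => m j / p ^ e) + Finsupp.equivFunOnFinite.symm fun j => m j % p ^ e := by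
        ext j
        simp [Nat.div_add_mod]
      rw [this]
      exact congrArg (fun m => φ i (MvPowerSeries.coeff m x)) hm

/-- `q`-independence of a family: the monomials of degree `< q` in each variable are independent over `K^q`. -/
def PI {σ K : Type*} [Field K] (q : ℕ) (b : σ → K) : Prop :=
  ∀ s : Finset (σ →₀ ℕ), (∀ e ∈ s, ∀ i, e i < q) → ∀ c : (σ →₀ ℕ) → K,
    ∑ e ∈ s, c e ^ q * e.prod (fun i j => b i ^ j) = 0 → ∀ e ∈ s, c e = 0

/-- `q`-independence of a set. -/
def PInd {K : Type*} [Field K] (q : ℕ) (T : Set K) : Prop :=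
  ∀ s : Finset (K →₀ ℕ), (∀ e ∈ s, (e.support : Set K) ⊆ T ∧ ∀ i, e i < q) → ∀ c : (K →₀ ℕ) → K,
    ∑ e ∈ s, c e ^ q * e.prod (fun i j => i ^ j) = 0 → ∀ e ∈ s, c e = 0

theorem PInd.pi {K : Type*} [Field K] {q : ℕ} {T : Set K} (hq : 0 < q) (h : PInd q T) : PI q ((↑) : T → K) := by
  classical
  intro s hs c hc e he
  have hinj : Function.Injective (Finsupp.mapDomain (M := ℕ) ((↑) : T → K)) := Finsupp.mapDomain_injective Subtype.val_injective
  have h1 := h (s.image (Finsupp.mapDomain ((↑) : T → K))) ?_ (fun e => c (Function.invFun (Finsupp.mapDomain ((↑) : T → K)) e)) ?_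
    (Finsupp.mapDomain ((↑) : T → K) e) (Finset.mem_image_of_mem _ he)
  · simpa [Function.leftInverse_invFun hinj e] using h1
  · intro e he
    obtain ⟨e, he', rfl⟩ := Finset.mem_image.mp he
    constructor
    · intro x hx
      have := Finsupp.mapDomain_support hx
      obtain ⟨y, -, rfl⟩ := Finset.mem_image.mp this
      exact y.2
    · intro i
      by_cases hi : i ∈ T
      · have := Finsupp.mapDomain_apply Subtype.val_injective e ⟨i, hi⟩
        simp only at this
        rw [this]
        exact hs e he' _
      · rw [Finsupp.mapDomain_of_notMem_range]
        · exact hq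
        · simpa using hi
  · rw [Finset.sum_image (fun x _ y _ h => hinj h), ← hc]
    refine Finset.sum_congr rfl fun e _ => ?_
    rw [Function.leftInverse_invFun hinj e, Finsupp.prod_mapDomain_index_inj Subtype.val_injective]

theorem PI.pInd {σ K : Type*} [Field K] {q : ℕ} {b : σ → K} (hb : Function.Injective b) (h : PI q b) : PInd q (Set.range b) := by
  classical
  intro s hs c hc e he
  have hm : ∀ e ∈ s, Finsupp.mapDomain b (Finsupp.comapDomain b e hb.injOn) = e := fun e he =>
    Finsupp.mapDomain_comapDomain b hb e (hs e he).1
  have h1 := h (s.image fun e => Finsupp.comapDomain b e hb.injOn) ?_ (fun e => c (Finsupp.mapDomain b e)) ?_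
    _ (Finset.mem_image_of_mem _ he)
  · simpa [hm e he] using h1
  · intro e he i
    obtain ⟨e, he', rfl⟩ := Finset.mem_image.mp he
    exact (hs e he').2 _
  · rw [Finset.sum_image, ← hc]
    · refine Finset.sum_congr rfl fun e he => ?_
      rw [hm e he]
      conv_rhs => rw [← hm e he]
      rw [Finsupp.prod_mapDomain_index_inj hb, hm e he]
    · intro x hx y hy hxy
      rw [← hm x hx, ← hm y hy]
      simp only at hxy
      rw [hxy]

theorem PI.baseChange {k k' : Type u} [Field k] [Field k'] [Algebra k k'] (p e : ℕ) [ExpChar k p]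
    (hk : ∀ (F : Type u) [Field F] [Algebra k F], IsReduced (k' ⊗[k] F)) {σ : Type*} {b : σ → k} (h : PI (p ^ e) b) :
    PI (p ^ e) (fun i => algebraMap k k' (b i)) := by
  classical
  intro s hs c hc a ha
  have h1 := lin_disj p e hk (n := s) (fun a => a.1.prod (fun i j => b i ^ j)) ?_ (fun a => c a.1) ?_
  · exact congrFun h1 ⟨a, ha⟩
  · intro d hd
    funext a
    have := h s hs (fun e => if h : e ∈ s then d ⟨e, h⟩ else 0) ?_ a.1 a.2
    · simpa using this
    · rw [← hd, ← Finset.sum_coe_sort]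
      refine Finset.sum_congr rfl fun a _ => ?_
      simp
  · rw [← hc, ← Finset.sum_coe_sort s]
    refine Finset.sum_congr rfl fun a _ => ?_
    congr 1
    simp [Finsupp.prod]

theorem PI.succ {σ K : Type*} [Field K] (p : ℕ) [ExpChar K p] {b : σ → K} (h1 : PI p b) (n : ℕ) (hn : PI (p ^ n) b) :
    PI (p ^ (n + 1)) b := by
  classical
  have hp : 0 < p := expChar_pos K p
  intro s hs c hc
  let md : (σ →₀ ℕ) → (σ →₀ ℕ) := Finsupp.mapRange (· % p) (by simp)
  let dv : (σ →₀ ℕ) → (σ →₀ ℕ) := Finsupp.mapRange (· / p) (by simp)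
  have hmd : ∀ e i, md e i = e i % p := fun e i => Finsupp.mapRange_apply
  have hdv : ∀ e i, dv e i = e i / p := fun e i => Finsupp.mapRange_apply
  have hsum : ∀ e, e = p • dv e + md e := by
    intro e
    ext i
    simp [hmd, hdv, Nat.div_add_mod]
  have hprod : ∀ e : σ →₀ ℕ, e.prod (fun i j => b i ^ j) = ((dv e).prod (fun i j => b i ^ j)) ^ p * (md e).prod (fun i j => b i ^ j) := by
    intro e
    conv_lhs => rw [hsum e]
    rw [Finsupp.prod_add_index' (by simp) (by intros; rw [pow_add]), Finsupp.prod_of_support_subset (p • dv e) (s := (dv e).support) Finsupp.support_smul _ (by simp)]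
    congr 1
    rw [Finsupp.prod, ← Finset.prod_pow]
    refine Finset.prod_congr rfl fun i _ => ?_
    rw [Finsupp.smul_apply, smul_eq_mul, mul_comm, pow_mul]
  have h2 : ∀ r ∈ s.image md, ∑ e ∈ s with md e = r, c e ^ p ^ n * (dv e).prod (fun i j => b i ^ j) = 0 := by
    refine h1 (s.image md) ?_ (fun r => ∑ e ∈ s with md e = r, c e ^ p ^ n * (dv e).prod (fun i j => b i ^ j)) ?_
    · intro r hr i
      obtain ⟨e, -, rfl⟩ := Finset.mem_image.mp hr
      rw [hmd]
      exact Nat.mod_lt _ hp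
    · rw [← hc, ← Finset.sum_fiberwise_of_maps_to (g := md) (t := s.image md) (fun i hi => Finset.mem_image_of_mem _ hi)]
      refine Finset.sum_congr rfl fun r hr => ?_
      rw [sum_pow_char, Finset.sum_mul]
      refine Finset.sum_congr rfl fun e he => ?_
      rw [Finset.mem_filter] at he
      rw [hprod e, he.2, mul_pow, ← pow_mul, ← pow_succ, mul_assoc]
  intro e he
  have h3 := h2 (md e) (Finset.mem_image_of_mem _ he)
  have hinj : ∀ x, md x = md e → p • dv x + md e = x := by
    intro x hx
    conv_rhs => rw [hsum x, hx]
  have h4 := hn ((s.filter (fun x => md x = md e)).image dv) ?_ (fun d => c (p • d + md e)) ?_ (dv e) ?_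
  · simpa [← hsum e] using h4
  · intro d hd i
    obtain ⟨x, hx, rfl⟩ := Finset.mem_image.mp hd
    rw [hdv]
    refine Nat.div_lt_of_lt_mul ?_
    rw [← pow_succ']
    exact hs x (Finset.mem_filter.mp hx).1 i
  · rw [Finset.sum_image, ← h3]
    · refine Finset.sum_congr rfl fun x hx => ?_
      rw [hinj x (Finset.mem_filter.mp hx).2]
    · intro x hx y hy hxy
      rw [← hinj x (Finset.mem_filter.mp hx).2, ← hinj y (Finset.mem_filter.mp hy).2, hxy]
  · refine Finset.mem_image_of_mem _ (Finset.mem_filter.mpr ⟨he, rfl⟩)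

theorem PI.pow {σ K : Type*} [Field K] (p : ℕ) [ExpChar K p] {b : σ → K} (h1 : PI p b) (n : ℕ) : PI (p ^ n) b := by
  induction n with
  | zero =>
    intro s hs c hc e he
    have hz : ∀ e ∈ s, e = 0 := fun e he => by
      ext i
      have := hs e he i
      simp at this
      simpa using this
    have : s = {0} := by
      ext x
      rw [Finset.mem_singleton]
      refine ⟨hz x, fun h => ?_⟩
      rw [h, ← hz e he]
      exact he
    rw [this] at hc
    rw [hz e he]
    simpa using hc
  | succ n ih => exact h1.succ p n ih

theorem PInd.exists_maximal {K : Type*} [Field K] (q : ℕ) (T0 : Set K) (h0 : PInd q T0) :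
    ∃ T, T0 ⊆ T ∧ PInd q T ∧ ∀ T', PInd q T' → T ⊆ T' → T' ⊆ T := by
  classical
  obtain ⟨T, h1, h2⟩ := zorn_subset_nonempty {T : Set K | PInd q T} (by
    intro c hc hchain hne
    refine ⟨⋃₀ c, ?_, fun s hs => Set.subset_sUnion_of_mem hs⟩
    intro s hs a ha
    obtain ⟨t, ht, htc⟩ := DirectedOn.exists_mem_subset_of_finset_subset_biUnion (f := id) (s := s.biUnion Finsupp.support) hne
      (fun x hx y hy => by
        rcases hchain.total hx hy with h | h
        · exact ⟨y, hy, h, le_rfl⟩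
        · exact ⟨x, hx, le_rfl, h⟩) (by
        intro x hx
        simp only [Finset.coe_biUnion, Set.mem_iUnion] at hx
        obtain ⟨e, he, hxe⟩ := hx
        obtain ⟨t, ht, hxt⟩ := (hs e he).1 hxe
        exact Set.mem_biUnion ht hxt)
    exact hc ht s (fun e he => ⟨fun x hx => htc (by
      simp only [Finset.coe_biUnion, Set.mem_iUnion]
      exact ⟨e, he, hx⟩), (hs e he).2⟩) a ha) T0 h0
  exact ⟨T, h1, h2.1, fun T' h => h2.2 h⟩

theorem PInd.gen {K : Type*} [Field K] (p : ℕ) [hp : Fact p.Prime] [CharP K p] (T : Set K) (h : PInd p T)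
    (hmax : ∀ T', PInd p T' → T ⊆ T' → T' ⊆ T) (x : K) : x ∈ Subring.closure (Set.range (fun y : K => y ^ p) ∪ T) := by
  classical
  by_contra hx
  let L : Subfield K :=
    { Subring.closure (Set.range (fun y : K => y ^ p) ∪ T) with
      inv_mem' := by
        intro y hy
        by_cases h0 : y = 0
        · rw [h0, inv_zero]; exact Subring.zero_mem _
        · have : y⁻¹ = y ^ (p - 1) * (y⁻¹) ^ p := by
            obtain ⟨q, rfl⟩ := Nat.exists_eq_succ_of_ne_zero hp.out.ne_zero
            simp only [Nat.succ_eq_add_one, Nat.add_sub_cancel]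
            rw [pow_succ, ← mul_assoc, ← mul_pow, mul_inv_cancel₀ h0, one_pow, one_mul]
          rw [this]
          exact Subring.mul_mem _ (Subring.pow_mem _ hy _) (Subring.subset_closure (Or.inl ⟨y⁻¹, rfl⟩)) }
  have hLp : ∀ y : K, y ^ p ∈ L := fun y => Subring.subset_closure (Or.inl ⟨y, rfl⟩)
  have hLT : ∀ y ∈ T, y ∈ L := fun y hy => Subring.subset_closure (Or.inr hy)
  have hxL : x ∉ L := hx
  have hxT : x ∉ T := fun h => hxL (hLT x h)
  have hmin : minpoly L x = Polynomial.X ^ p - Polynomial.C (⟨x ^ p, hLp x⟩ : L) := by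
    refine (minpoly.eq_of_irreducible_of_monic (X_pow_sub_C_irreducible_of_prime hp.out ?_) ?_
      (Polynomial.monic_X_pow_sub_C _ hp.out.ne_zero)).symm
    · intro b hb
      have h1 : (b : K) ^ p = x ^ p := congrArg Subtype.val hb
      have h2 : (b : K) = x := frobenius_inj K p h1
      exact hxL (h2 ▸ b.2)
    · rw [map_sub, map_pow, Polynomial.aeval_X, Polynomial.aeval_C]
      exact sub_self _
  refine hxT (hmax (insert x T) ?_ (Set.subset_insert _ _) (Set.mem_insert _ _))
  intro s hs c hc
  have hsupp : ∀ e ∈ s, ((e.erase x).support : Set K) ⊆ T := by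
    intro e he y hy
    rw [Finsupp.support_erase] at hy
    rcases (hs e he).1 (Finset.mem_of_mem_erase hy) with h | h
    · exact absurd h (Finset.ne_of_mem_erase hy)
    · exact h
  have hmem : ∀ e ∈ s, c e ^ p * (e.erase x).prod (fun i j => i ^ j) ∈ L := by
    intro e he
    refine L.mul_mem (hLp _) (L.prod_mem fun y hy => L.pow_mem (hLT y (hsupp e he hy)) _)
  let P : Polynomial L := ∑ e ∈ s.attach, Polynomial.monomial (e.1 x) ⟨_, hmem e.1 e.2⟩
  have hP0 : Polynomial.aeval x P = 0 := by
    simp only [P, map_sum, Polynomial.aeval_monomial]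
    rw [← hc, ← Finset.sum_attach s]
    refine Finset.sum_congr rfl fun e _ => ?_
    rw [← Finsupp.mul_prod_erase' e.1 x (fun i j => i ^ j) (by simp)]
    change (c e.1 ^ p * (e.1.erase x).prod (fun i j => i ^ j)) * x ^ (e.1 x) = _
    ring
  have hP : P = 0 := by
    by_contra hne
    have h1 := minpoly.degree_le_of_ne_zero L x hne hP0
    rw [hmin, Polynomial.degree_X_pow_sub_C hp.out.pos] at h1
    have h2 : P.degree < p := by
      refine lt_of_le_of_lt (Polynomial.degree_sum_le _ _) ((Finset.sup_lt_iff (WithBot.bot_lt_coe p)).mpr fun e he => ?_)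
      refine lt_of_le_of_lt (Polynomial.degree_monomial_le _ _) ?_
      exact Nat.cast_lt.mpr ((hs e.1 e.2).2 x)
    exact absurd h1 (not_le.mpr h2)
  intro e he
  have h3 : ∑ d ∈ s with d x = e x, c d ^ p * (d.erase x).prod (fun i j => i ^ j) = 0 := by
    have h4 := congrArg (fun Q : Polynomial L => ((Q.coeff (e x) : L) : K)) hP
    simp only [P, Polynomial.finsetSum_coeff, Polynomial.coeff_monomial, Polynomial.coeff_zero] at h4
    rw [Finset.sum_filter, ← Finset.sum_attach s]
    refine Eq.trans ?_ h4
    rw [AddSubmonoidClass.coe_finsetSum]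
    refine Finset.sum_congr rfl fun d _ => ?_
    split_ifs <;> rfl
  have hrec : ∀ d : K →₀ ℕ, d x = e x → d.erase x + Finsupp.single x (e x) = d := by
    intro d hd
    rw [← hd, Finsupp.erase_add_single]
  have h5 := h ((s.filter (fun d => d x = e x)).image (Finsupp.erase x)) ?_ (fun d => c (d + Finsupp.single x (e x))) ?_
    (e.erase x) (Finset.mem_image_of_mem _ (Finset.mem_filter.mpr ⟨he, rfl⟩))
  · simpa [hrec e rfl] using h5
  · intro d hd
    obtain ⟨d, hd1, rfl⟩ := Finset.mem_image.mp hd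
    have hd' := (Finset.mem_filter.mp hd1).1
    refine ⟨hsupp d hd', fun i => lt_of_le_of_lt ?_ ((hs d hd').2 i)⟩
    rw [Finsupp.erase_apply]
    split_ifs <;> simp
  · rw [Finset.sum_image, ← h3]
    · refine Finset.sum_congr rfl fun d hd => ?_
      rw [hrec d (Finset.mem_filter.mp hd).2]
    · intro d hd d' hd' hdd
      rw [← hrec d (Finset.mem_filter.mp hd).2, ← hrec d' (Finset.mem_filter.mp hd').2, hdd]

theorem gen_pow {K : Type*} [Field K] (p : ℕ) [ExpChar K p] (T : Set K)
    (h : ∀ x : K, x ∈ Subring.closure (Set.range (fun y : K => y ^ p) ∪ T)) (n : ℕ) (x : K) :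
    x ∈ Subring.closure (Set.range (fun y : K => y ^ p ^ n) ∪ T) := by
  induction n generalizing x with
  | zero => exact Subring.subset_closure (Or.inl ⟨x, by simp⟩)
  | succ n ih =>
    have h1 : ∀ y : K, y ^ p ^ n ∈ Subring.closure (Set.range (fun y : K => y ^ p ^ (n + 1)) ∪ T) := by
      intro y
      have h2 : Subring.closure (Set.range (fun y : K => y ^ p) ∪ T) ≤
          (Subring.closure (Set.range (fun y : K => y ^ p ^ (n + 1)) ∪ T)).comap (iterateFrobenius K p n) := by
        rw [Subring.closure_le]
        rintro z (⟨w, rfl⟩ | hz)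
        · refine Subring.subset_closure (Or.inl ⟨w, ?_⟩)
          simp only [iterateFrobenius_def, ← pow_mul, ← pow_succ']
        · rw [SetLike.mem_coe, Subring.mem_comap, iterateFrobenius_def]
          have hz' : z ∈ Subring.closure (Set.range (fun y : K => y ^ p ^ (n + 1)) ∪ T) := Subring.subset_closure (Or.inr hz)
          exact pow_mem hz' _
      have := h2 (h y)
      rwa [Subring.mem_comap, iterateFrobenius_def] at this
    have h3 : Subring.closure (Set.range (fun y : K => y ^ p ^ n) ∪ T) ≤ Subring.closure (Set.range (fun y : K => y ^ p ^ (n + 1)) ∪ T) := by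
      rw [Subring.closure_le]
      rintro z (⟨w, rfl⟩ | hz)
      · exact h1 w
      · exact Subring.subset_closure (Or.inr hz)
    exact h3 (ih x)

/-- The subring generated by the `n`-th ghost components and the elements `β i`. -/
noncomputable def DD {S σ : Type*} [CommRing S] (p : ℕ) [Fact p.Prime] (β : σ → S) (n : ℕ) : Subring S :=
  (MvPolynomial.eval₂Hom (WittVector.ghostComponent (p := p) (R := S) n) β).range

theorem DD_gen {S σ : Type*} [CommRing S] (p : ℕ) [Fact p.Prime] (β : σ → S) (n : ℕ) (w : WittVector p S) (e : σ →₀ ℕ) :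
    WittVector.ghostComponent n w * e.prod (fun i j => β i ^ j) ∈ DD p β n :=
  ⟨MvPolynomial.monomial e w, by simp [MvPolynomial.eval₂_monomial]⟩

theorem DD_ghost {S σ : Type*} [CommRing S] (p : ℕ) [Fact p.Prime] (β : σ → S) (n : ℕ) (w : WittVector p S) :
    WittVector.ghostComponent n w ∈ DD p β n := by
  simpa using DD_gen p β n w 0

theorem DD_beta {S σ : Type*} [CommRing S] (p : ℕ) [Fact p.Prime] (β : σ → S) (n : ℕ) (i : σ) : β i ∈ DD p β n := by
  simpa using DD_gen p β n 1 (Finsupp.single i 1)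

theorem DD_induction {S σ : Type*} [CommRing S] (p : ℕ) [Fact p.Prime] (β : σ → S) (n : ℕ) {P : S → Prop}
    (h0 : ∀ x y, P x → P y → P (x + y))
    (h1 : ∀ (w : WittVector p S) (e : σ →₀ ℕ), P (WittVector.ghostComponent n w * e.prod (fun i j => β i ^ j))) {x : S}
    (hx : x ∈ DD p β n) : P x := by
  obtain ⟨f, rfl⟩ := hx
  induction f using MvPolynomial.induction_on' with
  | monomial e w => simpa [MvPolynomial.eval₂_monomial] using h1 w e
  | add f g hf hg => rw [map_add]; exact h0 _ _ hf hg

theorem DD_anti {S σ : Type*} [CommRing S] (p : ℕ) [Fact p.Prime] (β : σ → S) (n : ℕ) : DD p β (n + 1) ≤ DD p β n := by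
  intro x hx
  refine DD_induction p β (n + 1) (fun x y hx hy => add_mem hx hy) (fun w e => ?_) hx
  rw [← WittVector.ghostComponent_frobenius]
  exact DD_gen p β n _ e

theorem DD_p_mul {S σ : Type*} [CommRing S] (p : ℕ) [Fact p.Prime] (β : σ → S) (n : ℕ) {x : S} (hx : x ∈ DD p β n) :
    (p : S) * x ∈ DD p β (n + 1) := by
  refine DD_induction p β n (P := fun x => (p : S) * x ∈ DD p β (n + 1))
    (fun x y hx hy => by rw [mul_add]; exact add_mem hx hy) (fun w e => ?_) hx
  rw [← mul_assoc, ← WittVector.ghostComponent_verschiebung]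
  exact DD_gen p β _ _ e

theorem ghost_decomp {S : Type*} [CommRing S] (p : ℕ) [Fact p.Prime] (n : ℕ) (w : WittVector p S) :
    ∃ v : WittVector p S, WittVector.ghostComponent (n + 1) w = w.coeff 0 ^ p ^ (n + 1) + p * WittVector.ghostComponent n v := by
  have h1 : (w - WittVector.teichmuller p (w.coeff 0)).coeff 0 = 0 := by
    have := (WittVector.constantCoeff (p := p) (R := S)).map_sub w (WittVector.teichmuller p (w.coeff 0))
    simpa [WittVector.constantCoeff] using this
  have h2 := WittVector.eq_iterate_verschiebung (n := 1) (x := w - WittVector.teichmuller p (w.coeff 0)) (by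
    intro i hi
    obtain rfl : i = 0 := by omega
    exact h1)
  refine ⟨(w - WittVector.teichmuller p (w.coeff 0)).shift 1, ?_⟩
  rw [← WittVector.ghostComponent_verschiebung]
  simp only [Function.iterate_one] at h2
  rw [← h2, map_sub, WittVector.ghostComponent_teichmuller]
  ring

theorem DD_normal {S σ : Type*} [CommRing S] (p : ℕ) [hp : Fact p.Prime] (β : σ → S) (n : ℕ) {x : S} (hx : x ∈ DD p β (n + 1)) :
    ∃ (s : Finset (σ →₀ ℕ)) (a : (σ →₀ ℕ) → S) (d : S), (∀ e ∈ s, ∀ i, e i < p ^ (n + 1)) ∧ d ∈ DD p β n ∧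
      x = ∑ e ∈ s, a e ^ p ^ (n + 1) * e.prod (fun i j => β i ^ j) + p * d := by
  classical
  have h1 : ∃ (s : Finset (σ →₀ ℕ)) (g : (σ →₀ ℕ) → WittVector p S), (∀ e ∈ s, ∀ i, e i < p ^ (n + 1)) ∧
      x = ∑ e ∈ s, WittVector.ghostComponent (n + 1) (g e) * e.prod (fun i j => β i ^ j) := by
    refine DD_induction p β (n + 1) (P := fun x => ∃ (s : Finset (σ →₀ ℕ)) (g : (σ →₀ ℕ) → WittVector p S), (∀ e ∈ s, ∀ i, e i < p ^ (n + 1)) ∧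
      x = ∑ e ∈ s, WittVector.ghostComponent (n + 1) (g e) * e.prod (fun i j => β i ^ j)) ?_ ?_ hx
    · rintro x y ⟨s, g, hs, rfl⟩ ⟨t, h, ht, rfl⟩
      refine ⟨s ∪ t, fun e => (if e ∈ s then g e else 0) + (if e ∈ t then h e else 0), ?_, ?_⟩
      · intro e he
        rcases Finset.mem_union.mp he with h | h
        · exact hs e h
        · exact ht e h
      · simp only [map_add, add_mul, Finset.sum_add_distrib]
        congr 1
        · refine Finset.sum_subset_zero_on_sdiff Finset.subset_union_left ?_ ?_
          · intro e he
            rw [if_neg (Finset.mem_sdiff.mp he).2]; simp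
          · intro e he
            rw [if_pos he]
        · refine Finset.sum_subset_zero_on_sdiff Finset.subset_union_right ?_ ?_
          · intro e he
            rw [if_neg (Finset.mem_sdiff.mp he).2]; simp
          · intro e he
            rw [if_pos he]
    · intro w e
      let q := p ^ (n + 1)
      let md : σ →₀ ℕ := Finsupp.mapRange (· % q) (by simp) e
      let dv : σ →₀ ℕ := Finsupp.mapRange (· / q) (by simp) e
      have hmd : ∀ i, md i = e i % q := fun i => Finsupp.mapRange_apply
      have hdv : ∀ i, dv i = e i / q := fun i => Finsupp.mapRange_apply
      have hsum : e = q • dv + md := by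
        ext i
        simp [hmd, hdv, Nat.div_add_mod]
      have hprod : e.prod (fun i j => β i ^ j) = (dv.prod (fun i j => β i ^ j)) ^ q * md.prod (fun i j => β i ^ j) := by
        conv_lhs => rw [hsum]
        rw [Finsupp.prod_add_index' (by simp) (by intros; rw [pow_add]), Finsupp.prod_of_support_subset (q • dv) (s := dv.support) Finsupp.support_smul _ (by simp)]
        congr 1
        rw [Finsupp.prod, ← Finset.prod_pow]
        refine Finset.prod_congr rfl fun i _ => ?_
        rw [Finsupp.smul_apply, smul_eq_mul, mul_comm, pow_mul]
      refine ⟨{md}, fun _ => w * WittVector.teichmuller p (dv.prod (fun i j => β i ^ j)), ?_, ?_⟩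
      · intro e he i
        rw [Finset.mem_singleton.mp he, hmd]
        exact Nat.mod_lt _ (pow_pos hp.out.pos _)
      · rw [Finset.sum_singleton, hprod, map_mul, WittVector.ghostComponent_teichmuller, mul_assoc]
  obtain ⟨s, g, hs, rfl⟩ := h1
  choose v hv using fun e => ghost_decomp p n (g e)
  refine ⟨s, fun e => (g e).coeff 0, ∑ e ∈ s, WittVector.ghostComponent n (v e) * e.prod (fun i j => β i ^ j), hs, ?_, ?_⟩
  · exact sum_mem fun e _ => DD_gen p β n _ e
  · rw [Finset.mul_sum, ← Finset.sum_add_distrib]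
    refine Finset.sum_congr rfl fun e _ => ?_
    rw [hv]
    ring

theorem DD_map {S A σ τ : Type*} [CommRing S] [CommRing A] (p : ℕ) [Fact p.Prime] (β : σ → S) (γ : τ → A) (f : S →+* A)
    (j : σ → τ) (hj : ∀ i, f (β i) = γ (j i)) (n : ℕ) {x : S} (hx : x ∈ DD p β n) : f x ∈ DD p γ n := by
  refine DD_induction p β n (P := fun x => f x ∈ DD p γ n) (fun x y hx hy => by rw [map_add]; exact add_mem hx hy) (fun w e => ?_) hx
  rw [map_mul]
  refine mul_mem ?_ ?_
  · have : f (WittVector.ghostComponent n w) = WittVector.ghostComponent n (WittVector.map f w) := by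
      rw [WittVector.ghostComponent_apply, WittVector.ghostComponent_apply]
      simp only [MvPolynomial.aeval_def, MvPolynomial.hom_eval₂]
      congr 1
      exact RingHom.ext_int _ _
    rw [this]
    exact DD_ghost p γ n _
  · rw [Finsupp.prod, map_prod]
    refine prod_mem fun i _ => ?_
    rw [map_pow, hj]
    exact pow_mem (DD_beta p γ n _) _

section
variable {S σ : Type*} [CommRing S] [IsLocalRing S] (p : ℕ) [hp : Fact p.Prime] (β : σ → S)

/-- The coefficient ring. -/
noncomputable def CC : Subring S where
  carrier := {x | ∀ n, ∃ d ∈ DD p β n, x - d ∈ maximalIdeal S ^ (n + 1)}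
  mul_mem' := by
    intro x y hx hy n
    obtain ⟨d, hd, h⟩ := hx n
    obtain ⟨d', hd', h'⟩ := hy n
    refine ⟨d * d', mul_mem hd hd', ?_⟩
    have : x * y - d * d' = x * (y - d') + (x - d) * d' := by ring
    rw [this]
    exact add_mem (Ideal.mul_mem_left _ _ h') (Ideal.mul_mem_right _ _ h)
  one_mem' := fun n => ⟨1, one_mem _, by simp⟩
  add_mem' := by
    intro x y hx hy n
    obtain ⟨d, hd, h⟩ := hx n
    obtain ⟨d', hd', h'⟩ := hy n
    refine ⟨d + d', add_mem hd hd', ?_⟩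
    have : x + y - (d + d') = (x - d) + (y - d') := by ring
    rw [this]
    exact add_mem h h'
  zero_mem' := fun n => ⟨0, zero_mem _, by simp⟩
  neg_mem' := by
    intro x hx n
    obtain ⟨d, hd, h⟩ := hx n
    refine ⟨-d, neg_mem hd, ?_⟩
    have : -x - -d = -(x - d) := by ring
    rw [this]
    exact neg_mem h

theorem mem_CC {x : S} : x ∈ CC p β ↔ ∀ n, ∃ d ∈ DD p β n, x - d ∈ maximalIdeal S ^ (n + 1) := Iff.rfl

variable {p β}
variable [CharP (ResidueField S) p]

theorem p_mem_max {S : Type*} [CommRing S] [IsLocalRing S] (p : ℕ) [CharP (ResidueField S) p] : (p : S) ∈ maximalIdeal S := by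
  rw [← residue_eq_zero_iff, map_natCast]
  exact CharP.cast_eq_zero _ _

theorem DD_surj (hgen : ∀ x : ResidueField S, x ∈ Subring.closure (Set.range (fun y : ResidueField S => y ^ p) ∪ Set.range (fun i => residue S (β i))))
    (n : ℕ) (x : S) : ∃ d ∈ DD p β n, x - d ∈ maximalIdeal S := by
  have h1 := gen_pow p _ hgen n (residue S x)
  have h2 : Subring.closure (Set.range (fun y : ResidueField S => y ^ p ^ n) ∪ Set.range (fun i => residue S (β i))) ≤ (DD p β n).map (residue S) := by
    rw [Subring.closure_le]
    rintro _ (⟨w, rfl⟩ | ⟨i, rfl⟩)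
    · obtain ⟨w, rfl⟩ := residue_surjective w
      refine ⟨w ^ p ^ n, ?_, by simp⟩
      rw [← WittVector.ghostComponent_teichmuller p]
      exact DD_ghost p β n _
    · exact ⟨β i, DD_beta p β n i, rfl⟩
  obtain ⟨d, hd, hdx⟩ := h2 h1
  refine ⟨d, hd, ?_⟩
  rw [← residue_eq_zero_iff, map_sub, hdx, sub_self]

theorem DD_inter (hind : PI p (fun i => residue S (β i))) (n : ℕ) {x : S} (hx : x ∈ DD p β (n + 1)) (hxm : x ∈ maximalIdeal S) :
    ∃ d ∈ DD p β n, x - p * d ∈ maximalIdeal S ^ (n + 2) := by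
  obtain ⟨s, a, d, hs, hd, rfl⟩ := DD_normal p β n hx
  refine ⟨d, hd, ?_⟩
  rw [add_sub_cancel_right]
  refine sum_mem fun e he => Ideal.mul_mem_right _ _ ?_
  have h1 := PI.pow p hind (n + 1) s hs (fun e => residue S (a e)) (by
    have h2 := (residue_eq_zero_iff _).mpr hxm
    rw [map_add, map_mul, map_natCast, CharP.cast_eq_zero, zero_mul, add_zero] at h2
    rw [← h2, map_sum]
    refine Finset.sum_congr rfl fun e _ => ?_
    rw [map_mul, map_pow]
    congr 1
    simp [Finsupp.prod]) e he
  rw [residue_eq_zero_iff] at h1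
  refine Ideal.pow_le_pow_right ?_ (Ideal.pow_mem_pow h1 _)
  have := Nat.lt_pow_self hp.out.one_lt (n := n + 1)
  omega

theorem DD_lift (hind : PI p (fun i => residue S (β i)))
    (hgen : ∀ x : ResidueField S, x ∈ Subring.closure (Set.range (fun y : ResidueField S => y ^ p) ∪ Set.range (fun i => residue S (β i))))
    (n : ℕ) {x : S} (hx : x ∈ DD p β n) : ∃ d ∈ DD p β (n + 1), x - d ∈ maximalIdeal S ^ (n + 1) := by
  induction n generalizing x with
  | zero => simpa using DD_surj hgen 1 x
  | succ n ih =>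
    obtain ⟨y, hy, hxy⟩ := DD_surj hgen (n + 2) x
    obtain ⟨d, hd, hdx⟩ := DD_inter hind n (sub_mem hx (DD_anti p β _ hy)) hxy
    obtain ⟨d', hd', hdd⟩ := ih hd
    refine ⟨y + p * d', add_mem hy (DD_p_mul p β _ hd'), ?_⟩
    have : x - (y + p * d') = (x - y - p * d) + p * (d - d') := by ring
    rw [this]
    refine add_mem hdx ?_
    rw [pow_succ' _ (n + 1)]
    exact Ideal.mul_mem_mul (p_mem_max p) hdd

end

theorem exists_lim {R : Type*} [CommRing R] (I : Ideal R) [IsPrecomplete I R] (a : ℕ) (u : ℕ → R)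
    (hu : ∀ n, u (n + 1) - u n ∈ I ^ (n + a)) : ∃ L, ∀ n, L - u n ∈ I ^ (n + a) := by
  have h1 : ∀ i j, u (i + j) - u i ∈ I ^ (i + a) := by
    intro i j
    induction j with
    | zero => simp
    | succ j ih =>
      have : u (i + (j + 1)) - u i = (u (i + j + 1) - u (i + j)) + (u (i + j) - u i) := by
        rw [← add_assoc]; ring
      rw [this]
      exact add_mem (Ideal.pow_le_pow_right (by omega) (hu (i + j))) ih
  obtain ⟨L, hL⟩ := IsPrecomplete.prec (I := I) (M := R) inferInstance (f := fun i => u (i - a)) (by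
    intro m n hmn
    rw [SModEq.sub_mem, smul_eq_mul, Ideal.mul_top, ← neg_mem_iff, neg_sub]
    by_cases hm : m ≤ a
    · have := h1 (m - a) (n - a - (m - a))
      rw [show m - a + (n - a - (m - a)) = n - a by omega] at this
      exact Ideal.pow_le_pow_right (by omega) this
    · have := h1 (m - a) (n - m)
      rw [show m - a + (n - m) = n - a by omega, show m - a + a = m by omega] at this
      exact this)
  refine ⟨L, fun n => ?_⟩
  have := hL (n + a)
  rw [SModEq.sub_mem, smul_eq_mul, Ideal.mul_top, ← neg_mem_iff, neg_sub, Nat.add_sub_cancel] at this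
  exact this

theorem eq_zero_of_forall_pow {R : Type*} [CommRing R] (I : Ideal R) [IsHausdorff I R] (x : R) (hx : ∀ n, x ∈ I ^ n) : x = 0 := by
  refine IsHausdorff.haus (I := I) inferInstance x fun n => ?_
  rw [SModEq.zero, smul_eq_mul, Ideal.mul_top]
  exact hx n

theorem CC_closed {S σ : Type*} [CommRing S] [IsLocalRing S] {p : ℕ} [hp : Fact p.Prime] {β : σ → S} {x : S} (h : ∀ n, ∃ c ∈ CC p β, x - c ∈ maximalIdeal S ^ (n + 1)) : x ∈ CC p β := by
  intro n
  obtain ⟨c, hc, hx⟩ := h n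
  obtain ⟨d, hd, hcd⟩ := hc n
  refine ⟨d, hd, ?_⟩
  rw [← sub_add_sub_cancel x c d]
  exact add_mem hx hcd

theorem DD_le {S σ : Type*} [CommRing S] {p : ℕ} [hp : Fact p.Prime] {β : σ → S} (n j : ℕ) : DD p β (n + j) ≤ DD p β n := by
  induction j with
  | zero => exact le_rfl
  | succ j ih => exact (DD_anti p β (n + j)).trans ih

section
variable {S σ : Type*} [CommRing S] [IsLocalRing S] [IsAdicComplete (maximalIdeal S) S] {p : ℕ} [hp : Fact p.Prime] {β : σ → S}
  [CharP (ResidueField S) p]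

theorem CC_lift (hind : PI p (fun i => residue S (β i)))
    (hgen : ∀ x : ResidueField S, x ∈ Subring.closure (Set.range (fun y : ResidueField S => y ^ p) ∪ Set.range (fun i => residue S (β i))))
    (n : ℕ) {x : S} (hx : x ∈ DD p β n) : ∃ c ∈ CC p β, x - c ∈ maximalIdeal S ^ (n + 1) := by
  choose g hg hg' using fun (j : ℕ) (y : DD p β j) => DD_lift hind hgen j y.2
  let u : (j : ℕ) → DD p β (n + j) := fun j => Nat.rec (motive := fun j => DD p β (n + j)) ⟨x, hx⟩ (fun j y => ⟨g (n + j) y, hg (n + j) y⟩) j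
  have hu : ∀ j, ((u (j + 1) : S) - u j) ∈ maximalIdeal S ^ (j + (n + 1)) := by
    intro j
    have := hg' (n + j) (u j)
    rw [← neg_mem_iff, neg_sub]
    convert! this using 2
    omega
  obtain ⟨L, hL⟩ := exists_lim (maximalIdeal S) (n + 1) (fun j => (u j : S)) hu
  refine ⟨L, fun i => ?_, ?_⟩
  · by_cases hi : n ≤ i
    · obtain ⟨j, rfl⟩ := Nat.exists_eq_add_of_le hi
      refine ⟨u j, (u j).2, ?_⟩
      have := hL j
      rwa [show n + j + 1 = j + (n + 1) by omega]
    · obtain ⟨j, rfl⟩ := Nat.exists_eq_add_of_le (show i ≤ n by omega)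
      refine ⟨x, DD_le i j hx, Ideal.pow_le_pow_right (by omega) (hL 0)⟩
  · have := hL 0
    rw [← neg_mem_iff, neg_sub]
    rw [zero_add] at this
    exact this

theorem CC_surj (hind : PI p (fun i => residue S (β i)))
    (hgen : ∀ x : ResidueField S, x ∈ Subring.closure (Set.range (fun y : ResidueField S => y ^ p) ∪ Set.range (fun i => residue S (β i))))
    (x : S) : ∃ c ∈ CC p β, x - c ∈ maximalIdeal S := by
  have := CC_lift hind hgen 0 (x := x) (by
    have := DD_ghost p β 0 (WittVector.teichmuller p x)
    rwa [WittVector.ghostComponent_teichmuller, pow_zero, pow_one] at this)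
  simpa using this

theorem CC_inter (hind : PI p (fun i => residue S (β i)))
    (hgen : ∀ x : ResidueField S, x ∈ Subring.closure (Set.range (fun y : ResidueField S => y ^ p) ∪ Set.range (fun i => residue S (β i))))
    {x : S} (hx : x ∈ CC p β) (hxm : x ∈ maximalIdeal S) (n : ℕ) : ∃ c ∈ CC p β, x - p * c ∈ maximalIdeal S ^ (n + 2) := by
  obtain ⟨d, hd, h1⟩ := hx (n + 1)
  have hdm : d ∈ maximalIdeal S := by
    have := sub_mem hxm (Ideal.pow_le_self (by omega) h1)
    rwa [sub_sub_cancel] at this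
  obtain ⟨d', hd', h2⟩ := DD_inter hind n hd hdm
  obtain ⟨c, hc, h3⟩ := CC_lift hind hgen n hd'
  refine ⟨c, hc, ?_⟩
  have : x - p * c = (x - d) + (d - p * d') + p * (d' - c) := by ring
  rw [this]
  refine add_mem (add_mem h1 h2) ?_
  rw [pow_succ' _ (n + 1)]
  exact Ideal.mul_mem_mul (p_mem_max p) h3

theorem CC_p [IsNoetherianRing S] (hind : PI p (fun i => residue S (β i)))
    (hgen : ∀ x : ResidueField S, x ∈ Subring.closure (Set.range (fun y : ResidueField S => y ^ p) ∪ Set.range (fun i => residue S (β i))))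
    (hS : (p : S) = 0 ∨ ∀ x : S, p * x = 0 → x = 0) {x : S} (hx : x ∈ CC p β) (hxm : x ∈ maximalIdeal S) :
    ∃ c ∈ CC p β, x = p * c := by
  have key := CC_inter hind hgen hx hxm
  rcases hS with h0 | h0
  · refine ⟨0, zero_mem _, ?_⟩
    rw [mul_zero]
    refine eq_zero_of_forall_pow (maximalIdeal S) x fun n => ?_
    obtain ⟨c, -, hc⟩ := key n
    rw [h0, zero_mul, sub_zero] at hc
    exact Ideal.pow_le_pow_right (by omega) hc
  · choose c hc hxc using key
    obtain ⟨a, ha⟩ := Ideal.exists_pow_inf_eq_pow_smul (maximalIdeal S) (Ideal.span {(p : S)} : Submodule S S)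
    have hAR : ∀ n z, (p : S) * z ∈ maximalIdeal S ^ (n + a) → z ∈ maximalIdeal S ^ n := by
      intro n z hz
      have h1 : (p : S) * z ∈ (maximalIdeal S ^ (n + a) • ⊤ ⊓ (Ideal.span {(p : S)}) : Submodule S S) := by
        refine ⟨?_, Ideal.mul_mem_right _ _ (Ideal.mem_span_singleton_self _)⟩
        simpa using hz
      rw [ha (n + a) (by omega), Nat.add_sub_cancel] at h1
      have h2 := Submodule.smul_mono (le_refl (maximalIdeal S ^ n)) (inf_le_right : (maximalIdeal S ^ a • ⊤ ⊓ (Ideal.span {(p : S)}) : Submodule S S) ≤ Ideal.span {(p : S)}) h1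
      rw [smul_eq_mul, mul_comm, Ideal.mem_span_singleton_mul] at h2
      obtain ⟨w, hw, hpw⟩ := h2
      have := h0 (w - z) (by rw [mul_sub, hpw, sub_self])
      rw [sub_eq_zero] at this
      rwa [← this]
    have hcauchy : ∀ n, c (n + 1 + a) - c (n + a) ∈ maximalIdeal S ^ (n + 1) := by
      intro n
      apply hAR
      have : (p : S) * (c (n + 1 + a) - c (n + a)) = (x - p * c (n + a)) - (x - p * c (n + 1 + a)) := by ring
      rw [this]
      exact sub_mem (Ideal.pow_le_pow_right (by omega) (hxc _)) (Ideal.pow_le_pow_right (by omega) (hxc _))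
    obtain ⟨L, hL⟩ := exists_lim (maximalIdeal S) 1 (fun n => c (n + a)) hcauchy
    refine ⟨L, CC_closed fun n => ⟨_, hc (n + a), hL n⟩, ?_⟩
    rw [← sub_eq_zero]
    refine eq_zero_of_forall_pow (maximalIdeal S) _ fun n => ?_
    have : x - p * L = (x - p * c (n + a)) - p * (L - c (n + a)) := by ring
    rw [this]
    exact sub_mem (Ideal.pow_le_pow_right (by omega) (hxc _)) (Ideal.mul_mem_left _ _ (Ideal.pow_le_pow_right (by omega) (hL n)))

theorem CC_complete : IsAdicComplete (Ideal.span {(p : CC p β)}) (CC p β) := by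
  have hpm : (p : S) ∈ maximalIdeal S := p_mem_max p
  have hlim : ∀ u : ℕ → CC p β, (∀ n, ((u (n + 1) : S) - u n) ∈ maximalIdeal S ^ n) → ∃ L : CC p β, ∀ n, (L : S) - u n ∈ maximalIdeal S ^ n := by
    intro u hu
    obtain ⟨L, hL⟩ := exists_lim (maximalIdeal S) 0 (fun n => (u n : S)) hu
    exact ⟨⟨L, CC_closed fun n => ⟨_, (u (n + 1)).2, hL (n + 1)⟩⟩, hL⟩
  have hdvd : ∀ (x : CC p β) n, (p : CC p β) ^ n ∣ x → (x : S) ∈ maximalIdeal S ^ n := by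
    rintro _ n ⟨y, rfl⟩
    push_cast
    exact Ideal.mul_mem_right _ _ (Ideal.pow_mem_pow hpm _)
  refine { haus' := fun x hx => ?_, prec' := fun u hu => ?_ }
  · apply Subtype.ext
    refine eq_zero_of_forall_pow (maximalIdeal S) _ fun n => hdvd x n ?_
    exact (mem_span_pow _ _ _).mp (hx n)
  · have h1 : ∀ n, (p : CC p β) ^ n ∣ u (n + 1) - u n := by
      intro n
      rw [← mem_span_pow, SModEq.zero, ← neg_mem_iff, neg_sub, ← SModEq.sub_mem]
      exact hu (Nat.le_succ n)
    obtain ⟨L, hL⟩ := hlim u fun n => by simpa using hdvd _ _ (h1 n)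
    refine ⟨L, fun n => ?_⟩
    choose t ht using h1
    obtain ⟨s, hs⟩ := hlim (fun j => ∑ i ∈ Finset.range j, (p : CC p β) ^ i * t (n + i)) fun j => by
      rw [Finset.sum_range_succ]
      push_cast
      rw [add_sub_cancel_left]
      exact Ideal.mul_mem_right _ _ (Ideal.pow_mem_pow hpm _)
    rw [SModEq.sub_mem, ← neg_mem_iff, neg_sub, ← SModEq.zero, mem_span_pow]
    refine ⟨s, ?_⟩
    have h2 : ∀ j, u (n + j) - u n = (p : CC p β) ^ n * ∑ i ∈ Finset.range j, (p : CC p β) ^ i * t (n + i) := by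
      intro j
      induction j with
      | zero => simp
      | succ j ih =>
        rw [Finset.sum_range_succ, mul_add, ← ih, ← mul_assoc, ← pow_add, ← ht (n + j), ← add_assoc]
        ring
    apply Subtype.ext
    rw [← sub_eq_zero]
    refine eq_zero_of_forall_pow (maximalIdeal S) _ fun j => ?_
    have h3 : ((u (n + j) : S) - u n) = (p : S) ^ n * ((∑ i ∈ Finset.range j, (p : CC p β) ^ i * t (n + i) : CC p β) : S) := by
      have := congrArg (Subtype.val) (h2 j)
      push_cast at this ⊢
      exact this
    have h4 : (((L - u n : CC p β) : S) - ((p ^ n * s : CC p β) : S)) = (L - u (n + j)) - (p : S) ^ n * (s - ((∑ i ∈ Finset.range j, (p : CC p β) ^ i * t (n + i) : CC p β) : S)) := by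
      rw [mul_sub, ← h3]
      push_cast
      ring
    rw [h4]
    exact sub_mem (Ideal.pow_le_pow_right (by omega) (hL (n + j))) (Ideal.mul_mem_left _ _ (hs j))

end

/-- `C` is a coefficient ring of `S`, with uniformizer `p`. -/
structure IsCoeff {S : Type*} [CommRing S] [IsLocalRing S] (p : ℕ) (C : Subring S) : Prop where
  surj : ∀ x : S, ∃ c ∈ C, x - c ∈ maximalIdeal S
  inter : ∀ x ∈ C, x ∈ maximalIdeal S → ∃ c ∈ C, x = p * c
  complete : IsAdicComplete (Ideal.span {(p : C)}) C

theorem coeff_exists_p {S A : Type u} [CommRing S] [CommRing A] [IsLocalRing S] [IsLocalRing A] [IsNoetherianRing S] [IsNoetherianRing A]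
    [IsAdicComplete (maximalIdeal S) S] [IsAdicComplete (maximalIdeal A) A] [Algebra S A] [IsLocalHom (algebraMap S A)]
    (p : ℕ) [hp : Fact p.Prime] [CharP (ResidueField S) p]
    (hk : ∀ (F : Type u) [Field F] [Algebra (ResidueField S) F], IsReduced (ResidueField A ⊗[ResidueField S] F))
    (hS : (p : S) = 0 ∨ ∀ x : S, p * x = 0 → x = 0) (hA : (p : A) = 0 ∨ ∀ x : A, p * x = 0 → x = 0) :
    ∃ (C : Subring S) (C' : Subring A), IsCoeff p C ∧ IsCoeff p C' ∧ C ≤ C'.comap (algebraMap S A) := by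
  classical
  haveI : CharP (ResidueField A) p := charP_of_injective_algebraMap (algebraMap (ResidueField S) (ResidueField A)).injective p
  obtain ⟨B, -, hB, hBmax⟩ := PInd.exists_maximal (K := ResidueField S) p ∅ (by
    have := PI.pInd (K := ResidueField S) (q := p) (b := (fun i : PEmpty.{1} => i.elim)) (fun i => i.elim) (by
      intro s hs c hc e he
      have hz : ∀ e : PEmpty.{1} →₀ ℕ, e = 0 := fun e => Subsingleton.elim _ _
      have : s = {0} := by
        ext x
        rw [Finset.mem_singleton]
        refine ⟨fun _ => hz x, fun h => ?_⟩
        rw [h, ← hz e]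
        exact he
      rw [this] at hc
      rw [hz e]
      simpa [hp.out.ne_zero] using hc)
    rwa [Set.range_eq_empty] at this)
  have hBpi := hB.pi hp.out.pos
  have hB1 : PInd p (Set.range fun b : B => algebraMap (ResidueField S) (ResidueField A) b) := by
    refine PI.pInd ((algebraMap (ResidueField S) (ResidueField A)).injective.comp Subtype.val_injective) ?_
    have := PI.baseChange (k := ResidueField S) (k' := ResidueField A) p 1 hk (b := ((↑) : B → ResidueField S)) (by rwa [pow_one])
    rwa [pow_one] at this
  obtain ⟨B', hBB', hB', hBmax'⟩ := PInd.exists_maximal (K := ResidueField A) p _ hB1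
  have hlift : ∀ b : B, ∃ x : S, residue S x = b := fun b => residue_surjective _
  choose β hβ using hlift
  have hlift' : ∀ b : B', ∃ x : A, residue A x = b ∧ ∀ a : B, algebraMap (ResidueField S) (ResidueField A) a = b → algebraMap S A (β a) = x := by
    intro b
    by_cases h : ∃ a : B, algebraMap (ResidueField S) (ResidueField A) a = b
    · obtain ⟨a, ha⟩ := h
      refine ⟨algebraMap S A (β a), ?_, fun a' ha' => ?_⟩
      · rw [← ha, ← hβ]
        rfl
      · have : a' = a := Subtype.ext ((algebraMap (ResidueField S) (ResidueField A)).injective (ha'.trans ha.symm))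
        rw [this]
    · obtain ⟨x, hx⟩ := residue_surjective (R := A) (b : ResidueField A)
      exact ⟨x, hx, fun a ha => absurd ⟨a, ha⟩ h⟩
  choose γ hγ hγβ using hlift'
  have e1 : (fun i => residue S (β i)) = ((↑) : B → ResidueField S) := funext hβ
  have e2 : (fun i => residue A (γ i)) = ((↑) : B' → ResidueField A) := funext hγ
  have i1 : PI p (fun i => residue S (β i)) := by rw [e1]; exact hBpi
  have i2 : PI p (fun i => residue A (γ i)) := by rw [e2]; exact hB'.pi hp.out.pos
  have g1 := PInd.gen p B hB hBmax
  have g2 := PInd.gen p B' hB' hBmax'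
  rw [show B = Set.range (fun i => residue S (β i)) by rw [e1, Subtype.range_coe]] at g1
  rw [show B' = Set.range (fun i => residue A (γ i)) by rw [e2, Subtype.range_coe]] at g2
  refine ⟨CC p β, CC p γ, ⟨CC_surj i1 g1, fun x hx hxm => CC_p i1 g1 hS hx hxm, CC_complete⟩,
    ⟨CC_surj i2 g2, fun x hx hxm => CC_p i2 g2 hA hx hxm, CC_complete⟩, ?_⟩
  intro x hx n
  obtain ⟨d, hd, hxd⟩ := hx n
  refine ⟨algebraMap S A d, DD_map p β γ (algebraMap S A) (fun a => ⟨algebraMap _ _ (a : ResidueField S), hBB' ⟨a, rfl⟩⟩)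
    (fun a => hγβ _ a rfl) n hd, ?_⟩
  rw [← map_sub]
  have h1 := Ideal.mem_map_of_mem (algebraMap S A) hxd
  rw [Ideal.map_pow] at h1
  refine Ideal.pow_right_mono (Ideal.map_le_iff_le_comap.mpr fun y hy => ?_) _ h1
  exact map_nonunit (algebraMap S A) y hy

theorem coeff_zorn {S : Type*} [CommRing S] [IsLocalRing S] (C₀ : Subring S) (h₀ : ∀ x ∈ C₀, x ∈ maximalIdeal S → x = 0) :
    ∃ C : Subring S, C₀ ≤ C ∧ (∀ x ∈ C, x ∈ maximalIdeal S → x = 0) ∧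
      ∀ D : Subring S, C ≤ D → (∀ x ∈ D, x ∈ maximalIdeal S → x = 0) → D ≤ C := by
  obtain ⟨C, hC, hmax⟩ := zorn_le_nonempty₀ {C : Subring S | ∀ x ∈ C, x ∈ maximalIdeal S → x = 0} (by
    intro c hc hch y hy
    refine ⟨sSup c, ?_, fun z hz => le_sSup hz⟩
    intro x hx hxm
    rw [Subring.mem_sSup_of_directedOn ⟨y, hy⟩ hch.directedOn] at hx
    obtain ⟨s, hs, hxs⟩ := hx
    exact hc hs x hxs hxm) C₀ h₀
  exact ⟨C, hC, hmax.prop, fun D hD h => hmax.le_of_ge h hD⟩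

theorem coeff_max {S : Type*} [CommRing S] [IsLocalRing S] [CharZero (ResidueField S)] [HenselianLocalRing S] (C : Subring S)
    (hC : ∀ x ∈ C, x ∈ maximalIdeal S → x = 0)
    (hmax : ∀ D : Subring S, C ≤ D → (∀ x ∈ D, x ∈ maximalIdeal S → x = 0) → D ≤ C) (x : S) :
    ∃ c ∈ C, x - c ∈ maximalIdeal S := by
  classical
  have key : ∀ a : S, (∀ f : Polynomial C, Polynomial.aeval a f ∈ maximalIdeal S → Polynomial.aeval a f = 0) → a ∈ C := by
    intro a ha
    refine hmax (Polynomial.aeval (R := C) a).range.toSubring ?_ ?_ ?_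
    · intro c hc
      exact ⟨Polynomial.C ⟨c, hc⟩, by simp; rfl⟩
    · rintro _ ⟨f, rfl⟩ hf
      exact ha f hf
    · exact ⟨Polynomial.X, by simp⟩
  have hinv : ∀ c : C, c ≠ 0 → ∃ d : C, d * c = 1 := by
    intro c hc
    have hu : IsUnit (c : S) := by
      by_contra h
      exact hc (Subtype.ext (hC c c.2 h))
    obtain ⟨v, hv⟩ := hu.exists_left_inv
    have hvC : v ∈ C := by
      refine key v fun f hf => ?_
      have h1 : (c : S) ^ f.natDegree * Polynomial.aeval v f ∈ C := by
        rw [Polynomial.aeval_eq_sum_range, Finset.mul_sum]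
        refine sum_mem fun i hi => ?_
        have hi' : i ≤ f.natDegree := by
          have := Finset.mem_range.mp hi
          omega
        have : (c : S) ^ f.natDegree * f.coeff i • v ^ i = c ^ (f.natDegree - i) * f.coeff i := by
          rw [← Nat.sub_add_cancel hi', pow_add, Nat.add_sub_cancel, Algebra.smul_def]
          have h2 : (c : S) ^ i * v ^ i = 1 := by rw [← mul_pow, mul_comm, hv, one_pow]
          change (c : S) ^ (f.natDegree - i) * c ^ i * ((f.coeff i : S) * v ^ i) = _
          linear_combination (c : S) ^ (f.natDegree - i) * (f.coeff i : S) * h2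
        rw [this]
        exact mul_mem (pow_mem c.2 _) (f.coeff i).2
      have h2 := hC _ h1 (Ideal.mul_mem_left _ _ hf)
      exact (hu.pow _).mul_right_eq_zero.mp h2
    exact ⟨⟨v, hvC⟩, Subtype.ext hv⟩
  have hchar : ∀ n : ℕ, n ≠ 0 → ∀ c : C, n • c = 0 → c = 0 := by
    intro n hn c h
    have hu : IsUnit (n : S) := by
      by_contra h
      have := (residue_eq_zero_iff (n : S)).mpr h
      rw [map_natCast] at this
      exact hn (by exact_mod_cast this)
    have h1 := congrArg (Subtype.val) h
    apply Subtype.ext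
    refine hu.mul_right_eq_zero.mp ?_
    rw [← nsmul_eq_mul]
    simpa using h1
  by_cases hx : ∃ f : Polynomial C, f ≠ 0 ∧ Polynomial.aeval x f ∈ maximalIdeal S
  swap
  · push Not at hx
    refine ⟨x, key x fun f hf => ?_, by simp⟩
    by_cases h : f = 0
    · simp [h]
    · exact absurd hf (hx f h)
  have hex : ∃ n : ℕ, ∃ f : Polynomial C, f ≠ 0 ∧ Polynomial.aeval x f ∈ maximalIdeal S ∧ f.natDegree = n := by
    obtain ⟨f, h1, h2⟩ := hx
    exact ⟨_, f, h1, h2, rfl⟩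
  obtain ⟨f₀, hf₀, hf₀x, hdeg⟩ := Nat.find_spec hex
  have hmin : ∀ g : Polynomial C, g ≠ 0 → Polynomial.aeval x g ∈ maximalIdeal S → f₀.natDegree ≤ g.natDegree := by
    intro g hg hgx
    rw [hdeg]
    exact Nat.find_min' hex ⟨g, hg, hgx, rfl⟩
  obtain ⟨d, hd⟩ := hinv f₀.leadingCoeff (Polynomial.leadingCoeff_ne_zero.mpr hf₀)
  obtain ⟨f, hf⟩ : ∃ f, f = Polynomial.C d * f₀ := ⟨_, rfl⟩
  have hfm : f.Monic := by
    rw [hf, mul_comm]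
    exact Polynomial.monic_mul_C_of_leadingCoeff_mul_eq_one (by rw [mul_comm]; exact hd)
  have hfx : Polynomial.aeval x f ∈ maximalIdeal S := by
    rw [hf, map_mul]
    exact Ideal.mul_mem_left _ _ hf₀x
  have hdegf : f.natDegree ≤ f₀.natDegree := by
    rw [hf]
    exact Polynomial.natDegree_C_mul_le _ _
  have hmin' : ∀ g : Polynomial C, g.degree < f.degree → Polynomial.aeval x g ∈ maximalIdeal S → g = 0 := by
    intro g hg hgx
    by_contra hg0
    have h1 := hmin g hg0 hgx
    have h2 := Polynomial.natDegree_lt_natDegree hg0 hg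
    omega
  have hder : IsUnit (Polynomial.aeval x (Polynomial.derivative f)) := by
    by_contra h
    have h1 := hmin' _ (Polynomial.degree_derivative_lt hfm.ne_zero) h
    have hpos : 0 < f.natDegree := by
      by_contra h0
      have h3 := Polynomial.eq_one_of_monic_natDegree_zero hfm (by omega)
      rw [h3, map_one] at hfx
      exact (Ideal.ne_top_iff_one _).mp (Ideal.IsPrime.ne_top inferInstance) hfx
    have h2 := congrArg (fun q => Polynomial.coeff q (f.natDegree - 1)) h1
    simp only [Polynomial.coeff_derivative, Polynomial.coeff_zero] at h2
    rw [Nat.sub_add_cancel hpos, hfm.coeff_natDegree, one_mul] at h2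
    have h3 := hchar f.natDegree (by omega) 1 (by
      rw [nsmul_eq_mul, mul_one]
      have : ((f.natDegree - 1 : ℕ) : C) + 1 = ((f.natDegree - 1 + 1 : ℕ) : C) := by push_cast; ring
      rw [this, Nat.sub_add_cancel hpos] at h2
      exact h2)
    exact one_ne_zero h3
  obtain ⟨a, ha, hax⟩ := HenselianLocalRing.is_henselian (f.map (algebraMap C S)) (hfm.map _) x (by
    rwa [Polynomial.eval_map_algebraMap]) (by
    rwa [Polynomial.derivative_map, Polynomial.eval_map_algebraMap])
  refine ⟨a, key a fun g hg => ?_, by rw [← neg_sub]; exact neg_mem hax⟩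
  have h0 : Polynomial.aeval a f = 0 := by
    rwa [Polynomial.IsRoot.def, Polynomial.eval_map_algebraMap] at ha
  have h1 : Polynomial.aeval a g = Polynomial.aeval a (g %ₘ f) := by
    conv_lhs => rw [← Polynomial.modByMonic_add_div g f]
    rw [map_add, map_mul, h0, zero_mul, add_zero]
  have h2 : Polynomial.aeval x (g %ₘ f) ∈ maximalIdeal S := by
    have h3 : Polynomial.aeval a (g %ₘ f) - Polynomial.aeval x (g %ₘ f) ∈ maximalIdeal S := by
      rw [← Polynomial.eval_map_algebraMap, ← Polynomial.eval_map_algebraMap]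
      obtain ⟨t, ht⟩ := Polynomial.sub_dvd_eval_sub a x ((g %ₘ f).map (algebraMap C S))
      rw [ht]
      exact Ideal.mul_mem_right _ _ hax
    rw [h1] at hg
    have := sub_mem hg h3
    rwa [sub_sub_cancel] at this
  rw [h1, hmin' _ (Polynomial.degree_modByMonic_lt _ hfm) h2, map_zero]

theorem isCoeff_zero {S : Type*} [CommRing S] [IsLocalRing S] (C : Subring S) (h : ∀ x ∈ C, x ∈ maximalIdeal S → x = 0)
    (h' : ∀ x : S, ∃ c ∈ C, x - c ∈ maximalIdeal S) : IsCoeff 0 C := by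
  refine ⟨h', fun x hx hm => ⟨0, zero_mem _, by simpa using h x hx hm⟩, ?_⟩
  rw [Nat.cast_zero, Ideal.span_singleton_eq_bot.mpr rfl]
  infer_instance

theorem coeff_exists_zero {S A : Type u} [CommRing S] [CommRing A] [IsLocalRing S] [IsLocalRing A]
    [IsAdicComplete (maximalIdeal S) S] [IsAdicComplete (maximalIdeal A) A] [Algebra S A] [IsLocalHom (algebraMap S A)]
    [CharZero (ResidueField S)] :
    ∃ (C : Subring S) (C' : Subring A), IsCoeff 0 C ∧ IsCoeff 0 C' ∧ C ≤ C'.comap (algebraMap S A) := by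
  haveI : CharZero (ResidueField A) := charZero_of_injective_algebraMap (algebraMap (ResidueField S) (ResidueField A)).injective
  haveI : HenselianLocalRing S := ⟨fun f hf a h1 h2 => HenselianRing.is_henselian (I := maximalIdeal S) f hf a h1 (by exact h2.map _)⟩
  haveI : HenselianLocalRing A := ⟨fun f hf a h1 h2 => HenselianRing.is_henselian (I := maximalIdeal A) f hf a h1 (by exact h2.map _)⟩
  obtain ⟨C, -, hC, hm⟩ := coeff_zorn (⊥ : Subring S) (by
    rintro x ⟨n, rfl⟩ hx
    have := (residue_eq_zero_iff _).mpr hx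
    simp only [eq_intCast, map_intCast, Int.cast_eq_zero] at this
    simp [this])
  obtain ⟨C', hCC', hC', hm'⟩ := coeff_zorn (C.map (algebraMap S A)) (by
    rintro _ ⟨x, hx, rfl⟩ h
    rw [hC x hx (by
      by_contra h1
      exact h ((not_not.mp h1 : IsUnit x).map (algebraMap S A))), map_zero])
  exact ⟨C, C', isCoeff_zero C hC (coeff_max C hC hm), isCoeff_zero C' hC' (coeff_max C' hC' hm'), Subring.map_le_iff_le_comap.mp hCC'⟩

theorem mem_span_X {r : ℕ} {U : Type*} [CommRing U] (f : MvPowerSeries (Fin r) U) (hf : MvPowerSeries.constantCoeff f = 0) :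
    f ∈ Ideal.span (Set.range (MvPowerSeries.X : Fin r → MvPowerSeries (Fin r) U)) := by
  classical
  let g : Fin r → MvPowerSeries (Fin r) U := fun i m => if ∀ j < i, m j = 0 then MvPowerSeries.coeff (m + Finsupp.single i 1) f else 0
  have hg : ∀ i m, MvPowerSeries.coeff m (g i) = if ∀ j < i, m j = 0 then MvPowerSeries.coeff (m + Finsupp.single i 1) f else 0 := fun i m => rfl
  have : f = ∑ i, g i * MvPowerSeries.X i := by
    ext n
    rw [map_sum]
    by_cases hn : n = 0
    · subst hn
      rw [Finset.sum_eq_zero, MvPowerSeries.coeff_zero_eq_constantCoeff_apply, hf]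
      intro i _
      rw [MvPowerSeries.coeff_zero_mul_X]
    · have hex : ∃ i, n i ≠ 0 := by
        by_contra h
        push Not at h
        exact hn (Finsupp.ext h)
      have hne : (Finset.univ.filter fun i => n i ≠ 0).Nonempty := by
        obtain ⟨i, hi⟩ := hex
        exact ⟨i, by simpa using hi⟩
      obtain ⟨i, hi, hmin⟩ := Finset.exists_minimal hne
      have hi0 : n i ≠ 0 := by simpa using hi
      have hmin' : ∀ j < i, n j = 0 := by
        intro j hj
        by_contra h
        exact absurd (hmin (y := j) (by simpa using h) hj.le) (not_le.mpr hj)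
      have hterm : ∀ j, MvPowerSeries.coeff n (g j * MvPowerSeries.X j) = if n j ≠ 0 ∧ ∀ l < j, n l = 0 then MvPowerSeries.coeff n f else 0 := by
        intro j
        rw [MvPowerSeries.X_def, MvPowerSeries.coeff_mul_monomial, hg]
        by_cases hj : n j = 0
        · rw [if_neg, if_neg (by tauto)]
          intro h
          have := h j
          rw [hj, Finsupp.single_eq_same] at this
          omega
        · have hle : Finsupp.single j 1 ≤ n := by
            rw [Finsupp.single_le_iff]
            omega
          rw [if_pos hle, tsub_add_cancel_of_le hle, mul_one]
          have : (∀ l < j, (n - Finsupp.single j 1 : Fin r →₀ ℕ) l = 0) ↔ ∀ l < j, n l = 0 := by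
            refine forall₂_congr fun l hl => ?_
            rw [Finsupp.tsub_apply, Finsupp.single_eq_of_ne hl.ne, Nat.sub_zero]
          simp only [this, hj, ne_eq, not_false_eq_true, true_and]
      simp only [hterm]
      rw [Finset.sum_eq_single i, if_pos ⟨hi0, hmin'⟩]
      · intro j _ hji
        rw [if_neg]
        rintro ⟨h1, h2⟩
        rcases lt_or_gt_of_ne hji with h | h
        · exact h1 (hmin' j h)
        · exact hi0 (h2 i h)
      · simp
  rw [this]
  exact sum_mem fun i _ => Ideal.mul_mem_left _ _ (Ideal.subset_span ⟨i, rfl⟩)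

theorem maximalIdeal_power {r : ℕ} {k : Type*} [Field k] :
    maximalIdeal (MvPowerSeries (Fin r) k) = Ideal.span (Set.range MvPowerSeries.X) := by
  refine le_antisymm (fun f hf => mem_span_X f ?_) ?_
  · by_contra h
    exact hf (MvPowerSeries.isUnit_iff_constantCoeff.mpr (isUnit_iff_ne_zero.mpr h))
  · rw [Ideal.span_le]
    rintro _ ⟨i, rfl⟩ h
    rw [MvPowerSeries.isUnit_iff_constantCoeff, MvPowerSeries.constantCoeff_X] at h
    exact not_isUnit_zero h

theorem exists_param {r : ℕ} {k : Type*} [Field k] (f : MvPowerSeries (Fin r) k) (hf : f ≠ 0) (hfu : ¬ IsUnit f) :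
    ∃ (s : ℕ) (z : Fin s → MvPowerSeries (Fin r) k) (N : ℕ), s < r ∧ (∀ i, ¬ IsUnit (z i)) ∧
      maximalIdeal (MvPowerSeries (Fin r) k) ^ N ≤ Ideal.span ({f} ∪ Set.range z) := by
  classical
  haveI : IsDomain (MvPowerSeries (Fin r) k) := NoZeroDivisors.to_isDomain _
  haveI : IsNoetherianRing (MvPowerSeries (Fin r) k) := MvPowerSeries.isNoetherianRing k
  haveI : Nontrivial (MvPowerSeries (Fin r) k ⧸ Ideal.span {f}) := Ideal.Quotient.nontrivial_iff.mpr (by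
    rwa [Ne, Ideal.span_singleton_eq_top])
  haveI : IsLocalRing (MvPowerSeries (Fin r) k ⧸ Ideal.span {f}) := IsLocalRing.of_surjective' (Ideal.Quotient.mk _) Ideal.Quotient.mk_surjective
  obtain ⟨s, hs, hcard⟩ := Ideal.exists_finset_card_eq_height_of_isNoetherianRing (maximalIdeal (MvPowerSeries (Fin r) k ⧸ Ideal.span {f}))
  have hdim : ringKrullDim (MvPowerSeries (Fin r) k ⧸ Ideal.span {f}) + 1 ≤ r := by
    refine (ringKrullDim_quotient_succ_le_of_nonZeroDivisor (mem_nonZeroDivisors_of_ne_zero hf)).trans ?_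
    rw [← IsLocalRing.maximalIdeal_height_eq_ringKrullDim]
    have h1 := Ideal.height_le_spanFinrank (maximalIdeal (MvPowerSeries (Fin r) k)) (Ideal.IsPrime.ne_top inferInstance)
    have h2 : (maximalIdeal (MvPowerSeries (Fin r) k)).spanFinrank ≤ r := by
      rw [maximalIdeal_power]
      refine (Submodule.spanFinrank_span_le_ncard_of_finite (Set.finite_range _)).trans ?_
      rw [← Set.image_univ]
      exact (Set.ncard_image_le Set.finite_univ).trans (by simp)
    have h3 := h1.trans (Nat.cast_le.mpr h2)
    exact_mod_cast h3
  rw [← IsLocalRing.maximalIdeal_height_eq_ringKrullDim, ← hcard] at hdim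
  have hlt : s.card < r := by exact_mod_cast hdim
  have hsle : Ideal.span (s : Set _) ≤ maximalIdeal (MvPowerSeries (Fin r) k ⧸ Ideal.span {f}) := hs.1.2
  have hrad : (Ideal.span (s : Set _)).radical = maximalIdeal (MvPowerSeries (Fin r) k ⧸ Ideal.span {f}) := by
    refine le_antisymm (Ideal.IsPrime.radical_le_iff inferInstance |>.mpr hsle) ?_
    rw [Ideal.radical_eq_sInf]
    refine le_sInf fun J hJ => ?_
    exact hs.2 ⟨hJ.2, hJ.1⟩ (le_maximalIdeal hJ.2.ne_top)
  obtain ⟨N, hN⟩ := Ideal.exists_radical_pow_le_of_fg (Ideal.span (s : Set (MvPowerSeries (Fin r) k ⧸ Ideal.span {f}))) (IsNoetherian.noetherian _)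
  rw [hrad] at hN
  have hlift : ∀ i : Fin s.card, ∃ z, Ideal.Quotient.mk (Ideal.span {f}) z = (s.equivFin.symm i : MvPowerSeries (Fin r) k ⧸ Ideal.span {f}) :=
    fun i => Ideal.Quotient.mk_surjective _
  choose z hz using hlift
  refine ⟨s.card, z, N, hlt, fun i hi => ?_, ?_⟩
  · have h1 := hi.map (Ideal.Quotient.mk (Ideal.span {f}))
    rw [hz] at h1
    exact hsle (Ideal.subset_span (s.equivFin.symm i).2) h1
  · have hm : (maximalIdeal (MvPowerSeries (Fin r) k)).map (Ideal.Quotient.mk (Ideal.span {f})) ≤ maximalIdeal _ := by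
      rw [Ideal.map_le_iff_le_comap]
      intro x hx hu
      haveI : IsLocalHom (Ideal.Quotient.mk (Ideal.span {f})) := IsLocalHom.of_surjective _ Ideal.Quotient.mk_surjective
      exact hx ((isUnit_map_iff (Ideal.Quotient.mk (Ideal.span {f})) x).mp hu)
    have h2 : (maximalIdeal (MvPowerSeries (Fin r) k) ^ N).map (Ideal.Quotient.mk (Ideal.span {f})) ≤ (Ideal.span (Set.range z)).map (Ideal.Quotient.mk (Ideal.span {f})) := by
      rw [Ideal.map_pow]
      refine (Ideal.pow_right_mono hm N).trans (hN.trans ?_)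
      rw [Ideal.map_span, Ideal.span_le]
      intro x hx
      refine Ideal.subset_span ⟨z (s.equivFin ⟨x, hx⟩), ⟨_, rfl⟩, ?_⟩
      rw [hz]
      simp
    rw [Ideal.map_le_iff_le_comap, Ideal.comap_map_of_surjective _ Ideal.Quotient.mk_surjective, ← RingHom.ker_eq_comap_bot, Ideal.mk_ker] at h2
    rwa [Ideal.span_union, sup_comm]

theorem isHausdorff_of_map {R A M : Type*} [CommRing R] [CommRing A] [Algebra R A] [AddCommGroup M] [Module R M] [Module A M] [IsScalarTower R A M]
    (I : Ideal R) (J : Ideal A) (h : I.map (algebraMap R A) ≤ J) [IsHausdorff J M] : IsHausdorff I M := by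
  refine ⟨fun x hx => IsHausdorff.haus (I := J) inferInstance x fun n => ?_⟩
  have h1 := hx n
  rw [SModEq.zero] at h1 ⊢
  have h2 : (I ^ n • ⊤ : Submodule R M) ≤ (J ^ n • ⊤ : Submodule A M).restrictScalars R := by
    rw [Submodule.smul_le]
    intro a ha y _
    rw [Submodule.restrictScalars_mem, ← algebraMap_smul A a y]
    refine Submodule.smul_mem_smul ?_ trivial
    have := Ideal.mem_map_of_mem (algebraMap R A) ha
    rw [Ideal.map_pow] at this
    exact Ideal.pow_right_mono h n this
  exact h2 h1

theorem span_of_coeff {r : ℕ} {C A ι : Type*} [CommRing C] [CommRing A] [IsLocalRing A] [IsNoetherianRing A] [Algebra (MvPowerSeries (Fin r) C) A]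
    (π : C) [IsAdicComplete (Ideal.span {π}) C] [Finite ι] (hπ : algebraMap (MvPowerSeries (Fin r) C) A (MvPowerSeries.C π) ∈ maximalIdeal A)
    (hX : ∀ i, algebraMap (MvPowerSeries (Fin r) C) A (MvPowerSeries.X i) ∈ maximalIdeal A) (v : ι → A)
    (hv : ∀ x : A, ∃ w ∈ Submodule.span (MvPowerSeries (Fin r) C) (Set.range v),
      x - w ∈ Ideal.span ({algebraMap (MvPowerSeries (Fin r) C) A (MvPowerSeries.C π)} ∪ Set.range (fun i => algebraMap (MvPowerSeries (Fin r) C) A (MvPowerSeries.X i)))) :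
    Submodule.span (MvPowerSeries (Fin r) C) (Set.range v) = ⊤ := by
  obtain ⟨J, hJ⟩ : ∃ J, J = Ideal.span {algebraMap (MvPowerSeries (Fin r) C) A (MvPowerSeries.C π)} := ⟨_, rfl⟩
  have hjac : maximalIdeal A ≤ Ideal.jacobson ⊥ := by rw [jacobson_eq_maximalIdeal ⊥ bot_ne_top]
  haveI : IsHausdorff (maximalIdeal A) A := IsHausdorff.of_le_jacobson _ _ hjac
  haveI : IsHausdorff (maximalIdeal A) (A ⧸ J) := IsHausdorff.of_le_jacobson _ _ hjac
  haveI : IsHausdorff (Ideal.span (Set.range (MvPowerSeries.X : Fin r → MvPowerSeries (Fin r) C))) (A ⧸ J) := by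
    refine isHausdorff_of_map (A := A) _ (maximalIdeal A) ?_
    rw [Ideal.map_span, Ideal.span_le]
    rintro _ ⟨_, ⟨i, rfl⟩, rfl⟩
    exact hX i
  haveI : IsHausdorff (Ideal.span {(MvPowerSeries.C π : MvPowerSeries (Fin r) C)}) A := by
    refine isHausdorff_of_map (A := A) _ (maximalIdeal A) ?_
    rw [Ideal.map_span, Ideal.span_le]
    rintro _ ⟨_, rfl, rfl⟩
    exact hπ
  haveI : IsAdicComplete (Ideal.span {(MvPowerSeries.C π : MvPowerSeries (Fin r) C)}) (MvPowerSeries (Fin r) C) := mvPowerSeries_complete π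
  let q : A →ₗ[MvPowerSeries (Fin r) C] (A ⧸ J) := (Ideal.Quotient.mkₐ (MvPowerSeries (Fin r) C) J).toLinearMap
  have hq : ∀ x, q x = Ideal.Quotient.mk J x := fun x => rfl
  have hmap : Submodule.map q (Submodule.span (MvPowerSeries (Fin r) C) (Set.range v)) = Submodule.span (MvPowerSeries (Fin r) C) (Set.range (q ∘ v)) := by
    rw [Submodule.map_span, Set.range_comp]
  have h1 := finite_of_complete (Ideal.span (Set.range (MvPowerSeries.X : Fin r → MvPowerSeries (Fin r) C))) (q ∘ v) (by
    rw [eq_top_iff]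
    intro x _
    obtain ⟨x, rfl⟩ := Ideal.Quotient.mk_surjective x
    obtain ⟨w, hw, hxw⟩ := hv x
    have h2 : Ideal.Quotient.mk J x = q w + Ideal.Quotient.mk J (x - w) := by rw [hq, ← map_add]; congr 1; ring
    rw [h2]
    refine Submodule.add_mem_sup (hmap ▸ Submodule.mem_map_of_mem hw) ?_
    rw [Ideal.span_union, ← hJ] at hxw
    obtain ⟨a, ha, b, hb, hab⟩ := Submodule.mem_sup.mp hxw
    rw [← hab, map_add, Ideal.Quotient.eq_zero_iff_mem.mpr ha, zero_add]
    obtain ⟨c, hc⟩ := (Ideal.mem_span_range_iff_exists_fun).mp hb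
    rw [← hc, map_sum]
    refine sum_mem fun i _ => ?_
    have h3 : Ideal.Quotient.mk J (c i * algebraMap (MvPowerSeries (Fin r) C) A (MvPowerSeries.X i)) = (MvPowerSeries.X i : MvPowerSeries (Fin r) C) • q (c i) := by
      rw [← map_smul, hq, Algebra.smul_def, mul_comm]
    rw [h3]
    exact Submodule.smul_mem_smul (Ideal.subset_span ⟨i, rfl⟩) trivial)
  refine finite_of_complete (Ideal.span {(MvPowerSeries.C π : MvPowerSeries (Fin r) C)}) v ?_
  rw [eq_top_iff]
  intro x _
  have h2 : q x ∈ Submodule.map q (Submodule.span (MvPowerSeries (Fin r) C) (Set.range v)) := by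
    rw [hmap, h1]; trivial
  obtain ⟨w, hw, hwx⟩ := h2
  have h3 : x - w ∈ J := by
    rw [← Ideal.Quotient.eq_zero_iff_mem, map_sub, ← hq, ← hq, hwx, sub_self]
  rw [← add_sub_cancel w x]
  refine Submodule.add_mem_sup hw ?_
  rw [hJ, Ideal.mem_span_singleton'] at h3
  obtain ⟨c, hc⟩ := h3
  rw [← hc, mul_comm, ← Algebra.smul_def]
  exact Submodule.smul_mem_smul (Ideal.mem_span_singleton_self _) trivial

/-- finitely many elements span `S` over `C` modulo powers of the maximal ideal -/
theorem exists_span_mod_pow {C S : Type*} [CommRing C] [CommRing S] [IsLocalRing S] [IsNoetherianRing S] [Algebra C S]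
    (hsurj : ∀ x : S, ∃ c : C, x - algebraMap C S c ∈ maximalIdeal S) (N : ℕ) :
    ∃ s : Finset S, ∀ x : S, ∃ w ∈ Submodule.span C (s : Set S), x - w ∈ maximalIdeal S ^ N := by
  classical
  induction N with
  | zero => exact ⟨∅, fun x => ⟨0, zero_mem _, by simp⟩⟩
  | succ N ih =>
    obtain ⟨s, hs⟩ := ih
    obtain ⟨t, ht⟩ := (IsNoetherian.noetherian (maximalIdeal S ^ N) : (maximalIdeal S ^ N).FG)
    refine ⟨s ∪ t, fun x => ?_⟩
    obtain ⟨w, hw, hxw⟩ := hs x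
    have key : ∀ y ∈ Submodule.span S (t : Set S), ∃ w ∈ Submodule.span C (t : Set S), y - w ∈ maximalIdeal S ^ (N + 1) := by
      intro y hy
      induction hy using Submodule.span_induction with
      | mem y hy => exact ⟨y, Submodule.subset_span hy, by simp⟩
      | zero => exact ⟨0, zero_mem _, by simp⟩
      | add a b _ _ ha hb =>
        obtain ⟨a', h1, h2⟩ := ha
        obtain ⟨b', h3, h4⟩ := hb
        exact ⟨a' + b', add_mem h1 h3, by rw [add_sub_add_comm]; exact add_mem h2 h4⟩
      | smul c y hy h =>
        obtain ⟨y', h1, h2⟩ := h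
        obtain ⟨d, hd⟩ := hsurj c
        refine ⟨d • y', Submodule.smul_mem _ _ h1, ?_⟩
        have hy' : y ∈ maximalIdeal S ^ N := by rw [← ht]; exact hy
        have : c • y - d • y' = (c - algebraMap C S d) * y + algebraMap C S d * (y - y') := by
          rw [smul_eq_mul, Algebra.smul_def d]; ring
        rw [this]
        refine add_mem ?_ (Ideal.mul_mem_left _ _ h2)
        rw [pow_succ']
        exact Ideal.mul_mem_mul hd hy'
    obtain ⟨w', hw', hx'⟩ := key (x - w) (by rw [ht]; exact hxw)
    refine ⟨w + w', ?_, by rwa [← sub_sub]⟩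
    rw [Finset.coe_union, Submodule.span_union]
    exact Submodule.add_mem_sup hw hw'

theorem finite_of_coeff {r : ℕ} {C S : Type*} [CommRing C] [CommRing S] [IsLocalRing S] [IsNoetherianRing S] [Algebra (MvPowerSeries (Fin r) C) S]
    (π : C) [IsAdicComplete (Ideal.span {π}) C] (hπ : algebraMap (MvPowerSeries (Fin r) C) S (MvPowerSeries.C π) ∈ maximalIdeal S)
    (hX : ∀ i, algebraMap (MvPowerSeries (Fin r) C) S (MvPowerSeries.X i) ∈ maximalIdeal S)
    (hsurj : ∀ x : S, ∃ c : C, x - algebraMap (MvPowerSeries (Fin r) C) S (MvPowerSeries.C c) ∈ maximalIdeal S) (N : ℕ)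
    (hN : maximalIdeal S ^ N ≤ Ideal.span ({algebraMap (MvPowerSeries (Fin r) C) S (MvPowerSeries.C π)} ∪ Set.range (fun i => algebraMap (MvPowerSeries (Fin r) C) S (MvPowerSeries.X i)))) :
    Module.Finite (MvPowerSeries (Fin r) C) S := by
  obtain ⟨s, hs⟩ := exists_span_mod_pow (C := MvPowerSeries (Fin r) C) (S := S) (fun x => (hsurj x).imp' _ fun c h => h) N
  have hr : Set.range (fun i : s => (i : S)) = (s : Set S) := by ext; simp
  have := span_of_coeff (r := r) π hπ hX (fun i : s => (i : S)) (fun x => by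
    obtain ⟨w, h1, h2⟩ := hs x
    exact ⟨w, by rwa [hr], hN h2⟩)
  rw [hr] at this
  exact ⟨⟨s, this⟩⟩

theorem cohen_param_step {C S : Type*} [CommRing C] [CommRing S] [IsLocalRing S] [IsNoetherianRing S] [Algebra C S]
    (π : C) (hπ : algebraMap C S π ∈ maximalIdeal S)
    (hker : ∀ c, algebraMap C S c ∈ maximalIdeal S → π ∣ c) (hsurj : ∀ x : S, ∃ c : C, x - algebraMap C S c ∈ maximalIdeal S)
    {r : ℕ} (Φ : MvPowerSeries (Fin r) C →+* S) (hΦC : ∀ c, Φ (MvPowerSeries.C c) = algebraMap C S c)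
    (hΦX : ∀ i, Φ (MvPowerSeries.X i) ∈ maximalIdeal S) (N : ℕ)
    (hN : maximalIdeal S ^ N ≤ Ideal.span ({algebraMap C S π} ∪ Set.range fun i => Φ (MvPowerSeries.X i)))
    (g : MvPowerSeries (Fin r) C) (hg : Φ g = 0) (hg0 : MvPowerSeries.map ((residue S).comp (algebraMap C S)) g ≠ 0) :
    ∃ (s : ℕ) (y : Fin s → S), s < r ∧ (∀ i, y i ∈ maximalIdeal S) ∧ ∃ M, maximalIdeal S ^ M ≤ Ideal.span ({algebraMap C S π} ∪ Set.range y) := by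
  obtain ⟨ρ, hρ⟩ : ∃ ρ, ρ = (residue S).comp (algebraMap C S) := ⟨_, rfl⟩
  rw [← hρ] at hg0
  have hρk : ∀ c, ρ c = 0 ↔ π ∣ c := by
    intro c
    rw [hρ, RingHom.comp_apply, residue_eq_zero_iff]
    refine ⟨hker c, ?_⟩
    rintro ⟨d, rfl⟩
    rw [map_mul]
    exact Ideal.mul_mem_right _ _ hπ
  have hρs : Function.Surjective ρ := by
    intro x
    obtain ⟨x, rfl⟩ := residue_surjective x
    obtain ⟨c, hc⟩ := hsurj x
    refine ⟨c, ?_⟩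
    rw [hρ, RingHom.comp_apply, eq_comm, ← sub_eq_zero, ← map_sub, residue_eq_zero_iff]
    exact hc
  have hmaps : Function.Surjective (MvPowerSeries.map (σ := Fin r) ρ) := by
    intro x
    choose c hc using fun m => hρs (MvPowerSeries.coeff m x)
    exact ⟨c, MvPowerSeries.ext fun m => (MvPowerSeries.coeff_map _ _ _).trans (hc m)⟩
  have hspan : Ideal.span (Set.range (MvPowerSeries.X : Fin r → MvPowerSeries (Fin r) C)) ≤ (maximalIdeal S).comap Φ := by
    rw [Ideal.span_le]
    rintro _ ⟨i, rfl⟩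
    exact hΦX i
  have hunit : ∀ h : MvPowerSeries (Fin r) C, ¬ IsUnit (MvPowerSeries.map ρ h) ↔ Φ h ∈ maximalIdeal S := by
    intro h
    have h1 : Φ h - algebraMap C S (MvPowerSeries.constantCoeff h) ∈ maximalIdeal S := by
      rw [← hΦC, ← map_sub]
      exact hspan (mem_span_X _ (by simp))
    rw [MvPowerSeries.isUnit_iff_constantCoeff, isUnit_iff_ne_zero, not_not, MvPowerSeries.constantCoeff_map, hρ, RingHom.comp_apply, residue_eq_zero_iff]
    constructor
    · intro h2
      have := add_mem h1 h2
      rwa [sub_add_cancel] at this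
    · intro h2
      have := sub_mem h2 h1
      rwa [sub_sub_cancel] at this
  obtain ⟨s, z, M, hs, hz, hM⟩ := exists_param (MvPowerSeries.map ρ g) hg0 ((hunit g).mpr (by rw [hg]; exact zero_mem _))
  choose Z hZ using fun i => hmaps (z i)
  refine ⟨s, fun i => Φ (Z i), hs, fun i => (hunit _).mp (by rw [hZ]; exact hz i), ?_⟩
  obtain ⟨I, hI⟩ : ∃ I, I = Ideal.span ({algebraMap C S π} ∪ Set.range fun i => Φ (Z i)) := ⟨_, rfl⟩
  rw [← hI]
  have hπI : algebraMap C S π ∈ I := by rw [hI]; exact Ideal.subset_span (Or.inl rfl)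
  have hXi : ∀ i, Φ (MvPowerSeries.X i) ∈ I.radical := by
    intro i
    refine ⟨M, ?_⟩
    have h1 : (MvPowerSeries.X i : MvPowerSeries (Fin r) (ResidueField S)) ^ M ∈ Ideal.span ({MvPowerSeries.map ρ g} ∪ Set.range z) := by
      refine hM (Ideal.pow_mem_pow ?_ M)
      rw [maximalIdeal_power]
      exact Ideal.subset_span ⟨i, rfl⟩
    have h2 : Ideal.span ({MvPowerSeries.map ρ g} ∪ Set.range z) = (Ideal.span ({g} ∪ Set.range Z)).map (MvPowerSeries.map ρ) := by
      rw [Ideal.map_span, Set.image_union, Set.image_singleton, ← Set.range_comp]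
      congr 3
      exact funext fun i => (hZ i).symm
    rw [h2, Ideal.mem_map_iff_of_surjective _ hmaps] at h1
    obtain ⟨w, hw, hwx⟩ := h1
    have h3 : MvPowerSeries.map ρ (MvPowerSeries.X i ^ M - w) = 0 := by
      rw [map_sub, hwx, map_pow, MvPowerSeries.map_X, sub_self]
    rw [map_eq_zero_iff_dvd ρ π hρk] at h3
    obtain ⟨t, ht⟩ := h3
    have h4 : Φ (MvPowerSeries.X i) ^ M = Φ w + algebraMap C S π * Φ t := by
      rw [← hΦC, ← map_mul, ← ht, ← map_pow, ← map_add]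
      congr 1
      ring
    rw [h4]
    refine add_mem ?_ (Ideal.mul_mem_right _ _ hπI)
    have h5 : Ideal.span ({g} ∪ Set.range Z) ≤ I.comap Φ := by
      rw [Ideal.span_le]
      rintro _ (rfl | ⟨i, rfl⟩)
      · change Φ _ ∈ I
        rw [hg]
        exact zero_mem _
      · change Φ _ ∈ I
        rw [hI]
        exact Ideal.subset_span (Or.inr ⟨i, rfl⟩)
    exact h5 hw
  have hle : maximalIdeal S ≤ I.radical := by
    intro x hx
    have h1 := hN (Ideal.pow_mem_pow hx N)
    have h2 : Ideal.span ({algebraMap C S π} ∪ Set.range fun i => Φ (MvPowerSeries.X i)) ≤ I.radical := by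
      rw [Ideal.span_le]
      rintro _ (rfl | ⟨i, rfl⟩)
      · exact Ideal.le_radical hπI
      · exact hXi i
    have h3 := h2 h1
    exact Ideal.mem_radical_of_pow_mem h3
  obtain ⟨M', hM'⟩ := Ideal.exists_radical_pow_le_of_fg I (IsNoetherian.noetherian _)
  exact ⟨M', (Ideal.pow_right_mono hle _).trans hM'⟩

theorem cohen_structure {C S : Type*} [CommRing C] [CommRing S] [IsLocalRing S] [IsNoetherianRing S] [IsDomain S] [IsAdicComplete (maximalIdeal S) S] [Algebra C S]
    (π : C) [IsAdicComplete (Ideal.span {π}) C] (hinj : Function.Injective (algebraMap C S)) (hπ : algebraMap C S π ∈ maximalIdeal S)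
    (hker : ∀ c, algebraMap C S c ∈ maximalIdeal S → π ∣ c) (hsurj : ∀ x : S, ∃ c : C, x - algebraMap C S c ∈ maximalIdeal S) :
    ∃ (r : ℕ) (Φ : MvPowerSeries (Fin r) C →+* S), Function.Injective Φ ∧ (∀ c, Φ (MvPowerSeries.C c) = algebraMap C S c) ∧
    (∀ i, Φ (MvPowerSeries.X i) ∈ maximalIdeal S) ∧ ∃ N : ℕ,
      maximalIdeal S ^ N ≤ Ideal.span ({algebraMap C S π} ∪ Set.range fun i => Φ (MvPowerSeries.X i)) := by
  classical
  have hex : ∃ (r : ℕ), ∃ y : Fin r → S, (∀ i, y i ∈ maximalIdeal S) ∧ ∃ M, maximalIdeal S ^ M ≤ Ideal.span ({algebraMap C S π} ∪ Set.range y) := by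
    obtain ⟨n, s, hs⟩ := Submodule.fg_iff_exists_fin_generating_family.mp (IsNoetherian.noetherian (maximalIdeal S))
    refine ⟨n, s, fun i => hs ▸ Submodule.subset_span ⟨i, rfl⟩, 1, ?_⟩
    rw [pow_one]
    conv_lhs => rw [← hs]
    exact Ideal.span_mono Set.subset_union_right
  obtain ⟨y, hy, N, hN⟩ := Nat.find_spec hex
  have hmin : ∀ s < Nat.find hex, _ := fun s hs => Nat.find_min hex hs
  generalize Nat.find hex = r at y hmin
  obtain ⟨Φ, hΦ⟩ := exists_mvPowerSeries_eval (maximalIdeal S) (algebraMap C S) y hy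
  have hΦC : ∀ c, Φ (MvPowerSeries.C c) = algebraMap C S c := by
    intro c
    have := hΦ (MvPolynomial.C c)
    rwa [MvPolynomial.coe_C, MvPolynomial.eval₂_C] at this
  have hΦX : ∀ i, Φ (MvPowerSeries.X i) = y i := by
    intro c
    have := hΦ (MvPolynomial.X c)
    rwa [MvPolynomial.coe_X, MvPolynomial.eval₂_X] at this
  have hNy : maximalIdeal S ^ N ≤ Ideal.span ({algebraMap C S π} ∪ Set.range fun i => Φ (MvPowerSeries.X i)) := by
    simp only [hΦX]
    exact hN
  have hXm : ∀ i, Φ (MvPowerSeries.X i) ∈ maximalIdeal S := fun i => by rw [hΦX]; exact hy i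
  refine ⟨r, Φ, ?_, hΦC, hXm, N, hNy⟩
  have hall : ∀ g, Φ g = 0 → MvPowerSeries.map ((residue S).comp (algebraMap C S)) g = 0 := by
    intro g hg
    by_contra hg0
    obtain ⟨s, z, hs, h1, h2⟩ := cohen_param_step π hπ hker hsurj Φ hΦC hXm N hNy g hg hg0
    exact hmin s hs ⟨z, h1, h2⟩
  have hρk : ∀ c, ((residue S).comp (algebraMap C S)) c = 0 ↔ π ∣ c := by
    intro c
    rw [RingHom.comp_apply, residue_eq_zero_iff]
    refine ⟨hker c, ?_⟩
    rintro ⟨d, rfl⟩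
    rw [map_mul]
    exact Ideal.mul_mem_right _ _ hπ
  have hdvd : ∀ g, Φ g = 0 → MvPowerSeries.C π ∣ g := fun g hg => (map_eq_zero_iff_dvd _ π hρk g).mp (hall g hg)
  rw [injective_iff_map_eq_zero]
  intro g hg
  by_cases hp0 : π = 0
  · have := hdvd g hg
    rwa [hp0, map_zero, zero_dvd_iff] at this
  have hp0' : algebraMap C S π ≠ 0 := fun h => hp0 (hinj (h.trans (map_zero _).symm))
  have hall' : ∀ n : ℕ, ∀ g, Φ g = 0 → (MvPowerSeries.C π) ^ n ∣ g := by
    intro n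
    induction n with
    | zero => intro g _; simp
    | succ n ih =>
      intro g hg
      obtain ⟨t, rfl⟩ := hdvd g hg
      rw [map_mul, hΦC] at hg
      rw [pow_succ']
      exact mul_dvd_mul_left _ (ih t ((mul_eq_zero.mp hg).resolve_left hp0'))
  haveI : IsAdicComplete (Ideal.span {(MvPowerSeries.C π : MvPowerSeries (Fin r) C)}) (MvPowerSeries (Fin r) C) := mvPowerSeries_complete π
  exact IsHausdorff.haus (I := Ideal.span {(MvPowerSeries.C π : MvPowerSeries (Fin r) C)}) inferInstance g fun n => (mem_span_pow _ _ _).mpr (hall' n g hg)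

theorem compare_injective {R0 Λ S A : Type*} [CommRing R0] [CommRing Λ] [CommRing S] [CommRing A] [Algebra R0 S] [Algebra R0 Λ] [Algebra S A]
    [Algebra Λ A] [Algebra R0 A] [IsScalarTower R0 S A] [IsScalarTower R0 Λ A] [IsNoetherianRing Λ] [IsLocalRing Λ] [IsLocalRing S] [IsLocalRing A]
    [IsLocalHom (algebraMap S A)] [Module.Flat S A] [Module.Finite R0 S] (N : ℕ)
    (hN : maximalIdeal S ^ N ≤ ((maximalIdeal S).comap (algebraMap R0 S)).map (algebraMap R0 S))
    (hsurj : ∀ s : S, ∃ x : R0, s - algebraMap R0 S x ∈ maximalIdeal S)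
    (hΛ : ∀ l : Λ, algebraMap Λ A l ∈ maximalIdeal A → l ∈ ((maximalIdeal S).comap (algebraMap R0 S)).map (algebraMap R0 Λ))
    (f : S ⊗[R0] Λ →ₐ[S] A) (hf : ∀ l : Λ, f (1 ⊗ₜ l) = algebraMap Λ A l) (hfs : Function.Surjective f) : Function.Injective f := by
  classical
  haveI : IsNoetherianRing (S ⊗[R0] Λ) := by
    letI : Algebra Λ (S ⊗[R0] Λ) := Algebra.TensorProduct.rightAlgebra
    haveI : Module.Finite Λ (S ⊗[R0] Λ) := Module.Finite.equiv (Algebra.TensorProduct.commRight R0 Λ S).toLinearEquiv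
    exact IsNoetherianRing.of_finite Λ (S ⊗[R0] Λ)
  obtain ⟨mT, hmT⟩ : ∃ mT, mT = (maximalIdeal S).map (algebraMap S (S ⊗[R0] Λ)) := ⟨_, rfl⟩
  have hR0 : ∀ x : R0, algebraMap S (S ⊗[R0] Λ) (algebraMap R0 S x) = (1 : S) ⊗ₜ[R0] algebraMap R0 Λ x := by
    intro x
    rw [Algebra.TensorProduct.algebraMap_apply, Algebra.algebraMap_self, RingHom.id_apply, Algebra.algebraMap_eq_smul_one, Algebra.algebraMap_eq_smul_one, TensorProduct.smul_tmul]
  -- elements mapping to the maximal ideal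
  have hA : ∀ t : S ⊗[R0] Λ, f t ∈ maximalIdeal A → t ∈ mT := by
    intro t ht
    have h1 : ∃ l : Λ, t - 1 ⊗ₜ l ∈ mT := by
      clear ht
      induction t using TensorProduct.induction_on with
      | zero => exact ⟨0, by simp⟩
      | add a b ha hb =>
        obtain ⟨l, h1⟩ := ha
        obtain ⟨l', h2⟩ := hb
        exact ⟨l + l', by rw [TensorProduct.tmul_add, add_sub_add_comm]; exact add_mem h1 h2⟩
      | tmul s l =>
        obtain ⟨x, hx⟩ := hsurj s
        refine ⟨x • l, ?_⟩
        have : s ⊗ₜ[R0] l - 1 ⊗ₜ (x • l) = algebraMap S (S ⊗[R0] Λ) (s - algebraMap R0 S x) * (1 ⊗ₜ l) := by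
          rw [Algebra.TensorProduct.algebraMap_apply, Algebra.TensorProduct.tmul_mul_tmul, one_mul, mul_one, Algebra.algebraMap_self, RingHom.id_apply,
            TensorProduct.sub_tmul, ← TensorProduct.smul_tmul, Algebra.algebraMap_eq_smul_one]
        rw [this, hmT]
        exact Ideal.mul_mem_right _ _ (Ideal.mem_map_of_mem _ hx)
    obtain ⟨l, hl⟩ := h1
    have h2 : ∀ t ∈ mT, f t ∈ maximalIdeal A := by
      have : mT ≤ (maximalIdeal A).comap f := by
        rw [hmT, Ideal.map_le_iff_le_comap]
        intro x hx
        rw [Ideal.mem_comap, Ideal.mem_comap, AlgHom.commutes]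
        exact map_nonunit _ _ hx
      exact this
    have h3 : f (1 ⊗ₜ l) ∈ maximalIdeal A := by
      have := sub_mem ht (h2 _ hl)
      rwa [← map_sub, sub_sub_cancel] at this
    rw [hf] at h3
    have h4 := hΛ l h3
    have h5 : ((maximalIdeal S).comap (algebraMap R0 S)).map (algebraMap R0 Λ) ≤ mT.comap (Algebra.TensorProduct.includeRight : Λ →ₐ[R0] S ⊗[R0] Λ) := by
      rw [Ideal.map_le_iff_le_comap]
      intro x hx
      change (1 : S) ⊗ₜ[R0] algebraMap R0 Λ x ∈ mT
      rw [← hR0, hmT]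
      exact Ideal.mem_map_of_mem _ hx
    have h6 : (1 : S) ⊗ₜ[R0] l ∈ mT := h5 h4
    have := add_mem hl h6
    rwa [sub_add_cancel] at this
  -- the Jacobson radical
  have hjac : mT ≤ Ideal.jacobson ⊥ := by
    rw [Ideal.jacobson_bot, Ring.jacobson_eq_sInf_isMaximal]
    refine le_sInf fun M hM => ?_
    letI : Algebra Λ (S ⊗[R0] Λ) := Algebra.TensorProduct.rightAlgebra
    haveI : Module.Finite Λ (S ⊗[R0] Λ) := Module.Finite.equiv (Algebra.TensorProduct.commRight R0 Λ S).toLinearEquiv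
    haveI : M.IsMaximal := hM
    have h1 := Ideal.isMaximal_comap_of_isIntegral_of_isMaximal (R := Λ) M
    have h2 := eq_maximalIdeal h1
    rw [hmT, Ideal.map_le_iff_le_comap]
    have h3 : ((maximalIdeal S).comap (algebraMap R0 S)).map (algebraMap R0 S) ≤ M.comap (algebraMap S (S ⊗[R0] Λ)) := by
      rw [Ideal.map_le_iff_le_comap]
      intro x hx
      rw [Ideal.mem_comap, Ideal.mem_comap, hR0]
      have h4 : algebraMap R0 Λ x ∈ maximalIdeal Λ := by
        intro hu
        have h5 := hu.map (algebraMap Λ A)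
        rw [← IsScalarTower.algebraMap_apply, IsScalarTower.algebraMap_apply R0 S A] at h5
        exact hx ((isUnit_map_iff (algebraMap S A) _).mp h5)
      rw [← h2] at h4
      exact h4
    intro x hx
    exact Ideal.IsPrime.mem_of_pow_mem inferInstance N (h3 (hN (Ideal.pow_mem_pow hx N)))
  -- the kernel
  obtain ⟨K, hK⟩ : ∃ K, K = RingHom.ker f := ⟨_, rfl⟩
  have hKle : K ≤ mT • K := by
    intro t ht
    have ht0 : f t = 0 := by rwa [hK, RingHom.mem_ker] at ht
    have h1 : t ∈ mT := hA t (by rw [ht0]; exact zero_mem _)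
    have h2 : ∃ (l : ℕ) (s : Fin l → S) (b : Fin l → S ⊗[R0] Λ), (∀ i, s i ∈ maximalIdeal S) ∧ t = ∑ i, algebraMap S (S ⊗[R0] Λ) (s i) * b i := by
      rw [hmT, Ideal.map, Ideal.span, Submodule.mem_span_set'] at h1
      obtain ⟨l, b, g, h⟩ := h1
      choose s hs hsg using fun i => (g i).2
      refine ⟨l, s, b, hs, ?_⟩
      rw [← h]
      refine Finset.sum_congr rfl fun i _ => ?_
      rw [smul_eq_mul, hsg, mul_comm]
    obtain ⟨l, s, b, hs, hsum⟩ := h2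
    have h3 : ∑ i, s i • f (b i) = 0 := by
      rw [← ht0, hsum, map_sum]
      refine Finset.sum_congr rfl fun i _ => ?_
      rw [map_mul, AlgHom.commutes, Algebra.smul_def]
    obtain ⟨k, a, y, h4, h5⟩ := (Module.Flat.iff_forall_isTrivialRelation (R := S) (M := A)).mp inferInstance h3
    choose z hz using fun j => hfs (y j)
    have h4 : ∀ i, f (b i) = ∑ j, a i j • y j := h4
    have h6 : t = ∑ i, algebraMap S (S ⊗[R0] Λ) (s i) * (b i - ∑ j, algebraMap S _ (a i j) * z j) := by
      simp only [mul_sub, Finset.sum_sub_distrib]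
      rw [← hsum, eq_comm, sub_eq_self]
      simp only [Finset.mul_sum, ← mul_assoc, ← map_mul]
      rw [Finset.sum_comm]
      refine Finset.sum_eq_zero fun j _ => ?_
      rw [← Finset.sum_mul, ← map_sum, h5, map_zero, zero_mul]
    rw [h6]
    refine sum_mem fun i _ => ?_
    refine Submodule.smul_mem_smul (by rw [hmT]; exact Ideal.mem_map_of_mem _ (hs i)) ?_
    rw [hK, RingHom.mem_ker, map_sub, h4, map_sum, sub_eq_zero]
    refine Finset.sum_congr rfl fun j _ => ?_
    rw [map_mul, AlgHom.commutes, Algebra.smul_def, hz]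
  have hK0 := Submodule.eq_bot_of_le_smul_of_le_jacobson_bot mT K (IsNoetherian.noetherian _) hKle hjac
  exact (RingHom.injective_iff_ker_eq_bot f).mpr (hK ▸ hK0)

theorem coeff_unit {C A : Type*} [CommRing C] [CommRing A] [IsLocalRing A] (j : C →+* A) (π : C) [IsAdicComplete (Ideal.span {π}) C]
    (hker : ∀ c, j c ∈ maximalIdeal A → π ∣ c) (hsurj : ∀ x : A, ∃ c : C, x - j c ∈ maximalIdeal A) (c : C) (hc : IsUnit (j c)) : IsUnit c := by
  obtain ⟨a, ha⟩ := hc.exists_right_inv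
  obtain ⟨d, hd⟩ := hsurj a
  have h1 : j (1 - c * d) ∈ maximalIdeal A := by
    rw [map_sub, map_one, map_mul, ← ha, ← mul_sub]
    exact Ideal.mul_mem_left _ _ hd
  have h2 : 1 - c * d ∈ Ideal.jacobson (⊥ : Ideal C) := IsAdicComplete.le_jacobson_bot (Ideal.span {π}) (Ideal.mem_span_singleton.mpr (hker _ h1))
  rw [Ideal.mem_jacobson_bot] at h2
  have h3 := h2 (-1)
  have h4 : (1 - c * d) * (-1) + 1 = c * d := by ring
  rw [h4] at h3
  exact isUnit_of_mul_isUnit_left h3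

theorem coeff_isLocalRing {C A : Type*} [CommRing C] [CommRing A] [IsLocalRing A] (j : C →+* A) (π : C) [IsAdicComplete (Ideal.span {π}) C]
    (hker : ∀ c, j c ∈ maximalIdeal A → π ∣ c) (hsurj : ∀ x : A, ∃ c : C, x - j c ∈ maximalIdeal A) : IsLocalRing C := by
  haveI : IsLocalHom j := ⟨fun c hc => coeff_unit j π hker hsurj c hc⟩
  exact RingHom.domain_isLocalRing j

theorem coeff_noetherian {C A : Type*} [CommRing C] [CommRing A] [IsLocalRing A] (j : C →+* A) (π : C) [IsAdicComplete (Ideal.span {π}) C]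
    (hker : ∀ c, j c ∈ maximalIdeal A → π ∣ c) (hsurj : ∀ x : A, ∃ c : C, x - j c ∈ maximalIdeal A) : IsNoetherianRing C := by
  classical
  have h1 : ∀ x : C, x ≠ 0 → ∃ (n : ℕ) (v : C), IsUnit v ∧ x = π ^ n * v := by
    intro x hx
    have h2 : ∃ n : ℕ, ¬ π ^ n ∣ x := by
      by_contra h
      push Not at h
      exact hx (IsHausdorff.haus (I := Ideal.span {π}) inferInstance x fun n => (mem_span_pow _ _ _).mpr (h n))
    have h3 := Nat.find_spec h2
    have h4 : Nat.find h2 ≠ 0 := by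
      intro h0
      rw [h0, pow_zero] at h3
      exact h3 (one_dvd _)
    obtain ⟨n, hn⟩ := Nat.exists_eq_succ_of_ne_zero h4
    have h5 : π ^ n ∣ x := by
      by_contra h
      have := Nat.find_min' h2 h
      omega
    obtain ⟨v, hv⟩ := h5
    refine ⟨n, v, ?_, hv⟩
    by_contra hvu
    have h6 : j v ∈ maximalIdeal A := fun h => hvu (coeff_unit j π hker hsurj v h)
    obtain ⟨w, hw⟩ := hker v h6
    refine h3 ⟨w, ?_⟩
    rw [hn, hv, hw, pow_succ, mul_assoc]
  rw [isNoetherianRing_iff_ideal_fg]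
  intro I
  by_cases hI : I = ⊥
  · rw [hI]; exact Submodule.fg_bot
  · obtain ⟨x, hxI, hx⟩ := Submodule.exists_mem_ne_zero_of_ne_bot hI
    have hmem : ∀ x ∈ I, ∀ (n : ℕ) (v : C), IsUnit v → x = π ^ n * v → π ^ n ∈ I := by
      intro x hx n v hv h
      rw [h] at hx
      exact (Ideal.mul_unit_mem_iff_mem I hv).mp hx
    have hex : ∃ n : ℕ, π ^ n ∈ I := by
      obtain ⟨n, v, hv, h⟩ := h1 x hx
      exact ⟨n, hmem x hxI n v hv h⟩
    have : I = Ideal.span {π ^ Nat.find hex} := by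
      refine le_antisymm (fun y hy => ?_) ?_
      · by_cases hy0 : y = 0
        · rw [hy0]; exact zero_mem _
        obtain ⟨n, v, hv, h⟩ := h1 y hy0
        rw [Ideal.mem_span_singleton, h]
        exact (pow_dvd_pow π (Nat.find_min' hex (hmem y hy n v hv h))).mul_right v
      · rw [Ideal.span_singleton_le_iff_mem]
        exact Nat.find_spec hex
    rw [this]
    exact ⟨{π ^ Nat.find hex}, by simp⟩

theorem compare_power {r : ℕ} {C C' S A : Type u} [CommRing C] [CommRing C'] [CommRing S] [CommRing A] [Algebra C C']
    [Algebra (MvPowerSeries (Fin r) C) S] [Algebra S A] [Algebra (MvPowerSeries (Fin r) C') A] [Algebra (MvPowerSeries (Fin r) C) A]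
    [IsScalarTower (MvPowerSeries (Fin r) C) S A] [IsScalarTower (MvPowerSeries (Fin r) C) (MvPowerSeries (Fin r) C') A]
    [IsLocalRing S] [IsLocalRing A] [IsNoetherianRing S] [IsNoetherianRing A]
    [IsLocalHom (algebraMap S A)] [Module.Flat S A] (π : C) [IsAdicComplete (Ideal.span {π}) C] [IsAdicComplete (Ideal.span {algebraMap C C' π}) C']
    (hπ : algebraMap (MvPowerSeries (Fin r) C) S (MvPowerSeries.C π) ∈ maximalIdeal S)
    (hX : ∀ i, algebraMap (MvPowerSeries (Fin r) C) S (MvPowerSeries.X i) ∈ maximalIdeal S)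
    (hsurj : ∀ x : S, ∃ c : C, x - algebraMap (MvPowerSeries (Fin r) C) S (MvPowerSeries.C c) ∈ maximalIdeal S) (N : ℕ)
    (hN : maximalIdeal S ^ N ≤ Ideal.span ({algebraMap (MvPowerSeries (Fin r) C) S (MvPowerSeries.C π)} ∪ Set.range (fun i => algebraMap (MvPowerSeries (Fin r) C) S (MvPowerSeries.X i))))
    (hsurj' : ∀ x : A, ∃ c : C', x - algebraMap (MvPowerSeries (Fin r) C') A (MvPowerSeries.C c) ∈ maximalIdeal A)
    (hker' : ∀ c : C', algebraMap (MvPowerSeries (Fin r) C') A (MvPowerSeries.C c) ∈ maximalIdeal A → algebraMap C C' π ∣ c)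
    (hmA : (maximalIdeal S).map (algebraMap S A) = maximalIdeal A) :
    Nonempty ((S ⊗[MvPowerSeries (Fin r) C] (MvPowerSeries (Fin r) C')) ≃ₐ[S] A) := by
  classical
  have aC : ∀ c : C, algebraMap (MvPowerSeries (Fin r) C) (MvPowerSeries (Fin r) C') (MvPowerSeries.C c) = MvPowerSeries.C (algebraMap C C' c) :=
    fun c => MvPowerSeries.map_C _ _
  have aX : ∀ i, algebraMap (MvPowerSeries (Fin r) C) (MvPowerSeries (Fin r) C') (MvPowerSeries.X i) = MvPowerSeries.X i :=
    fun c => MvPowerSeries.map_X _ _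
  have tow : ∀ x, algebraMap (MvPowerSeries (Fin r) C') A (algebraMap (MvPowerSeries (Fin r) C) (MvPowerSeries (Fin r) C') x) = algebraMap S A (algebraMap (MvPowerSeries (Fin r) C) S x) :=
    fun x => by rw [← IsScalarTower.algebraMap_apply, ← IsScalarTower.algebraMap_apply]
  have h1 : algebraMap (MvPowerSeries (Fin r) C') A (MvPowerSeries.C (algebraMap C C' π)) = algebraMap S A (algebraMap (MvPowerSeries (Fin r) C) S (MvPowerSeries.C π)) := by
    rw [← aC, tow]
  have h2 : ∀ i, algebraMap (MvPowerSeries (Fin r) C') A (MvPowerSeries.X i) = algebraMap S A (algebraMap (MvPowerSeries (Fin r) C) S (MvPowerSeries.X i)) :=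
    fun i => by rw [← aX, tow]
  haveI : IsNoetherianRing C' := coeff_noetherian ((algebraMap (MvPowerSeries (Fin r) C') A).comp MvPowerSeries.C) (algebraMap C C' π) hker' hsurj'
  haveI : IsLocalRing C' := coeff_isLocalRing ((algebraMap (MvPowerSeries (Fin r) C') A).comp MvPowerSeries.C) (algebraMap C C' π) hker' hsurj'
  haveI : IsNoetherianRing (MvPowerSeries (Fin r) C') := MvPowerSeries.isNoetherianRing C'
  haveI : Module.Finite (MvPowerSeries (Fin r) C) S := finite_of_coeff π hπ hX hsurj N hN
  obtain ⟨f, hfdef⟩ : ∃ f : S ⊗[MvPowerSeries (Fin r) C] (MvPowerSeries (Fin r) C') →ₐ[S] A,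
      ∀ s l, f (s ⊗ₜ l) = algebraMap S A s * algebraMap (MvPowerSeries (Fin r) C') A l :=
    ⟨Algebra.TensorProduct.lift (Algebra.ofId S A) (IsScalarTower.toAlgHom (MvPowerSeries (Fin r) C) (MvPowerSeries (Fin r) C') A) (fun _ _ => Commute.all _ _),
      fun s l => rfl⟩
  have hfl : ∀ l, f (1 ⊗ₜ l) = algebraMap (MvPowerSeries (Fin r) C') A l := fun l => by rw [hfdef, map_one, one_mul]
  have hfs : Function.Surjective f := by
    have hpow : ∀ n : ℕ, ∀ a : A, ∃ t, a - f t ∈ (maximalIdeal S ^ n).map (algebraMap S A) := by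
      intro n
      induction n with
      | zero => exact fun a => ⟨0, by rw [pow_zero, Ideal.one_eq_top, Ideal.map_top]; trivial⟩
      | succ n ih =>
        intro a
        obtain ⟨t, ht⟩ := ih a
        have key : ∀ b ∈ (maximalIdeal S ^ n).map (algebraMap S A), ∃ t, b - f t ∈ (maximalIdeal S ^ (n + 1)).map (algebraMap S A) := by
          intro b hb
          rw [Ideal.map] at hb
          induction hb using Submodule.span_induction with
          | mem b hb =>
            obtain ⟨s, hs, rfl⟩ := hb
            exact ⟨s ⊗ₜ 1, by rw [hfdef, map_one, mul_one, sub_self]; exact zero_mem _⟩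
          | zero => exact ⟨0, by simp⟩
          | add x y _ _ hx hy =>
            obtain ⟨x', hx⟩ := hx
            obtain ⟨y', hy⟩ := hy
            exact ⟨x' + y', by rw [map_add, add_sub_add_comm]; exact add_mem hx hy⟩
          | smul c x hx h =>
            obtain ⟨x', hx'⟩ := h
            obtain ⟨d, hd⟩ := hsurj' c
            refine ⟨1 ⊗ₜ (MvPowerSeries.C d) * x', ?_⟩
            have h3 : c • x - f (1 ⊗ₜ (MvPowerSeries.C d) * x') = (c - algebraMap (MvPowerSeries (Fin r) C') A (MvPowerSeries.C d)) * x + algebraMap (MvPowerSeries (Fin r) C') A (MvPowerSeries.C d) * (x - f x') := by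
              rw [map_mul, hfl, smul_eq_mul]; ring
            rw [h3]
            refine add_mem ?_ (Ideal.mul_mem_left _ _ hx')
            rw [pow_succ', Ideal.map_mul, hmA]
            exact Ideal.mul_mem_mul hd hx
        obtain ⟨t', ht'⟩ := key _ ht
        exact ⟨t + t', by rwa [map_add, ← sub_sub]⟩
    obtain ⟨n, v, hv⟩ := Module.Finite.exists_fin (R := MvPowerSeries (Fin r) C) (M := S)
    have hrange : ∀ t, f t ∈ Submodule.span (MvPowerSeries (Fin r) C') (Set.range fun i => algebraMap S A (v i)) := by
      intro t
      induction t using TensorProduct.induction_on with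
      | zero => rw [map_zero]; exact zero_mem _
      | add a b ha hb => rw [map_add]; exact add_mem ha hb
      | tmul s l =>
        rw [hfdef, mul_comm, ← Algebra.smul_def]
        refine Submodule.smul_mem _ _ ?_
        have hs : s ∈ Submodule.span (MvPowerSeries (Fin r) C) (Set.range v) := by rw [hv]; trivial
        induction hs using Submodule.span_induction with
        | mem b hb =>
          obtain ⟨i, rfl⟩ := hb
          exact Submodule.subset_span ⟨i, rfl⟩
        | zero => rw [map_zero]; exact zero_mem _
        | add x y _ _ hx hy => rw [map_add]; exact add_mem hx hy
        | smul c x _ hx =>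
          rw [Algebra.smul_def, map_mul, ← tow, ← Algebra.smul_def]
          exact Submodule.smul_mem _ _ hx
    have hspan := span_of_coeff (algebraMap C C' π) (by rw [h1]; exact map_nonunit _ _ hπ) (fun i => by rw [h2]; exact map_nonunit _ _ (hX i))
      (fun i => algebraMap S A (v i)) (by
        intro x
        obtain ⟨t, ht⟩ := hpow N x
        refine ⟨f t, hrange t, ?_⟩
        have h3 := Ideal.map_mono (f := algebraMap S A) hN ht
        rw [Ideal.map_span, Set.image_union, Set.image_singleton, ← Set.range_comp] at h3
        rw [h1]
        simp only [h2]
        exact h3)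
    intro a
    have ha : a ∈ Submodule.span (MvPowerSeries (Fin r) C') (Set.range fun i => algebraMap S A (v i)) := by rw [hspan]; trivial
    induction ha using Submodule.span_induction with
    | mem b hb =>
      obtain ⟨i, rfl⟩ := hb
      exact ⟨v i ⊗ₜ 1, by rw [hfdef, map_one, mul_one]⟩
    | zero => exact ⟨0, map_zero _⟩
    | add x y _ _ hx hy =>
      obtain ⟨x', rfl⟩ := hx
      obtain ⟨y', rfl⟩ := hy
      exact ⟨x' + y', map_add _ _ _⟩
    | smul c x _ hx =>
      obtain ⟨x', rfl⟩ := hx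
      exact ⟨1 ⊗ₜ c * x', by rw [map_mul, hfl, Algebra.smul_def]⟩
  have hle : Ideal.span ({algebraMap (MvPowerSeries (Fin r) C) S (MvPowerSeries.C π)} ∪ Set.range (fun i => algebraMap (MvPowerSeries (Fin r) C) S (MvPowerSeries.X i))) ≤
      ((maximalIdeal S).comap (algebraMap (MvPowerSeries (Fin r) C) S)).map (algebraMap (MvPowerSeries (Fin r) C) S) := by
    rw [Ideal.span_le]
    rintro _ (rfl | ⟨i, rfl⟩)
    · exact Ideal.mem_map_of_mem _ hπ
    · exact Ideal.mem_map_of_mem _ (hX i)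
  refine ⟨AlgEquiv.ofBijective f ⟨compare_injective N (hN.trans hle) (fun s => (hsurj s).imp' _ fun c h => h) ?_ f hfl hfs, hfs⟩⟩
  intro l hl
  have h3 : l - MvPowerSeries.C (MvPowerSeries.constantCoeff l) ∈ Ideal.span (Set.range (MvPowerSeries.X : Fin r → MvPowerSeries (Fin r) C')) :=
    mem_span_X _ (by simp)
  have h4 : Ideal.span (Set.range (MvPowerSeries.X : Fin r → MvPowerSeries (Fin r) C')) ≤
      ((maximalIdeal S).comap (algebraMap (MvPowerSeries (Fin r) C) S)).map (algebraMap (MvPowerSeries (Fin r) C) (MvPowerSeries (Fin r) C')) := by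
    rw [Ideal.span_le]
    rintro _ ⟨i, rfl⟩
    rw [← aX]
    exact Ideal.mem_map_of_mem _ (hX i)
  have h5 : Ideal.span (Set.range (MvPowerSeries.X : Fin r → MvPowerSeries (Fin r) C')) ≤ (maximalIdeal A).comap (algebraMap _ A) := by
    rw [Ideal.span_le]
    rintro _ ⟨i, rfl⟩
    change algebraMap _ A _ ∈ maximalIdeal A
    rw [h2]
    exact map_nonunit _ _ (hX i)
  have h6 : algebraMap (MvPowerSeries (Fin r) C') A (MvPowerSeries.C (MvPowerSeries.constantCoeff l)) ∈ maximalIdeal A := by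
    have h7 : algebraMap (MvPowerSeries (Fin r) C') A (l - MvPowerSeries.C (MvPowerSeries.constantCoeff l)) ∈ maximalIdeal A := h5 h3
    have := sub_mem hl h7
    rwa [map_sub, sub_sub_cancel] at this
  obtain ⟨d, hd⟩ := hker' _ h6
  have h8 := h4 h3
  rw [hd] at h8
  have h9 : (MvPowerSeries.C (algebraMap C C' π * d) : MvPowerSeries (Fin r) C') ∈ ((maximalIdeal S).comap (algebraMap (MvPowerSeries (Fin r) C) S)).map (algebraMap (MvPowerSeries (Fin r) C) (MvPowerSeries (Fin r) C')) := by
    rw [map_mul, ← aC]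
    exact Ideal.mul_mem_right _ _ (Ideal.mem_map_of_mem _ hπ)
  have := add_mem h8 h9
  rwa [sub_add_cancel] at this

theorem reduced_transport {C C' k k' : Type u} [CommRing C] [CommRing C'] [Field k] [Field k'] [Algebra C C'] [Algebra k k']
    (f : C ≃+* k) (f' : C' ≃+* k') (hf : ∀ c, f' (algebraMap C C' c) = algebraMap k k' (f c))
    (hk : ∀ (F : Type u) [Field F] [Algebra k F], IsReduced (k' ⊗[k] F)) (F : Type u) [Field F] [Algebra C F] : IsReduced (C' ⊗[C] F) := by
  letI : Algebra k F := ((algebraMap C F).comp f.symm.toRingHom).toAlgebra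
  letI : Algebra C k := f.toRingHom.toAlgebra
  letI : Algebra C k' := ((algebraMap k k').comp f.toRingHom).toAlgebra
  haveI : IsScalarTower C k k' := IsScalarTower.of_algebraMap_eq fun _ => rfl
  haveI : IsScalarTower C k F := IsScalarTower.of_algebraMap_eq fun c => by
    change _ = algebraMap C F (f.symm (f c))
    rw [f.symm_apply_apply]
  have hs : ∀ x : k, ∃ c : C, algebraMap C k c = x := f.surjective
  haveI : TensorProduct.CompatibleSMul C k k' F := ⟨fun x m n => by
    obtain ⟨c, rfl⟩ := hs x
    rw [algebraMap_smul, algebraMap_smul, TensorProduct.smul_tmul]⟩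
  haveI : TensorProduct.CompatibleSMul k C k' F := inferInstance
  have e1 : k' ⊗[k] F ≃ₐ[C] k' ⊗[C] F := Algebra.TensorProduct.equivOfCompatibleSMul C k C k' F
  have e0 : C' ≃ₐ[C] k' := AlgEquiv.ofRingEquiv (f := f') hf
  have e2 := Algebra.TensorProduct.congr e0 (AlgEquiv.refl : F ≃ₐ[C] F)
  haveI := hk F
  exact isReduced_of_injective (e2.trans e1.symm) (AlgEquiv.injective _)

theorem exists_field_of_equiv {C k : Type u} [h : CommRing C] [Field k] (f : C ≃+* k) : ∃ g : Field C, g.toCommRing = h :=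
  ⟨(MulEquiv.isField (Field.toIsField k) f.toMulEquiv).toField, rfl⟩

theorem lambda_field {C C' k k' F : Type u} [hC : CommRing C] [hC' : CommRing C'] [Field k] [Field k'] [Field F] [Algebra C C'] [Algebra k k']
    (f : C ≃+* k) (f' : C' ≃+* k') (hf : ∀ c, f' (algebraMap C C' c) = algebraMap k k' (f c))
    (hk : ∀ (F : Type u) [Field F] [Algebra k F], IsReduced (k' ⊗[k] F)) (n : ℕ) [Algebra (MvPowerSeries (Fin n) C) F]
    (hF : Function.Injective (algebraMap (MvPowerSeries (Fin n) C) F)) : PIC (F ⊗[MvPowerSeries (Fin n) C] (MvPowerSeries (Fin n) C')) := by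
  obtain ⟨g, h⟩ := exists_field_of_equiv f
  subst h
  obtain ⟨g', h⟩ := exists_field_of_equiv f'
  subst h
  obtain ⟨p, hp⟩ := ExpChar.exists C
  exact geo_power_field p n (reduced_transport f f' hf hk) hF

theorem lambda_zero {R0 Λ F : Type u} [CommRing R0] [CommRing Λ] [Field F] [Algebra R0 Λ] [Algebra R0 F] [IsDomain R0] [CharZero R0]
    (hF : Function.Injective (algebraMap R0 F))
    (hΛ : PIC Λ) : PIC (F ⊗[R0] Λ) := by
  haveI : FaithfulSMul R0 F := (faithfulSMul_iff_algebraMap_injective R0 F).mpr hF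
  letI : Algebra (FractionRing R0) F := FractionRing.liftAlgebra R0 F
  haveI : IsScalarTower R0 (FractionRing R0) F := FractionRing.isScalarTower_liftAlgebra R0 F
  refine PIC.of_equiv (Algebra.TensorProduct.cancelBaseChange R0 (FractionRing R0) (FractionRing R0) F Λ).toRingEquiv.symm ?_
  letI : Algebra Λ (FractionRing R0 ⊗[R0] Λ) := Algebra.TensorProduct.rightAlgebra
  haveI : IsLocalization (Algebra.algebraMapSubmonoid Λ (nonZeroDivisors R0)) (FractionRing R0 ⊗[R0] Λ) := inferInstance
  haveI : CharZero (FractionRing R0) := charZero_of_injective_algebraMap (IsFractionRing.injective R0 (FractionRing R0))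
  exact geo_perfect (hΛ.localization (Algebra.algebraMapSubmonoid Λ (nonZeroDivisors R0)) _) F

theorem lambda_pic {C C' k k' F : Type u} [CommRing C] [CommRing C'] [IsDomain C] [Field k] [Field k'] [Field F] [Algebra C C'] [Algebra k k']
    (f : C →+* k) (f' : C' →+* k') (hs : Function.Surjective f) (hs' : Function.Surjective f') (p : ℕ) [CharP k p]
    (hker : ∀ x, f x = 0 ↔ (p : C) ∣ x) (hker' : ∀ x, f' x = 0 ↔ (p : C') ∣ x) [IsAdicComplete (Ideal.span {(p : C')}) C']
    (hp' : (p : C) ≠ 0 → ∀ x : C', (p : C') * x = 0 → x = 0)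
    (hf : ∀ c, f' (algebraMap C C' c) = algebraMap k k' (f c))
    (hk : ∀ (F : Type u) [Field F] [Algebra k F], IsReduced (k' ⊗[k] F)) (n : ℕ) [Algebra (MvPowerSeries (Fin n) C) F]
    (hF : Function.Injective (algebraMap (MvPowerSeries (Fin n) C) F)) : PIC (F ⊗[MvPowerSeries (Fin n) C] (MvPowerSeries (Fin n) C')) := by
  by_cases hp : (p : C) = 0
  · have hp1 : (p : C') = 0 := by rw [← map_natCast (algebraMap C C'), hp, map_zero]
    have i1 : Function.Injective f := (injective_iff_map_eq_zero _).mpr fun x hx => by rwa [hker, hp, zero_dvd_iff] at hx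
    have i2 : Function.Injective f' := (injective_iff_map_eq_zero _).mpr fun x hx => by rwa [hker', hp1, zero_dvd_iff] at hx
    exact lambda_field (RingEquiv.ofBijective f ⟨i1, hs⟩) (RingEquiv.ofBijective f' ⟨i2, hs'⟩) hf hk n hF
  · have hnz := hp' hp
    haveI : IsDomain C' := CIC.isDomain f' (p : C') hnz hker'
    have h1 : (p : C') ≠ 0 := fun h => one_ne_zero (hnz 1 (by rw [h, zero_mul]))
    have h2 : CIC C' := CIC.of_complete f' (p : C') h1 hs' hker' (CIC.of_field k')
    haveI : CharZero C := by
      obtain ⟨q, hq⟩ := CharP.exists C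
      have h3 : ((q : ℕ) : k) = 0 := by rw [← map_natCast f, CharP.cast_eq_zero, map_zero]
      rw [CharP.cast_eq_zero_iff k p] at h3
      rcases CharP.char_is_prime_or_zero C q with h4 | h4
      · rcases (Nat.dvd_prime h4).mp h3 with h5 | h5
        · exact absurd h5 (CharP.char_ne_one k p)
        · rw [h5] at hp
          exact absurd (CharP.cast_eq_zero C q) hp
      · subst h4
        exact CharP.charP_to_charZero C
    haveI : IsDomain (MvPowerSeries (Fin n) C) := NoZeroDivisors.to_isDomain _
    haveI : IsDomain (MvPowerSeries (Fin n) C') := NoZeroDivisors.to_isDomain _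
    haveI : CharZero (MvPowerSeries (Fin n) C) := charZero_of_injective_ringHom (f := (MvPowerSeries.C : C →+* MvPowerSeries (Fin n) C)) MvPowerSeries.C_injective
    exact lambda_zero hF (h2.mvPowerSeries n).pic

theorem power_hom_ext {r : ℕ} {C A : Type*} [CommRing C] [CommRing A] (I : Ideal A) [IsHausdorff I A] (f g : MvPowerSeries (Fin r) C →+* A)
    (hC : ∀ c, f (MvPowerSeries.C c) = g (MvPowerSeries.C c)) (hX : ∀ i, f (MvPowerSeries.X i) = g (MvPowerSeries.X i))
    (hI : ∀ i, f (MvPowerSeries.X i) ∈ I) (x) : f x = g x := by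
  rw [← sub_eq_zero]
  refine IsHausdorff.haus (I := I) inferInstance _ fun n => ?_
  rw [SModEq.zero, smul_eq_mul, Ideal.mul_top]
  induction n generalizing x with
  | zero => simp
  | succ n ih =>
    have key : ∀ y ∈ Ideal.span (Set.range (MvPowerSeries.X : Fin r → MvPowerSeries (Fin r) C)), f y - g y ∈ I ^ (n + 1) := by
      intro y hy
      induction hy using Submodule.span_induction with
      | mem b hb =>
        obtain ⟨i, rfl⟩ := hb
        rw [hX, sub_self]; exact zero_mem _
      | zero => simp
      | add x y _ _ hx hy => rw [map_add, map_add, add_sub_add_comm]; exact add_mem hx hy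
      | smul c x hx h =>
        have h1 : f x ∈ I := by
          have : Ideal.span (Set.range (MvPowerSeries.X : Fin r → MvPowerSeries (Fin r) C)) ≤ I.comap f := by
            rw [Ideal.span_le]
            rintro _ ⟨i, rfl⟩
            exact hI i
          exact this hx
        have h2 : f (c • x) - g (c • x) = (f c - g c) * f x + g c * (f x - g x) := by
          rw [smul_eq_mul, map_mul, map_mul]; ring
        rw [h2]
        refine add_mem ?_ (Ideal.mul_mem_left _ _ h)
        rw [pow_succ]
        exact Ideal.mul_mem_mul (ih c) h1
    have h3 := key (x - MvPowerSeries.C (MvPowerSeries.constantCoeff x)) (mem_span_X _ (by simp))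
    rwa [map_sub, map_sub, hC, sub_sub_sub_cancel_right] at h3

theorem fgn_abstract {C C' S A F : Type u} [CommRing C] [CommRing C'] [CommRing S] [CommRing A] [Field F] [Algebra C C'] [Algebra C S] [Algebra C' A]
    [Algebra S A] [Algebra S F] [IsLocalRing S] [IsLocalRing A] [IsNoetherianRing S] [IsNoetherianRing A] [IsDomain S]
    [IsAdicComplete (maximalIdeal S) S] [IsAdicComplete (maximalIdeal A) A] [IsLocalHom (algebraMap S A)] [Module.Flat S A]
    (hmA : (maximalIdeal S).map (algebraMap S A) = maximalIdeal A)
    (hcomp : ∀ c, algebraMap C' A (algebraMap C C' c) = algebraMap S A (algebraMap C S c))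
    (p : ℕ) [CharP (ResidueField S) p] [IsAdicComplete (Ideal.span {(p : C)}) C] [IsAdicComplete (Ideal.span {(p : C')}) C']
    (hinj : Function.Injective (algebraMap C S)) (hinj' : Function.Injective (algebraMap C' A))
    (hker : ∀ c, algebraMap C S c ∈ maximalIdeal S → (p : C) ∣ c) (hsurj : ∀ x : S, ∃ c : C, x - algebraMap C S c ∈ maximalIdeal S)
    (hker' : ∀ c, algebraMap C' A c ∈ maximalIdeal A → (p : C') ∣ c) (hsurj' : ∀ x : A, ∃ c : C', x - algebraMap C' A c ∈ maximalIdeal A)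
    (hk : ∀ (F : Type u) [Field F] [Algebra (ResidueField S) F], IsReduced (ResidueField A ⊗[ResidueField S] F))
    (hF : Function.Injective (algebraMap S F)) : PIC (A ⊗[S] F) := by
  haveI : IsDomain C := hinj.isDomain
  have hpm : (p : S) ∈ maximalIdeal S := by
    rw [← residue_eq_zero_iff, map_natCast, CharP.cast_eq_zero]
  obtain ⟨r, Φ, hΦ, hΦC, hΦX, N, hN⟩ := cohen_structure (C := C) (S := S) (p : C) hinj (by rwa [map_natCast]) hker hsurj
  obtain ⟨Ψ, hΨ⟩ := exists_mvPowerSeries_eval (maximalIdeal A) (algebraMap C' A) (fun i => algebraMap S A (Φ (MvPowerSeries.X i)))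
    (fun i => map_nonunit _ _ (hΦX i))
  have hΨC : ∀ c, Ψ (MvPowerSeries.C c) = algebraMap C' A c := fun c => by
    have := hΨ (MvPolynomial.C c)
    rwa [MvPolynomial.coe_C, MvPolynomial.eval₂_C] at this
  have hΨX : ∀ i, Ψ (MvPowerSeries.X i) = algebraMap S A (Φ (MvPowerSeries.X i)) := fun c => by
    have := hΨ (MvPolynomial.X c)
    rwa [MvPolynomial.coe_X, MvPolynomial.eval₂_X] at this
  letI : Algebra (MvPowerSeries (Fin r) C) S := Φ.toAlgebra
  letI : Algebra (MvPowerSeries (Fin r) C') A := Ψ.toAlgebra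
  letI : Algebra (MvPowerSeries (Fin r) C) A := ((algebraMap S A).comp Φ).toAlgebra
  letI : Algebra (MvPowerSeries (Fin r) C) F := ((algebraMap S F).comp Φ).toAlgebra
  haveI : IsScalarTower (MvPowerSeries (Fin r) C) S A := IsScalarTower.of_algebraMap_eq fun _ => rfl
  haveI : IsScalarTower (MvPowerSeries (Fin r) C) S F := IsScalarTower.of_algebraMap_eq fun _ => rfl
  haveI : IsScalarTower (MvPowerSeries (Fin r) C) (MvPowerSeries (Fin r) C') A := IsScalarTower.of_algebraMap_eq fun x => by
    refine power_hom_ext (maximalIdeal A) ((algebraMap S A).comp Φ) (Ψ.comp (MvPowerSeries.map (algebraMap C C'))) ?_ ?_ ?_ x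
    · intro c
      rw [RingHom.comp_apply, RingHom.comp_apply, MvPowerSeries.map_C, hΨC, hΦC, hcomp]
    · intro i
      rw [RingHom.comp_apply, RingHom.comp_apply, MvPowerSeries.map_X, hΨX]
    · intro i
      exact map_nonunit (algebraMap S A) _ (hΦX i)
  have hadic : IsAdicComplete (Ideal.span {algebraMap C C' (p : C)}) C' := by rwa [map_natCast]
  have e1 : ∀ c, algebraMap (MvPowerSeries (Fin r) C) S (MvPowerSeries.C c) = algebraMap C S c := hΦC
  have e2 : ∀ c, algebraMap (MvPowerSeries (Fin r) C') A (MvPowerSeries.C c) = algebraMap C' A c := hΨC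
  obtain ⟨e⟩ := compare_power (r := r) (C := C) (C' := C') (S := S) (A := A) (p : C) (by rwa [e1, map_natCast]) hΦX (fun x => by
    obtain ⟨c, hc⟩ := hsurj x
    exact ⟨c, by rwa [e1]⟩) N (by rwa [e1]) (fun x => by
    obtain ⟨c, hc⟩ := hsurj' x
    exact ⟨c, by rwa [e2]⟩) (fun c hc => by
    rw [e2] at hc
    rw [map_natCast]
    exact hker' c hc) hmA
  have E1 := (Algebra.TensorProduct.comm S A F).toRingEquiv
  have E2 := (Algebra.TensorProduct.congr (AlgEquiv.refl : F ≃ₐ[S] F) e).toRingEquiv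
  have E3 := (Algebra.TensorProduct.cancelBaseChange (MvPowerSeries (Fin r) C) S S F (MvPowerSeries (Fin r) C')).toRingEquiv
  refine PIC.of_equiv ((E1.trans E2.symm).trans E3) ?_
  refine lambda_pic (k := ResidueField S) (k' := ResidueField A) ((residue S).comp (algebraMap C S)) ((residue A).comp (algebraMap C' A)) ?_ ?_ p ?_ ?_ ?_ ?_ hk r (hF.comp hΦ)
  · intro x
    obtain ⟨x, rfl⟩ := residue_surjective x
    obtain ⟨c, hc⟩ := hsurj x
    rw [← residue_eq_zero_iff, map_sub, sub_eq_zero] at hc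
    exact ⟨c, hc.symm⟩
  · intro x
    obtain ⟨x, rfl⟩ := residue_surjective x
    obtain ⟨c, hc⟩ := hsurj' x
    rw [← residue_eq_zero_iff, map_sub, sub_eq_zero] at hc
    exact ⟨c, hc.symm⟩
  · intro x
    rw [RingHom.comp_apply, residue_eq_zero_iff]
    refine ⟨hker x, ?_⟩
    rintro ⟨y, rfl⟩
    rw [map_mul, map_natCast]
    exact Ideal.mul_mem_right _ _ hpm
  · intro x
    rw [RingHom.comp_apply, residue_eq_zero_iff]
    refine ⟨hker' x, ?_⟩
    rintro ⟨y, rfl⟩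
    rw [map_mul, map_natCast, ← map_natCast (algebraMap S A)]
    exact Ideal.mul_mem_right _ _ (map_nonunit _ _ hpm)
  · intro h0 x hx
    have h1 : (p : S) ≠ 0 := by
      rw [← map_natCast (algebraMap C S)]
      exact (map_ne_zero_iff _ hinj).mpr h0
    have h2 : IsSMulRegular A (algebraMap S A p) := (IsSMulRegular.of_ne_zero h1).of_flat
    apply hinj'
    rw [map_zero]
    apply h2
    change algebraMap S A p • _ = algebraMap S A p • (0 : A)
    rw [smul_zero, smul_eq_mul, map_natCast, ← map_natCast (algebraMap C' A), ← map_mul, hx, map_zero]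
  · intro c
    rw [RingHom.comp_apply, RingHom.comp_apply, hcomp, ResidueField.algebraMap_residue]

theorem fgn_domain {S A F : Type u} [CommRing S] [CommRing A] [Field F]
    [Algebra S A] [Algebra S F] [IsLocalRing S] [IsLocalRing A] [IsNoetherianRing S] [IsNoetherianRing A] [IsDomain S]
    [IsAdicComplete (maximalIdeal S) S] [IsAdicComplete (maximalIdeal A) A] [IsLocalHom (algebraMap S A)] [Module.Flat S A]
    (hmA : (maximalIdeal S).map (algebraMap S A) = maximalIdeal A)
    (hk : ∀ (F : Type u) [Field F] [Algebra (ResidueField S) F], IsReduced (ResidueField A ⊗[ResidueField S] F))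
    (hF : Function.Injective (algebraMap S F)) : PIC (A ⊗[S] F) := by
  obtain ⟨p, hp⟩ := CharP.exists (ResidueField S)
  obtain ⟨C, C', h1, h2, h3⟩ : ∃ (C : Subring S) (C' : Subring A), IsCoeff p C ∧ IsCoeff p C' ∧ C ≤ C'.comap (algebraMap S A) := by
    rcases CharP.char_is_prime_or_zero (ResidueField S) p with h4 | h4
    · haveI : Fact p.Prime := ⟨h4⟩
      by_cases h0 : (p : S) = 0
      · exact coeff_exists_p p hk (Or.inl h0) (Or.inl (by rw [← map_natCast (algebraMap S A), h0, map_zero]))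
      · refine coeff_exists_p p hk (Or.inr fun x hx => (mul_eq_zero.mp hx).resolve_left h0) (Or.inr fun x hx => ?_)
        have h2 : IsSMulRegular A (algebraMap S A p) := (IsSMulRegular.of_ne_zero h0).of_flat
        apply h2
        change algebraMap S A p • _ = algebraMap S A p • (0 : A)
        rw [smul_zero, smul_eq_mul, map_natCast, hx]
    · subst h4
      haveI : CharZero (ResidueField S) := CharP.charP_to_charZero _
      exact coeff_exists_zero
  letI : Algebra C C' := (((algebraMap S A).comp C.subtype).codRestrict C' fun c => h3 c.2).toAlgebra
  haveI := h1.complete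
  haveI := h2.complete
  refine fgn_abstract (C := C) (C' := C') hmA (fun c => rfl) p Subtype.val_injective Subtype.val_injective ?_ ?_ ?_ ?_ hk hF
  · intro c hc
    obtain ⟨d, hd, h⟩ := h1.inter c c.2 hc
    exact ⟨⟨d, hd⟩, Subtype.ext h⟩
  · intro x
    obtain ⟨c, hc, h⟩ := h1.surj x
    exact ⟨⟨c, hc⟩, h⟩
  · intro c hc
    obtain ⟨d, hd, h⟩ := h2.inter c c.2 hc
    exact ⟨⟨d, hd⟩, Subtype.ext h⟩
  · intro x
    obtain ⟨c, hc, h⟩ := h2.surj x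
    exact ⟨⟨c, hc⟩, h⟩

noncomputable def pushIso (S T F A : Type u) [CommRing S] [CommRing T] [CommRing F] [CommRing A] [Algebra S T] [Algebra S F] [Algebra T F] [IsScalarTower S T F]
    [Algebra S A] : (T ⊗[S] A) ⊗[T] F ≃+* A ⊗[S] F :=
  ((Algebra.TensorProduct.comm T (T ⊗[S] A) F).toRingEquiv.trans (Algebra.TensorProduct.cancelBaseChange S T T F A).toRingEquiv).trans
    (Algebra.TensorProduct.comm S F A).toRingEquiv

theorem res_equiv {S A : Type u} [CommRing S] [CommRing A] [Algebra S A] [IsLocalRing S] [IsLocalRing A] [IsLocalHom (algebraMap S A)]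
    (hmA : (maximalIdeal S).map (algebraMap S A) = maximalIdeal A) : Nonempty ((ResidueField S ⊗[S] A) ≃ₐ[ResidueField S] ResidueField A) := by
  obtain ⟨f, hf⟩ : ∃ f : ResidueField S ⊗[S] A →ₐ[ResidueField S] ResidueField A, ∀ s a, f (s ⊗ₜ a) = algebraMap _ _ s * residue A a :=
    ⟨Algebra.TensorProduct.lift (Algebra.ofId _ _) (IsScalarTower.toAlgHom S A (ResidueField A)) (fun _ _ => Commute.all _ _), fun s l => rfl⟩
  have h1 : ∀ t : ResidueField S ⊗[S] A, ∃ a, t = 1 ⊗ₜ a := by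
    intro t
    induction t using TensorProduct.induction_on with
    | zero => exact ⟨0, by rw [tmul_zero]⟩
    | add x y hx hy =>
      obtain ⟨a, rfl⟩ := hx
      obtain ⟨b, rfl⟩ := hy
      exact ⟨a + b, by rw [tmul_add]⟩
    | tmul s a =>
      obtain ⟨s, rfl⟩ := residue_surjective s
      refine ⟨s • a, ?_⟩
      rw [← TensorProduct.smul_tmul, Algebra.smul_def, mul_one]
      rfl
  refine ⟨AlgEquiv.ofBijective f ⟨(injective_iff_map_eq_zero _).mpr fun t ht => ?_, fun x => ?_⟩⟩
  · obtain ⟨a, rfl⟩ := h1 t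
    rw [hf, map_one, one_mul, residue_eq_zero_iff, ← hmA] at ht
    have h2 : (maximalIdeal S).map (algebraMap S A) ≤ RingHom.ker (Algebra.TensorProduct.includeRight : A →ₐ[S] ResidueField S ⊗[S] A) := by
      rw [Ideal.map_le_iff_le_comap]
      intro x hx
      change (1 : ResidueField S) ⊗ₜ[S] (algebraMap S A x) = 0
      rw [Algebra.algebraMap_eq_smul_one, ← TensorProduct.smul_tmul, Algebra.smul_def, mul_one, ResidueField.algebraMap_eq, (residue_eq_zero_iff _).mpr hx, zero_tmul]
    exact h2 ht
  · obtain ⟨a, rfl⟩ := residue_surjective x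
    exact ⟨1 ⊗ₜ a, by rw [hf, map_one, one_mul]⟩

theorem res_reduced {S A : Type u} [CommRing S] [CommRing A] [Algebra S A] [IsLocalRing S] [IsLocalRing A] [IsLocalHom (algebraMap S A)]
    (hmA : (maximalIdeal S).map (algebraMap S A) = maximalIdeal A)
    (hk : ∀ (F : Type u) [Field F] [Algebra S F], (∀ x ∈ maximalIdeal S, algebraMap S F x = 0) → IsReduced (A ⊗[S] F))
    (F : Type u) [Field F] [Algebra (ResidueField S) F] : IsReduced (ResidueField A ⊗[ResidueField S] F) := by
  obtain ⟨e⟩ := res_equiv (S := S) (A := A) hmA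
  letI : Algebra S F := ((algebraMap (ResidueField S) F).comp (residue S)).toAlgebra
  haveI : IsScalarTower S (ResidueField S) F := IsScalarTower.of_algebraMap_eq fun _ => rfl
  have h1 : IsReduced (A ⊗[S] F) := hk F fun x hx => by
    change algebraMap (ResidueField S) F (residue S x) = 0
    rw [(residue_eq_zero_iff _).mpr hx, map_zero]
  have E := ((Algebra.TensorProduct.congr e (AlgEquiv.refl : F ≃ₐ[ResidueField S] F)).symm.toRingEquiv.trans (pushIso S (ResidueField S) F A))
  exact isReduced_of_injective E E.injective

theorem maximal_of_surjective {A B : Type*} [CommRing A] [CommRing B] [IsLocalRing A] [IsLocalRing B] (f : A →+* B) (hf : Function.Surjective f) :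
    (maximalIdeal A).map f = maximalIdeal B := by
  haveI : IsLocalHom f := IsLocalHom.of_surjective f hf
  refine le_antisymm (Ideal.map_le_iff_le_comap.mpr fun x hx => map_nonunit f x hx) fun b hb => ?_
  obtain ⟨a, rfl⟩ := hf b
  exact Ideal.mem_map_of_mem _ fun h => hb (h.map f)

theorem complete_of_surjective {A B : Type*} [CommRing A] [CommRing B] [IsLocalRing A] [IsLocalRing B] [IsNoetherianRing A] [IsAdicComplete (maximalIdeal A) A]
    (f : A →+* B) (hf : Function.Surjective f) : IsAdicComplete (maximalIdeal B) B := by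
  rw [← maximal_of_surjective f hf]
  letI := f.toAlgebra
  haveI : Module.Finite A B := Module.Finite.of_surjective (Algebra.linearMap A B) hf
  exact (IsAdicComplete.map_algebraMap_iff _ _).mpr (isAdicComplete_of_finite (M := B) (maximalIdeal A))

theorem fgn {S A F : Type u} [CommRing S] [CommRing A] [Field F]
    [Algebra S A] [Algebra S F] [IsLocalRing S] [IsLocalRing A] [IsNoetherianRing S] [IsNoetherianRing A]
    [IsAdicComplete (maximalIdeal S) S] [IsAdicComplete (maximalIdeal A) A] [IsLocalHom (algebraMap S A)] [Module.Flat S A]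
    (hmA : (maximalIdeal S).map (algebraMap S A) = maximalIdeal A)
    (hk : ∀ (F : Type u) [Field F] [Algebra S F], (∀ x ∈ maximalIdeal S, algebraMap S F x = 0) → IsReduced (A ⊗[S] F)) : PIC (A ⊗[S] F) := by
  obtain ⟨T, _, _, _, _, hT, hinj, hs⟩ : ∃ (T : Type u) (_ : CommRing T) (_ : Algebra S T) (_ : Algebra T F) (_ : IsScalarTower S T F), IsDomain T ∧
      Function.Injective (algebraMap T F) ∧ Function.Surjective (algebraMap S T) := by
    haveI : (RingHom.ker (algebraMap S F)).IsPrime := RingHom.ker_isPrime _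
    letI : Algebra (S ⧸ RingHom.ker (algebraMap S F)) F := (RingHom.kerLift (algebraMap S F)).toAlgebra
    exact ⟨S ⧸ RingHom.ker (algebraMap S F), inferInstance, inferInstance, inferInstance, IsScalarTower.of_algebraMap_eq fun _ => rfl, inferInstance,
      RingHom.kerLift_injective _, Ideal.Quotient.mk_surjective⟩
  haveI : IsLocalRing T := IsLocalRing.of_surjective' (algebraMap S T) hs
  haveI : IsNoetherianRing T := isNoetherianRing_of_surjective S T (algebraMap S T) hs
  haveI : IsAdicComplete (maximalIdeal T) T := complete_of_surjective (algebraMap S T) hs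
  have hs' : Function.Surjective (Algebra.TensorProduct.includeRight : A →ₐ[S] T ⊗[S] A).toRingHom := by
    intro t
    induction t using TensorProduct.induction_on with
    | zero => exact ⟨0, map_zero _⟩
    | add x y hx hy =>
      obtain ⟨a, rfl⟩ := hx
      obtain ⟨b, rfl⟩ := hy
      exact ⟨a + b, map_add _ _ _⟩
    | tmul s a =>
      obtain ⟨s, rfl⟩ := hs s
      refine ⟨s • a, ?_⟩
      change 1 ⊗ₜ _ = _
      rw [← TensorProduct.smul_tmul, Algebra.smul_def, mul_one]
  haveI : Module.FaithfullyFlat S A := @Module.FaithfullyFlat.of_flat_of_isLocalHom S A _ _ _ _ _ _ _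
  haveI : Nontrivial (T ⊗[S] A) := inferInstance
  haveI : IsLocalRing (T ⊗[S] A) := IsLocalRing.of_surjective' _ hs'
  haveI : IsNoetherianRing (T ⊗[S] A) := isNoetherianRing_of_surjective A _ _ hs'
  haveI : IsAdicComplete (maximalIdeal (T ⊗[S] A)) (T ⊗[S] A) := complete_of_surjective _ hs'
  have hcomm : ∀ s : S, algebraMap T (T ⊗[S] A) (algebraMap S T s) = (Algebra.TensorProduct.includeRight : A →ₐ[S] T ⊗[S] A).toRingHom (algebraMap S A s) := by
    intro s
    change algebraMap S T s ⊗ₜ 1 = 1 ⊗ₜ algebraMap S A s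
    rw [Algebra.algebraMap_eq_smul_one, Algebra.algebraMap_eq_smul_one, smul_tmul]
  haveI : IsLocalHom (algebraMap T (T ⊗[S] A)) := by
    constructor
    intro t ht
    obtain ⟨s, rfl⟩ := hs t
    rw [hcomm] at ht
    haveI := IsLocalHom.of_surjective _ hs'
    have h1 := isUnit_of_map_unit _ _ ht
    exact (isUnit_of_map_unit (algebraMap S A) _ h1).map _
  have hmA' : (maximalIdeal T).map (algebraMap T (T ⊗[S] A)) = maximalIdeal (T ⊗[S] A) := by
    rw [← maximal_of_surjective (algebraMap S T) hs, ← maximal_of_surjective _ hs', ← hmA, Ideal.map_map, Ideal.map_map]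
    congr 1
    exact RingHom.ext hcomm
  refine PIC.of_equiv (pushIso S T F A).symm (fgn_domain hmA' (res_reduced hmA' ?_) hinj)
  intro F' _ _ hF'
  letI : Algebra S F' := ((algebraMap T F').comp (algebraMap S T)).toAlgebra
  haveI : IsScalarTower S T F' := IsScalarTower.of_algebraMap_eq fun _ => rfl
  haveI := hk F' (fun x hx => hF' _ (by rw [← maximal_of_surjective (algebraMap S T) hs]; exact Ideal.mem_map_of_mem _ hx))
  exact isReduced_of_injective (pushIso S T F' A) (pushIso S T F' A).injective

theorem res_reduced' {S A : Type u} [CommRing S] [CommRing A] [Algebra S A] [IsLocalRing S] [IsLocalRing A] [IsLocalHom (algebraMap S A)]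
    (hmA : (maximalIdeal S).map (algebraMap S A) = maximalIdeal A)
    (hk : ∀ (F : Type u) [Field F] [Algebra (ResidueField S) F], IsReduced (ResidueField A ⊗[ResidueField S] F))
    (F : Type u) [Field F] [Algebra S F] (hF : ∀ x ∈ maximalIdeal S, algebraMap S F x = 0) : IsReduced (A ⊗[S] F) := by
  obtain ⟨e⟩ := res_equiv (S := S) (A := A) hmA
  obtain ⟨_, _⟩ := exists_tower' S F hF
  haveI := hk F
  have E := ((Algebra.TensorProduct.congr e (AlgEquiv.refl : F ≃ₐ[ResidueField S] F)).symm.toRingEquiv.trans (pushIso S (ResidueField S) F A)).symm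
  exact isReduced_of_injective E E.injective

theorem res_bij {R S : Type u} [CommRing R] [CommRing S] [Algebra R S] [IsLocalRing R] [IsLocalRing S] [IsLocalHom (algebraMap R S)]
    (hS : ∀ s : S, ∃ r : R, s - algebraMap R S r ∈ maximalIdeal S) : Function.Bijective (ResidueField.map (algebraMap R S)) := by
  refine ⟨RingHom.injective _, fun x => ?_⟩
  obtain ⟨x, rfl⟩ := residue_surjective x
  obtain ⟨r, hr⟩ := hS x
  rw [← residue_eq_zero_iff, map_sub, sub_eq_zero] at hr
  exact ⟨residue R r, by rw [ResidueField.map_residue, hr]⟩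

theorem field_fibre_flat {R A S A' : Type u} [CommRing R] [CommRing A] [CommRing S] [CommRing A'] [Algebra R A] [Algebra R S] [Algebra A A']
    [Algebra S A'] [Algebra R A'] [IsScalarTower R S A'] [IsScalarTower R A A'] [IsLocalRing R] [IsLocalRing A] [IsLocalRing S] [IsLocalRing A']
    [IsNoetherianRing S] [IsNoetherianRing A'] [Module.Flat R A] [Module.FaithfullyFlat A A']
    [IsLocalHom (algebraMap S A')]
    (hmA : (maximalIdeal R).map (algebraMap R A) = maximalIdeal A) (hmS : (maximalIdeal R).map (algebraMap R S) = maximalIdeal S)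
    (hmA' : (maximalIdeal A).map (algebraMap A A') = maximalIdeal A')
    (hS : ∀ s : S, ∃ r : R, s - algebraMap R S r ∈ maximalIdeal S) (hA : ∀ s : A', ∃ r : A, s - algebraMap A A' r ∈ maximalIdeal A') : Module.Flat S A' := by
  refine flat_of_quot fun j => quot_flat (R := R) (A := A) (maximalIdeal R ^ j) (surj_pow _ (by rwa [hmS]) j) ?_ ?_ _ (by rw [Ideal.map_pow, hmS])
  · intro s
    obtain ⟨r, hr⟩ := surj_pow (maximalIdeal A) (by rwa [hmA']) j s
    refine ⟨r, ?_⟩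
    rwa [← hmA, ← Ideal.map_pow, Ideal.map_map, ← IsScalarTower.algebraMap_eq] at hr
  · intro a ha
    rw [IsScalarTower.algebraMap_eq R A A', ← Ideal.map_map] at ha
    have := Ideal.mem_comap.mpr ha
    rwa [Ideal.comap_map_eq_self_of_faithfullyFlat] at this

theorem field_fibre_abs {R A S A' L : Type u} [CommRing R] [CommRing A] [CommRing S] [CommRing A'] [Algebra R A] [Algebra R S] [Algebra A A']
    [Algebra S A'] [Algebra R A'] [IsScalarTower R S A'] [IsScalarTower R A A'] [IsLocalRing R] [IsLocalRing A] [IsLocalRing S] [IsLocalRing A']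
    [IsNoetherianRing S] [IsNoetherianRing A'] [Module.Flat R A] [Module.FaithfullyFlat A A']
    [IsLocalHom (algebraMap S A')] [IsLocalHom (algebraMap R A)] [IsLocalHom (algebraMap R S)] [IsLocalHom (algebraMap A A')]
    [IsAdicComplete (maximalIdeal S) S] [IsAdicComplete (maximalIdeal A') A']
    (hmA : (maximalIdeal R).map (algebraMap R A) = maximalIdeal A) (hmS : (maximalIdeal R).map (algebraMap R S) = maximalIdeal S)
    (hmA' : (maximalIdeal A).map (algebraMap A A') = maximalIdeal A')
    (hS : ∀ s : S, ∃ r : R, s - algebraMap R S r ∈ maximalIdeal S) (hA : ∀ s : A', ∃ r : A, s - algebraMap A A' r ∈ maximalIdeal A')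
    [Field L] [Algebra R L] [Algebra.EssFiniteType R L] (hR : PIC (S ⊗[R] L))
    (hk : ∀ (F : Type u) [Field F] [Algebra R F], (∀ x ∈ maximalIdeal R, algebraMap R F x = 0) → IsReduced (A ⊗[R] F)) : PIC (A ⊗[R] L) := by
  haveI : Module.Flat S A' := field_fibre_flat (R := R) (A := A) hmA hmS hmA' hS hA
  have hm : (maximalIdeal S).map (algebraMap S A') = maximalIdeal A' := by
    rw [← hmS, ← hmA', ← hmA, Ideal.map_map, Ideal.map_map, ← IsScalarTower.algebraMap_eq, ← IsScalarTower.algebraMap_eq]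
  have hk1 : ∀ (F : Type u) [Field F] [Algebra (ResidueField S) F], IsReduced (ResidueField A' ⊗[ResidueField S] F) :=
    reduced_transport (RingEquiv.ofBijective _ (res_bij hS)).symm (RingEquiv.ofBijective _ (res_bij hA)).symm (fun c => by
      rw [RingEquiv.symm_apply_eq]
      obtain ⟨d, rfl⟩ := (RingEquiv.ofBijective _ (res_bij hS)).surjective c
      rw [RingEquiv.symm_apply_apply]
      obtain ⟨x, rfl⟩ := residue_surjective d
      rw [RingEquiv.ofBijective_apply, RingEquiv.ofBijective_apply]
      rw [ResidueField.map_residue, ResidueField.algebraMap_residue, ResidueField.algebraMap_residue, ResidueField.map_residue, ← IsScalarTower.algebraMap_apply,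
        ← IsScalarTower.algebraMap_apply]) (res_reduced hmA hk)
  have hk2 := res_reduced' hm hk1
  haveI : IsNoetherianRing (S ⊗[R] L) := Algebra.EssFiniteType.isNoetherianRing S _
  haveI : IsNoetherianRing (A' ⊗[S] (S ⊗[R] L)) := Algebra.EssFiniteType.isNoetherianRing A' _
  haveI : IsNoetherianRing ((S ⊗[R] L) ⊗[S] A') := isNoetherianRing_of_ringEquiv _ (Algebra.TensorProduct.comm S A' (S ⊗[R] L)).toRingEquiv
  have h1 : PIC ((S ⊗[R] L) ⊗[S] A') := by
    refine ascent hR fun F _ _ => ?_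
    letI : Algebra S F := ((algebraMap (S ⊗[R] L) F).comp (algebraMap S (S ⊗[R] L))).toAlgebra
    haveI : IsScalarTower S (S ⊗[R] L) F := IsScalarTower.of_algebraMap_eq fun _ => rfl
    exact PIC.of_equiv (pushIso S (S ⊗[R] L) F A') (fgn hm hk2)
  have h2 : PIC ((A ⊗[R] L) ⊗[A] A') :=
    PIC.of_equiv ((((Algebra.TensorProduct.comm A (A ⊗[R] L) A').toRingEquiv.trans (Algebra.TensorProduct.cancelBaseChange R A A A' L).toRingEquiv).trans
      (Algebra.TensorProduct.cancelBaseChange R S S A' L).toRingEquiv.symm).trans (Algebra.TensorProduct.comm S A' (S ⊗[R] L)).toRingEquiv) h1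
  exact PIC.of_faithfullyFlat h2

theorem comp_res {R : Type u} [CommRing R] [IsLocalRing R] [IsNoetherianRing R] (s : AdicCompletion (maximalIdeal R) R) :
    ∃ r : R, s - algebraMap R _ r ∈ maximalIdeal (AdicCompletion (maximalIdeal R) R) := by
  obtain ⟨y, hy⟩ := (AdicCompletion.residueField_map_bijective (R := R)).2 (residue _ s)
  obtain ⟨r, rfl⟩ := residue_surjective y
  refine ⟨r, ?_⟩
  rw [← residue_eq_zero_iff, map_sub, sub_eq_zero, ← hy]
  rfl

theorem field_fibre {R A L : Type u} [CommRing R] [CommRing A] [Algebra R A] [IsLocalRing R] [IsLocalRing A] [IsNoetherianRing R] [IsNoetherianRing A]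
    [Module.Flat R A] [IsLocalHom (algebraMap R A)]
    (hmA : (maximalIdeal R).map (algebraMap R A) = maximalIdeal A)
    [Field L] [Algebra R L] [Algebra.EssFiniteType R L] (hR : PIC (AdicCompletion (maximalIdeal R) R ⊗[R] L))
    (hk : ∀ (F : Type u) [Field F] [Algebra R F], (∀ x ∈ maximalIdeal R, algebraMap R F x = 0) → IsReduced (A ⊗[R] F)) : PIC (A ⊗[R] L) := by
  obtain ⟨A', _, _, _, _, _, _, hA1, hA2, hA3, hA4⟩ : ∃ (A' : Type u) (_ : CommRing A') (_ : IsLocalRing A') (_ : IsNoetherianRing A') (_ : Algebra A A') (_ : IsLocalHom (algebraMap A A'))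
      (_ : Module.Flat A A'), IsAdicComplete (maximalIdeal A') A' ∧ (maximalIdeal A).map (algebraMap A A') = maximalIdeal A' ∧
      (∀ s : A', ∃ r : A, s - algebraMap A A' r ∈ maximalIdeal A') ∧ True :=
    ⟨AdicCompletion (maximalIdeal A) A, inferInstance, inferInstance, inferInstance, inferInstance, inferInstance, inferInstance, inferInstance,
      AdicCompletion.maximalIdeal_eq_map.symm, comp_res, trivial⟩
  letI : Algebra R A' := ((algebraMap A A').comp (algebraMap R A)).toAlgebra
  haveI : IsScalarTower R A A' := IsScalarTower.of_algebraMap_eq fun _ => rfl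
  have hmap : (maximalIdeal R).map (algebraMap R A') = maximalIdeal A' := by
    rw [IsScalarTower.algebraMap_eq R A A', ← Ideal.map_map, hmA, hA2]
  obtain ⟨g, hg⟩ := exists_completion_lift (maximalIdeal R) (maximalIdeal A') hmap.le
  letI : Algebra (AdicCompletion (maximalIdeal R) R) A' := g.toAlgebra
  haveI : IsScalarTower R (AdicCompletion (maximalIdeal R) R) A' := IsScalarTower.of_algebraMap_eq fun x => (hg x).symm
  have hloc : (maximalIdeal (AdicCompletion (maximalIdeal R) R)).map (algebraMap _ A') = maximalIdeal A' := by
    rw [AdicCompletion.maximalIdeal_eq_map, Ideal.map_map, ← IsScalarTower.algebraMap_eq, hmap]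
  haveI : IsLocalHom (algebraMap (AdicCompletion (maximalIdeal R) R) A') :=
    ((local_hom_TFAE (algebraMap (AdicCompletion (maximalIdeal R) R) A')).out 0 2).mpr hloc.le
  haveI : Module.FaithfullyFlat A A' := @Module.FaithfullyFlat.of_flat_of_isLocalHom A A' _ _ _ _ _ _ _
  exact field_fibre_abs (A' := A') hmA AdicCompletion.maximalIdeal_eq_map.symm hA2 comp_res hA3 hR hk

theorem scale_of_finite {R L : Type u} [CommRing R] (p : Ideal R) [p.IsPrime] [Field L] [Algebra R L] [Algebra p.ResidueField L]
    [IsScalarTower R p.ResidueField L] [Module.Finite p.ResidueField L] (l : L) : ∃ s : R, algebraMap R L s ≠ 0 ∧ IsIntegral R (s • l) := by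
  letI : Algebra (R ⧸ p) L := ((algebraMap p.ResidueField L).comp (algebraMap (R ⧸ p) p.ResidueField)).toAlgebra
  haveI : IsScalarTower (R ⧸ p) p.ResidueField L := IsScalarTower.of_algebraMap_eq fun _ => rfl
  haveI : IsScalarTower R (R ⧸ p) L := IsScalarTower.of_algebraMap_eq fun x => by
    rw [IsScalarTower.algebraMap_apply (R ⧸ p) p.ResidueField L, ← IsScalarTower.algebraMap_apply R (R ⧸ p) p.ResidueField,
      ← IsScalarTower.algebraMap_apply]
  have h2 : IsAlgebraic (R ⧸ p) l := (IsFractionRing.isAlgebraic_iff (R ⧸ p) p.ResidueField L).mpr (Algebra.IsAlgebraic.isAlgebraic l)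
  obtain ⟨y, hy0, hy⟩ := h2.exists_integral_multiple
  obtain ⟨s, rfl⟩ := Ideal.Quotient.mk_surjective y
  haveI : Algebra.IsIntegral R (R ⧸ p) := Algebra.isIntegral_of_surjective Ideal.Quotient.mk_surjective
  refine ⟨s, ?_, ?_⟩
  · rw [IsScalarTower.algebraMap_apply R (R ⧸ p) L, IsScalarTower.algebraMap_apply (R ⧸ p) p.ResidueField L]
    rw [map_ne_zero_iff _ (algebraMap p.ResidueField L).injective, map_ne_zero_iff _ (IsFractionRing.injective (R ⧸ p) p.ResidueField)]
    exact hy0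
  · have h3 : IsIntegral R ((Ideal.Quotient.mk p s) • l) := isIntegral_trans _ hy
    rwa [← Ideal.Quotient.algebraMap_eq, algebraMap_smul] at h3

theorem normal_finite {R A L : Type u} [CommRing R] [IsNoetherianRing R] [IsLocalRing R] [CommRing A] [IsNoetherianRing A]
    [IsLocalRing A] [Algebra R A] [IsLocalHom (algebraMap R A)] [Module.Flat R A]
    [Field L] [Algebra R L] [Algebra.EssFiniteType R L]
    (hL : ∀ l : L, ∃ s : R, algebraMap R L s ≠ 0 ∧ IsIntegral R (s • l))
    (hR : PIC (AdicCompletion (maximalIdeal R) R ⊗[R] L))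
    (hk : ∀ (F : Type u) [Field F] [Algebra R F], (∀ x ∈ maximalIdeal R, algebraMap R F x = 0) → PIC (A ⊗[R] F)) : PIC (A ⊗[R] L) := by
  obtain ⟨hP, -⟩ := closed_fiber (R := R) (A := A) (hk (ResidueField R) fun x hx => (residue_eq_zero_iff x).mpr hx)
  refine normal_of_generic hL hR.isReduced hk ?_
  have hmA : (maximalIdeal R).map (algebraMap R (Localization.AtPrime ((maximalIdeal R).map (algebraMap R A)))) =
      maximalIdeal (Localization.AtPrime ((maximalIdeal R).map (algebraMap R A))) := by
    have h := Ideal.map_map (I := maximalIdeal R) (algebraMap R A) (algebraMap A (Localization.AtPrime ((maximalIdeal R).map (algebraMap R A))))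
    rw [← IsScalarTower.algebraMap_eq] at h
    exact h.symm.trans (Localization.AtPrime.map_eq_maximalIdeal (I := (maximalIdeal R).map (algebraMap R A)))
  haveI : IsLocalHom (algebraMap R (Localization.AtPrime ((maximalIdeal R).map (algebraMap R A)))) :=
    ((local_hom_TFAE (algebraMap R (Localization.AtPrime ((maximalIdeal R).map (algebraMap R A))))).out 0 2).mpr hmA.le
  haveI : Module.Flat R (Localization.AtPrime ((maximalIdeal R).map (algebraMap R A))) := Module.Flat.trans R A _
  haveI : IsNoetherianRing (Localization.AtPrime ((maximalIdeal R).map (algebraMap R A))) :=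
    IsLocalization.isNoetherianRing ((maximalIdeal R).map (algebraMap R A)).primeCompl _ inferInstance
  refine field_fibre hmA hR ?_
  intro F _ _ hF
  have h1 : PIC (A ⊗[R] F) := hk F hF
  letI : Algebra (A ⊗[R] F) (Localization.AtPrime ((maximalIdeal R).map (algebraMap R A)) ⊗[A] (A ⊗[R] F)) := Algebra.TensorProduct.rightAlgebra
  haveI : IsLocalization (Algebra.algebraMapSubmonoid (A ⊗[R] F) ((maximalIdeal R).map (algebraMap R A)).primeCompl)
    (Localization.AtPrime ((maximalIdeal R).map (algebraMap R A)) ⊗[A] (A ⊗[R] F)) := inferInstance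
  have h2 := (h1.localization (Algebra.algebraMapSubmonoid (A ⊗[R] F) ((maximalIdeal R).map (algebraMap R A)).primeCompl)
    (Localization.AtPrime ((maximalIdeal R).map (algebraMap R A)) ⊗[A] (A ⊗[R] F)))
  have e := (Algebra.TensorProduct.cancelBaseChange R A A (Localization.AtPrime ((maximalIdeal R).map (algebraMap R A))) F).toRingEquiv
  exact (PIC.of_equiv e.symm h2).isReduced

theorem normal_all {R A : Type u} [CommRing R] [IsNoetherianRing R] [IsLocalRing R] [CommRing A] [IsNoetherianRing A]
    [IsLocalRing A] [Algebra R A] [IsLocalHom (algebraMap R A)] [Module.Flat R A]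
    (hR : ∀ (F : Type u) [Field F] [Algebra R F], PIC (AdicCompletion (maximalIdeal R) R ⊗[R] F))
    (hk : ∀ (F : Type u) [Field F] [Algebra R F], (∀ x ∈ maximalIdeal R, algebraMap R F x = 0) → PIC (A ⊗[R] F))
    (F : Type u) [Field F] [Algebra R F] : PIC (A ⊗[R] F) := by
  haveI : (RingHom.ker (algebraMap R F)).IsPrime := RingHom.ker_isPrime _
  obtain ⟨h1, h2⟩ := exists_tower R F (RingHom.ker (algebraMap R F)) rfl
  letI : Algebra (RingHom.ker (algebraMap R F)).ResidueField F := h1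
  haveI : IsScalarTower R (RingHom.ker (algebraMap R F)).ResidueField F := h2
  refine PIC.of_equiv (fibIso R (RingHom.ker (algebraMap R F)).ResidueField F A).symm ?_
  refine geo ?_ F
  intro l _ _ _ _
  letI : Algebra R l := ((algebraMap (RingHom.ker (algebraMap R F)).ResidueField l).comp (algebraMap R (RingHom.ker (algebraMap R F)).ResidueField)).toAlgebra
  haveI : IsScalarTower R (RingHom.ker (algebraMap R F)).ResidueField l := IsScalarTower.of_algebraMap_eq fun x => rfl
  refine PIC.of_equiv (fibIso R (RingHom.ker (algebraMap R F)).ResidueField l A) ?_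
  haveI : Algebra.EssFiniteType R (RingHom.ker (algebraMap R F)).ResidueField := inferInstance
  haveI : Algebra.EssFiniteType R l := Algebra.EssFiniteType.comp R (RingHom.ker (algebraMap R F)).ResidueField l
  exact normal_finite (scale_of_finite (RingHom.ker (algebraMap R F))) (hR l) hk

theorem nishimura_andre_normal
    (R A : Type u) [CommRing R] [IsNoetherianRing R] [IsLocalRing R]
    [CommRing A] [IsNoetherianRing A] [IsLocalRing A]
    [Algebra R A] [IsLocalHom (algebraMap R A)] [Module.Flat R A] :
    ((∀ (p : Ideal R) [p.IsPrime],
        GeometricallyNormalAlgebra (ResidueField (Localization.AtPrime p))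
          ((ResidueField (Localization.AtPrime p)) ⊗[R]
            (AdicCompletion (maximalIdeal R) R))) →
      GeometricallyNormalAlgebra (ResidueField R) ((ResidueField R) ⊗[R] A) →
      ∀ (p : Ideal R) [p.IsPrime],
        GeometricallyNormalAlgebra (ResidueField (Localization.AtPrime p))
          ((ResidueField (Localization.AtPrime p)) ⊗[R] A)) := by
  intro h1 h2 p _ k' _ _
  have hP : ∀ (B B' : Type u) [CommRing B] [CommRing B'], (B ≃+* B') → PIC B → PIC B' :=
    fun B B' _ _ e h => PIC.of_equiv e.symm h
  exact isNormalRing_iff.mpr (fib_out (fun B _ => PIC B) hP R A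
    (fun F _ _ => normal_all (fib_in (fun B _ => PIC B) hP R _ (fun p _ k' _ _ => isNormalRing_iff.mp (h1 p k')))
      (fib_closed (fun B _ => PIC B) hP R A (fun k' _ _ => isNormalRing_iff.mp (h2 k'))) F) _ k')

/-- Theorem of Nishimura–André: let `φ : (R,m,k) → A` be a flat local homomorphism of
noetherian local rings.  If the formal fibers of `R` (the fibers of `R → R̂`) are
geometrically reduced (resp. geometrically normal) and the closed fiber `A ⊗_R k` is
geometrically reduced (resp. geometrically normal) over `k`, then every fiber
`A ⊗_R κ(p)` is geometrically reduced (resp. geometrically normal) over `κ(p)`. -/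
theorem nishimura_andre
    (R A : Type u) [CommRing R] [IsNoetherianRing R] [IsLocalRing R]
    [CommRing A] [IsNoetherianRing A] [IsLocalRing A]
    [Algebra R A] [IsLocalHom (algebraMap R A)] [Module.Flat R A] :
    ((∀ (p : Ideal R) [p.IsPrime],
        GeometricallyReducedAlgebra (ResidueField (Localization.AtPrime p))
          ((ResidueField (Localization.AtPrime p)) ⊗[R]
            (AdicCompletion (maximalIdeal R) R))) →
      GeometricallyReducedAlgebra (ResidueField R) ((ResidueField R) ⊗[R] A) →
      ∀ (p : Ideal R) [p.IsPrime],
        GeometricallyReducedAlgebra (ResidueField (Localization.AtPrime p))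
          ((ResidueField (Localization.AtPrime p)) ⊗[R] A)) ∧
    ((∀ (p : Ideal R) [p.IsPrime],
        GeometricallyNormalAlgebra (ResidueField (Localization.AtPrime p))
          ((ResidueField (Localization.AtPrime p)) ⊗[R]
            (AdicCompletion (maximalIdeal R) R))) →
      GeometricallyNormalAlgebra (ResidueField R) ((ResidueField R) ⊗[R] A) →
      ∀ (p : Ideal R) [p.IsPrime],
        GeometricallyNormalAlgebra (ResidueField (Localization.AtPrime p))
          ((ResidueField (Localization.AtPrime p)) ⊗[R] A)) := by
  exact ⟨nishimura_andre_reduced R A, nishimura_andre_normal R A⟩
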